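/- Let θ > 0 and ε > 0 be given. There exists a constant C = C(ε, θ) > 0 such that for all X ≥ 2 and all real 2 ≤ h ≤ X, the number of integers x ∈ [X, 2X] such that the interval (x, x + h] contains no x^θ-smooth number is at most C · X · h^{−1/2 + ε}. -/

import Mathlib

open scoped Classical

/-- The additive character `x ↦ exp (2 π i x)`. -/
noncomputable def ex (x : ℝ) : ℂ := Complex.exp ((2 * Real.pi * x : ℝ) * Complex.I)

lemma ex_add (x y : ℝ) : ex (x + y) = ex x * ex y := by
  unfold ex; rw [← Complex.exp_add]; congr 1; push_cast; ring

lemma norm_ex (x : ℝ) : ‖ex x‖ = 1 := by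
  unfold ex; exact Complex.norm_exp_ofReal_mul_I _

lemma conj_ex (x : ℝ) : (starRingEnd ℂ) (ex x) = ex (-x) := by
  unfold ex
  rw [← Complex.exp_conj, map_mul, Complex.conj_ofReal, Complex.conj_I]
  congr 1; push_cast; ring

lemma ex_int (m : ℤ) : ex m = 1 := by
  unfold ex; rw [← Complex.exp_int_mul_two_pi_mul_I m]; congr 1; push_cast; ring

lemma ex_sub_int (x : ℝ) (m : ℤ) : ex (x - m) = ex x := by
  have h := ex_add (x - m) m
  rw [ex_int, mul_one, sub_add_cancel] at h
  exact h.symm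

lemma norm_sum_ex_neg (s : Finset ℕ) (f : ℕ → ℝ) :
    ‖∑ n ∈ s, ex (-f n)‖ = ‖∑ n ∈ s, ex (f n)‖ := by
  rw [← Complex.norm_conj, map_sum]
  congr 1
  exact Finset.sum_congr rfl fun n _ => by rw [conj_ex, neg_neg]

/-- The coefficient `1 / (ex d - 1)` in cotangent form. -/
lemma cot_mul_ex_sub_one (d : ℝ) (hd : Real.sin (Real.pi * d) ≠ 0) :
    (-(1 / 2 : ℂ) - ((Real.cos (Real.pi * d) / Real.sin (Real.pi * d) / 2 : ℝ) : ℂ) * Complex.I)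
      * (ex d - 1) = 1 := by
  unfold ex
  have h2 : (2 * Real.pi * d : ℝ) = 2 * (Real.pi * d) := by ring
  rw [h2, Complex.exp_mul_I, ← Complex.ofReal_cos, ← Complex.ofReal_sin, Real.cos_two_mul,
    Real.sin_two_mul]
  set s := Real.sin (Real.pi * d)
  set c := Real.cos (Real.pi * d)
  have hsc : s ^ 2 + c ^ 2 = 1 := Real.sin_sq_add_cos_sq _
  apply Complex.ext
  · simp [pow_two]
    field_simp
    nlinarith
  · simp [pow_two]
    field_simp
    linear_combination (-2 * c) * hsc

lemma two_mul_le_sin_pi {δ d : ℝ} (h0 : 0 < δ) (h1 : δ ≤ d) (h2 : d ≤ 1 - δ) :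
    2 * δ ≤ Real.sin (Real.pi * d) := by
  have hpi := Real.pi_pos
  rcases le_total d (1 / 2) with h | h
  · have := Real.mul_le_sin (x := Real.pi * d) (by nlinarith) (by nlinarith)
    have e : 2 / Real.pi * (Real.pi * d) = 2 * d := by field_simp
    linarith
  · have := Real.mul_le_sin (x := Real.pi * (1 - d)) (by nlinarith) (by nlinarith)
    have e : 2 / Real.pi * (Real.pi * (1 - d)) = 2 * (1 - d) := by field_simp
    have e2 : Real.sin (Real.pi * (1 - d)) = Real.sin (Real.pi * d) := by
      rw [mul_sub, mul_one, Real.sin_pi_sub]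
    linarith

lemma cot_antitone {a b : ℝ} (ha : 0 < Real.sin a) (hb : 0 < Real.sin b) (hab : a ≤ b)
    (hba : b - a ≤ Real.pi) : Real.cos b / Real.sin b ≤ Real.cos a / Real.sin a := by
  rw [div_le_div_iff₀ hb ha]
  have := Real.sin_nonneg_of_nonneg_of_le_pi (sub_nonneg.2 hab) hba
  rw [Real.sin_sub] at this
  linarith

/-- **Kusmin–Landau inequality**. -/
lemma kusmin_landau (f : ℕ → ℝ) (N : ℕ) (δ : ℝ) (hδ : 0 < δ) (m : ℤ)
    (h1 : ∀ n ≤ N, m + δ ≤ f (n + 1) - f n) (h2 : ∀ n ≤ N, f (n + 1) - f n ≤ m + 1 - δ)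
    (hmono : ∀ n < N, f (n + 1) - f n ≤ f (n + 2) - f (n + 1)) :
    ‖∑ n ∈ Finset.range (N + 1), ex (f n)‖ ≤ 1 / δ := by
  set d : ℕ → ℝ := fun n => f (n + 1) - f n - m with hd
  have hs : ∀ n ≤ N, 2 * δ ≤ Real.sin (Real.pi * d n) := fun n hn =>
    two_mul_le_sin_pi hδ (by have := h1 n hn; simp only [hd]; linarith)
      (by have := h2 n hn; simp only [hd]; linarith)
  set u : ℕ → ℝ := fun n => Real.cos (Real.pi * d n) / Real.sin (Real.pi * d n) / 2 with hu
  set c : ℕ → ℂ := fun n => -(1 / 2 : ℂ) - (u n : ℂ) * Complex.I with hc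
  set E : ℕ → ℂ := fun n => ex (f n - n * m) with hE
  have hEe : ∀ n, E n = ex (f n) := fun n => by
    simp only [hE]
    have := ex_sub_int (f n) (n * m)
    push_cast at this
    exact this
  have hcE : ∀ n ≤ N, E n = c n * (E (n + 1) - E n) := fun n hn => by
    have h := cot_mul_ex_sub_one (d n) (by have := hs n hn; linarith)
    have e : E (n + 1) = E n * ex (d n) := by
      simp only [hE, ← ex_add, hd]; congr 1; push_cast; ring
    rw [e]
    have h' : c n * (ex (d n) - 1) = 1 := h
    linear_combination (-E n) * h'
  have hnE : ∀ n, ‖E n‖ = 1 := fun n => norm_ex _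
  have hcn : ∀ n ≤ N, ‖c n‖ ≤ 1 / (4 * δ) := fun n hn => by
    have h := cot_mul_ex_sub_one (d n) (by have := hs n hn; linarith)
    have h' : ‖c n‖ * ‖ex (d n) - 1‖ = 1 := by rw [← norm_mul]; simp only [hc, hu]; rw [h]; simp
    have hn1 : ‖ex (d n) - 1‖ = 2 * |Real.sin (Real.pi * d n)| := by
      unfold ex
      have := Complex.norm_exp_I_mul_ofReal_sub_one (2 * Real.pi * d n)
      rw [mul_comm Complex.I] at this
      rw [this, Real.norm_eq_abs, abs_mul, abs_two]
      congr 3; ring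
    have hsn := hs n hn
    rw [hn1, abs_of_pos (by linarith)] at h'
    rw [le_div_iff₀ (by positivity)]
    nlinarith [norm_nonneg (c n)]
  have huc : ∀ n, |u n| ≤ ‖c n‖ := fun n => by
    have := Complex.abs_im_le_norm (c n)
    simpa [hc] using this
  have hum : ∀ n < N, u (n + 1) ≤ u n := fun n hn => by
    have ha := hs n hn.le
    have hb := hs (n + 1) hn
    have hm := hmono n hn
    have hm2 := h2 (n + 1) hn
    have hm1 := h1 n hn.le
    have := cot_antitone (a := Real.pi * d n) (b := Real.pi * d (n + 1)) (by linarith)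
      (by linarith) (by
        apply mul_le_mul_of_nonneg_left _ Real.pi_pos.le
        simp only [hd]; linarith) (by
        rw [← mul_sub]
        have : d (n + 1) - d n ≤ 1 := by simp only [hd]; linarith
        nlinarith [Real.pi_pos])
    simp only [hu]; linarith
  have key : ∀ k ≤ N, ‖∑ n ∈ Finset.range (k + 1), E n - c k * E (k + 1)‖
      ≤ ‖c 0‖ + (u 0 - u k) := by
    intro k hk
    induction k with
    | zero =>
      rw [zero_add, Finset.sum_range_one, sub_self, add_zero]
      have : E 0 - c 0 * E (0 + 1) = -(c 0 * E 0) := by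
        nth_rewrite 1 [hcE 0 hk]; ring
      rw [zero_add] at this
      rw [this, norm_neg, norm_mul, hnE, mul_one]
    | succ k ih =>
      have e : ∑ n ∈ Finset.range (k + 1 + 1), E n - c (k + 1) * E (k + 1 + 1)
          = (∑ n ∈ Finset.range (k + 1), E n - c k * E (k + 1)) + (c k - c (k + 1)) * E (k + 1) := by
        rw [Finset.sum_range_succ]
        linear_combination hcE (k + 1) hk
      rw [e]
      have e2 : ‖(c k - c (k + 1)) * E (k + 1)‖ = u k - u (k + 1) := by
        rw [norm_mul, hnE, mul_one]
        have : c k - c (k + 1) = ((u (k + 1) - u k : ℝ) : ℂ) * Complex.I := by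
          simp only [hc]; push_cast; ring
        rw [this, norm_mul, Complex.norm_I, mul_one, Complex.norm_real, Real.norm_eq_abs, abs_sub_comm,
          abs_of_nonneg (sub_nonneg.2 (hum k hk))]
      calc _ ≤ _ := norm_add_le _ _
        _ ≤ ‖c 0‖ + (u 0 - u k) + (u k - u (k + 1)) := add_le_add (ih (by omega)) e2.le
        _ = _ := by ring
  have hk := key N le_rfl
  have e : ∑ n ∈ Finset.range (N + 1), ex (f n) = ∑ n ∈ Finset.range (N + 1), E n :=
    Finset.sum_congr rfl fun n _ => (hEe n).symm
  rw [e]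
  have h3 : ‖∑ n ∈ Finset.range (N + 1), E n‖
      ≤ ‖∑ n ∈ Finset.range (N + 1), E n - c N * E (N + 1)‖ + ‖c N * E (N + 1)‖ := by
    have := norm_add_le (∑ n ∈ Finset.range (N + 1), E n - c N * E (N + 1)) (c N * E (N + 1))
    rwa [sub_add_cancel] at this
  rw [norm_mul, hnE, mul_one] at h3
  have a1 := hcn 0 (Nat.zero_le _)
  have a2 := hcn N le_rfl
  have a3 := (abs_le.1 (huc 0)).2
  have a4 := (abs_le.1 (huc N)).1
  have e4 : 1 / δ = 4 * (1 / (4 * δ)) := by field_simp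
  linarith

/-- Kusmin–Landau on an interval of integers. -/
lemma kusmin_landau_Icc (f : ℕ → ℝ) (a b : ℕ) (hab : a ≤ b) (δ : ℝ) (hδ : 0 < δ) (m : ℤ)
    (h1 : ∀ n, a ≤ n → n ≤ b → m + δ ≤ f (n + 1) - f n)
    (h2 : ∀ n, a ≤ n → n ≤ b → f (n + 1) - f n ≤ m + 1 - δ)
    (hmono : ∀ n, a ≤ n → n < b → f (n + 1) - f n ≤ f (n + 2) - f (n + 1)) :
    ‖∑ n ∈ Finset.Icc a b, ex (f n)‖ ≤ 1 / δ := by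
  have e : ∑ n ∈ Finset.Icc a b, ex (f n)
      = ∑ n ∈ Finset.range (b - a + 1), ex ((fun k => f (a + k)) n) := by
    rw [Finset.range_eq_Ico, ← Finset.Ico_add_one_right_eq_Icc, Finset.sum_Ico_eq_sum_range,
      Nat.sub_add_comm hab, ← Finset.range_eq_Ico]
  rw [e]
  refine kusmin_landau _ _ δ hδ m (fun n hn => ?_) (fun n hn => ?_) (fun n hn => ?_)
  · exact h1 (a + n) (by omega) (by omega)
  · exact h2 (a + n) (by omega) (by omega)
  · exact hmono (a + n) (by omega) (by omega)

lemma eq_Icc_of_ordConvex (s : Finset ℕ) (hs : s.Nonempty)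
    (h : ∀ a ∈ s, ∀ b ∈ s, ∀ n, a ≤ n → n ≤ b → n ∈ s) :
    s = Finset.Icc (s.min' hs) (s.max' hs) := by
  ext n
  rw [Finset.mem_Icc]
  exact ⟨fun hn => ⟨s.min'_le n hn, s.le_max' n hn⟩,
    fun hn => h _ (s.min'_mem hs) _ (s.max'_mem hs) n hn.1 hn.2⟩

/-- Second derivative test (with a free parameter `δ`). -/
lemma second_derivative_test (f : ℕ → ℝ) (N : ℕ) (lam C δ : ℝ) (hlam : 0 < lam) (hC : 0 ≤ C) (hδ : 0 < δ)
    (h1 : ∀ n, n + 1 < N → lam ≤ (f (n + 2) - f (n + 1)) - (f (n + 1) - f n))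
    (h2 : ∀ n, n + 1 < N → (f (n + 2) - f (n + 1)) - (f (n + 1) - f n) ≤ C * lam) :
    ‖∑ n ∈ Finset.range N, ex (f n)‖ ≤ (C * lam * N + 2) * (1 / δ + (2 * δ / lam + 1)) := by
  rcases Nat.eq_zero_or_pos N with rfl | hN
  · simp; positivity
  set d : ℕ → ℝ := fun n => f (n + 1) - f n with hd
  have hdd : ∀ n k, n + k < N → d n + k * lam ≤ d (n + k) := by
    intro n k hk
    induction k with
    | zero => simp
    | succ k ih =>
      have a := ih (by omega)
      have b := h1 (n + k) (by omega)
      have c : d (n + (k + 1)) = f (n + k + 2) - f (n + k + 1) := rfl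
      have c' : d (n + k) = f (n + k + 1) - f (n + k) := rfl
      rw [c]; push_cast; linarith
  have hdmono : ∀ n k, n ≤ k → k < N → d n ≤ d k := by
    intro n k hnk hk
    obtain ⟨j, rfl⟩ := Nat.exists_eq_add_of_le hnk
    have := hdd n j hk
    have : 0 ≤ (j : ℝ) * lam := by positivity
    linarith
  have hdup : ∀ k, k < N → d k ≤ d 0 + k * (C * lam) := by
    intro k hk
    induction k with
    | zero => simp
    | succ k ih =>
      have a := ih (by omega)
      have b := h2 k (by omega)
      have c : d (k + 1) = f (k + 2) - f (k + 1) := rfl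
      have c' : d k = f (k + 1) - f k := rfl
      rw [c]; push_cast; linarith
  set g : ℕ → ℤ := fun n => ⌊d n + δ⌋ with hg
  have hcard : (((Finset.range N).image g).card : ℝ) ≤ C * lam * N + 2 := by
    have hsub : (Finset.range N).image g ⊆ Finset.Icc (g 0) (g (N - 1)) := by
      intro m hm
      obtain ⟨n, hn, rfl⟩ := Finset.mem_image.1 hm
      have hn := Finset.mem_range.1 hn
      rw [Finset.mem_Icc]
      exact ⟨Int.floor_le_floor (by linarith [hdmono 0 n (Nat.zero_le _) hn]),
        Int.floor_le_floor (by linarith [hdmono n (N - 1) (by omega) (by omega)])⟩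
    have h01 : g 0 ≤ g (N - 1) :=
      Int.floor_le_floor (by linarith [hdmono 0 (N - 1) (Nat.zero_le _) (by omega)])
    have hc := Finset.card_le_card hsub
    rw [Int.card_Icc] at hc
    have hc' : (((Finset.range N).image g).card : ℝ) ≤ ((g (N - 1) + 1 - g 0).toNat : ℝ) := by
      exact_mod_cast hc
    have e : ((g (N - 1) + 1 - g 0).toNat : ℝ) = (g (N - 1) : ℝ) + 1 - g 0 := by
      have : ((g (N - 1) + 1 - g 0).toNat : ℤ) = g (N - 1) + 1 - g 0 :=
        Int.toNat_of_nonneg (by omega)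
      exact_mod_cast this
    have f1 : (g (N - 1) : ℝ) ≤ d (N - 1) + δ := Int.floor_le _
    have f2 : d 0 + δ < g 0 + 1 := Int.lt_floor_add_one _
    have f3 := hdup (N - 1) (by omega)
    have hCl : 0 ≤ (N - 1 : ℕ) * (C * lam) := by
      have := hdmono 0 (N - 1) (Nat.zero_le _) (by omega)
      linarith
    have f4 : ((N - 1 : ℕ) : ℝ) * (C * lam) ≤ C * lam * N := by
      have hle : ((N - 1 : ℕ) : ℝ) ≤ N := by exact_mod_cast Nat.sub_le _ _
      have : 0 ≤ C * lam := by positivity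
      nlinarith
    linarith
  have hfib : ∀ m ∈ (Finset.range N).image g,
      ‖∑ n ∈ (Finset.range N).filter (fun n => g n = m), ex (f n)‖ ≤ 1 / δ + (2 * δ / lam + 1) := by
    intro m _
    rw [← Finset.sum_filter_add_sum_filter_not _ (fun n => m + δ ≤ d n)]
    refine (norm_add_le _ _).trans (add_le_add ?_ ?_)
    · set s := ((Finset.range N).filter (fun n => g n = m)).filter (fun n => m + δ ≤ d n) with hs
      have hmem : ∀ n, n ∈ s ↔ n < N ∧ g n = m ∧ m + δ ≤ d n := by
        intro n; simp [hs, and_assoc]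
      rcases s.eq_empty_or_nonempty with h0 | hne
      · rw [h0]; simp; positivity
      have hconv := eq_Icc_of_ordConvex s hne (by
        intro a ha b hb n han hnb
        rw [hmem] at ha hb ⊢
        have hnN : n < N := by omega
        have l1 := hdmono a n han hnN
        have l2 := hdmono n b hnb hb.1
        refine ⟨hnN, le_antisymm ?_ ?_, by linarith [ha.2.2]⟩
        · rw [← hb.2.1]; exact Int.floor_le_floor (by linarith)
        · rw [← ha.2.1]; exact Int.floor_le_floor (by linarith))
      have hle : s.min' hne ≤ s.max' hne := s.min'_le_max' hne
      have hIcc : ∀ n, s.min' hne ≤ n → n ≤ s.max' hne → n ∈ s := by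
        intro n h3 h4
        rw [hconv]; exact Finset.mem_Icc.2 ⟨h3, h4⟩
      rw [hconv]
      refine kusmin_landau_Icc f _ _ hle δ hδ m ?_ ?_ ?_
      · intro n h3 h4
        exact ((hmem n).1 (hIcc n h3 h4)).2.2
      · intro n h3 h4
        have := ((hmem n).1 (hIcc n h3 h4)).2.1
        have h5 : d n + δ < m + 1 := by rw [← this]; exact Int.lt_floor_add_one _
        have : d n = f (n + 1) - f n := rfl
        linarith
      · intro n h3 h4
        have hn := ((hmem _).1 (hIcc (n + 1) (by omega) (by omega))).1
        have := h1 n hn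
        linarith
    · set s := ((Finset.range N).filter (fun n => g n = m)).filter (fun n => ¬ m + δ ≤ d n) with hs
      have hmem : ∀ n, n ∈ s ↔ n < N ∧ g n = m ∧ d n < m + δ := by
        intro n; simp [hs, and_assoc]
      refine (norm_sum_le _ _).trans ?_
      simp only [norm_ex, Finset.sum_const, nsmul_eq_mul, mul_one]
      rcases s.eq_empty_or_nonempty with h0 | hne
      · rw [h0]; simp; positivity
      have hle : s.min' hne ≤ s.max' hne := s.min'_le_max' hne
      have hsub : s ⊆ Finset.Icc (s.min' hne) (s.max' hne) := fun n hn =>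
        Finset.mem_Icc.2 ⟨s.min'_le n hn, s.le_max' n hn⟩
      have hc := Finset.card_le_card hsub
      rw [Nat.card_Icc] at hc
      have ha := (hmem _).1 (s.min'_mem hne)
      have hb := (hmem _).1 (s.max'_mem hne)
      obtain ⟨j, hj⟩ := Nat.exists_eq_add_of_le hle
      have hl := hdd (s.min' hne) j (by rw [← hj]; exact hb.1)
      rw [← hj] at hl
      have h5 : (m : ℝ) ≤ d (s.min' hne) + δ := by
        rw [← ha.2.1]; exact Int.floor_le _
      have hcj : s.card ≤ j + 1 := by omega
      have hcj' : (s.card : ℝ) ≤ j + 1 := by exact_mod_cast hcj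
      have : (j : ℝ) ≤ 2 * δ / lam := by
        rw [le_div_iff₀ hlam]; linarith [hb.2.2]
      linarith
  rw [← Finset.sum_fiberwise_of_maps_to (g := g) (t := (Finset.range N).image g)
    (fun n hn => Finset.mem_image_of_mem g hn)]
  calc _ ≤ ∑ m ∈ (Finset.range N).image g,
        ‖∑ n ∈ (Finset.range N).filter (fun n => g n = m), ex (f n)‖ := norm_sum_le _ _
    _ ≤ ∑ m ∈ (Finset.range N).image g, (1 / δ + (2 * δ / lam + 1)) := Finset.sum_le_sum hfib
    _ = ((Finset.range N).image g).card * (1 / δ + (2 * δ / lam + 1)) := by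
        rw [Finset.sum_const, nsmul_eq_mul]
    _ ≤ _ := by
      apply mul_le_mul_of_nonneg_right hcard
      positivity

/-- The van der Corput differencing inequality. -/
lemma vdc_inequality (z : ℕ → ℂ) (M Q : ℕ) (hQ : 0 < Q) (B : ℝ) (hBn : 0 ≤ B)
    (hz : ∀ n, ‖z n‖ ≤ 1)
    (hB : ∀ r, 1 ≤ r → r < Q →
      ‖∑ n ∈ Finset.range (M - r), z (n + r) * (starRingEnd ℂ) (z n)‖ ≤ B) :
    ‖∑ n ∈ Finset.range M, z n‖ ^ 2 ≤ (M + Q) * (M / Q + B) := by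
  set z' : ℕ → ℂ := fun n => if Q ≤ n ∧ n < Q + M then z (n - Q) else 0 with hz'
  set S := ∑ n ∈ Finset.range M, z n with hS
  -- sums over windows
  have hwin : ∀ (F : ℕ → ℂ) (q : ℕ), q ≤ Q → (∀ n, ¬ (Q ≤ n ∧ n < Q + M) → F n = 0) →
      ∑ K ∈ Finset.range (M + Q), F (K + q) = ∑ n ∈ Finset.range M, F (Q + n) := by
    intro F q hq hF
    have e1 : ∑ K ∈ Finset.range (M + Q), F (K + q) = ∑ n ∈ Finset.Ico q (q + (M + Q)), F n := by
      rw [Finset.sum_Ico_eq_sum_range]; simp [add_comm]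
    have e2 : ∑ n ∈ Finset.range M, F (Q + n) = ∑ n ∈ Finset.Ico Q (Q + M), F n := by
      rw [Finset.sum_Ico_eq_sum_range]; simp
    rw [e1, e2]
    symm
    apply Finset.sum_subset
    · intro n hn
      rw [Finset.mem_Ico] at hn ⊢; omega
    · intro n _ hn
      rw [Finset.mem_Ico] at hn; exact hF n hn
  have h1 : ∑ K ∈ Finset.range (M + Q), ∑ q ∈ Finset.range Q, z' (K + q) = Q * S := by
    rw [Finset.sum_comm]
    rw [Finset.sum_congr rfl (g := fun _ => S)]
    · simp
    · intro q hq
      rw [hwin z' q (Finset.mem_range.1 hq).le (fun n hn => by simp only [hz']; rw [if_neg hn])]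
      apply Finset.sum_congr rfl
      intro n hn
      simp only [hz']
      rw [if_pos ⟨by omega, by have := Finset.mem_range.1 hn; omega⟩]
      congr 1; omega
  have hcorr : ∀ q < Q, ∀ q' < Q, q' < q →
      ‖∑ K ∈ Finset.range (M + Q), z' (K + q) * (starRingEnd ℂ) (z' (K + q'))‖ ≤ B := by
    intro q hq q' hq' hlt
    have e := hwin (fun n => z' (n + (q - q')) * (starRingEnd ℂ) (z' n)) q' hq'.le
      (fun n hn => by simp only [hz']; rw [if_neg hn]; simp)
    have e2 : ∑ K ∈ Finset.range (M + Q), z' (K + q) * (starRingEnd ℂ) (z' (K + q'))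
        = ∑ K ∈ Finset.range (M + Q), z' (K + q' + (q - q')) * (starRingEnd ℂ) (z' (K + q')) :=
      Finset.sum_congr rfl fun K _ => by congr 2; omega
    rw [e2, e]
    refine le_trans (le_of_eq ?_) (hB (q - q') (by omega) (by omega))
    congr 1
    symm
    apply Finset.sum_subset_zero_on_sdiff
    · intro n hn
      rw [Finset.mem_range] at hn ⊢; omega
    · intro n hn
      rw [Finset.mem_sdiff, Finset.mem_range, Finset.mem_range] at hn
      simp only [hz']
      rw [if_neg (by omega)]; simp
    · intro n hn
      have := Finset.mem_range.1 hn
      simp only [hz']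
      rw [if_pos (by omega), if_pos (by omega)]
      congr 3 <;> omega
  have hdiag : ∀ q < Q, ‖∑ K ∈ Finset.range (M + Q), z' (K + q) * (starRingEnd ℂ) (z' (K + q))‖ ≤ M := by
    intro q hq
    rw [hwin (fun n => z' n * (starRingEnd ℂ) (z' n)) q hq.le
      (fun n hn => by simp only [hz']; rw [if_neg hn]; simp)]
    refine (norm_sum_le _ _).trans ?_
    calc _ ≤ ∑ n ∈ Finset.range M, (1 : ℝ) := by
          apply Finset.sum_le_sum
          intro n _
          rw [norm_mul, Complex.norm_conj]
          have : ‖z' (Q + n)‖ ≤ 1 := by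
            simp only [hz']; split_ifs
            · exact hz _
            · simp
          exact mul_le_one₀ this (norm_nonneg _) this
      _ = M := by simp
  have hB0 : ∀ q < Q, ∀ q' < Q, ‖∑ K ∈ Finset.range (M + Q), z' (K + q) * (starRingEnd ℂ) (z' (K + q'))‖
      ≤ (if q = q' then (M : ℝ) else 0) + |B| := by
    intro q hq q' hq'
    rcases lt_trichotomy q q' with h | h | h
    · rw [if_neg h.ne, zero_add]
      refine le_trans ?_ (le_abs_self B)
      refine le_trans (le_of_eq ?_) (hcorr q' hq' q hq h)
      rw [← Complex.norm_conj, map_sum]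
      congr 1
      exact Finset.sum_congr rfl fun K _ => by rw [map_mul, Complex.conj_conj, mul_comm]
    · subst h
      rw [if_pos rfl]
      have := hdiag q hq
      have := abs_nonneg B
      linarith
    · rw [if_neg h.ne', zero_add]
      exact (hcorr q hq q' hq' h).trans (le_abs_self B)
  have h2 : (Q * ‖S‖) ^ 2 ≤ (M + Q) * (Q * M + Q * Q * |B|) := by
    have e : (Q : ℝ) * ‖S‖ = ‖∑ K ∈ Finset.range (M + Q), ∑ q ∈ Finset.range Q, z' (K + q)‖ := by
      rw [h1]; simp
    rw [e]
    calc _ ≤ (∑ K ∈ Finset.range (M + Q), ‖∑ q ∈ Finset.range Q, z' (K + q)‖) ^ 2 := by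
          gcongr; exact norm_sum_le _ _
      _ ≤ (Finset.range (M + Q)).card * ∑ K ∈ Finset.range (M + Q), ‖∑ q ∈ Finset.range Q, z' (K + q)‖ ^ 2 :=
          sq_sum_le_card_mul_sum_sq
      _ = (M + Q) * ∑ K ∈ Finset.range (M + Q), ‖∑ q ∈ Finset.range Q, z' (K + q)‖ ^ 2 := by
          simp
      _ ≤ _ := by
          gcongr
          have e3 : ((∑ K ∈ Finset.range (M + Q), ‖∑ q ∈ Finset.range Q, z' (K + q)‖ ^ 2 : ℝ) : ℂ)
              = ∑ q ∈ Finset.range Q, ∑ q' ∈ Finset.range Q,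
                ∑ K ∈ Finset.range (M + Q), z' (K + q) * (starRingEnd ℂ) (z' (K + q')) := by
            push_cast
            rw [Finset.sum_congr rfl (g := fun K => ∑ q ∈ Finset.range Q, ∑ q' ∈ Finset.range Q,
              z' (K + q) * (starRingEnd ℂ) (z' (K + q')))]
            · rw [Finset.sum_comm]
              exact Finset.sum_congr rfl fun q _ => Finset.sum_comm
            · intro K _
              rw [← Complex.mul_conj', map_sum, Finset.sum_mul_sum]
          have e4 : ∑ K ∈ Finset.range (M + Q), ‖∑ q ∈ Finset.range Q, z' (K + q)‖ ^ 2
              ≤ ‖((∑ K ∈ Finset.range (M + Q), ‖∑ q ∈ Finset.range Q, z' (K + q)‖ ^ 2 : ℝ) : ℂ)‖ := by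
            rw [Complex.norm_real]; exact le_abs_self _
          refine e4.trans ?_
          rw [e3]
          calc _ ≤ ∑ q ∈ Finset.range Q, ∑ q' ∈ Finset.range Q,
                ((if q = q' then (M : ℝ) else 0) + |B|) := by
                refine (norm_sum_le _ _).trans (Finset.sum_le_sum fun q hq => ?_)
                refine (norm_sum_le _ _).trans (Finset.sum_le_sum fun q' hq' => ?_)
                exact hB0 q (Finset.mem_range.1 hq) q' (Finset.mem_range.1 hq')
            _ = _ := by
                simp only [Finset.sum_add_distrib, Finset.sum_ite_eq, Finset.mem_range,
                  Finset.sum_const, Finset.card_range, nsmul_eq_mul]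
                rw [Finset.sum_congr rfl (g := fun _ => (M : ℝ))]
                · simp; ring
                · intro q hq; rw [if_pos (Finset.mem_range.1 hq)]
  have hQ' : (0 : ℝ) < Q := by exact_mod_cast hQ
  rw [abs_of_nonneg hBn] at h2
  have : (M + Q : ℝ) * (Q * M + Q * Q * B) = Q ^ 2 * ((M + Q) * (M / Q + B)) := by
    field_simp
  rw [this, mul_pow] at h2
  exact le_of_mul_le_mul_left h2 (by positivity)

lemma fwdDiff_shift_sub (f : ℕ → ℝ) (k q n : ℕ) :
    ((fwdDiff 1)^[k] (fun n => f (n + q) - f n)) n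
      = ∑ i ∈ Finset.range q, ((fwdDiff 1)^[k + 1] f) (n + i) := by
  have h : (fun n => f (n + q) - f n) = fun n => ∑ i ∈ Finset.range q, (fwdDiff 1 f) (n + i) := by
    funext n
    have := Finset.sum_range_sub (fun i => f (n + i)) q
    simp only [add_zero] at this
    rw [← this]; rfl
  rw [h]
  have h2 : ∀ (k : ℕ) (g : ℕ → ℝ) (n : ℕ),
      ((fwdDiff 1)^[k] (fun n => ∑ i ∈ Finset.range q, g (n + i))) n
        = ∑ i ∈ Finset.range q, ((fwdDiff 1)^[k] g) (n + i) := by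
    intro k
    induction k with
    | zero => intro g n; rfl
    | succ k ih =>
      intro g n
      rw [Function.iterate_succ_apply, Function.iterate_succ_apply, ← ih]
      refine congrFun (congrArg _ ?_) n
      funext n
      simp only [fwdDiff, ← Finset.sum_sub_distrib]
      exact Finset.sum_congr rfl fun i _ => by rw [add_right_comm]
  rw [h2 k, Function.iterate_succ_apply]

/-- The `k`-th derivative test, in a qualitative power-saving form. -/
lemma kth_derivative_test (k : ℕ) (C : ℝ) (hC : 1 ≤ C) : ∀ δ : ℝ, 0 < δ → δ ≤ 1 →
    ∃ A : ℝ, 0 < A ∧ ∃ η : ℝ, 0 < η ∧ η ≤ 1 ∧ ∀ (N : ℝ) (M : ℕ) (f : ℕ → ℝ) (lam : ℝ), 1 ≤ N → (M : ℝ) ≤ N →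
      N ^ (-(2 - δ)) ≤ lam → lam ≤ N ^ (-δ) →
      (∀ n < M, lam ≤ ((fwdDiff 1)^[k + 2] f) n ∧ ((fwdDiff 1)^[k + 2] f) n ≤ C * lam) →
      ‖∑ n ∈ Finset.range M, ex (f n)‖ ≤ A * N ^ (1 - η) := by
  induction k with
  | zero =>
    intro δ hδ hδ1
    refine ⟨4 * C + 8, by positivity, δ / 2, by positivity, by linarith, ?_⟩
    intro N M f lam hN hM hl1 hl2 hf
    have hN0 : 0 < N := by linarith
    have hlam : 0 < lam := lt_of_lt_of_le (Real.rpow_pos_of_pos hN0 _) hl1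
    have hlam1 : lam ≤ 1 := hl2.trans (Real.rpow_le_one_of_one_le_of_nonpos hN (by linarith))
    have hs : 0 < Real.sqrt lam := Real.sqrt_pos.2 hlam
    have hf' : ∀ n, n + 1 < M → lam ≤ (f (n + 2) - f (n + 1)) - (f (n + 1) - f n) ∧
        (f (n + 2) - f (n + 1)) - (f (n + 1) - f n) ≤ C * lam := by
      intro n hn
      have := hf n (by omega)
      simpa [fwdDiff] using this
    have h := second_derivative_test f M lam C (Real.sqrt lam) hlam (by linarith) hs
      (fun n hn => (hf' n hn).1) (fun n hn => (hf' n hn).2)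
    refine h.trans ?_
    have hsq : Real.sqrt lam * Real.sqrt lam = lam := Real.mul_self_sqrt hlam.le
    have e1 : 2 * Real.sqrt lam / lam = 2 * (1 / Real.sqrt lam) := by
      rw [div_eq_iff hlam.ne']; nth_rewrite 3 [← hsq]; field_simp
    have e2 : 1 ≤ 1 / Real.sqrt lam := by
      rw [le_div_iff₀ hs, one_mul]; exact Real.sqrt_le_one.2 hlam1
    have u1 : Real.sqrt lam ≤ N ^ (-(δ / 2)) := by
      rw [Real.sqrt_eq_rpow]
      calc lam ^ (1 / 2 : ℝ) ≤ (N ^ (-δ)) ^ (1 / 2 : ℝ) := Real.rpow_le_rpow hlam.le hl2 (by norm_num)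
        _ = _ := by rw [← Real.rpow_mul hN0.le]; congr 1; ring
    have u2 : 1 / Real.sqrt lam ≤ N ^ (1 - δ / 2) := by
      rw [div_le_iff₀ hs, Real.sqrt_eq_rpow]
      calc (1 : ℝ) = N ^ (1 - δ / 2) * (N ^ (-(2 - δ))) ^ (1 / 2 : ℝ) := by
            rw [← Real.rpow_mul hN0.le, ← Real.rpow_add hN0]
            symm
            convert Real.rpow_zero N using 2; ring
        _ ≤ _ := by
            gcongr
    have u3 : N * N ^ (-(δ / 2)) = N ^ (1 - δ / 2) := by
      nth_rewrite 1 [← Real.rpow_one N]; rw [← Real.rpow_add hN0]; congr 1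
    rw [e1]
    set s := Real.sqrt lam
    calc (C * lam * M + 2) * (1 / s + (2 * (1 / s) + 1)) ≤ (C * lam * N + 2) * (4 * (1 / s)) := by
          gcongr; linarith
      _ = 4 * C * N * s + 8 * (1 / s) := by
          rw [← hsq]; field_simp; ring
      _ ≤ 4 * C * N * N ^ (-(δ / 2)) + 8 * N ^ (1 - δ / 2) := by gcongr
      _ = _ := by rw [mul_assoc (4 * C), u3]; ring
  | succ k ih =>
    intro δ hδ hδ1
    obtain ⟨A, hA, η, hη, hη1, H⟩ := ih (δ / 2) (by positivity) (by linarith)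
    set κ := min (δ / 2) η with hκ
    have hκ0 : 0 < κ := lt_min (by positivity) hη
    refine ⟨3 * (1 + A), by positivity, κ / 2, by positivity, ?_, ?_⟩
    · have := min_le_right (δ / 2) η; linarith
    intro N M f lam hN hM hl1 hl2 hf
    have hN0 : 0 < N := by linarith
    have hlam : 0 < lam := lt_of_lt_of_le (Real.rpow_pos_of_pos hN0 _) hl1
    set P := N ^ (δ / 2) with hP
    have hP1 : 1 ≤ P := Real.one_le_rpow hN (by positivity)
    have hPN : P ≤ N := by
      calc P ≤ N ^ (1 : ℝ) := Real.rpow_le_rpow_of_exponent_le hN (by linarith)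
        _ = N := Real.rpow_one N
    set Q := ⌈P⌉₊ with hQ
    have hQ0 : 0 < Q := Nat.ceil_pos.2 (by linarith)
    have hQP : P ≤ Q := Nat.le_ceil P
    have hQ2 : (Q : ℝ) ≤ 2 * N := by have := Nat.ceil_lt_add_one (show 0 ≤ P by linarith); linarith
    have hB : ∀ r, 1 ≤ r → r < Q →
        ‖∑ n ∈ Finset.range (M - r), ex (f (n + r)) * (starRingEnd ℂ) (ex (f n))‖ ≤ A * N ^ (1 - η) := by
      intro r hr1 hr2
      have hrP : (r : ℝ) ≤ P := by
        have := Nat.lt_ceil.1 hr2; exact this.le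
      have hr1' : (1 : ℝ) ≤ r := by exact_mod_cast hr1
      have e : ∑ n ∈ Finset.range (M - r), ex (f (n + r)) * (starRingEnd ℂ) (ex (f n))
          = ∑ n ∈ Finset.range (M - r), ex ((fun n => f (n + r) - f n) n) :=
        Finset.sum_congr rfl fun n _ => by rw [conj_ex, ← ex_add, ← sub_eq_add_neg]
      rw [e]
      apply H N (M - r) _ (r * lam) hN
      · exact (Nat.cast_le.2 (Nat.sub_le _ _)).trans hM
      · calc N ^ (-(2 - δ / 2)) ≤ N ^ (-(2 - δ)) :=
              Real.rpow_le_rpow_of_exponent_le hN (by linarith)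
          _ ≤ lam := hl1
          _ ≤ r * lam := by nlinarith
      · calc (r : ℝ) * lam ≤ P * N ^ (-δ) := by gcongr
          _ = N ^ (-(δ / 2)) := by rw [hP, ← Real.rpow_add hN0]; congr 1; ring
      · intro n hn
        rw [fwdDiff_shift_sub]
        constructor
        · calc (r : ℝ) * lam = ∑ i ∈ Finset.range r, lam := by simp
            _ ≤ _ := Finset.sum_le_sum fun i hi =>
              (hf (n + i) (by have := Finset.mem_range.1 hi; omega)).1
        · calc _ ≤ ∑ i ∈ Finset.range r, C * lam := Finset.sum_le_sum fun i hi =>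
              (hf (n + i) (by have := Finset.mem_range.1 hi; omega)).2
            _ = _ := by simp; ring
    have hv := vdc_inequality (fun n => ex (f n)) M Q hQ0 (A * N ^ (1 - η)) (by positivity)
      (fun n => (norm_ex _).le) hB
    have hsq : ‖∑ n ∈ Finset.range M, ex (f n)‖ ^ 2 ≤ (3 * (1 + A) * N ^ (1 - κ / 2)) ^ 2 := by
      refine hv.trans ?_
      have f1 : (M : ℝ) / Q ≤ N ^ (1 - κ) := by
        calc (M : ℝ) / Q ≤ N / P := by gcongr
          _ = N ^ (1 - δ / 2) := by rw [hP, Real.rpow_sub hN0, Real.rpow_one]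
          _ ≤ _ := Real.rpow_le_rpow_of_exponent_le hN (by have := min_le_left (δ / 2) η; linarith)
      have f2 : N ^ (1 - η) ≤ N ^ (1 - κ) :=
        Real.rpow_le_rpow_of_exponent_le hN (by have := min_le_right (δ / 2) η; linarith)
      have f3 : N * N ^ (1 - κ) = (N ^ (1 - κ / 2)) ^ 2 := by
        rw [← Real.rpow_natCast, ← Real.rpow_mul hN0.le]
        nth_rewrite 1 [← Real.rpow_one N]; rw [← Real.rpow_add hN0]; congr 1; push_cast; ring
      calc (M + Q : ℝ) * (M / Q + A * N ^ (1 - η)) ≤ (N + 2 * N) * (N ^ (1 - κ) + A * N ^ (1 - κ)) := by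
            gcongr
        _ = 3 * (1 + A) * (N * N ^ (1 - κ)) := by ring
        _ = 3 * (1 + A) * (N ^ (1 - κ / 2)) ^ 2 := by rw [f3]
        _ ≤ _ := by
            rw [mul_pow]
            gcongr
            nlinarith
    exact (sq_le_sq₀ (norm_nonneg _) (by positivity)).1 hsq

/-- The multiplicative character `z ↦ z ^ (i t)` on positive reals. -/
noncomputable def ch (t z : ℝ) : ℂ := Complex.exp ((t * Real.log z : ℝ) * Complex.I)

lemma norm_ch (t z : ℝ) : ‖ch t z‖ = 1 := Complex.norm_exp_ofReal_mul_I _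

lemma ch_mul (t : ℝ) {x y : ℝ} (hx : x ≠ 0) (hy : y ≠ 0) : ch t (x * y) = ch t x * ch t y := by
  unfold ch; rw [← Complex.exp_add, Real.log_mul hx hy]; congr 1; push_cast; ring

lemma ch_div (t : ℝ) {x y : ℝ} (hx : x ≠ 0) (hy : y ≠ 0) :
    ch t (x / y) = ch t x * (starRingEnd ℂ) (ch t y) := by
  unfold ch
  rw [← Complex.exp_conj, ← Complex.exp_add, Real.log_div hx hy, map_mul, Complex.conj_ofReal,
    Complex.conj_I]
  congr 1; push_cast; ring

lemma ch_one (t : ℝ) : ch t 1 = 1 := by simp [ch]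

lemma ch_sub (s t z : ℝ) : ch (s - t) z = ch s z * (starRingEnd ℂ) (ch t z) := by
  unfold ch
  rw [← Complex.exp_conj, ← Complex.exp_add, map_mul, Complex.conj_ofReal, Complex.conj_I]
  congr 1; push_cast; ring

lemma conj_ch (t z : ℝ) : (starRingEnd ℂ) (ch t z) = ch (-t) z := by
  unfold ch
  rw [← Complex.exp_conj, map_mul, Complex.conj_ofReal, Complex.conj_I]
  congr 1; push_cast; ring

lemma continuous_ch (z : ℝ) : Continuous fun t => ch t z := by unfold ch; fun_prop

lemma ch_eq_ex (t z : ℝ) : ch t z = ex (t / (2 * Real.pi) * Real.log z) := by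
  unfold ch ex; congr 3; field_simp

/-- Iterated differences of the logarithm. -/
noncomputable def logDiff : ℕ → ℝ → ℝ
  | 0 => Real.log
  | k + 1 => fun x => logDiff k (x + 1) - logDiff k x

lemma hasDerivAt_logDiff (k : ℕ) : ∀ x : ℝ, 0 < x →
    HasDerivAt (logDiff k) ((-1) ^ k * k.factorial / ∏ i ∈ Finset.range (k + 1), (x + i)) x := by
  induction k with
  | zero => intro x hx; simpa [logDiff] using Real.hasDerivAt_log hx.ne'
  | succ k ih =>
    intro x hx
    have h1 := (ih (x + 1) (by linarith)).comp_add_const x 1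
    have h := h1.sub (ih x hx)
    refine HasDerivAt.congr_deriv (f := logDiff (k + 1)) h ?_
    have e1 : ∏ i ∈ Finset.range (k + 1 + 1), (x + i) = (∏ i ∈ Finset.range (k + 1), (x + i)) * (x + (k + 1)) := by
      rw [Finset.prod_range_succ]; push_cast; rfl
    have e2 : x * ∏ i ∈ Finset.range (k + 1), (x + 1 + i) = ∏ i ∈ Finset.range (k + 1 + 1), (x + i) := by
      rw [Finset.prod_range_succ' (fun i : ℕ => x + (i : ℝ)) (k + 1), mul_comm]
      simp only [Nat.cast_zero, add_zero]
      congr 1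
      exact Finset.prod_congr rfl fun i _ => by push_cast; ring
    have p1 : 0 < ∏ i ∈ Finset.range (k + 1), (x + i) := Finset.prod_pos fun i _ => by positivity
    have p2 : 0 < ∏ i ∈ Finset.range (k + 1), (x + 1 + i) := Finset.prod_pos fun i _ => by positivity
    have p3 : 0 < x + (k + 1) := by positivity
    have e3 := e2.trans e1
    rw [e1]
    set a := ∏ i ∈ Finset.range (k + 1), (x + i)
    set b := ∏ i ∈ Finset.range (k + 1), (x + 1 + i)
    rw [div_sub_div _ _ p2.ne' p1.ne', div_eq_div_iff (by positivity) (by positivity),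
      Nat.factorial_succ]
    push_cast
    rw [pow_succ]
    have : a = x * b / (x + (k + 1)) := by field_simp; linarith
    rw [this]; field_simp; ring

lemma logDiff_bounds (k : ℕ) (x : ℝ) (hx : 0 < x) :
    (k.factorial : ℝ) / (x + 1 + k) ^ (k + 1) ≤ (-1) ^ k * logDiff (k + 1) x ∧
      (-1) ^ k * logDiff (k + 1) x ≤ (k.factorial : ℝ) / x ^ (k + 1) := by
  obtain ⟨ξ, hξ, he⟩ := exists_hasDerivAt_eq_slope (logDiff k)
    (fun x => (-1) ^ k * k.factorial / ∏ i ∈ Finset.range (k + 1), (x + i))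
    (show x < x + 1 by linarith)
    (fun y hy => (hasDerivAt_logDiff k y (lt_of_lt_of_le hx hy.1)).continuousAt.continuousWithinAt)
    (fun y hy => hasDerivAt_logDiff k y (hx.trans hy.1))
  have hξ0 : 0 < ξ := hx.trans hξ.1
  have e : (-1) ^ k * logDiff (k + 1) x = k.factorial / ∏ i ∈ Finset.range (k + 1), (ξ + i) := by
    have : logDiff (k + 1) x = logDiff k (x + 1) - logDiff k x := rfl
    rw [add_sub_cancel_left, div_one] at he
    rw [this, ← he, mul_div_assoc, ← mul_assoc, ← mul_pow]; simp
  rw [e]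
  have hp : 0 < ∏ i ∈ Finset.range (k + 1), (ξ + i) := Finset.prod_pos fun i _ => by positivity
  constructor
  · apply div_le_div_of_nonneg_left (by positivity) hp
    calc _ ≤ ∏ i ∈ Finset.range (k + 1), (x + 1 + k) := by
          apply Finset.prod_le_prod (fun i _ => by positivity)
          intro i hi
          have : (i : ℝ) ≤ k := by exact_mod_cast Nat.lt_succ_iff.1 (Finset.mem_range.1 hi)
          linarith [hξ.2]
      _ = _ := by simp
  · apply div_le_div_of_nonneg_left (by positivity) (by positivity)
    calc x ^ (k + 1) = ∏ i ∈ Finset.range (k + 1), x := by simp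
      _ ≤ _ := by
          apply Finset.prod_le_prod (fun i _ => by positivity)
          intro i _
          have : (0 : ℝ) ≤ i := by positivity
          linarith [hξ.1]

lemma fwdDiff_log (c : ℝ) (a k : ℕ) : ∀ n, ((fwdDiff 1)^[k] (fun n : ℕ => c * Real.log (a + n : ℝ))) n
    = c * logDiff k (a + n) := by
  induction k with
  | zero => intro n; rfl
  | succ k ih =>
    intro n
    rw [Function.iterate_succ_apply', fwdDiff, ih, ih, ← mul_sub]
    congr 1
    simp only [logDiff]
    push_cast
    rw [add_assoc]

lemma sum_Ioc_ch (t : ℝ) (a b : ℕ) : ∑ m ∈ Finset.Ioc a b, ch t m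
    = ∑ n ∈ Finset.range (b - a), ex (t / (2 * Real.pi) * Real.log (((a + 1 : ℕ) : ℝ) + n)) := by
  rw [← Finset.Ico_add_one_add_one_eq_Ioc, Finset.sum_Ico_eq_sum_range]
  simp only [Nat.add_sub_add_right]
  exact Finset.sum_congr rfl fun n _ => by rw [ch_eq_ex]; push_cast; rfl

lemma norm_sum_Ioc_ch_neg (t : ℝ) (a b : ℕ) :
    ‖∑ m ∈ Finset.Ioc a b, ch (-t) m‖ = ‖∑ m ∈ Finset.Ioc a b, ch t m‖ := by
  rw [← Complex.norm_conj, map_sum]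
  congr 1
  exact Finset.sum_congr rfl fun n _ => by rw [conj_ch, neg_neg]

lemma norm_sum_Ioc_ch_le (t : ℝ) (a b : ℕ) : ‖∑ m ∈ Finset.Ioc a b, ch t m‖ ≤ (b - a : ℕ) := by
  refine (norm_sum_le _ _).trans ?_
  simp [norm_ch]

/-- Bound for a dyadic block of the zeta sum. -/
lemma zeta_block_pos (M a b : ℕ) (hM : 1 ≤ M) (ha : M ≤ a) (hb : b ≤ 2 * M) (τ : ℝ) (hτ : 0 < τ) :
    ‖∑ m ∈ Finset.Ioc a b, ch τ m‖ ≤ 160 * (M / τ + Real.sqrt τ) := by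
  have hpi := Real.pi_pos
  have hpi3 := Real.pi_gt_three
  have hpi4 := Real.pi_le_four
  have hM' : (1 : ℝ) ≤ M := by exact_mod_cast hM
  have hsτ : 0 < Real.sqrt τ := Real.sqrt_pos.2 hτ
  have hsq : Real.sqrt τ * Real.sqrt τ = τ := Real.mul_self_sqrt hτ.le
  rcases Nat.lt_or_ge a b with hab | hab
  swap
  · rw [Finset.Ioc_eq_empty (by omega)]; simp; positivity
  have hcount : ((b - a : ℕ) : ℝ) ≤ M := by exact_mod_cast (by omega : b - a ≤ M)
  rw [← norm_sum_Ioc_ch_neg, sum_Ioc_ch]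
  set c := -τ / (2 * Real.pi) with hc
  set f : ℕ → ℝ := fun n => c * Real.log (((a + 1 : ℕ) : ℝ) + n) with hf
  have hx : ∀ n, n < b - a → (M : ℝ) ≤ ((a + 1 : ℕ) : ℝ) + n ∧ ((a + 1 : ℕ) : ℝ) + n ≤ 2 * M := by
    intro n hn
    constructor
    · exact_mod_cast (by omega : M ≤ a + 1 + n)
    · exact_mod_cast (by omega : a + 1 + n ≤ 2 * M)
  have hd1 : ∀ n, n < b - a → -(τ / (2 * Real.pi * M)) ≤ f (n + 1) - f n ∧
      f (n + 1) - f n ≤ -(τ / (6 * Real.pi * M)) := by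
    intro n hn
    obtain ⟨l, u⟩ := hx n hn
    have e : f (n + 1) - f n = c * logDiff 1 (((a + 1 : ℕ) : ℝ) + n) := fwdDiff_log c (a + 1) 1 n
    have hxp : (0 : ℝ) < ((a + 1 : ℕ) : ℝ) + n := by linarith
    have hb := logDiff_bounds 0 _ hxp
    set x := ((a + 1 : ℕ) : ℝ) + n
    simp only [pow_zero, one_mul, zero_add, Nat.factorial_zero, Nat.cast_one, CharP.cast_eq_zero,
      add_zero, pow_one] at hb
    rw [e, hc]
    have h1 : 1 / (3 * M) ≤ logDiff 1 x := by
      refine le_trans ?_ hb.1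
      apply one_div_le_one_div_of_le (by positivity); linarith
    have h2 : logDiff 1 x ≤ 1 / M := by
      refine hb.2.trans ?_
      apply one_div_le_one_div_of_le (by positivity); linarith
    have e1 : -(τ / (2 * Real.pi * M)) = -τ / (2 * Real.pi) * (1 / M) := by field_simp
    have e2 : -(τ / (6 * Real.pi * M)) = -τ / (2 * Real.pi) * (1 / (3 * M)) := by field_simp; norm_num
    have hcn : -τ / (2 * Real.pi) ≤ 0 := by
      rw [neg_div]; have : 0 < τ / (2 * Real.pi) := by positivity
      linarith
    rw [e1, e2]
    exact ⟨mul_le_mul_of_nonpos_left h2 hcn, mul_le_mul_of_nonpos_left h1 hcn⟩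
  have hd2 : ∀ n, n < b - a → τ / (32 * Real.pi * M ^ 2) ≤ (f (n + 2) - f (n + 1)) - (f (n + 1) - f n) ∧
      (f (n + 2) - f (n + 1)) - (f (n + 1) - f n) ≤ 16 * (τ / (32 * Real.pi * M ^ 2)) := by
    intro n hn
    obtain ⟨l, u⟩ := hx n hn
    have e : (f (n + 2) - f (n + 1)) - (f (n + 1) - f n) = c * logDiff 2 (((a + 1 : ℕ) : ℝ) + n) :=
      fwdDiff_log c (a + 1) 2 n
    have hxp : (0 : ℝ) < ((a + 1 : ℕ) : ℝ) + n := by linarith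
    have hb := logDiff_bounds 1 _ hxp
    set x := ((a + 1 : ℕ) : ℝ) + n
    simp only [pow_one, Nat.factorial_one, Nat.cast_one, neg_mul, one_mul] at hb
    rw [e, hc]
    have h1 : 1 / (16 * M ^ 2) ≤ -logDiff 2 x := by
      refine le_trans ?_ hb.1
      apply one_div_le_one_div_of_le (by positivity); norm_num; nlinarith
    have h2 : -logDiff 2 x ≤ 1 / M ^ 2 := by
      refine hb.2.trans ?_
      apply one_div_le_one_div_of_le (by positivity); norm_num; nlinarith
    have e0 : -τ / (2 * Real.pi) * logDiff 2 x = τ / (2 * Real.pi) * (-logDiff 2 x) := by ring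
    have e1 : τ / (32 * Real.pi * M ^ 2) = τ / (2 * Real.pi) * (1 / (16 * M ^ 2)) := by
      field_simp; norm_num
    have e2 : 16 * (τ / (32 * Real.pi * M ^ 2)) = τ / (2 * Real.pi) * (1 / M ^ 2) := by
      field_simp; norm_num
    rw [e0, e2, e1]
    have hcn : 0 ≤ τ / (2 * Real.pi) := by positivity
    exact ⟨mul_le_mul_of_nonneg_left h1 hcn, mul_le_mul_of_nonneg_left h2 hcn⟩
  rcases le_or_gt τ M with h | h
  · have hδ : 0 < τ / (6 * Real.pi * M) := by positivity
    have hle : τ / (2 * Real.pi * M) ≤ 1 / 6 := by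
      rw [div_le_div_iff₀ (by positivity) (by norm_num)]; nlinarith
    have hle2 : τ / (6 * Real.pi * M) ≤ 1 / 6 := by
      rw [div_le_div_iff₀ (by positivity) (by norm_num)]; nlinarith
    have hk := kusmin_landau f (b - a - 1) _ hδ (-1)
      (fun n hn => by have := (hd1 n (by omega)).1; push_cast; linarith)
      (fun n hn => by have := (hd1 n (by omega)).2; push_cast; linarith)
      (fun n hn => by
        have := (hd2 n (by omega)).1
        have : 0 < τ / (32 * Real.pi * M ^ 2) := by positivity
        linarith)
    have e : b - a - 1 + 1 = b - a := by omega
    rw [e] at hk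
    refine hk.trans ?_
    have : 1 / (τ / (6 * Real.pi * M)) = 6 * Real.pi * (M / τ) := by field_simp
    rw [this]
    have hq : 0 < M / τ := by positivity
    nlinarith
  · rcases le_or_gt τ (M ^ 2) with h2 | h2
    · set lam := τ / (32 * Real.pi * M ^ 2) with hlam
      have hl : 0 < lam := by positivity
      have hl1 : lam ≤ 1 := by
        rw [hlam, div_le_one (by positivity)]; nlinarith [sq_nonneg (M : ℝ)]
      have hs : 0 < Real.sqrt lam := Real.sqrt_pos.2 hl
      have hss : Real.sqrt lam * Real.sqrt lam = lam := Real.mul_self_sqrt hl.le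
      have h := second_derivative_test f (b - a) lam 16 (Real.sqrt lam) hl (by norm_num) hs
        (fun n hn => (hd2 n (by omega)).1) (fun n hn => (hd2 n (by omega)).2)
      refine h.trans ?_
      have hs1 : 1 ≤ 1 / Real.sqrt lam := by
        rw [le_div_iff₀ hs, one_mul]; exact Real.sqrt_le_one.2 hl1
      have e1 : 2 * Real.sqrt lam / lam = 2 * (1 / Real.sqrt lam) := by
        rw [div_eq_iff hl.ne']; nth_rewrite 3 [← hss]; field_simp
      have u1 : Real.sqrt lam * M ≤ Real.sqrt τ := by
        rw [← sq_le_sq₀ (by positivity) hsτ.le, mul_pow, sq (√lam), hss, sq, sq, hsq, hlam]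
        rw [div_mul_eq_mul_div, div_le_iff₀ (by positivity)]
        have : (0 : ℝ) < M * M := by positivity
        nlinarith [mul_pos hτ this]
      have u2 : 1 / Real.sqrt lam ≤ 12 * Real.sqrt τ := by
        rw [div_le_iff₀ hs, ← sq_le_sq₀ (by positivity) (by positivity), mul_pow, mul_pow, sq (√τ),
          sq (√lam), hss, hsq, hlam]
        rw [mul_div_assoc', le_div_iff₀ (by positivity)]
        have : (M : ℝ) * M ≤ τ * τ := by nlinarith
        nlinarith
      rw [e1]
      set s := Real.sqrt lam
      have hq : 0 < M / τ := by positivity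
      calc (16 * lam * (b - a : ℕ) + 2) * (1 / s + (2 * (1 / s) + 1))
          ≤ (16 * lam * M + 2) * (4 * (1 / s)) := by gcongr; linarith
        _ = 64 * (s * M) + 8 * (1 / s) := by rw [← hss]; field_simp; ring
        _ ≤ 64 * √τ + 8 * (12 * √τ) := by gcongr
        _ ≤ _ := by nlinarith
    · rw [← sum_Ioc_ch]
      refine (norm_sum_Ioc_ch_le _ _ _).trans (hcount.trans ?_)
      have : (M : ℝ) ≤ √τ := Real.le_sqrt_of_sq_le h2.le
      have hq : 0 < M / τ := by positivity
      linarith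

lemma zeta_block (M a b : ℕ) (hM : 1 ≤ M) (ha : M ≤ a) (hb : b ≤ 2 * M) (τ : ℝ) (hτ : τ ≠ 0) :
    ‖∑ m ∈ Finset.Ioc a b, ch τ m‖ ≤ 160 * (M / |τ| + Real.sqrt |τ|) := by
  rcases lt_or_gt_of_ne hτ with h | h
  · rw [← norm_sum_Ioc_ch_neg, abs_of_neg h]
    exact zeta_block_pos M a b hM ha hb (-τ) (by linarith)
  · rw [abs_of_pos h]; exact zeta_block_pos M a b hM ha hb τ h

lemma zeta_dyadic (M j : ℕ) (hM : 1 ≤ M) (τ : ℝ) (hτ : τ ≠ 0) :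
    ‖∑ m ∈ Finset.Ioc M (2 ^ j * M), ch τ m‖ ≤ j * (160 * (2 ^ j * M / |τ| + Real.sqrt |τ|)) := by
  have hτ' : 0 < |τ| := abs_pos.2 hτ
  induction j with
  | zero => simp
  | succ j ih =>
    have h1 : M ≤ 2 ^ j * M := Nat.le_mul_of_pos_left _ (by positivity)
    have h2 : 2 ^ j * M ≤ 2 ^ (j + 1) * M := Nat.mul_le_mul_right _ (Nat.pow_le_pow_right (by norm_num) (by omega))
    rw [← Finset.sum_Ioc_consecutive _ h1 h2]
    have h3 := zeta_block (2 ^ j * M) (2 ^ j * M) (2 ^ (j + 1) * M) (by omega) le_rfl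
      (by rw [pow_succ]; linarith [mul_comm 2 (2 ^ j * M)]) τ hτ
    refine (norm_add_le _ _).trans ((add_le_add ih h3).trans ?_)
    push_cast
    have e : (2 : ℝ) ^ (j + 1) = 2 ^ j + 2 ^ j := by rw [pow_succ]; ring
    have : (2 : ℝ) ^ j * M / |τ| ≤ 2 ^ (j + 1) * M / |τ| := by
      rw [e]
      apply div_le_div_of_nonneg_right _ hτ'.le
      have : (0 : ℝ) ≤ 2 ^ j * M := by positivity
      linarith
    have hj : (0 : ℝ) ≤ j := by positivity
    nlinarith

set_option maxHeartbeats 600000 in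
/-- The power-saving bound for `∑ m ^ (i t)` from one derivative test. -/
lemma zeta_power_saving_single (κ : ℝ) (hκ : 1 ≤ κ) (k : ℕ) (δ : ℝ) (hδ : 0 < δ) (hδ1 : δ ≤ 1 / 2) :
    ∃ A : ℝ, 0 < A ∧ ∃ η : ℝ, 0 < η ∧ ∀ (Z t : ℝ) (a b : ℕ), 1 ≤ Z → Z ≤ a + 1 → b ≤ κ * Z →
      Z ^ (k + 2 * δ) ≤ t → t ≤ Z ^ (k + 2 - 2 * δ) →
      ‖∑ m ∈ Finset.Ioc a b, ch t m‖ ≤ A * Z ^ (1 - η) := by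
  set c1 : ℝ := ((k + 1).factorial : ℝ) / (2 * Real.pi) with hc1
  have hc1p : 0 < c1 := by positivity
  set w : ℝ := (κ + 2 + k) with hw
  have hwp : 1 ≤ w := by have : (0 : ℝ) ≤ k := by positivity
                         linarith
  set C : ℝ := w ^ (k + 2) with hC
  have hC1 : 1 ≤ C := one_le_pow₀ hwp
  obtain ⟨A, hA, η, hη, hη1, H⟩ := kth_derivative_test k C hC1 δ hδ (by linarith)
  -- beyond `Z0` the hypotheses of the derivative test hold
  set Z0 : ℝ := (max 1 (max (c1 * κ ^ δ) (C / (c1 * 1)))) ^ (1 / δ) with hZ0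
  have hκ0 : 0 < κ := by linarith
  refine ⟨A * κ ^ (1 - η) + κ * Z0, by positivity, η, hη, ?_⟩
  intro Z t a b hZ ha hb ht1 ht2
  have hZp : 0 < Z := by linarith
  have ht : 0 < t := lt_of_lt_of_le (Real.rpow_pos_of_pos hZp _) ht1
  rcases le_or_gt Z Z0 with hs | hs
  · refine (norm_sum_Ioc_ch_le t a b).trans ?_
    have h1 : ((b - a : ℕ) : ℝ) ≤ b := by exact_mod_cast Nat.sub_le _ _
    have h2 : 1 ≤ Z ^ (1 - η) := Real.one_le_rpow hZ (by linarith)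
    have h3 : κ * Z ≤ κ * Z0 := by gcongr
    have h4 : 0 ≤ A * κ ^ (1 - η) := by positivity
    have h5 : 0 ≤ κ * Z0 := by positivity
    nlinarith
  · have hZd : max 1 (max (c1 * κ ^ δ) (C / (c1 * 1))) ≤ Z ^ δ := by
      have h0 : (0 : ℝ) ≤ max 1 (max (c1 * κ ^ δ) (C / (c1 * 1))) := le_trans zero_le_one (le_max_left _ _)
      calc _ = Z0 ^ δ := by
            rw [hZ0, ← Real.rpow_mul h0]
            rw [one_div_mul_cancel hδ.ne', Real.rpow_one]
        _ ≤ Z ^ δ := Real.rpow_le_rpow (by positivity) hs.le hδ.le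
    have hZ1 : c1 * κ ^ δ ≤ Z ^ δ := (le_max_left _ _).trans ((le_max_right _ _).trans hZd)
    have hZ2 : C / c1 ≤ Z ^ δ := by
      have := (le_max_right (c1 * κ ^ δ) (C / (c1 * 1))).trans ((le_max_right _ _).trans hZd)
      rwa [mul_one] at this
    rcases Nat.lt_or_ge a b with hab | hab
    swap
    · rw [Finset.Ioc_eq_empty (by omega)]; simp; positivity
    set cc : ℝ := (-1) ^ (k + 1) * (t / (2 * Real.pi)) with hcc
    have hsum : ‖∑ m ∈ Finset.Ioc a b, ch t m‖
        = ‖∑ n ∈ Finset.range (b - a), ex ((fun n : ℕ => cc * Real.log (((a + 1 : ℕ) : ℝ) + n)) n)‖ := by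
      rw [sum_Ioc_ch]
      rcases Nat.even_or_odd (k + 1) with he | ho
      · simp only [hcc, he.neg_one_pow, one_mul]
      · simp only [hcc, ho.neg_one_pow, neg_mul, one_mul]
        exact (norm_sum_ex_neg _ _).symm
    set lam : ℝ := c1 * t / (w * Z) ^ (k + 2) with hlam
    have hM : ((b - a : ℕ) : ℝ) ≤ κ * Z := by
      have h1 : ((b - a : ℕ) : ℝ) ≤ b := by exact_mod_cast Nat.sub_le _ _
      linarith
    have hlamC : lam = c1 / C * (t / Z ^ ((k : ℝ) + 2)) := by
      rw [hlam, hC, mul_pow]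
      have : Z ^ ((k : ℝ) + 2) = Z ^ (k + 2) := by rw [← Real.rpow_natCast]; push_cast; rfl
      rw [this]; field_simp
    have hq1 : Z ^ (-(2 - 2 * δ)) ≤ t / Z ^ ((k : ℝ) + 2) := by
      rw [le_div_iff₀ (by positivity), ← Real.rpow_add hZp]
      have e : -(2 - 2 * δ) + ((k : ℝ) + 2) = k + 2 * δ := by ring
      rw [e]; exact ht1
    have hq2 : t / Z ^ ((k : ℝ) + 2) ≤ Z ^ (-(2 * δ)) := by
      rw [div_le_iff₀ (by positivity), ← Real.rpow_add hZp]
      have e : -(2 * δ) + ((k : ℝ) + 2) = k + 2 - 2 * δ := by ring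
      rw [e]; exact ht2
    have hκZ : 1 ≤ κ * Z := by nlinarith
    have hb2 : (κ * Z) ^ (-(2 - δ)) ≤ lam := by
      calc (κ * Z) ^ (-(2 - δ)) ≤ Z ^ (-(2 - δ)) :=
            Real.rpow_le_rpow_of_nonpos hZp (by nlinarith) (by linarith)
        _ = Z ^ (-δ) * Z ^ (-(2 - 2 * δ)) := by rw [← Real.rpow_add hZp]; congr 1; ring
        _ ≤ c1 / C * (t / Z ^ ((k : ℝ) + 2)) := by
            gcongr
            rw [Real.rpow_neg hZp.le, inv_le_comm₀ (by positivity) (by positivity), inv_div]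
            exact hZ2
        _ = lam := hlamC.symm
    have hb3 : lam ≤ (κ * Z) ^ (-δ) := by
      calc lam = c1 / C * (t / Z ^ ((k : ℝ) + 2)) := hlamC
        _ ≤ c1 * Z ^ (-(2 * δ)) := by
            gcongr; exact div_le_self hc1p.le hC1
        _ = c1 * (Z ^ (-δ) * Z ^ (-δ)) := by rw [← Real.rpow_add hZp]; congr 2; ring
        _ ≤ κ ^ (-δ) * Z ^ (-δ) := by
            rw [← mul_assoc]
            gcongr
            rw [Real.rpow_neg hκ0.le, Real.rpow_neg hZp.le, ← div_eq_mul_inv, div_le_iff₀ (by positivity),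
              inv_mul_eq_div, le_div_iff₀ (by positivity)]
            exact hZ1
        _ = _ := (Real.mul_rpow hκ0.le hZp.le).symm
    have h := H (κ * Z) (b - a) (fun n : ℕ => cc * Real.log (((a + 1 : ℕ) : ℝ) + n)) lam hκZ hM hb2 hb3 (by
      intro n hn
      rw [fwdDiff_log]
      set x := (((a + 1 : ℕ) : ℝ) + n) with hx
      have hxZ : Z ≤ x := by rw [hx]; push_cast; have : (0 : ℝ) ≤ n := by positivity
                             linarith
      have hxb : x ≤ κ * Z := by
        refine le_trans ?_ hb
        rw [hx]; exact_mod_cast (by omega : a + 1 + n ≤ b)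
      have hxp : 0 < x := by linarith
      have hl := logDiff_bounds (k + 1) x hxp
      have e : cc * logDiff (k + 2) x = t / (2 * Real.pi) * ((-1) ^ (k + 1) * logDiff (k + 1 + 1) x) := by
        rw [hcc]; ring
      rw [e]
      have htp : 0 ≤ t / (2 * Real.pi) := by positivity
      constructor
      · refine le_trans ?_ (mul_le_mul_of_nonneg_left hl.1 htp)
        have e2 : t / (2 * Real.pi) * (((k + 1).factorial : ℝ) / (x + 1 + ((k + 1 : ℕ) : ℝ)) ^ (k + 1 + 1))
            = c1 * t / (x + 1 + ((k + 1 : ℕ) : ℝ)) ^ (k + 1 + 1) := by rw [hc1]; field_simp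
        rw [e2, hlam]
        apply div_le_div_of_nonneg_left (by positivity) (by positivity)
        apply pow_le_pow_left₀ (by positivity)
        rw [hw]; push_cast
        have hk0 : (0 : ℝ) ≤ k := by positivity
        have hkZ : 2 + (k : ℝ) ≤ (2 + k) * Z := le_mul_of_one_le_right (by linarith) hZ
        linarith
      · refine (mul_le_mul_of_nonneg_left hl.2 htp).trans ?_
        have e2 : t / (2 * Real.pi) * (((k + 1).factorial : ℝ) / x ^ (k + 1 + 1))
            = c1 * t / x ^ (k + 1 + 1) := by rw [hc1]; field_simp
        have e3 : C * lam = c1 * t / Z ^ (k + 1 + 1) := by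
          rw [hC, hlam, mul_pow]; field_simp
        rw [e2, e3]
        apply div_le_div_of_nonneg_left (by positivity) (by positivity)
        exact pow_le_pow_left₀ hZp.le hxZ _)
    rw [hsum]
    refine h.trans ?_
    rw [Real.mul_rpow hκ0.le hZp.le, ← mul_assoc]
    have : 0 ≤ κ * Z0 * Z ^ (1 - η) := by positivity
    linarith

/-- A uniform power saving for `∑ m ^ (i t)` when `|t|` lies between fixed powers of the length. -/
lemma zeta_power_saving_pos (κ : ℝ) (hκ : 1 ≤ κ) (δ : ℝ) (hδ : 0 < δ) (hδ1 : δ ≤ 1 / 4) (n : ℕ) :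
    ∃ A : ℝ, 0 < A ∧ ∃ η : ℝ, 0 < η ∧ ∀ (Z t : ℝ) (a b : ℕ), 1 ≤ Z → Z ≤ a + 1 → b ≤ κ * Z →
      Z ^ (2 * δ) ≤ t → t ≤ Z ^ (n + 2 - 2 * δ) →
      ‖∑ m ∈ Finset.Ioc a b, ch t m‖ ≤ A * Z ^ (1 - η) := by
  induction n with
  | zero =>
    obtain ⟨A, hA, η, hη, H⟩ := zeta_power_saving_single κ hκ 0 δ hδ (by linarith)
    refine ⟨A, hA, η, hη, fun Z t a b hZ ha hb h1 h2 => H Z t a b hZ ha hb ?_ ?_⟩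
    · simpa using h1
    · simpa using h2
  | succ n ih =>
    obtain ⟨A, hA, η, hη, H⟩ := ih
    obtain ⟨A', hA', η', hη', H'⟩ := zeta_power_saving_single κ hκ (n + 1) δ hδ (by linarith)
    refine ⟨A + A', by positivity, min η η', lt_min hη hη', fun Z t a b hZ ha hb h1 h2 => ?_⟩
    have hA1 : Z ^ (1 - η) ≤ Z ^ (1 - min η η') :=
      Real.rpow_le_rpow_of_exponent_le hZ (by linarith [min_le_left η η'])
    have hA2 : Z ^ (1 - η') ≤ Z ^ (1 - min η η') :=
      Real.rpow_le_rpow_of_exponent_le hZ (by linarith [min_le_right η η'])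
    have hp : 0 ≤ Z ^ (1 - min η η') := by positivity
    rcases le_total t (Z ^ ((n : ℝ) + 2 - 2 * δ)) with h | h
    · refine (H Z t a b hZ ha hb h1 h).trans ?_
      nlinarith
    · refine (H' Z t a b hZ ha hb ((Real.rpow_le_rpow_of_exponent_le hZ ?_).trans h) h2).trans ?_
      · push_cast; linarith
      · nlinarith

lemma zeta_power_saving (κ : ℝ) (hκ : 1 ≤ κ) (δ : ℝ) (hδ : 0 < δ) (n : ℕ) :
    ∃ A : ℝ, 0 < A ∧ ∃ η : ℝ, 0 < η ∧ ∀ (Z t : ℝ) (a b : ℕ), 1 ≤ Z → Z ≤ a + 1 → b ≤ κ * Z →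
      Z ^ δ ≤ |t| → |t| ≤ Z ^ n →
      ‖∑ m ∈ Finset.Ioc a b, ch t m‖ ≤ A * Z ^ (1 - η) := by
  obtain ⟨A, hA, η, hη, H⟩ := zeta_power_saving_pos κ hκ (min (δ / 2) (1 / 4))
    (lt_min (by linarith) (by norm_num)) (min_le_right _ _) n
  have hd := min_le_left (δ / 2) (1 / 4)
  have hd2 := min_le_right (δ / 2) (1 / 4)
  refine ⟨A, hA, η, hη, fun Z t a b hZ ha hb h1 h2 => ?_⟩
  have key := H Z |t| a b hZ ha hb ((Real.rpow_le_rpow_of_exponent_le hZ (by linarith)).trans h1)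
    (h2.trans (by
      rw [← Real.rpow_natCast]
      exact Real.rpow_le_rpow_of_exponent_le hZ (by linarith)))
  rcases abs_cases t with ⟨h, -⟩ | ⟨h, -⟩
  · rwa [h] at key
  · rwa [h, norm_sum_Ioc_ch_neg] at key

/-- Geometric sums over the integers. -/
lemma sum_pow_natAbs_le (S : Finset ℤ) (r : ℝ) (h0 : 0 ≤ r) (h1 : r < 1) :
    ∑ k ∈ S, r ^ k.natAbs ≤ 2 / (1 - r) := by
  have hs := summable_geometric_of_lt_one h0 h1
  have key : ∀ S' : Finset ℤ, (Set.InjOn Int.natAbs (S' : Set ℤ)) → ∑ k ∈ S', r ^ k.natAbs ≤ 1 / (1 - r) := by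
    intro S' hS'
    rw [← Finset.sum_image (f := fun n : ℕ => r ^ n) (g := Int.natAbs) hS', one_div,
      ← tsum_geometric_of_lt_one h0 h1]
    exact hs.sum_le_tsum _ (fun _ _ => by positivity)
  rw [← Finset.sum_filter_add_sum_filter_not S (fun k => 0 ≤ k)]
  have e : 2 / (1 - r) = 1 / (1 - r) + 1 / (1 - r) := by ring
  rw [e]
  apply add_le_add
  · apply key
    intro a ha b hb hab
    simp only [Finset.coe_filter, Set.mem_ofPred_eq] at ha hb
    omega
  · apply key
    intro a ha b hb hab
    simp only [Finset.coe_filter, Set.mem_ofPred_eq] at ha hb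
    omega

/-- A Gaussian sum over well separated points. -/
lemma sum_gaussian_separated {ι : Type*} (s : Finset ι) (z : ι → ℝ) (N δ T z0 : ℝ) (hδ : 0 < δ)
    (hT : 0 < T) (hz : ∀ i ∈ s, 0 < z i ∧ z i ≤ N) (hz0 : 0 < z0) (hz0N : z0 ≤ N)
    (hsep : ∀ i ∈ s, ∀ j ∈ s, i ≠ j → δ ≤ |z i - z j|) :
    ∑ i ∈ s, Real.exp (-(T ^ 2 * Real.log (z i / z0) ^ 2 / 4)) ≤ 24 * (1 + N / (δ * T)) := by
  have hN : 0 < N := lt_of_lt_of_le hz0 hz0N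
  set a : ℝ := T / (2 * N) with ha
  have hap : 0 < a := by positivity
  set b : ℝ := min (a * δ) 1 with hb
  have hbp : 0 < b := lt_min (by positivity) one_pos
  have hb1 : b ≤ 1 := min_le_right _ _
  set k : ι → ℤ := fun i => ⌊(z i - z0) / δ⌋ with hk
  have hterm : ∀ i ∈ s, Real.exp (-(T ^ 2 * Real.log (z i / z0) ^ 2 / 4)) ≤
      6 * Real.exp (-b) ^ (k i).natAbs := by
    intro i hi
    obtain ⟨hi1, hi2⟩ := hz i hi
    -- the logarithm is bounded below
    have hlog : |z i - z0| / N ≤ |Real.log (z i / z0)| := by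
      have A : ∀ x y : ℝ, 0 < x → x ≤ y → y ≤ N → (y - x) / N ≤ Real.log (y / x) := by
        intro x y hx hxy hyN
        have hy : 0 < y := by linarith
        have h1 : 1 - (y / x)⁻¹ ≤ Real.log (y / x) := Real.one_sub_inv_le_log_of_pos (by positivity)
        have h2 : 1 - (y / x)⁻¹ = (y - x) / y := by rw [inv_div]; field_simp
        rw [h2] at h1
        refine le_trans ?_ h1
        exact div_le_div_of_nonneg_left (by linarith) hy hyN
      rcases le_total (z i) z0 with h | h
      · have := A (z i) z0 hi1 h hz0N
        rw [abs_of_nonpos (by linarith), ← abs_neg, ← Real.log_inv, inv_div]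
        refine le_trans (le_of_eq (by ring)) (this.trans (le_abs_self _))
      · rw [abs_of_nonneg (by linarith)]
        exact (A z0 (z i) hz0 h hi2).trans (le_abs_self _)
    have hx : a * |z i - z0| ≤ T * |Real.log (z i / z0)| / 2 := by
      have : a * |z i - z0| = T / 2 * (|z i - z0| / N) := by rw [ha]; field_simp
      rw [this]; nlinarith
    have hk1 : δ * (((k i).natAbs : ℝ) - 1) ≤ |z i - z0| := by
      have f1 := Int.floor_le ((z i - z0) / δ)
      have f2 := Int.lt_floor_add_one ((z i - z0) / δ)
      have g1 : ((k i : ℤ) : ℝ) * δ ≤ z i - z0 := (le_div_iff₀ hδ).1 f1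
      have g2 : z i - z0 < (((k i : ℤ) : ℝ) + 1) * δ := (div_lt_iff₀ hδ).1 f2
      have hc : (((k i).natAbs : ℕ) : ℝ) = |((k i : ℤ) : ℝ)| := by
        rw [← Int.cast_abs, Int.abs_eq_natAbs]; simp
      rw [hc]
      rcases abs_cases ((k i : ℤ) : ℝ) with ⟨e, -⟩ | ⟨e, -⟩ <;> rw [e]
      · refine le_trans ?_ (le_abs_self _); nlinarith
      · refine le_trans ?_ (neg_le_abs _); nlinarith
    have hbk : b * ((k i).natAbs : ℝ) ≤ a * |z i - z0| + 1 := by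
      rcases le_or_gt (((k i).natAbs : ℝ)) 1 with h | h
      · have : b * ((k i).natAbs : ℝ) ≤ 1 * 1 := mul_le_mul hb1 h (by positivity) zero_le_one
        have : 0 ≤ a * |z i - z0| := by positivity
        linarith
      · have h1 : b * (((k i).natAbs : ℝ) - 1) ≤ a * δ * (((k i).natAbs : ℝ) - 1) :=
          mul_le_mul_of_nonneg_right (min_le_left _ _) (by linarith)
        have h2 : a * (δ * (((k i).natAbs : ℝ) - 1)) ≤ a * |z i - z0| :=
          mul_le_mul_of_nonneg_left hk1 hap.le
        linarith
    have he : Real.exp (5 / 4) ≤ 6 := by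
      have h1 := Real.exp_one_lt_d9
      have h2 : Real.exp (1 / 4) ^ 4 = Real.exp 1 := by rw [← Real.exp_nat_mul]; norm_num
      have h3 : Real.exp (1 / 4) ≤ 2 := by
        by_contra h; push Not at h
        have : (2 : ℝ) ^ 4 < Real.exp (1 / 4) ^ 4 := pow_lt_pow_left₀ h (by norm_num) (by norm_num)
        linarith
      have h4 : Real.exp (5 / 4) = Real.exp 1 * Real.exp (1 / 4) := by rw [← Real.exp_add]; norm_num
      rw [h4]; nlinarith [Real.exp_pos (1 / 4)]
    calc Real.exp (-(T ^ 2 * Real.log (z i / z0) ^ 2 / 4))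
        ≤ Real.exp (5 / 4 + -(b * (k i).natAbs)) := by
          apply Real.exp_le_exp.2
          have h1 := hx
          set L := T * |Real.log (z i / z0)| / 2
          have h2 : T ^ 2 * Real.log (z i / z0) ^ 2 / 4 = L ^ 2 := by
            rw [← sq_abs (Real.log (z i / z0))]; ring
          rw [h2]
          nlinarith [sq_nonneg (L - 1 / 2)]
      _ = Real.exp (5 / 4) * Real.exp (-b) ^ (k i).natAbs := by
          rw [Real.exp_add, ← Real.exp_nat_mul]; congr 2; ring
      _ ≤ _ := mul_le_mul_of_nonneg_right he (by positivity)
  have hinj : Set.InjOn k (s : Set ι) := by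
    intro i hi j hj hij
    by_contra hne
    have h1 := hsep i hi j hj hne
    have f1 := Int.floor_le ((z i - z0) / δ)
    have f2 := Int.lt_floor_add_one ((z i - z0) / δ)
    have f3 := Int.floor_le ((z j - z0) / δ)
    have f4 := Int.lt_floor_add_one ((z j - z0) / δ)
    have hij' : (⌊(z i - z0) / δ⌋ : ℤ) = ⌊(z j - z0) / δ⌋ := hij
    rw [hij'] at f1 f2
    have : |(z i - z0) / δ - (z j - z0) / δ| < 1 := by rw [abs_lt]; constructor <;> linarith
    rw [← sub_div, abs_div, abs_of_pos hδ, div_lt_one hδ] at this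
    have e : z i - z0 - (z j - z0) = z i - z j := by ring
    rw [e] at this; linarith
  have hr1 : Real.exp (-b) < 1 := by rw [Real.exp_lt_one_iff]; linarith
  calc _ ≤ ∑ i ∈ s, 6 * Real.exp (-b) ^ (k i).natAbs := Finset.sum_le_sum hterm
    _ = 6 * ∑ n ∈ s.image k, Real.exp (-b) ^ n.natAbs := by
        rw [← Finset.mul_sum, Finset.sum_image hinj]
    _ ≤ 6 * (2 / (1 - Real.exp (-b))) := by
        gcongr
        exact sum_pow_natAbs_le _ _ (Real.exp_pos _).le hr1
    _ ≤ 6 * (2 * (1 + 1 / b)) := by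
        have h1 : 1 / (1 - Real.exp (-b)) ≤ 1 + 1 / b := by
          rw [div_le_iff₀ (by linarith)]
          have h2 : Real.exp (-b) ≤ 1 / (1 + b) := by
            rw [Real.exp_neg, ← one_div]
            exact one_div_le_one_div_of_le (by linarith) (by linarith [Real.add_one_le_exp b])
          have h3 : (1 + 1 / b) * (1 - 1 / (1 + b)) = 1 := by field_simp; ring
          have h4 : 0 < 1 + 1 / b := by positivity
          nlinarith
        have h2 : 2 / (1 - Real.exp (-b)) = 2 * (1 / (1 - Real.exp (-b))) := by ring
        rw [h2]; linarith
    _ ≤ 6 * (2 * (1 + (1 + 2 * N / (δ * T)))) := by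
        gcongr
        rw [hb]
        rcases min_choice (a * δ) 1 with h | h <;> rw [h]
        · have : 1 / (a * δ) = 2 * N / (δ * T) := by rw [ha]; field_simp
          linarith
        · have : 0 < 2 * N / (δ * T) := by positivity
          linarith
    _ = _ := by ring

open MeasureTheory in
/-- The Gaussian probability measure with density proportional to `exp (-(t / T) ^ 2)`. -/
noncomputable def gm (T : ℝ) : Measure ℝ := ProbabilityTheory.gaussianReal 0 (Real.toNNReal (T ^ 2 / 2))

instance (T : ℝ) : MeasureTheory.IsProbabilityMeasure (gm T) := by unfold gm; infer_instance

open MeasureTheory in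
lemma integrable_of_continuous_of_bound {E : Type*} [NormedAddCommGroup E] [SecondCountableTopology E]
    {μ : Measure ℝ} [IsFiniteMeasure μ] {f : ℝ → E} (hf : Continuous f) (C : ℝ)
    (hC : ∀ t, ‖f t‖ ≤ C) : Integrable f μ :=
  Integrable.of_bound hf.aestronglyMeasurable C (Filter.Eventually.of_forall hC)

open MeasureTheory in
lemma integral_ch_gm (T z : ℝ) :
    ∫ t, ch t z ∂(gm T) = ((Real.exp (-(T ^ 2 * Real.log z ^ 2 / 4)) : ℝ) : ℂ) := by
  have h := ProbabilityTheory.charFun_gaussianReal (μ := 0) (v := Real.toNNReal (T ^ 2 / 2)) (Real.log z)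
  rw [charFun_apply_real] at h
  have e : ∀ t : ℝ, ch t z = Complex.exp (Real.log z * t * Complex.I) := by
    intro t; unfold ch; congr 1; push_cast; ring
  simp_rw [e]
  unfold gm
  rw [h, Real.coe_toNNReal _ (by positivity)]
  push_cast
  congr 1; ring

/-- A continuous and bounded function. -/
def CB {E : Type*} [NormedAddCommGroup E] (f : ℝ → E) : Prop := Continuous f ∧ ∃ C : ℝ, ∀ t, ‖f t‖ ≤ C

namespace CB

variable {E : Type*} [NormedAddCommGroup E]

lemma integrable [SecondCountableTopology E] {f : ℝ → E} (h : CB f) {μ : MeasureTheory.Measure ℝ}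
    [MeasureTheory.IsFiniteMeasure μ] : MeasureTheory.Integrable f μ := by
  obtain ⟨h1, C, h2⟩ := h
  exact integrable_of_continuous_of_bound h1 C h2

lemma norm {f : ℝ → E} (h : CB f) : CB fun t => ‖f t‖ := by
  obtain ⟨h1, C, h2⟩ := h
  exact ⟨h1.norm, C, fun t => by simpa using h2 t⟩

lemma mul {𝕜 : Type*} [NormedField 𝕜] {f g : ℝ → 𝕜} (hf : CB f) (hg : CB g) : CB fun t => f t * g t := by
  obtain ⟨h1, C, h2⟩ := hf
  obtain ⟨h3, D, h4⟩ := hg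
  refine ⟨h1.mul h3, C * D, fun t => ?_⟩
  rw [norm_mul]
  exact mul_le_mul (h2 t) (h4 t) (norm_nonneg _) ((norm_nonneg _).trans (h2 t))

lemma pow {𝕜 : Type*} [NormedField 𝕜] {f : ℝ → 𝕜} (hf : CB f) (n : ℕ) : CB fun t => f t ^ n := by
  obtain ⟨h1, C, h2⟩ := hf
  refine ⟨h1.pow n, C ^ n, fun t => ?_⟩
  rw [norm_pow]
  exact pow_le_pow_left₀ (norm_nonneg _) (h2 t) _

lemma const (c : E) : CB fun _ : ℝ => c := ⟨continuous_const, ‖c‖, fun _ => le_rfl⟩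

lemma add {f g : ℝ → E} (hf : CB f) (hg : CB g) : CB fun t => f t + g t := by
  obtain ⟨h1, C, h2⟩ := hf
  obtain ⟨h3, D, h4⟩ := hg
  exact ⟨h1.add h3, C + D, fun t => (norm_add_le _ _).trans (add_le_add (h2 t) (h4 t))⟩

lemma sum {ι : Type*} (s : Finset ι) {f : ι → ℝ → E} (hf : ∀ i ∈ s, CB (f i)) :
    CB fun t => ∑ i ∈ s, f i t := by
  induction s using Finset.induction_on with
  | empty => simpa using const (0 : E)
  | insert a s ha ih =>
    simp_rw [Finset.sum_insert ha]
    exact (hf a (Finset.mem_insert_self _ _)).add (ih fun i hi => hf i (Finset.mem_insert_of_mem hi))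

lemma ch (z : ℝ) : CB fun t => _root_.ch t z := ⟨continuous_ch z, 1, fun t => (norm_ch t z).le⟩

lemma ch_neg (z : ℝ) : CB fun t => _root_.ch (-t) z :=
  ⟨(continuous_ch z).comp continuous_neg, 1, fun t => (norm_ch (-t) z).le⟩

end CB

open MeasureTheory in
/-- The Gaussian second moment of a generalized Dirichlet polynomial, expanded. -/
lemma integral_normSq_sum {ι : Type*} (s : Finset ι) (b : ι → ℝ) (z : ι → ℝ) (T : ℝ)
    (hz : ∀ i ∈ s, 0 < z i) :
    ∫ t, ‖∑ i ∈ s, (b i : ℂ) * ch t (z i)‖ ^ 2 ∂(gm T) =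
      ∑ i ∈ s, ∑ j ∈ s, b i * b j * Real.exp (-(T ^ 2 * Real.log (z i / z j) ^ 2 / 4)) := by
  have e : ∀ t, ((‖∑ i ∈ s, (b i : ℂ) * ch t (z i)‖ ^ 2 : ℝ) : ℂ) =
      ∑ i ∈ s, ∑ j ∈ s, ((b i * b j : ℝ) : ℂ) * ch t (z i / z j) := by
    intro t
    rw [← Complex.normSq_eq_norm_sq, Complex.normSq_eq_conj_mul_self, mul_comm, map_sum,
      Finset.sum_mul_sum]
    refine Finset.sum_congr rfl fun i hi => Finset.sum_congr rfl fun j hj => ?_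
    rw [ch_div t (hz i hi).ne' (hz j hj).ne', map_mul, Complex.conj_ofReal]
    push_cast; ring
  have h2 : ((∫ t, ‖∑ i ∈ s, (b i : ℂ) * ch t (z i)‖ ^ 2 ∂(gm T) : ℝ) : ℂ) =
      ((∑ i ∈ s, ∑ j ∈ s, b i * b j * Real.exp (-(T ^ 2 * Real.log (z i / z j) ^ 2 / 4)) : ℝ) : ℂ) := by
    rw [← integral_complex_ofReal]
    simp_rw [e]
    have hi : ∀ x : ℝ, ∀ c : ℂ, Integrable (fun t => c * ch t x) (gm T) :=
      fun x c => ((CB.const c).mul (CB.ch x)).integrable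
    rw [integral_finsetSum _ fun i _ => integrable_finsetSum _ fun j _ => hi _ _]
    push_cast
    refine Finset.sum_congr rfl fun i _ => ?_
    rw [integral_finsetSum _ fun j _ => hi _ _]
    refine Finset.sum_congr rfl fun j _ => ?_
    rw [integral_const_mul, integral_ch_gm]
    push_cast; ring
  exact_mod_cast h2

/-- The Gaussian mean value theorem. -/
lemma mean_value_separated {ι : Type*} (s : Finset ι) (b : ι → ℝ) (z : ι → ℝ) (N δ T : ℝ) (hδ : 0 < δ)
    (hT : 0 < T) (hz : ∀ i ∈ s, 0 < z i ∧ z i ≤ N)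
    (hsep : ∀ i ∈ s, ∀ j ∈ s, i ≠ j → δ ≤ |z i - z j|) :
    ∫ t, ‖∑ i ∈ s, (b i : ℂ) * ch t (z i)‖ ^ 2 ∂(gm T) ≤ 24 * (1 + N / (δ * T)) * ∑ i ∈ s, b i ^ 2 := by
  rw [integral_normSq_sum s b z T fun i hi => (hz i hi).1]
  set K : ι → ι → ℝ := fun i j => Real.exp (-(T ^ 2 * Real.log (z i / z j) ^ 2 / 4)) with hK
  have hKs : ∀ i j, K i j = K j i := by
    intro i j
    simp only [hK]
    rw [← inv_div (z j) (z i), Real.log_inv, neg_sq]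
  have hrow : ∀ j ∈ s, ∑ i ∈ s, K i j ≤ 24 * (1 + N / (δ * T)) := fun j hj =>
    sum_gaussian_separated s z N δ T (z j) hδ hT hz (hz j hj).1 (hz j hj).2 hsep
  have h1 : ∑ i ∈ s, ∑ j ∈ s, b i * b j * K i j ≤
      ∑ i ∈ s, ∑ j ∈ s, (b i ^ 2 / 2 * K i j + b j ^ 2 / 2 * K i j) := by
    refine Finset.sum_le_sum fun i _ => Finset.sum_le_sum fun j _ => ?_
    have : 0 < K i j := Real.exp_pos _
    nlinarith [sq_nonneg (b i - b j)]
  have h2 : ∑ i ∈ s, ∑ j ∈ s, b i ^ 2 / 2 * K i j ≤ ∑ i ∈ s, b i ^ 2 / 2 * (24 * (1 + N / (δ * T))) := by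
    refine Finset.sum_le_sum fun i hi => ?_
    rw [← Finset.mul_sum]
    refine mul_le_mul_of_nonneg_left ?_ (by positivity)
    simp_rw [hKs i]
    exact hrow i hi
  have h3 : ∑ i ∈ s, ∑ j ∈ s, b j ^ 2 / 2 * K i j ≤ ∑ i ∈ s, b i ^ 2 / 2 * (24 * (1 + N / (δ * T))) := by
    rw [Finset.sum_comm]
    refine Finset.sum_le_sum fun i hi => ?_
    rw [← Finset.mul_sum]
    exact mul_le_mul_of_nonneg_left (hrow i hi) (by positivity)
  simp_rw [Finset.sum_add_distrib] at h1
  rw [← Finset.sum_mul] at h2 h3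
  have h4 : ∑ i ∈ s, b i ^ 2 / 2 = (∑ i ∈ s, b i ^ 2) / 2 := by rw [Finset.sum_div]
  rw [h4] at h2 h3
  linarith

/-- The Gaussian mean value theorem for Dirichlet polynomials with repeated frequencies. -/
lemma mean_value_nat {ι : Type*} (s : Finset ι) (b : ι → ℝ) (n : ι → ℕ) (N T : ℝ)
    (hT : 0 < T) (hn : ∀ i ∈ s, 0 < n i ∧ (n i : ℝ) ≤ N) :
    ∫ t, ‖∑ i ∈ s, (b i : ℂ) * ch t (n i)‖ ^ 2 ∂(gm T) ≤
      24 * (1 + N / T) * ∑ i ∈ s, ∑ j ∈ s, if n i = n j then b i * b j else 0 := by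
  set q : ℕ → ℝ := fun k => ∑ i ∈ s with n i = k, b i with hq
  have e1 : ∀ t, ∑ i ∈ s, (b i : ℂ) * ch t (n i) = ∑ k ∈ s.image n, (q k : ℂ) * ch t k := by
    intro t
    rw [← Finset.sum_fiberwise_of_maps_to (t := s.image n) (g := n) fun i hi => Finset.mem_image_of_mem _ hi]
    refine Finset.sum_congr rfl fun k _ => ?_
    rw [hq]; push_cast; rw [Finset.sum_mul]
    refine Finset.sum_congr rfl fun i hi => ?_
    rw [(Finset.mem_filter.1 hi).2]
  have e2 : ∑ i ∈ s, ∑ j ∈ s, (if n i = n j then b i * b j else 0) = ∑ k ∈ s.image n, q k ^ 2 := by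
    rw [← Finset.sum_fiberwise_of_maps_to (t := s.image n) (g := n) fun i hi => Finset.mem_image_of_mem _ hi]
    refine Finset.sum_congr rfl fun k _ => ?_
    rw [sq]
    simp only [hq]
    rw [Finset.sum_mul_sum]
    refine Finset.sum_congr rfl fun i hi => ?_
    rw [Finset.sum_filter]
    refine Finset.sum_congr rfl fun j hj => ?_
    rw [(Finset.mem_filter.1 hi).2]
    simp only [eq_comm]
  simp_rw [e1]
  rw [e2]
  have := mean_value_separated (s.image n) q (fun k => (k : ℝ)) N 1 T one_pos hT (by
      intro k hk
      obtain ⟨i, hi, rfl⟩ := Finset.mem_image.1 hk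
      exact ⟨by exact_mod_cast (hn i hi).1, (hn i hi).2⟩) (by
      intro k _ l _ hkl
      have h : (1 : ℤ) ≤ |(k : ℤ) - l| := Int.one_le_abs (by omega)
      exact_mod_cast h)
  simpa using this

open MeasureTheory in
/-- Cauchy-Schwarz for bounded continuous functions. -/
lemma integral_mul_le_sqrt {μ : Measure ℝ} [IsFiniteMeasure μ] {f g : ℝ → ℝ} (hf : CB f) (hg : CB g)
    (hf0 : ∀ t, 0 ≤ f t) (hg0 : ∀ t, 0 ≤ g t) :
    ∫ t, f t * g t ∂μ ≤ Real.sqrt ((∫ t, f t ^ 2 ∂μ) * ∫ t, g t ^ 2 ∂μ) := by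
  have hm : ∀ {f : ℝ → ℝ}, CB f → MemLp f (ENNReal.ofReal 2) μ := by
    rintro f ⟨h1, C, h2⟩
    exact MemLp.of_bound h1.aestronglyMeasurable C (Filter.Eventually.of_forall h2)
  have h := integral_mul_le_Lp_mul_Lq_of_nonneg (μ := μ) Real.HolderConjugate.two_two
    (Filter.Eventually.of_forall hf0) (Filter.Eventually.of_forall hg0) (hm hf) (hm hg)
  simp only [Real.rpow_ofNat] at h
  rw [Real.sqrt_mul (integral_nonneg fun t => sq_nonneg _), Real.sqrt_eq_rpow, Real.sqrt_eq_rpow]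
  exact h

/-- The normalized sum `Z⁻¹ ∑_{Z < m ≤ κ Z} m ^ (i t)`. -/
noncomputable def dz (κ Z t : ℝ) : ℂ := ((1 / Z : ℝ) : ℂ) * ∑ m ∈ Finset.Ioc ⌊Z⌋₊ ⌊κ * Z⌋₊, ch t m

lemma CB.dz (κ Z : ℝ) : CB fun t => _root_.dz κ Z t :=
  (CB.const _).mul (CB.sum _ fun m _ => CB.ch m)

lemma norm_dz_le (κ Z t : ℝ) (hκ : 0 ≤ κ) (hZ : 0 < Z) : ‖dz κ Z t‖ ≤ κ := by
  unfold dz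
  rw [norm_mul, Complex.norm_real, Real.norm_of_nonneg (by positivity)]
  have h1 := norm_sum_Ioc_ch_le t ⌊Z⌋₊ ⌊κ * Z⌋₊
  have h2 : ((⌊κ * Z⌋₊ - ⌊Z⌋₊ : ℕ) : ℝ) ≤ κ * Z :=
    le_trans (by exact_mod_cast Nat.sub_le _ _) (Nat.floor_le (by positivity))
  calc 1 / Z * ‖∑ m ∈ Finset.Ioc ⌊Z⌋₊ ⌊κ * Z⌋₊, ch t m‖ ≤ 1 / Z * (κ * Z) := by
        gcongr; exact h1.trans h2
    _ = κ := by field_simp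

/-- A finite weighted family of positive integers `s i`, each with an approximate size `y i`. -/
structure Law where
  /-- the index type -/
  ι : Type
  [ft : Fintype ι]
  /-- the weights -/
  w : ι → ℝ
  /-- the integers -/
  s : ι → ℕ
  /-- the approximate sizes -/
  y : ι → ℝ

attribute [instance] Law.ft

namespace Law

/-- The Dirichlet polynomial of a law. -/
noncomputable def poly (A : Law) (t : ℝ) : ℂ := ∑ i, (A.w i : ℂ) * ch t (A.s i)

/-- The Dirichlet polynomial of the products `s m` with `s` from the law and `m` an integer. -/
noncomputable def R (A : Law) (κ Y t : ℝ) : ℂ :=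
  ∑ i, (A.w i : ℂ) * ch t (A.s i) * dz κ (Y / A.y i) t

/-- The law concentrated at `1`. -/
def one : Law := ⟨Unit, fun _ => 1, fun _ => 1, fun _ => 1⟩

/-- The product law. -/
def prod (A B : Law) : Law :=
  ⟨A.ι × B.ι, fun i => A.w i.1 * B.w i.2, fun i => A.s i.1 * B.s i.2, fun i => A.y i.1 * B.y i.2⟩

/-- The law of a product of independent copies. -/
def pow (A : Law) : ℕ → Law
  | 0 => one
  | k + 1 => prod A (pow A k)

lemma sum_one {M : Type*} [AddCommMonoid M] (f : one.ι → M) : ∑ i, f i = f () :=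
  Fintype.sum_unique (ι := Unit) f

lemma sum_prod {M : Type*} [AddCommMonoid M] (A B : Law) (f : (A.prod B).ι → M) :
    ∑ i, f i = ∑ i, ∑ j, f (i, j) :=
  Fintype.sum_prod_type (α₁ := A.ι) (α₂ := B.ι) f

/-- A mixture of laws. -/
def mix (V : Finset ℕ) (W : ℕ → ℝ) (A : ℕ → Law) : Law :=
  ⟨Σ v : V, (A v).ι, fun i => W i.1 * (A i.1).w i.2, fun i => (A i.1).s i.2, fun i => (A i.1).y i.2⟩

/-- The law of a prime of `P`, weighted by `1 / p`, with approximate size `y`. -/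
noncomputable def blk (P : Finset ℕ) (y : ℝ) : Law :=
  ⟨P, fun p => 1 / ((p : ℕ) * ∑ q ∈ P, (1 / q : ℝ)), fun p => p, fun _ => y⟩

lemma CB_poly (A : Law) : CB A.poly := CB.sum _ fun _ _ => (CB.const _).mul (CB.ch _)

lemma CB_R (A : Law) (κ Y : ℝ) : CB (A.R κ Y) :=
  CB.sum _ fun _ _ => ((CB.const _).mul (CB.ch _)).mul (CB.dz _ _)

lemma R_prod (A B : Law) (κ Y t : ℝ) (hA : ∀ i, A.s i ≠ 0) (hB : ∀ i, B.s i ≠ 0) :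
    (A.prod B).R κ Y t = ∑ i, (A.w i : ℂ) * ch t (A.s i) * B.R κ (Y / A.y i) t := by
  unfold R prod
  simp only
  rw [Fintype.sum_prod_type]
  refine Finset.sum_congr rfl fun i _ => ?_
  rw [Finset.mul_sum]
  refine Finset.sum_congr rfl fun j _ => ?_
  rw [Nat.cast_mul, ch_mul t (by exact_mod_cast hA i) (by exact_mod_cast hB j), div_mul_eq_div_div]
  push_cast; ring

lemma R_one (κ Y t : ℝ) : one.R κ Y t = dz κ Y t := by
  unfold R one
  simp [ch_one]

lemma R_prod_const (A B : Law) (κ Y t y : ℝ) (hA : ∀ i, A.s i ≠ 0) (hB : ∀ i, B.s i ≠ 0)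
    (hy : ∀ i, A.y i = y) : (A.prod B).R κ Y t = A.poly t * B.R κ (Y / y) t := by
  rw [R_prod A B κ Y t hA hB, poly, Finset.sum_mul]
  exact Finset.sum_congr rfl fun i _ => by rw [hy]

lemma pow_s_ne_zero (A : Law) (hA : ∀ i, A.s i ≠ 0) (k : ℕ) : ∀ i, (A.pow k).s i ≠ 0 := by
  induction k with
  | zero => intro i; exact one_ne_zero
  | succ k ih => rintro ⟨i, j⟩; exact mul_ne_zero (hA i) (ih j)

lemma pow_y_const (A : Law) (y : ℝ) (hy : ∀ i, A.y i = y) (k : ℕ) : ∀ i, (A.pow k).y i = y ^ k := by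
  induction k with
  | zero => intro i; exact (pow_zero y).symm
  | succ k ih =>
    rintro ⟨i, j⟩
    show A.y i * (A.pow k).y j = y ^ (k + 1)
    rw [hy, ih, pow_succ']

lemma poly_pow (A : Law) (hA : ∀ i, A.s i ≠ 0) (k : ℕ) (t : ℝ) : (A.pow k).poly t = A.poly t ^ k := by
  induction k with
  | zero =>
    show ∑ i, (one.w i : ℂ) * ch t (one.s i) = _
    rw [sum_one]; simp [one, ch_one]
  | succ k ih =>
    rw [pow_succ', ← ih]
    show (A.prod (A.pow k)).poly t = _
    unfold poly prod
    simp only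
    rw [Fintype.sum_prod_type, Finset.sum_mul_sum]
    refine Finset.sum_congr rfl fun i _ => Finset.sum_congr rfl fun j _ => ?_
    rw [Nat.cast_mul, ch_mul t (by exact_mod_cast hA i) (by exact_mod_cast pow_s_ne_zero A hA k j)]
    push_cast; ring

lemma R_pow_prod_const (A B : Law) (κ Y t y : ℝ) (k : ℕ) (hA : ∀ i, A.s i ≠ 0) (hB : ∀ i, B.s i ≠ 0)
    (hy : ∀ i, A.y i = y) : ((A.pow k).prod B).R κ Y t = A.poly t ^ k * B.R κ (Y / y ^ k) t := by
  rw [R_prod_const _ B κ Y t (y ^ k) (pow_s_ne_zero A hA k) hB (pow_y_const A y hy k), poly_pow A hA]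

lemma R_mix_prod (V : Finset ℕ) (W : ℕ → ℝ) (A : ℕ → Law) (B : Law) (κ Y t : ℝ) (y : ℕ → ℝ)
    (hA : ∀ v ∈ V, ∀ i, (A v).s i ≠ 0) (hB : ∀ i, B.s i ≠ 0) (hy : ∀ v ∈ V, ∀ i, (A v).y i = y v) :
    ((mix V W A).prod B).R κ Y t = ∑ v ∈ V, (W v : ℂ) * ((A v).poly t * B.R κ (Y / y v) t) := by
  rw [R_prod _ B κ Y t (fun i : Σ v : V, (A v).ι => hA _ i.1.2 i.2) hB, ← Finset.sum_coe_sort V]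
  unfold mix
  simp only
  rw [Fintype.sum_sigma]
  refine Finset.sum_congr rfl fun v _ => ?_
  unfold poly
  rw [Finset.sum_mul, Finset.mul_sum]
  refine Finset.sum_congr rfl fun i _ => ?_
  rw [hy v v.2 i]; push_cast; ring

/-- Quantitative information on a law: the prime factors lie in `[lo, hi)`, the ratio of the integers
to their approximate sizes is at most `S`, the gcd sum is at most `Γ`, the sizes are at most `U`. -/
structure Good (A : Law) (lo hi : ℕ) (S Γ U : ℝ) : Prop where
  w_nonneg : ∀ i, 0 ≤ A.w i
  w_sum : ∑ i, A.w i = 1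
  y_pos : ∀ i, 0 < A.y i
  y_le : ∀ i, A.y i ≤ A.s i
  s_le : ∀ i, (A.s i : ℝ) ≤ S * A.y i
  y_le_U : ∀ i, A.y i ≤ U
  primes : ∀ i, ∀ p : ℕ, p.Prime → p ∣ A.s i → lo ≤ p ∧ p < hi
  gcd : ∑ i, ∑ j, A.w i * A.w j * (Nat.gcd (A.s i) (A.s j) : ℝ) ≤ Γ

namespace Good

variable {A B : Law} {lo hi lo' hi' : ℕ} {S Γ U S' Γ' U' : ℝ}

lemma s_pos (h : Good A lo hi S Γ U) (i : A.ι) : 0 < A.s i := by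
  have := (h.y_pos i).trans_le (h.y_le i)
  exact_mod_cast this

lemma s_ne_zero (h : Good A lo hi S Γ U) (i : A.ι) : A.s i ≠ 0 := (h.s_pos i).ne'

lemma nonempty (h : Good A lo hi S Γ U) : Nonempty A.ι := by
  by_contra hne
  rw [not_nonempty_iff] at hne
  have := h.w_sum
  simp at this

lemma one_le_S (h : Good A lo hi S Γ U) : 1 ≤ S := by
  obtain ⟨i⟩ := h.nonempty
  have h1 := h.y_pos i
  have h2 := (h.y_le i).trans (h.s_le i)
  by_contra hS
  push Not at hS
  nlinarith

lemma one_le_Γ (h : Good A lo hi S Γ U) : 1 ≤ Γ := by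
  refine le_trans ?_ h.gcd
  have e : (1 : ℝ) = ∑ i, ∑ j, A.w i * A.w j * 1 := by
    simp_rw [mul_one, ← Finset.mul_sum]
    rw [h.w_sum]; simp [h.w_sum]
  rw [e]
  refine Finset.sum_le_sum fun i _ => Finset.sum_le_sum fun j _ => ?_
  refine mul_le_mul_of_nonneg_left ?_ (mul_nonneg (h.w_nonneg i) (h.w_nonneg j))
  exact_mod_cast Nat.gcd_pos_of_pos_left _ (h.s_pos i)

lemma U_pos (h : Good A lo hi S Γ U) : 0 < U := by
  obtain ⟨i⟩ := h.nonempty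
  exact (h.y_pos i).trans_le (h.y_le_U i)

lemma mono (h : Good A lo hi S Γ U) (hlo : lo' ≤ lo) (hhi : hi ≤ hi') (hS : S ≤ S') (hΓ : Γ ≤ Γ')
    (hU : U ≤ U') : Good A lo' hi' S' Γ' U' where
  w_nonneg := h.w_nonneg
  w_sum := h.w_sum
  y_pos := h.y_pos
  y_le := h.y_le
  s_le i := (h.s_le i).trans (mul_le_mul_of_nonneg_right hS (h.y_pos i).le)
  y_le_U i := (h.y_le_U i).trans hU
  primes i p hp hd := ⟨hlo.trans (h.primes i p hp hd).1, (h.primes i p hp hd).2.trans_le hhi⟩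
  gcd := h.gcd.trans hΓ

lemma one (lo hi : ℕ) : Good Law.one lo hi 1 1 1 where
  w_nonneg _ := zero_le_one
  w_sum := by rw [sum_one]; rfl
  y_pos _ := zero_lt_one
  y_le _ := by simp [Law.one]
  s_le _ := by simp [Law.one]
  y_le_U _ := le_rfl
  primes _ p hp hd := by
    exact absurd (Nat.dvd_one.1 hd) hp.one_lt.ne'
  gcd := by rw [sum_one, sum_one]; simp [Law.one]

lemma prod_of_gcd (hA : Good A lo hi S Γ U) (hB : Good B lo' hi' S' Γ' U') (hl : lo ≤ lo')
    (hh : hi ≤ hi') {Γ₂ : ℝ}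
    (hg : ∑ i, ∑ j, (A.prod B).w i * (A.prod B).w j * (Nat.gcd ((A.prod B).s i) ((A.prod B).s j) : ℝ) ≤ Γ₂) :
    Good (A.prod B) lo hi' (S * S') Γ₂ (U * U') where
  w_nonneg i := mul_nonneg (hA.w_nonneg _) (hB.w_nonneg _)
  w_sum := by
    rw [sum_prod]
    show ∑ i, ∑ j, A.w i * B.w j = 1
    simp_rw [← Finset.mul_sum]
    rw [hB.w_sum]; simp [hA.w_sum]
  y_pos i := mul_pos (hA.y_pos _) (hB.y_pos _)
  y_le i := by
    show A.y i.1 * B.y i.2 ≤ ((A.s i.1 * B.s i.2 : ℕ) : ℝ)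
    push_cast
    exact mul_le_mul (hA.y_le _) (hB.y_le _) (hB.y_pos _).le (Nat.cast_nonneg _)
  s_le i := by
    show ((A.s i.1 * B.s i.2 : ℕ) : ℝ) ≤ S * S' * (A.y i.1 * B.y i.2)
    push_cast
    calc (A.s i.1 : ℝ) * B.s i.2 ≤ (S * A.y i.1) * (S' * B.y i.2) :=
          mul_le_mul (hA.s_le _) (hB.s_le _) (Nat.cast_nonneg _) ((Nat.cast_nonneg _).trans (hA.s_le _))
      _ = _ := by ring
  y_le_U i := mul_le_mul (hA.y_le_U _) (hB.y_le_U _) (hB.y_pos _).le hA.U_pos.le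
  primes i p hp hdv := by
    rcases (Nat.Prime.dvd_mul hp).1 (show p ∣ A.s i.1 * B.s i.2 from hdv) with h | h
    · have := hA.primes _ p hp h; exact ⟨this.1, by omega⟩
    · have := hB.primes _ p hp h; exact ⟨by omega, this.2⟩
  gcd := hg

/-- Products of laws supported on disjoint ranges of primes. -/
lemma prod (hA : Good A lo hi S Γ U) (hB : Good B lo' hi' S' Γ' U') (hd : hi ≤ lo') (hl : lo ≤ lo')
    (hh : hi ≤ hi') : Good (A.prod B) lo hi' (S * S') (Γ * Γ') (U * U') := by
  refine prod_of_gcd hA hB hl hh ?_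
  · have hcop : ∀ i j, Nat.Coprime (A.s i) (B.s j) := by
      intro i j
      refine Nat.coprime_of_dvd fun p hp h1 h2 => ?_
      have := hA.primes i p hp h1
      have := hB.primes j p hp h2
      omega
    have e : ∀ i j : (A.prod B).ι, Nat.gcd ((A.prod B).s i) ((A.prod B).s j) =
        Nat.gcd (A.s i.1) (A.s j.1) * Nat.gcd (B.s i.2) (B.s j.2) := by
      intro i j
      show Nat.gcd (A.s i.1 * B.s i.2) (A.s j.1 * B.s j.2) = _
      rw [Nat.Coprime.gcd_mul _ (hcop j.1 j.2)]
      congr 1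
      · rw [Nat.gcd_comm, Nat.Coprime.gcd_mul_right_cancel_right _ (hcop _ _).symm, Nat.gcd_comm]
      · rw [Nat.gcd_comm, Nat.Coprime.gcd_mul_left_cancel_right _ (hcop _ _), Nat.gcd_comm]
    have e2 : ∑ i, ∑ j, (A.prod B).w i * (A.prod B).w j * (Nat.gcd ((A.prod B).s i) ((A.prod B).s j) : ℝ) =
        (∑ i, ∑ j, A.w i * A.w j * (Nat.gcd (A.s i) (A.s j) : ℝ)) *
          ∑ i, ∑ j, B.w i * B.w j * (Nat.gcd (B.s i) (B.s j) : ℝ) := by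
      simp_rw [e]
      have : ∀ i j : (A.prod B).ι, (A.prod B).w i * (A.prod B).w j *
          ((Nat.gcd (A.s i.1) (A.s j.1) * Nat.gcd (B.s i.2) (B.s j.2) : ℕ) : ℝ) =
          (A.w i.1 * A.w j.1 * (Nat.gcd (A.s i.1) (A.s j.1) : ℝ)) *
            (B.w i.2 * B.w j.2 * (Nat.gcd (B.s i.2) (B.s j.2) : ℝ)) := by
        intro i j
        show A.w i.1 * B.w i.2 * (A.w j.1 * B.w j.2) * _ = _
        push_cast; ring
      simp_rw [this]
      simp_rw [sum_prod]
      rw [Finset.sum_mul_sum]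
      refine Finset.sum_congr rfl fun i _ => Finset.sum_congr rfl fun k _ => ?_
      rw [Finset.sum_mul_sum]
    rw [e2]
    refine mul_le_mul hA.gcd hB.gcd ?_ (by linarith [hA.one_le_Γ])
    exact Finset.sum_nonneg fun i _ => Finset.sum_nonneg fun j _ =>
      mul_nonneg (mul_nonneg (hB.w_nonneg _) (hB.w_nonneg _)) (Nat.cast_nonneg _)

lemma norm_poly_le (h : Good A lo hi S Γ U) (t : ℝ) : ‖A.poly t‖ ≤ 1 := by
  unfold poly
  refine (norm_sum_le _ _).trans ?_
  rw [← h.w_sum]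
  refine Finset.sum_le_sum fun i _ => ?_
  rw [norm_mul, norm_ch, mul_one, Complex.norm_real, Real.norm_of_nonneg (h.w_nonneg i)]

lemma norm_R_le (h : Good A lo hi S Γ U) (κ Y t : ℝ) (hκ : 0 ≤ κ) (hY : 0 < Y) : ‖A.R κ Y t‖ ≤ κ := by
  unfold R
  refine (norm_sum_le _ _).trans ?_
  have e : κ = ∑ i, A.w i * κ := by rw [← Finset.sum_mul, h.w_sum, one_mul]
  rw [e]
  refine Finset.sum_le_sum fun i _ => ?_
  rw [norm_mul, norm_mul, norm_ch, mul_one, Complex.norm_real, Real.norm_of_nonneg (h.w_nonneg i), ← e]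
  exact mul_le_mul_of_nonneg_left (norm_dz_le _ _ _ hκ (div_pos hY (h.y_pos i))) (h.w_nonneg i)

end Good

/-- Solutions of `a m = b n` are determined by `m`, a multiple of `b / gcd a b`. -/
lemma sum_ite_mul_eq_le (a b M : ℕ) (ha : 0 < a) (hb : 0 < b) (I J : Finset ℕ) (hI : I ⊆ Finset.Ioc 0 M) :
    ∑ m ∈ I, ∑ m' ∈ J, (if a * m = b * m' then (1 : ℝ) else 0) ≤ (M : ℝ) * Nat.gcd a b / b := by
  set g := Nat.gcd a b with hg
  have hgp : 0 < g := Nat.gcd_pos_of_pos_left _ ha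
  set d := b / g with hd
  have hdb : d * g = b := Nat.div_mul_cancel (Nat.gcd_dvd_right a b)
  have hdp : 0 < d := Nat.pos_of_mul_pos_right (hdb ▸ hb)
  have h1 : ∀ m ∈ I, ∑ m' ∈ J, (if a * m = b * m' then (1 : ℝ) else 0) ≤ if d ∣ m then 1 else 0 := by
    intro m _
    by_cases hm : d ∣ m
    · rw [if_pos hm]
      rw [← Finset.sum_filter, Finset.sum_const, nsmul_eq_mul, mul_one]
      have : (J.filter fun m' => a * m = b * m').card ≤ 1 := by
        rw [Finset.card_le_one]
        intro x hx y hy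
        have hx := (Finset.mem_filter.1 hx).2
        have hy := (Finset.mem_filter.1 hy).2
        exact Nat.eq_of_mul_eq_mul_left hb (hx.symm.trans hy)
      exact_mod_cast this
    · rw [if_neg hm]
      refine le_of_eq (Finset.sum_eq_zero fun m' _ => if_neg fun h => hm ?_)
      have h2 : d ∣ (a / g) * m := by
        have ha' : a / g * g = a := Nat.div_mul_cancel (Nat.gcd_dvd_left a b)
        refine ⟨m', Nat.eq_of_mul_eq_mul_right hgp ?_⟩
        calc a / g * m * g = a / g * g * m := by ring
          _ = b * m' := by rw [ha', h]
          _ = d * g * m' := by rw [hdb]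
          _ = d * m' * g := by ring
      exact (Nat.coprime_div_gcd_div_gcd hgp).symm.dvd_of_dvd_mul_left h2
  calc _ ≤ ∑ m ∈ I, (if d ∣ m then (1 : ℝ) else 0) := Finset.sum_le_sum h1
    _ ≤ ∑ m ∈ Finset.Ioc 0 M, (if d ∣ m then (1 : ℝ) else 0) :=
        Finset.sum_le_sum_of_subset_of_nonneg hI fun m _ _ => by split_ifs <;> norm_num
    _ = ((M / d : ℕ) : ℝ) := by
        rw [← Finset.sum_filter, Finset.sum_const, nsmul_eq_mul, mul_one]
        congr 1
        convert Nat.Ioc_filter_dvd_card_eq_div M d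
    _ ≤ (M : ℝ) / d := Nat.cast_div_le
    _ = _ := by
        have : (b : ℝ) = d * g := by exact_mod_cast hdb.symm
        rw [this]
        have : (0 : ℝ) < g := by exact_mod_cast hgp
        have : (0 : ℝ) < d := by exact_mod_cast hdp
        field_simp

/-- The mean value theorem for laws. -/
lemma Good.mean_value {A : Law} {lo hi : ℕ} {S Γ U : ℝ} (h : Good A lo hi S Γ U) (κ Y T : ℝ) (hκ : 0 < κ)
    (hY : 0 < Y) (hT : 0 < T) :
    ∫ t, ‖A.R κ Y t‖ ^ 2 ∂(gm T) ≤ 24 * κ * Γ * (1 / Y + κ * S / T) := by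
  set I : A.ι → Finset ℕ := fun i => Finset.Ioc ⌊Y / A.y i⌋₊ ⌊κ * (Y / A.y i)⌋₊ with hI
  set s : Finset (Σ _ : A.ι, ℕ) := Finset.univ.sigma I with hs
  have e1 : ∀ t, A.R κ Y t = ∑ x ∈ s, ((A.w x.1 * (A.y x.1 / Y) : ℝ) : ℂ) * ch t ((A.s x.1 * x.2 : ℕ) : ℝ) := by
    intro t
    rw [hs, Finset.sum_sigma]
    unfold R dz
    refine Finset.sum_congr rfl fun i _ => ?_
    rw [Finset.mul_sum, Finset.mul_sum]
    refine Finset.sum_congr rfl fun m hm => ?_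
    have hm0 : (m : ℝ) ≠ 0 := by
      have := (Finset.mem_Ioc.1 hm).1
      exact_mod_cast (by omega : m ≠ 0)
    simp only
    rw [Nat.cast_mul, ch_mul t (by exact_mod_cast h.s_ne_zero i) hm0]
    have : (1 / (Y / A.y i)) = A.y i / Y := by rw [one_div_div]
    rw [this]; push_cast; ring
  simp_rw [e1]
  refine (mean_value_nat s _ (fun x => A.s x.1 * x.2) (κ * S * Y) T hT ?_).trans ?_
  · rintro ⟨i, m⟩ hx
    have hm := Finset.mem_Ioc.1 (Finset.mem_sigma.1 hx).2
    have hy := h.y_pos i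
    refine ⟨Nat.mul_pos (h.s_pos i) (by dsimp only at hm ⊢; omega), ?_⟩
    have h1 : (m : ℝ) ≤ κ * (Y / A.y i) := (Nat.le_floor_iff (by positivity)).1 hm.2
    push_cast
    calc (A.s i : ℝ) * m ≤ (S * A.y i) * (κ * (Y / A.y i)) :=
          mul_le_mul (h.s_le i) h1 (Nat.cast_nonneg _) ((Nat.cast_nonneg _).trans (h.s_le i))
      _ = κ * S * Y := by field_simp
  · have hS := h.one_le_S
    have key : ∑ x ∈ s, ∑ x' ∈ s, (if A.s x.1 * x.2 = A.s x'.1 * x'.2 then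
        A.w x.1 * (A.y x.1 / Y) * (A.w x'.1 * (A.y x'.1 / Y)) else 0) ≤ κ * Γ / Y := by
      rw [hs, Finset.sum_sigma]
      calc _ = ∑ i, ∑ j, A.w i * (A.y i / Y) * (A.w j * (A.y j / Y)) *
            ∑ m ∈ I i, ∑ m' ∈ I j, (if A.s i * m = A.s j * m' then (1 : ℝ) else 0) := by
            refine Finset.sum_congr rfl fun i _ => ?_
            simp_rw [Finset.sum_sigma]
            rw [Finset.sum_comm]
            refine Finset.sum_congr rfl fun j _ => ?_
            rw [Finset.mul_sum]
            refine Finset.sum_congr rfl fun m _ => ?_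
            rw [Finset.mul_sum]
            refine Finset.sum_congr rfl fun m' _ => ?_
            simp only [mul_ite, mul_one, mul_zero]
        _ ≤ ∑ i, ∑ j, κ / Y * (A.w i * A.w j * (Nat.gcd (A.s i) (A.s j) : ℝ)) := by
            refine Finset.sum_le_sum fun i _ => Finset.sum_le_sum fun j _ => ?_
            have hyi := h.y_pos i
            have hyj := h.y_pos j
            have hwi := h.w_nonneg i
            have hwj := h.w_nonneg j
            have hsj : (0 : ℝ) < A.s j := by exact_mod_cast h.s_pos j
            have h1 := sum_ite_mul_eq_le (A.s i) (A.s j) ⌊κ * (Y / A.y i)⌋₊ (h.s_pos i) (h.s_pos j) (I i) (I j)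
              (by intro m hm; have := Finset.mem_Ioc.1 hm; exact Finset.mem_Ioc.2 ⟨by omega, this.2⟩)
            have h2 : (⌊κ * (Y / A.y i)⌋₊ : ℝ) ≤ κ * (Y / A.y i) := Nat.floor_le (by positivity)
            calc _ ≤ A.w i * (A.y i / Y) * (A.w j * (A.y j / Y)) *
                  (κ * (Y / A.y i) * Nat.gcd (A.s i) (A.s j) / A.s j) := by
                  refine mul_le_mul_of_nonneg_left (h1.trans ?_) (by positivity)
                  gcongr
              _ = κ / Y * (A.w i * A.w j * (Nat.gcd (A.s i) (A.s j) : ℝ)) * (A.y j / A.s j) := by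
                  field_simp
              _ ≤ κ / Y * (A.w i * A.w j * (Nat.gcd (A.s i) (A.s j) : ℝ)) * 1 := by
                  refine mul_le_mul_of_nonneg_left ?_ (by positivity)
                  rw [div_le_one hsj]; exact h.y_le j
              _ = _ := mul_one _
        _ = κ / Y * ∑ i, ∑ j, A.w i * A.w j * (Nat.gcd (A.s i) (A.s j) : ℝ) := by
            simp_rw [← Finset.mul_sum]
        _ ≤ κ / Y * Γ := by gcongr; exact h.gcd
        _ = _ := by ring
    calc _ ≤ 24 * (1 + κ * S * Y / T) * (κ * Γ / Y) := mul_le_mul_of_nonneg_left key (by positivity)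
      _ = _ := by field_simp

/-- A law supported on distinct primes, with weights at most `M / p`. -/
structure PrimeLaw (A : Law) (lo hi : ℕ) (S M U : ℝ) : Prop where
  w_nonneg : ∀ i, 0 ≤ A.w i
  w_sum : ∑ i, A.w i = 1
  y_pos : ∀ i, 0 < A.y i
  y_le : ∀ i, A.y i ≤ A.s i
  s_le : ∀ i, (A.s i : ℝ) ≤ S * A.y i
  y_le_U : ∀ i, A.y i ≤ U
  prime : ∀ i, (A.s i).Prime
  range : ∀ i, lo ≤ A.s i ∧ A.s i < hi
  inj : Function.Injective A.s
  w_mul_le : ∀ i, A.w i * A.s i ≤ M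

namespace PrimeLaw

variable {A : Law} {lo hi : ℕ} {S M U : ℝ}

lemma M_nonneg (h : PrimeLaw A lo hi S M U) : 0 ≤ M := by
  have : Nonempty A.ι := by
    by_contra hne
    rw [not_nonempty_iff] at hne
    have := h.w_sum
    simp at this
  obtain ⟨i⟩ := this
  exact (mul_nonneg (h.w_nonneg i) (Nat.cast_nonneg _)).trans (h.w_mul_le i)

lemma sum_gcd_le (h : PrimeLaw A lo hi S M U) (c K : ℕ) (hc : c ≠ 0) (hK : c.primeFactors.card ≤ K) :
    ∑ i, A.w i * (Nat.gcd (A.s i) c : ℝ) ≤ 1 + K * M := by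
  have h1 : ∀ i, A.w i * (Nat.gcd (A.s i) c : ℝ) ≤ A.w i + if A.s i ∣ c then M else 0 := by
    intro i
    by_cases hd : A.s i ∣ c
    · rw [if_pos hd, Nat.gcd_eq_left hd]
      linarith [h.w_mul_le i, h.w_nonneg i]
    · rw [if_neg hd, ((h.prime i).coprime_iff_not_dvd.2 hd)]
      simp
  refine (Finset.sum_le_sum fun i _ => h1 i).trans ?_
  rw [Finset.sum_add_distrib, h.w_sum, ← Finset.sum_filter, Finset.sum_const, nsmul_eq_mul]
  have hcard : (Finset.univ.filter fun i => A.s i ∣ c).card ≤ K := by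
    refine le_trans ?_ hK
    refine Finset.card_le_card_of_injOn A.s (fun i hi => ?_) (h.inj.injOn)
    exact Nat.mem_primeFactors.2 ⟨h.prime i, (Finset.mem_filter.1 hi).2, hc⟩
  have := h.M_nonneg
  gcongr

lemma good (h : PrimeLaw A lo hi S M U) : Good A lo hi S (1 + M) U where
  w_nonneg := h.w_nonneg
  w_sum := h.w_sum
  y_pos := h.y_pos
  y_le := h.y_le
  s_le := h.s_le
  y_le_U := h.y_le_U
  primes i p hp hd := by
    rw [(Nat.prime_dvd_prime_iff_eq hp (h.prime i)).1 hd]; exact h.range i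
  gcd := by
    rw [Finset.sum_comm]
    have : ∀ j, ∑ i, A.w i * A.w j * (Nat.gcd (A.s i) (A.s j) : ℝ) ≤ A.w j * (1 + M) := by
      intro j
      have h1 := h.sum_gcd_le (A.s j) 1 (h.prime j).ne_zero (by rw [(h.prime j).primeFactors]; simp)
      calc _ = A.w j * ∑ i, A.w i * (Nat.gcd (A.s i) (A.s j) : ℝ) := by
            rw [Finset.mul_sum]; exact Finset.sum_congr rfl fun i _ => by ring
        _ ≤ A.w j * (1 + M) := by
            refine mul_le_mul_of_nonneg_left ?_ (h.w_nonneg j)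
            simpa using h1
    refine (Finset.sum_le_sum fun j _ => this j).trans (le_of_eq ?_)
    rw [← Finset.sum_mul, h.w_sum, one_mul]

lemma pow_w_nonneg (h : PrimeLaw A lo hi S M U) (k : ℕ) : ∀ i, 0 ≤ (A.pow k).w i := by
  induction k with
  | zero => exact fun _ => zero_le_one
  | succ k ih => exact fun i => mul_nonneg (h.w_nonneg _) (ih _)

lemma pow_sum_gcd_le (h : PrimeLaw A lo hi S M U) (c K : ℕ) (hc : c ≠ 0) (hK : c.primeFactors.card ≤ K)
    (k : ℕ) : ∑ i, (A.pow k).w i * (Nat.gcd ((A.pow k).s i) c : ℝ) ≤ (1 + K * M) ^ k := by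
  have hM := h.M_nonneg
  induction k with
  | zero =>
    show ∑ i, one.w i * (Nat.gcd (one.s i) c : ℝ) ≤ _
    rw [sum_one]; simp [one]
  | succ k ih =>
    show ∑ i, (A.prod (A.pow k)).w i * (Nat.gcd ((A.prod (A.pow k)).s i) c : ℝ) ≤ _
    rw [sum_prod]
    calc _ ≤ ∑ i, ∑ j, (A.w i * (Nat.gcd (A.s i) c : ℝ)) *
          ((A.pow k).w j * (Nat.gcd ((A.pow k).s j) c : ℝ)) := by
          refine Finset.sum_le_sum fun i _ => Finset.sum_le_sum fun j _ => ?_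
          show A.w i * (A.pow k).w j * (Nat.gcd (A.s i * (A.pow k).s j) c : ℝ) ≤ _
          have h1 : Nat.gcd (A.s i * (A.pow k).s j) c ≤ Nat.gcd (A.s i) c * Nat.gcd ((A.pow k).s j) c := by
            refine Nat.le_of_dvd ?_ ?_
            · exact Nat.mul_pos (Nat.gcd_pos_of_pos_right _ (by omega)) (Nat.gcd_pos_of_pos_right _ (by omega))
            · exact Nat.gcd_mul_left_dvd_mul_gcd _ _ _
          have h2 : (Nat.gcd (A.s i * (A.pow k).s j) c : ℝ) ≤ Nat.gcd (A.s i) c * Nat.gcd ((A.pow k).s j) c := by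
            exact_mod_cast h1
          have := mul_le_mul_of_nonneg_left h2 (mul_nonneg (h.w_nonneg i) (h.pow_w_nonneg k j))
          linarith
      _ = (∑ i, A.w i * (Nat.gcd (A.s i) c : ℝ)) * ∑ j, (A.pow k).w j * (Nat.gcd ((A.pow k).s j) c : ℝ) := by
          rw [Finset.sum_mul_sum]
      _ ≤ (1 + K * M) * (1 + K * M) ^ k := by
          refine mul_le_mul (h.sum_gcd_le c K hc hK) ih ?_ (by positivity)
          exact Finset.sum_nonneg fun j _ => mul_nonneg (h.pow_w_nonneg k j) (Nat.cast_nonneg _)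
      _ = _ := (pow_succ' _ _).symm

lemma pow_card_primeFactors (h : PrimeLaw A lo hi S M U) (k : ℕ) :
    ∀ i, ((A.pow k).s i).primeFactors.card ≤ k := by
  induction k with
  | zero => intro i; show (1 : ℕ).primeFactors.card ≤ 0; simp
  | succ k ih =>
    rintro ⟨i, j⟩
    show (A.s i * (A.pow k).s j).primeFactors.card ≤ k + 1
    rw [Nat.primeFactors_mul (h.prime i).ne_zero (pow_s_ne_zero A (fun i => (h.prime i).ne_zero) k j)]
    refine (Finset.card_union_le _ _).trans ?_
    rw [(h.prime i).primeFactors, Finset.card_singleton]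
    have := ih j
    omega

/-- Powers of prime laws. -/
lemma pow_good (h : PrimeLaw A lo hi S M U) (k : ℕ) :
    Good (A.pow k) lo hi (S ^ k) ((1 + k * M) ^ k) (U ^ k) := by
  induction k with
  | zero => simpa [pow] using Good.one lo hi
  | succ k ih =>
    rw [pow_succ' S, pow_succ' U]
    refine h.good.prod_of_gcd ih le_rfl le_rfl ?_
    have hws : ∑ i, (A.pow (k + 1)).w i = 1 := by
      show ∑ i, (A.prod (A.pow k)).w i = 1
      rw [sum_prod]
      show ∑ i, ∑ j, A.w i * (A.pow k).w j = 1
      simp_rw [← Finset.mul_sum]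
      rw [ih.w_sum]; simp [h.w_sum]
    show ∑ i, ∑ j, (A.pow (k + 1)).w i * (A.pow (k + 1)).w j *
      (Nat.gcd ((A.pow (k + 1)).s i) ((A.pow (k + 1)).s j) : ℝ) ≤ _
    rw [Finset.sum_comm]
    have : ∀ j, ∑ i, (A.pow (k + 1)).w i * (A.pow (k + 1)).w j *
        (Nat.gcd ((A.pow (k + 1)).s i) ((A.pow (k + 1)).s j) : ℝ) ≤
        (A.pow (k + 1)).w j * (1 + ((k + 1 : ℕ) : ℝ) * M) ^ (k + 1) := by
      intro j
      have h1 := h.pow_sum_gcd_le ((A.pow (k + 1)).s j) (k + 1)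
        (pow_s_ne_zero A (fun i => (h.prime i).ne_zero) _ j) (h.pow_card_primeFactors _ j) (k + 1)
      refine le_trans (le_of_eq ?_) (mul_le_mul_of_nonneg_left h1 (h.pow_w_nonneg _ j))
      rw [Finset.mul_sum]; exact Finset.sum_congr rfl fun i _ => by ring
    refine (Finset.sum_le_sum fun j _ => this j).trans (le_of_eq ?_)
    rw [← Finset.sum_mul, hws, one_mul]

lemma blk (P : Finset ℕ) (y S : ℝ) (lo hi : ℕ) (hP : P.Nonempty) (hprime : ∀ p ∈ P, p.Prime)
    (hy : 0 < y) (hyp : ∀ p ∈ P, y ≤ p ∧ (p : ℝ) ≤ S * y) (hr : ∀ p ∈ P, lo ≤ p ∧ p < hi) :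
    PrimeLaw (Law.blk P y) lo hi S (1 / ∑ q ∈ P, (1 / q : ℝ)) y where
  w_nonneg := fun i : P => by
    show 0 ≤ 1 / (((i : ℕ) : ℝ) * ∑ q ∈ P, (1 / q : ℝ))
    positivity
  w_sum := by
    have hL : 0 < ∑ q ∈ P, (1 / q : ℝ) :=
      Finset.sum_pos (fun q hq => by have := (hprime q hq).pos; positivity) hP
    show ∑ i : P, 1 / (((i : ℕ) : ℝ) * ∑ q ∈ P, (1 / q : ℝ)) = 1
    rw [Finset.sum_coe_sort P (fun i => 1 / ((i : ℝ) * ∑ q ∈ P, (1 / q : ℝ)))]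
    simp_rw [← div_div]
    rw [← Finset.sum_div, div_self hL.ne']
  y_pos _ := hy
  y_le := fun i : P => (hyp i i.2).1
  s_le := fun i : P => (hyp i i.2).2
  y_le_U _ := le_rfl
  prime := fun i : P => hprime i i.2
  range := fun i : P => hr i i.2
  inj := Subtype.val_injective
  w_mul_le := fun i : P => by
    show 1 / (((i : ℕ) : ℝ) * ∑ q ∈ P, (1 / q : ℝ)) * ((i : ℕ) : ℝ) ≤ _
    have : (0 : ℝ) < ((i : ℕ) : ℝ) := by exact_mod_cast (hprime i i.2).pos
    refine le_of_eq ?_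
    field_simp

lemma mix (V : Finset ℕ) (W : ℕ → ℝ) (A : ℕ → Law) (lo' hi' : ℕ → ℕ) (S M U : ℝ) (M' : ℕ → ℝ)
    (hW : ∀ v ∈ V, 0 ≤ W v) (hW1 : ∑ v ∈ V, W v = 1)
    (hA : ∀ v ∈ V, PrimeLaw (A v) (lo' v) (hi' v) S (M' v) U) (hM : ∀ v ∈ V, W v * M' v ≤ M)
    (hd : ∀ v ∈ V, ∀ v' ∈ V, v < v' → hi' v ≤ lo' v')
    (hr : ∀ v ∈ V, lo ≤ lo' v ∧ hi' v ≤ hi) : PrimeLaw (Law.mix V W A) lo hi S M U where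
  w_nonneg i := mul_nonneg (hW _ i.1.2) ((hA _ i.1.2).w_nonneg _)
  w_sum := by
    show ∑ i : (Σ v : V, (A v).ι), W i.1 * (A i.1).w i.2 = 1
    rw [Fintype.sum_sigma]
    have : ∀ v : V, ∑ j, W v * (A v).w j = W v := by
      intro v; rw [← Finset.mul_sum, (hA v v.2).w_sum, mul_one]
    simp only [this]
    rw [Finset.sum_coe_sort V W, hW1]
  y_pos i := (hA _ i.1.2).y_pos _
  y_le i := (hA _ i.1.2).y_le _
  s_le i := (hA _ i.1.2).s_le _
  y_le_U i := (hA _ i.1.2).y_le_U _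
  prime i := (hA _ i.1.2).prime _
  range i := by
    have h1 := (hA _ i.1.2).range i.2
    have h2 := hr _ i.1.2
    exact ⟨h2.1.trans h1.1, h1.2.trans_le h2.2⟩
  inj := by
    rintro ⟨⟨v, hv⟩, i⟩ ⟨⟨v', hv'⟩, i'⟩ h
    have h' : (A v).s i = (A v').s i' := h
    have h1 := (hA v hv).range i
    have h2 := (hA v' hv').range i'
    rcases lt_trichotomy v v' with hlt | heq | hlt
    · have := hd v hv v' hv' hlt; omega
    · subst heq
      rw [(hA v hv).inj h']
    · have := hd v' hv' v hv hlt; omega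
  w_mul_le i := by
    have h1 := (hA _ i.1.2).w_mul_le i.2
    show W i.1 * (A i.1).w i.2 * _ ≤ M
    rw [mul_assoc]
    exact (mul_le_mul_of_nonneg_left h1 (hW _ i.1.2)).trans (hM _ i.1.2)

end PrimeLaw

end Law

open MeasureTheory in
/-- Duality form of the Halász–Montgomery inequality. -/
lemma halasz_montgomery {ι : Type*} (s : Finset ι) (w : ι → ℝ) (n : ι → ℕ) (I : Finset ℕ)
    (hn : ∀ i ∈ s, n i ∈ I) (μ : Measure ℝ) [IsFiniteMeasure μ] (B : ℝ) (hB0 : 0 ≤ B)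
    (hB : ∀ᵐ t ∂μ, ∫ t', ‖∑ m ∈ I, ch (t - t') m‖ ∂μ ≤ B) :
    ∫ t, ‖∑ i ∈ s, (w i : ℂ) * ch t (n i)‖ ^ 2 ∂μ ≤
      (∑ i ∈ s, ∑ j ∈ s, if n i = n j then w i * w j else 0) * B := by
  set q : ℕ → ℝ := fun k => ∑ i ∈ s with n i = k, w i with hq
  have e1 : ∀ t, ∑ i ∈ s, (w i : ℂ) * ch t (n i) = ∑ k ∈ I, (q k : ℂ) * ch t k := by
    intro t
    rw [← Finset.sum_fiberwise_of_maps_to (g := n) hn]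
    refine Finset.sum_congr rfl fun k _ => ?_
    rw [hq]; simp only; push_cast
    rw [Finset.sum_mul]
    refine Finset.sum_congr rfl fun i hi => ?_
    rw [(Finset.mem_filter.1 hi).2]
  have e2 : (∑ i ∈ s, ∑ j ∈ s, if n i = n j then w i * w j else 0) = ∑ k ∈ I, q k ^ 2 := by
    rw [← Finset.sum_fiberwise_of_maps_to (g := n) hn]
    refine Finset.sum_congr rfl fun k _ => ?_
    rw [sq, hq]; simp only
    rw [Finset.sum_mul_sum]
    refine Finset.sum_congr rfl fun i hi => ?_
    rw [Finset.sum_filter]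
    refine Finset.sum_congr rfl fun j _ => ?_
    rw [(Finset.mem_filter.1 hi).2]
    simp only [eq_comm]
  rw [e2]
  simp_rw [e1]
  set Q : ℝ → ℂ := fun t => ∑ k ∈ I, (q k : ℂ) * ch t k with hQ
  have hQcb : CB Q := CB.sum _ fun k _ => (CB.const _).mul (CB.ch _)
  have hconj : ∀ {f : ℝ → ℂ}, CB f → CB fun t => (starRingEnd ℂ) (f t) := by
    rintro f ⟨h1, C, h2⟩
    exact ⟨Complex.continuous_conj.comp h1, C, fun t => by rw [Complex.norm_conj]; exact h2 t⟩
  set c : ℕ → ℂ := fun m => ∫ t, ch t m * (starRingEnd ℂ) (Q t) ∂μ with hc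
  set J : ℝ := ∫ t, ‖Q t‖ ^ 2 ∂μ with hJ
  have hJ0 : 0 ≤ J := integral_nonneg fun t => by positivity
  have hcint : ∀ m : ℕ, Integrable (fun t => ch t m * (starRingEnd ℂ) (Q t)) μ := fun m =>
    ((CB.ch _).mul (hconj hQcb)).integrable
  have h1 : (J : ℂ) = ∑ k ∈ I, (q k : ℂ) * c k := by
    rw [hJ, ← integral_complex_ofReal]
    have : ∀ t, ((‖Q t‖ ^ 2 : ℝ) : ℂ) = ∑ k ∈ I, (q k : ℂ) * (ch t k * (starRingEnd ℂ) (Q t)) := by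
      intro t
      have := Complex.mul_conj (Q t)
      rw [Complex.normSq_eq_norm_sq] at this
      rw [← this]
      conv_lhs => rw [hQ]
      rw [Finset.sum_mul]
      exact Finset.sum_congr rfl fun k _ => by ring
    simp_rw [this]
    rw [integral_finsetSum _ fun k _ => (hcint k).const_mul _]
    exact Finset.sum_congr rfl fun k _ => integral_const_mul _ _
  have h2 : J ^ 2 ≤ (∑ k ∈ I, q k ^ 2) * ∑ k ∈ I, ‖c k‖ ^ 2 := by
    have : J ≤ ∑ k ∈ I, |q k| * ‖c k‖ := by
      have h : ‖(J : ℂ)‖ ≤ ∑ k ∈ I, |q k| * ‖c k‖ := by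
        rw [h1]
        refine (norm_sum_le _ _).trans (le_of_eq (Finset.sum_congr rfl fun k _ => ?_))
        rw [norm_mul, Complex.norm_real, Real.norm_eq_abs]
      rwa [Complex.norm_real, Real.norm_of_nonneg hJ0] at h
    calc J ^ 2 ≤ (∑ k ∈ I, |q k| * ‖c k‖) ^ 2 := by gcongr
      _ ≤ _ := Finset.sum_mul_sq_le_sq_mul_sq _ _ _
      _ = _ := by simp
  set Z : ℝ → ℂ := fun τ => ∑ m ∈ I, ch τ m with hZ
  have hZcb : CB Z := CB.sum _ fun k _ => CB.ch _
  have hZsymm : ∀ a b, ‖Z (a - b)‖ = ‖Z (b - a)‖ := by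
    intro a b
    rw [hZ]; simp only
    rw [← Complex.norm_conj, map_sum]
    simp_rw [conj_ch]
    simp
  have hshift : ∀ t, CB fun t' => ‖Z (t - t')‖ := fun t =>
    CB.norm ⟨hZcb.1.comp (continuous_const.sub continuous_id), hZcb.2.choose, fun t' => hZcb.2.choose_spec _⟩
  have h3 : ∑ k ∈ I, ‖c k‖ ^ 2 ≤ B * J := by
    have e : ((∑ k ∈ I, ‖c k‖ ^ 2 : ℝ) : ℂ) =
        ∫ t, (starRingEnd ℂ) (Q t) * ∫ t', Q t' * Z (t - t') ∂μ ∂μ := by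
      have a1 : ∀ t, ∫ t', Q t' * Z (t - t') ∂μ = ∑ k ∈ I, ch t k * (starRingEnd ℂ) (c k) := by
        intro t
        have : ∀ t', Q t' * Z (t - t') = ∑ k ∈ I, ch t k * (starRingEnd ℂ) (ch t' k * (starRingEnd ℂ) (Q t')) := by
          intro t'
          rw [hZ]; simp only
          rw [Finset.mul_sum]
          refine Finset.sum_congr rfl fun k _ => ?_
          rw [ch_sub, map_mul, Complex.conj_conj]; ring
        simp_rw [this]
        rw [integral_finsetSum _ fun k _ =>
          (hconj ((CB.ch _).mul (hconj hQcb))).integrable.const_mul _]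
        refine Finset.sum_congr rfl fun k _ => ?_
        rw [integral_const_mul, hc, integral_conj]
      simp_rw [a1]
      have a2 : ∀ t, (starRingEnd ℂ) (Q t) * ∑ k ∈ I, ch t k * (starRingEnd ℂ) (c k) =
          ∑ k ∈ I, (ch t k * (starRingEnd ℂ) (Q t)) * (starRingEnd ℂ) (c k) := by
        intro t; rw [Finset.mul_sum]; exact Finset.sum_congr rfl fun k _ => by ring
      simp_rw [a2]
      rw [integral_finsetSum _ fun k _ => (hcint k).mul_const _]
      push_cast
      refine Finset.sum_congr rfl fun k _ => ?_
      rw [integral_mul_const]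
      have := Complex.mul_conj (c k)
      rw [Complex.normSq_eq_norm_sq] at this
      rw [hc] at this ⊢
      rw [this]; push_cast; rfl
    obtain ⟨CQ, hCQ⟩ := hQcb.2
    obtain ⟨CZ, hCZ⟩ := hZcb.2
    have hCZ0 : 0 ≤ CZ := (norm_nonneg _).trans (hCZ 0)
    have hcont : Continuous fun p : ℝ × ℝ => ‖Q p.1‖ ^ 2 * ‖Z (p.1 - p.2)‖ := by
      have := hQcb.1; have := hZcb.1; fun_prop
    have hprodint : Integrable (fun p : ℝ × ℝ => ‖Q p.1‖ ^ 2 * ‖Z (p.1 - p.2)‖) (μ.prod μ) := by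
      refine Integrable.of_bound hcont.aestronglyMeasurable (CQ ^ 2 * CZ) (Filter.Eventually.of_forall fun p => ?_)
      rw [Real.norm_of_nonneg (by positivity)]
      have := hCQ p.1; have := hCZ (p.1 - p.2)
      gcongr
    set K : ℝ → ℝ := fun t => ∫ t', ‖Z (t - t')‖ ∂μ with hK
    set K2 : ℝ → ℝ := fun t => ∫ t', ‖Q t'‖ ^ 2 * ‖Z (t - t')‖ ∂μ with hK2
    have i1 : Integrable (fun t => ‖Q t‖ ^ 2 * K t) μ := by
      have := hprodint.integral_prod_left
      simpa [integral_const_mul] using this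
    have i2 : Integrable K2 μ := by
      have := hprodint.integral_prod_right
      simp only [hZsymm] at this
      refine this.congr (Filter.Eventually.of_forall fun t => ?_)
      simp only [hK2]
    have swap : ∫ t, K2 t ∂μ = ∫ t, ‖Q t‖ ^ 2 * K t ∂μ := by
      have h := integral_integral_swap (f := fun t t' => ‖Q t‖ ^ 2 * ‖Z (t - t')‖) hprodint
      simp only [integral_const_mul] at h
      rw [hK, h]
      refine integral_congr_ae (Filter.Eventually.of_forall fun t => ?_)
      simp only [hK2]
      refine integral_congr_ae (Filter.Eventually.of_forall fun t' => ?_)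
      simp only [hZsymm t' t]
    have hpt : ∀ t, ‖(starRingEnd ℂ) (Q t) * ∫ t', Q t' * Z (t - t') ∂μ‖ ≤
        (‖Q t‖ ^ 2 * K t + K2 t) / 2 := by
      intro t
      rw [norm_mul, Complex.norm_conj]
      have b1 : ‖∫ t', Q t' * Z (t - t') ∂μ‖ ≤ ∫ t', ‖Q t'‖ * ‖Z (t - t')‖ ∂μ := by
        refine (norm_integral_le_integral_norm _).trans (le_of_eq ?_)
        simp_rw [norm_mul]
      have b2 : ‖Q t‖ * ∫ t', ‖Q t'‖ * ‖Z (t - t')‖ ∂μ ≤ (‖Q t‖ ^ 2 * K t + K2 t) / 2 := by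
        rw [hK, hK2]; simp only
        rw [← integral_const_mul, ← integral_const_mul,
          ← integral_add (((hshift t)).integrable.const_mul _)
            (((hQcb.norm.pow 2).mul (hshift t)).integrable), ← integral_div]
        refine integral_mono ((hQcb.norm.mul (hshift t)).integrable.const_mul _)
          ((((hshift t).integrable.const_mul _).add ((hQcb.norm.pow 2).mul (hshift t)).integrable).div_const _) ?_
        intro t'
        beta_reduce
        nlinarith [mul_nonneg (sq_nonneg (‖Q t‖ - ‖Q t'‖)) (norm_nonneg (Z (t - t')))]
      exact (mul_le_mul_of_nonneg_left b1 (norm_nonneg _)).trans b2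
    have hb : ‖((∑ k ∈ I, ‖c k‖ ^ 2 : ℝ) : ℂ)‖ ≤ ∫ t, (‖Q t‖ ^ 2 * K t + K2 t) / 2 ∂μ := by
      rw [e]
      exact norm_integral_le_of_norm_le ((i1.add i2).div_const 2) (Filter.Eventually.of_forall hpt)
    rw [Complex.norm_real, Real.norm_of_nonneg (by positivity)] at hb
    refine hb.trans ?_
    rw [integral_div, integral_add i1 i2, swap]
    have : ∫ t, ‖Q t‖ ^ 2 * K t ∂μ ≤ B * J := by
      rw [hJ, ← integral_const_mul]
      refine integral_mono_ae i1 ((hQcb.norm.pow 2).integrable.const_mul _) ?_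
      filter_upwards [hB] with t ht
      rw [mul_comm]
      gcongr
    linarith
  have hq0 : 0 ≤ ∑ k ∈ I, q k ^ 2 := by positivity
  have h4 : J ^ 2 ≤ ((∑ k ∈ I, q k ^ 2) * B) * J :=
    h2.trans (by rw [mul_assoc]; gcongr)
  rcases hJ0.eq_or_lt with h | h
  · rw [← h]; positivity
  · nlinarith

open MeasureTheory in
lemma integral_gm {E : Type*} [NormedAddCommGroup E] [NormedSpace ℝ E] (T : ℝ) (hT : 0 < T) (f : ℝ → E) :
    ∫ t, f t ∂gm T = ∫ t, (1 / (Real.sqrt Real.pi * T) * Real.exp (-(t / T) ^ 2)) • f t := by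
  have hv : Real.toNNReal (T ^ 2 / 2) ≠ 0 := by
    rw [Ne, Real.toNNReal_eq_zero, not_le]; positivity
  unfold gm
  rw [ProbabilityTheory.integral_gaussianReal_eq_integral_smul hv]
  refine integral_congr_ae (Filter.Eventually.of_forall fun t => ?_)
  simp only [ProbabilityTheory.gaussianPDFReal]
  rw [Real.coe_toNNReal _ (by positivity)]
  congr 2
  · rw [show 2 * Real.pi * (T ^ 2 / 2) = Real.pi * T ^ 2 by ring, Real.sqrt_mul Real.pi_pos.le,
      Real.sqrt_sq hT.le, one_div]
  · congr 1; field_simp; ring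

open MeasureTheory in
lemma gm_le (T : ℝ) (hT : 0 < T) : gm T ≤ ENNReal.ofReal (1 / T) • (volume : Measure ℝ) := by
  have hv : Real.toNNReal (T ^ 2 / 2) ≠ 0 := by
    rw [Ne, Real.toNNReal_eq_zero, not_le]; positivity
  unfold gm
  rw [ProbabilityTheory.gaussianReal_of_var_ne_zero _ hv, ← withDensity_const]
  refine withDensity_mono (Filter.Eventually.of_forall fun t => ?_)
  unfold ProbabilityTheory.gaussianPDF
  refine ENNReal.ofReal_le_ofReal ?_
  simp only [ProbabilityTheory.gaussianPDFReal]
  rw [Real.coe_toNNReal _ (by positivity), show 2 * Real.pi * (T ^ 2 / 2) = Real.pi * T ^ 2 by ring,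
    Real.sqrt_mul Real.pi_pos.le, Real.sqrt_sq hT.le, one_div]
  have h1 : Real.exp (-(t - 0) ^ 2 / (2 * (T ^ 2 / 2))) ≤ 1 := by
    apply Real.exp_le_one_iff.2
    have : 0 ≤ (t - 0) ^ 2 / (2 * (T ^ 2 / 2)) := by positivity
    rw [neg_div]; linarith
  have h2 : 1 ≤ Real.sqrt Real.pi := by
    rw [Real.one_le_sqrt]; linarith [Real.pi_gt_three]
  calc _ ≤ (Real.sqrt Real.pi * T)⁻¹ * 1 := by gcongr
    _ ≤ T⁻¹ := by
        rw [mul_one]; apply inv_anti₀ hT; nlinarith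

open MeasureTheory in
lemma setIntegral_gm_le (T a b : ℝ) (hT : 0 < T) (hab : a ≤ b) (U : Set ℝ)
    (hUab : U ⊆ Set.Icc a b) (g : ℝ → ℝ) (hg : Continuous g) (hg0 : ∀ t, 0 ≤ g t) :
    ∫ t in U, g t ∂gm T ≤ 1 / T * ∫ t in a..b, g t := by
  have hgi : IntegrableOn g (Set.Icc a b) (ENNReal.ofReal (1 / T) • (volume : Measure ℝ)) := by
    unfold IntegrableOn
    rw [Measure.restrict_smul]
    exact Integrable.smul_measure (hg.continuousOn.integrableOn_Icc) ENNReal.ofReal_ne_top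
  have hr : (gm T).restrict (Set.Icc a b) ≤ (ENNReal.ofReal (1 / T) • (volume : Measure ℝ)).restrict (Set.Icc a b) :=
    Measure.restrict_mono_measure (gm_le T hT) _
  calc ∫ t in U, g t ∂gm T ≤ ∫ t in Set.Icc a b, g t ∂gm T :=
        setIntegral_mono_set (IntegrableOn.mono_measure hgi (gm_le T hT))
          (Filter.Eventually.of_forall fun t => hg0 t) (Filter.Eventually.of_forall hUab)
    _ ≤ ∫ t in Set.Icc a b, g t ∂(ENNReal.ofReal (1 / T) • (volume : Measure ℝ)) :=
        integral_mono_measure hr (Filter.Eventually.of_forall hg0) hgi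
    _ = _ := by
        rw [Measure.restrict_smul, integral_smul_measure, intervalIntegral.integral_of_le hab,
          integral_Icc_eq_integral_Ioc, smul_eq_mul, ENNReal.toReal_ofReal (by positivity)]

lemma integral_one_div_one_add_abs_sub (x a : ℝ) (ha : 0 ≤ a) :
    ∫ t in (x - a)..(x + a), 1 / (1 + |x - t|) = 2 * Real.log (1 + a) := by
  have h0 : ∫ t in (x - a)..(x + a), 1 / (1 + |x - t|) = ∫ u in (-a)..a, 1 / (1 + |u|) := by
    rw [intervalIntegral.integral_comp_sub_left (fun u => 1 / (1 + |u|)) x]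
    congr 1 <;> ring
  have hc : Continuous fun u : ℝ => 1 / (1 + |u|) := by
    refine continuous_const.div (by fun_prop) fun u => by positivity
  have h1 : ∫ u in (0 : ℝ)..a, 1 / (1 + |u|) = Real.log (1 + a) := by
    rw [intervalIntegral.integral_congr (g := fun u => 1 / (1 + u))]
    · rw [intervalIntegral.integral_comp_add_left (fun u => 1 / u) 1,
        integral_one_div_of_pos (by norm_num) (by linarith)]
      simp
    · intro u hu
      rw [Set.uIcc_of_le ha] at hu
      simp only [abs_of_nonneg hu.1]
  have h2 : ∫ u in (-a)..(0 : ℝ), 1 / (1 + |u|) = Real.log (1 + a) := by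
    rw [← h1]
    have := intervalIntegral.integral_comp_neg (a := 0) (b := a) (fun u : ℝ => 1 / (1 + |u|))
    simp only [neg_zero, abs_neg] at this
    exact this.symm
  rw [h0, ← intervalIntegral.integral_add_adjacent_intervals (hc.intervalIntegrable _ _)
    (hc.intervalIntegrable _ _), h1, h2]; ring

lemma norm_zeta_le (M j : ℕ) (hM : 1 ≤ M) (hj : 1 ≤ j) (τ : ℝ) :
    ‖∑ m ∈ Finset.Ioc M (2 ^ j * M), ch τ m‖ ≤
      320 * j * (2 ^ j * M * (1 / (1 + |τ|)) + Real.sqrt |τ|) := by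
  have hj' : (1 : ℝ) ≤ j := by exact_mod_cast hj
  have hs := Real.sqrt_nonneg |τ|
  rcases lt_or_ge |τ| 1 with h | h
  · have h1 := norm_sum_Ioc_ch_le τ M (2 ^ j * M)
    have h2 : ((2 ^ j * M - M : ℕ) : ℝ) ≤ 2 ^ j * M := by
      exact_mod_cast Nat.sub_le _ _
    have h3 : (1 / 2 : ℝ) ≤ 1 / (1 + |τ|) := by
      apply one_div_le_one_div_of_le (by positivity); linarith
    have h4 : (2 : ℝ) ^ j * M * (1 / 2) ≤ 2 ^ j * M * (1 / (1 + |τ|)) := by gcongr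
    have h5 : (0 : ℝ) ≤ 2 ^ j * M := by positivity
    nlinarith
  · have hτ : τ ≠ 0 := by rintro rfl; norm_num at h
    refine (zeta_dyadic M j hM τ hτ).trans ?_
    have h1 : 1 / |τ| ≤ 2 * (1 / (1 + |τ|)) := by
      rw [mul_one_div, div_le_div_iff₀ (by linarith) (by linarith)]; linarith
    have h2 : 2 ^ j * M / |τ| ≤ 2 ^ j * M * (2 * (1 / (1 + |τ|))) := by
      rw [div_eq_mul_one_div]; gcongr
    have h5 : (0 : ℝ) ≤ 2 ^ j * M * (1 / (1 + |τ|)) := by positivity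
    calc _ ≤ (j : ℝ) * (160 * (2 ^ j * M * (2 * (1 / (1 + |τ|))) + Real.sqrt |τ|)) := by gcongr
      _ ≤ _ := by nlinarith

open MeasureTheory in
lemma Law.Good.large_values {A : Law} {lo hi : ℕ} {S Γ U : ℝ} (h : A.Good lo hi S Γ U) (N T T1 : ℝ)
    (hT : 0 < T) (hT1 : 1 ≤ T1) (hN : 2 < N) (hy : ∀ i, A.y i = N) (j : ℕ) (hS : S ≤ 2 ^ j) (E : Set ℝ)
    (hE : MeasurableSet E) (hE1 : ∀ t ∈ E, |t| ≤ T1) :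
    ∫ t in E, ‖A.poly t‖ ^ 2 ∂gm T ≤
      Γ / N * (1280 * (j + 1) * 2 ^ j * (N * Real.log (1 + 2 * T1) / T + Real.sqrt T1 * (gm T).real E)) := by
  set M : ℕ := ⌈N⌉₊ - 1 with hM
  have hc1 : N ≤ ⌈N⌉₊ := Nat.le_ceil N
  have hc2 : (⌈N⌉₊ : ℝ) < N + 1 := Nat.ceil_lt_add_one (by linarith)
  have hc3 : 1 ≤ ⌈N⌉₊ := by
    have : (0 : ℝ) < ⌈N⌉₊ := by linarith
    exact_mod_cast this
  have hMr : (M : ℝ) = ⌈N⌉₊ - 1 := by rw [hM]; push_cast [hc3]; ring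
  have hM1 : 1 ≤ M := by
    have : (0 : ℝ) < M := by rw [hMr]; linarith
    exact_mod_cast this
  have hMN : (M : ℝ) < N := by rw [hMr]; linarith
  have hMN2 : N ≤ 2 * M := by rw [hMr]; linarith
  set I := Finset.Ioc M (2 ^ (j + 1) * M) with hI
  have hmem : ∀ i ∈ (Finset.univ : Finset A.ι), A.s i ∈ I := by
    intro i _
    rw [hI, Finset.mem_Ioc]
    have h1 := h.y_le i
    have h2 := h.s_le i
    rw [hy] at h1 h2
    constructor
    · have : (M : ℝ) < A.s i := by linarith
      exact_mod_cast this
    · have h3 : (A.s i : ℝ) ≤ 2 ^ (j + 1) * M := by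
        calc (A.s i : ℝ) ≤ S * N := h2
          _ ≤ 2 ^ j * (2 * M) := by gcongr
          _ = _ := by ring
      exact_mod_cast h3
  have hlog : 0 ≤ Real.log (1 + 2 * T1) := Real.log_nonneg (by linarith)
  set B : ℝ := 320 * (j + 1 : ℕ) * (2 ^ (j + 1) * M * (1 / T * (2 * Real.log (1 + 2 * T1))) +
      Real.sqrt (2 * T1) * (gm T).real E) with hB
  have hB0 : 0 ≤ B := by positivity
  have key := halasz_montgomery Finset.univ A.w A.s I hmem ((gm T).restrict E) B hB0 (by
    refine (ae_restrict_iff' hE).2 (Filter.Eventually.of_forall fun t ht => ?_)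
    have hcZ : CB fun t' => ‖∑ m ∈ I, ch (t - t') m‖ := by
      refine CB.norm (CB.sum _ fun m _ => ⟨(continuous_ch m).comp (by fun_prop), 1, fun t' => (norm_ch _ _).le⟩)
    have hcg : Continuous fun t' : ℝ => 1 / (1 + |t - t'|) :=
      continuous_const.div (by fun_prop) fun u => by positivity
    have hbg : CB fun t' : ℝ => 1 / (1 + |t - t'|) := by
      refine ⟨hcg, 1, fun t' => ?_⟩
      rw [Real.norm_of_nonneg (by positivity)]
      rw [div_le_one (by positivity)]; linarith [abs_nonneg (t - t')]
    have e1 : ∫ t' in E, ‖∑ m ∈ I, ch (t - t') m‖ ∂gm T ≤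
        ∫ t' in E, 320 * (j + 1 : ℕ) * (2 ^ (j + 1) * M * (1 / (1 + |t - t'|)) + Real.sqrt (2 * T1)) ∂gm T := by
      refine setIntegral_mono_on hcZ.integrable.integrableOn ?_ hE fun t' ht' => ?_
      · exact ((CB.const _).mul (((CB.const _).mul hbg).add (CB.const _))).integrable.integrableOn
      · refine (norm_zeta_le M (j + 1) hM1 (by omega) (t - t')).trans ?_
        have : |t - t'| ≤ 2 * T1 := by
          have := abs_sub t t'; have := hE1 t ht; have := hE1 t' ht'; linarith
        gcongr
    refine e1.trans ?_
    rw [integral_const_mul, integral_add (((CB.const _).mul hbg).integrable) (CB.const _).integrable,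
      integral_const_mul, setIntegral_const, smul_eq_mul, mul_comm ((gm T).real E), hB]
    have e2 := setIntegral_gm_le T (t - 2 * T1) (t + 2 * T1) hT (by linarith) E (by
      intro t' ht'
      have h1 := abs_le.1 (hE1 t ht); have h2 := abs_le.1 (hE1 t' ht')
      constructor <;> linarith) _ hcg (fun t' => by positivity)
    rw [integral_one_div_one_add_abs_sub t (2 * T1) (by linarith)] at e2
    gcongr)
  have hw : (∑ i, ∑ i', if A.s i = A.s i' then A.w i * A.w i' else 0) ≤ Γ / N := by
    rw [le_div_iff₀ (by linarith), Finset.sum_mul]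
    refine le_trans (Finset.sum_le_sum fun i _ => ?_) h.gcd
    rw [Finset.sum_mul]
    refine Finset.sum_le_sum fun i' _ => ?_
    have hww := mul_nonneg (h.w_nonneg i) (h.w_nonneg i')
    split_ifs with heq
    · rw [heq, Nat.gcd_self]
      have := h.y_le i'
      rw [hy] at this
      gcongr
    · rw [zero_mul]; positivity
  have hΓ := h.one_le_Γ
  calc _ ≤ _ := key
    _ ≤ Γ / N * B := by gcongr
    _ ≤ _ := by
        gcongr
        rw [hB]
        have hsq : Real.sqrt (2 * T1) ≤ 2 * Real.sqrt T1 := by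
          rw [Real.sqrt_mul (by norm_num)]
          have : Real.sqrt 2 ≤ 2 := by rw [Real.sqrt_le_left (by norm_num)]; norm_num
          gcongr
        have hg0 : 0 ≤ (gm T).real E := measureReal_nonneg
        calc _ ≤ 320 * ((j + 1 : ℕ) : ℝ) * (2 ^ (j + 1) * N * (1 / T * (2 * Real.log (1 + 2 * T1))) +
              2 * Real.sqrt T1 * (gm T).real E) := by gcongr
          _ ≤ 320 * ((j + 1 : ℕ) : ℝ) * (2 ^ (j + 1) * N * (1 / T * (2 * Real.log (1 + 2 * T1))) +
              2 ^ j * 4 * Real.sqrt T1 * (gm T).real E) := by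
              have : (1 : ℝ) ≤ 2 ^ j := one_le_pow₀ (by norm_num)
              have h3 : 2 * Real.sqrt T1 * (gm T).real E ≤ 2 ^ j * 4 * Real.sqrt T1 * (gm T).real E := by
                gcongr; linarith
              gcongr
          _ = _ := by push_cast; field_simp; ring

lemma eventually_log_pow_le (C : ℝ) (K : ℕ) (s : ℝ) (hs : 0 < s) :
    ∀ᶠ X : ℝ in Filter.atTop, C * Real.log X ^ K ≤ X ^ s := by
  have h := isLittleO_log_rpow_rpow_atTop (K : ℝ) hs
  have h2 := h.bound (c := 1 / (|C| + 1)) (by positivity)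
  filter_upwards [h2, Filter.eventually_ge_atTop 1] with X hX hX1
  have hl := Real.log_nonneg hX1
  rw [Real.rpow_natCast, Real.norm_of_nonneg (by positivity), Real.norm_of_nonneg (by positivity)] at hX
  have hp : 0 ≤ Real.log X ^ K := by positivity
  have h3 : (|C| + 1) * Real.log X ^ K ≤ X ^ s := by
    rw [div_mul_eq_mul_div, one_mul, le_div_iff₀ (by positivity)] at hX
    linarith
  nlinarith [le_abs_self C]

lemma eventually_const_le (C s : ℝ) (hs : 0 < s) : ∀ᶠ X : ℝ in Filter.atTop, C ≤ X ^ s := by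
  simpa using eventually_log_pow_le C 0 s hs

open MeasureTheory in
lemma Law.PrimeLaw.eventually_large_values (η s Cm : ℝ) (hη : 0 < η) (hs : 0 < s) (hCm : 0 ≤ Cm) :
    ∀ᶠ X : ℝ in Filter.atTop, ∀ (A : Law) (lo hi : ℕ) (M U y T T1 τ σ : ℝ) (E : Set ℝ),
      A.PrimeLaw lo hi 4 M U → M ≤ Cm * Real.log X → (∀ i, A.y i = y) → X ^ (η / 2) ≤ y → y ≤ X ^ (2 * η) →
      0 < T → 1 ≤ T1 → T1 ≤ X ^ (τ + s) → 0 ≤ τ → τ ≤ 1 → 0 ≤ σ → σ ≤ 1 / 4 → MeasurableSet E →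
      (∀ t ∈ E, |t| ≤ T1) → (∀ t ∈ E, y ^ (-σ) ≤ ‖A.poly t‖) →
      T * (gm T).real E ≤ X ^ (τ * σ / (1 - 2 * σ) + 4 * s + η) := by
  set K : ℕ := ⌈(1 / 2 + 2 * s) * 4 / η⌉₊ + 1 with hK
  have ev1 := eventually_log_pow_le (2 * (1280 * (2 * K + 1) * 4 ^ K) * (1 + K * Cm) ^ K) K s hs
  have ev2 := eventually_log_pow_le (2 * (1 + s) + 2) 1 s hs
  filter_upwards [ev1, ev2, Filter.eventually_ge_atTop (Real.exp 1), eventually_const_le 3 (η / 2) (by positivity)]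
    with X hX1 hX2 hXe hX3 A lo hi M U y T T1 τ σ E hA hM hy hy1 hy2 hT hT1 hT1' hτ0 hτ1 hσ0 hσ1 hE hET hEb
  have hXp : 0 < X := (Real.exp_pos 1).trans_le hXe
  have hX1' : 1 ≤ X := by have := Real.add_one_le_exp (1 : ℝ); linarith
  have hL : 1 ≤ Real.log X := by
    rw [Real.le_log_iff_exp_le hXp]; exact hXe
  have hyp : 3 ≤ y := hX3.trans hy1
  set ν : ℝ := Real.log y / Real.log X with hν
  have hXν : X ^ ν = y := by
    rw [Real.rpow_def_of_pos hXp, hν, mul_div_cancel₀ _ (by linarith), Real.exp_log (by linarith)]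
  have hν1 : η / 2 ≤ ν := by
    rw [← hXν] at hy1
    exact (Real.rpow_le_rpow_left_iff (by have := Real.add_one_le_exp (1 : ℝ); linarith)).1 hy1
  have hν2 : ν ≤ 2 * η := by
    rw [← hXν] at hy2
    exact (Real.rpow_le_rpow_left_iff (by have := Real.add_one_le_exp (1 : ℝ); linarith)).1 hy2
  have hνp : 0 < ν := by linarith
  have hσ2 : 1 / 2 ≤ 1 - 2 * σ := by linarith
  set q : ℝ := (τ / 2 + 2 * s) / (ν * (1 - 2 * σ)) with hq
  have hq0 : 0 < q := by positivity
  set k : ℕ := ⌈q⌉₊ with hk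
  have hkq : q ≤ k := Nat.le_ceil q
  have hkq2 : (k : ℝ) < q + 1 := Nat.ceil_lt_add_one hq0.le
  have hk1 : 1 ≤ k := by
    have : (0 : ℝ) < k := by linarith
    exact_mod_cast this
  have hkK : k ≤ K := by
    have : q ≤ (1 / 2 + 2 * s) * 4 / η := by
      rw [hq, div_le_div_iff₀ (by positivity) hη]
      have h1 : η / 2 * (1 / 2) ≤ ν * (1 - 2 * σ) := by gcongr
      calc (τ / 2 + 2 * s) * η ≤ (1 / 2 + 2 * s) * η := by gcongr
        _ = (1 / 2 + 2 * s) * 4 * (η / 2 * (1 / 2)) := by ring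
        _ ≤ _ := by gcongr
    have : k ≤ ⌈(1 / 2 + 2 * s) * 4 / η⌉₊ := Nat.ceil_mono this
    omega
  have hM0 := hA.M_nonneg
  have hpow := hA.pow_good k
  have hlv := hpow.large_values (y ^ k) T T1 hT hT1 (by
    calc (2 : ℝ) < y ^ 1 := by linarith
      _ ≤ y ^ k := pow_le_pow_right₀ (by linarith) hk1) (Law.pow_y_const A y hy k) (2 * k)
    (by rw [pow_mul]; norm_num) E hE hET
  set N : ℝ := y ^ k with hN
  have hNp : 0 < N := by positivity
  set g : ℝ := (gm T).real E with hg
  have hg0 : 0 ≤ g := measureReal_nonneg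
  have hlow : (y ^ (-σ)) ^ (2 * k) * g ≤ ∫ t in E, ‖(A.pow k).poly t‖ ^ 2 ∂gm T := by
    have : ∫ t in E, (y ^ (-σ)) ^ (2 * k) ∂gm T ≤ ∫ t in E, ‖(A.pow k).poly t‖ ^ 2 ∂gm T := by
      refine setIntegral_mono_on (CB.const _).integrable ((Law.CB_poly _).norm.pow 2).integrable hE fun t ht => ?_
      rw [Law.poly_pow A (fun i => (hA.prime i).ne_zero), norm_pow, ← pow_mul, mul_comm k 2]
      exact pow_le_pow_left₀ (by positivity) (hEb t ht) _
    rw [setIntegral_const, smul_eq_mul, mul_comm] at this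
    exact this
  have hylam : (y ^ (-σ)) ^ (2 * k) = N ^ (-(2 * σ)) := by
    rw [hN, ← Real.rpow_natCast, ← Real.rpow_natCast, ← Real.rpow_mul (by linarith),
      ← Real.rpow_mul (by linarith)]
    congr 1; push_cast; ring
  rw [hylam] at hlow
  set Λ : ℝ := (1 + k * M) ^ k * (1280 * ((2 * k : ℕ) + 1) * 2 ^ (2 * k)) with hΛ
  have hΛ0 : 0 < Λ := by positivity
  have hΛX : 2 * Λ ≤ X ^ s := by
    refine le_trans ?_ hX1
    have hkr : (k : ℝ) ≤ K := by exact_mod_cast hkK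
    have h1 : 1 + k * M ≤ (1 + K * Cm) * Real.log X := by
      have : (k : ℝ) * M ≤ K * (Cm * Real.log X) := by gcongr
      calc 1 + k * M ≤ Real.log X + K * (Cm * Real.log X) := by gcongr
        _ = _ := by ring
    have h2 : (1 + k * M) ^ k ≤ (1 + K * Cm) ^ K * Real.log X ^ K := by
      rw [← mul_pow]
      have h1' : 1 ≤ (1 + K * Cm) * Real.log X := by
        have : 0 ≤ (K : ℝ) * Cm := by positivity
        exact one_le_mul_of_one_le_of_one_le (by linarith) hL
      calc (1 + k * M) ^ k ≤ ((1 + K * Cm) * Real.log X) ^ k := by gcongr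
        _ ≤ _ := pow_le_pow_right₀ h1' hkK
    have h3 : (2 : ℝ) ^ (2 * k) ≤ 4 ^ K := by
      rw [pow_mul]; norm_num
      exact pow_le_pow_right₀ (by norm_num) hkK
    calc 2 * Λ ≤ 2 * ((1 + K * Cm) ^ K * Real.log X ^ K * (1280 * (2 * K + 1) * 4 ^ K)) := by
          rw [hΛ]; push_cast; gcongr
      _ = _ := by ring
  have hT1log : Real.log (1 + 2 * T1) ≤ X ^ s := by
    refine le_trans ?_ hX2
    have h1 : 1 + 2 * T1 ≤ Real.exp 2 * X ^ (1 + s) := by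
      have e1 : T1 ≤ X ^ (1 + s) := hT1'.trans (Real.rpow_le_rpow_of_exponent_le hX1' (by linarith))
      have e2 := Real.add_one_le_exp (2 : ℝ)
      have e3 : (2 + 1) * X ^ (1 + s) ≤ Real.exp 2 * X ^ (1 + s) := by gcongr
      linarith
    calc Real.log (1 + 2 * T1) ≤ Real.log (Real.exp 2 * X ^ (1 + s)) := Real.log_le_log (by linarith) h1
      _ = 2 + (1 + s) * Real.log X := by
          rw [Real.log_mul (by positivity) (by positivity), Real.log_exp, Real.log_rpow hXp]
      _ ≤ 2 * Real.log X + (1 + s) * Real.log X := by linarith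
      _ ≤ _ := by
          rw [pow_one, ← add_mul]
          exact mul_le_mul_of_nonneg_right (by linarith) (by linarith)
  have hNX : N = X ^ (ν * k) := by
    rw [hN, ← hXν, ← Real.rpow_natCast, ← Real.rpow_mul hXp.le]
  have hN1 : X ^ (τ / 2 + 2 * s) ≤ N ^ (1 - 2 * σ) := by
    rw [hNX, ← Real.rpow_mul hXp.le]
    apply Real.rpow_le_rpow_of_exponent_le hX1'
    rw [hq, div_le_iff₀ (by positivity)] at hkq
    linarith
  have hsqT : Real.sqrt T1 ≤ X ^ (τ / 2 + s / 2) := by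
    rw [Real.sqrt_le_left (by positivity), ← Real.rpow_natCast, ← Real.rpow_mul hXp.le]
    refine hT1'.trans (le_of_eq ?_)
    congr 1; push_cast; ring
  have hhalf : 2 * Λ * Real.sqrt T1 / N ≤ N ^ (-(2 * σ)) := by
    rw [div_le_iff₀ hNp]
    calc 2 * Λ * Real.sqrt T1 ≤ X ^ s * X ^ (τ / 2 + s / 2) := by gcongr
      _ = X ^ (τ / 2 + s / 2 + s) := by rw [← Real.rpow_add hXp]; congr 1; ring
      _ ≤ X ^ (τ / 2 + 2 * s) := Real.rpow_le_rpow_of_exponent_le hX1' (by linarith)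
      _ ≤ N ^ (1 - 2 * σ) := hN1
      _ = N ^ (-(2 * σ)) * N := by
          rw [← Real.rpow_add_one hNp.ne']; congr 1; ring
  have hNσ : 0 < N ^ (-(2 * σ)) := by positivity
  have hfin : N ^ (-(2 * σ)) * (T * g) ≤ 2 * Λ * Real.log (1 + 2 * T1) := by
    have h1 : N ^ (-(2 * σ)) * g ≤ Λ * Real.log (1 + 2 * T1) / T + Λ * Real.sqrt T1 / N * g := by
      refine (hlow.trans hlv).trans (le_of_eq ?_)
      rw [hΛ]; field_simp
    have h2 : Λ * Real.sqrt T1 / N * g ≤ N ^ (-(2 * σ)) / 2 * g := by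
      have : Λ * Real.sqrt T1 / N ≤ N ^ (-(2 * σ)) / 2 := by
        have : 2 * Λ * Real.sqrt T1 / N = 2 * (Λ * Real.sqrt T1 / N) := by ring
        linarith
      gcongr
    have h3 : N ^ (-(2 * σ)) * g / 2 ≤ Λ * Real.log (1 + 2 * T1) / T := by linarith
    rw [le_div_iff₀ hT] at h3
    linarith
  have hNσ2 : N ^ (2 * σ) ≤ X ^ (τ * σ / (1 - 2 * σ) + 2 * s + η) := by
    rw [hNX, ← Real.rpow_mul hXp.le]
    apply Real.rpow_le_rpow_of_exponent_le hX1'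
    have h1 : ν * k ≤ ν * q + ν := by
      calc ν * k ≤ ν * (q + 1) := by gcongr
        _ = _ := by ring
    have h2 : ν * q = (τ / 2 + 2 * s) / (1 - 2 * σ) := by rw [hq]; field_simp
    have h3 : 2 * σ * ((τ / 2 + 2 * s) / (1 - 2 * σ)) = τ * σ / (1 - 2 * σ) + (4 * σ / (1 - 2 * σ)) * s := by
      field_simp; ring
    have h4 : 4 * σ / (1 - 2 * σ) ≤ 2 := by
      rw [div_le_iff₀ (by linarith)]; linarith
    calc ν * k * (2 * σ) ≤ (ν * q + ν) * (2 * σ) := by gcongr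
      _ = 2 * σ * ((τ / 2 + 2 * s) / (1 - 2 * σ)) + 2 * σ * ν := by rw [h2]; ring
      _ ≤ _ := by
          rw [h3]
          have h6 : 4 * σ / (1 - 2 * σ) * s ≤ 2 * s := by gcongr
          have h7 : 2 * σ * ν ≤ 2 * (1 / 4) * (2 * η) := by gcongr
          linarith
  calc T * g = N ^ (2 * σ) * (N ^ (-(2 * σ)) * (T * g)) := by
        rw [← mul_assoc, ← Real.rpow_add hNp]; simp
    _ ≤ X ^ (τ * σ / (1 - 2 * σ) + 2 * s + η) * (X ^ s * X ^ s) := by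
        have h0 : 0 ≤ Real.log (1 + 2 * T1) := Real.log_nonneg (by linarith)
        have : 2 * Λ * Real.log (1 + 2 * T1) ≤ X ^ s * X ^ s := by gcongr
        have h5 := hfin.trans this
        gcongr
    _ = _ := by
        rw [← Real.rpow_add hXp, ← Real.rpow_add hXp]; congr 1; ring

open MeasureTheory

lemma CB.list_prod {ι : Type*} (L : List ι) {f : ι → ℝ → ℝ} (hf : ∀ i ∈ L, CB (f i)) :
    CB fun t => (L.map fun i => f i t).prod := by
  induction L with
  | nil => simpa using CB.const (1 : ℝ)
  | cons a L ih =>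
    simpa using (hf a (by simp)).mul (ih fun i hi => hf i (by simp [hi]))

lemma list_prod_rpow_le {ι : Type*} (L : List ι) (f y : ι → ℝ) (a : ℝ) (hf : ∀ i ∈ L, 0 ≤ f i)
    (hy : ∀ i ∈ L, 0 ≤ y i) (h : ∀ i ∈ L, f i ≤ y i ^ a) : (L.map f).prod ≤ (L.map y).prod ^ a := by
  induction L with
  | nil => simp
  | cons b L ih =>
    have hy' : ∀ i ∈ L, 0 ≤ y i := fun i hi => hy i (by simp [hi])
    have h1 := ih (fun i hi => hf i (by simp [hi])) hy' fun i hi => h i (by simp [hi])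
    rw [List.map_cons, List.prod_cons, List.map_cons, List.prod_cons,
      Real.mul_rpow (hy b (by simp)) (List.prod_nonneg (by simpa using hy'))]
    refine mul_le_mul (h b (by simp)) h1 (List.prod_nonneg (by
      simpa using fun i hi => hf i (by simp [hi]))) (Real.rpow_nonneg (hy b (by simp)) _)

lemma setIntegral_le_sum_of_cover {ι : Type*} {μ : Measure ℝ} [IsFiniteMeasure μ] {f : ℝ → ℝ} (hf : CB f)
    (hf0 : ∀ t, 0 ≤ f t) (E : Set ℝ) (hE : MeasurableSet E) (I : Finset ι) (U : ι → Set ℝ)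
    (hU : ∀ i ∈ I, MeasurableSet (U i)) (hc : ∀ t ∈ E, ∃ i ∈ I, t ∈ U i) :
    ∫ t in E, f t ∂μ ≤ ∑ i ∈ I, ∫ t in U i, f t ∂μ := by
  rw [← integral_indicator hE, Finset.sum_congr rfl fun i hi => (integral_indicator (hU i hi)).symm,
    ← integral_finsetSum _ fun i hi => hf.integrable.indicator (hU i hi)]
  refine integral_mono (hf.integrable.indicator hE)
    (integrable_finsetSum _ fun i hi => hf.integrable.indicator (hU i hi)) fun t => ?_
  have h0 : ∀ i ∈ I, 0 ≤ (U i).indicator f t := fun i _ => Set.indicator_nonneg (fun t _ => hf0 t) t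
  by_cases ht : t ∈ E
  · obtain ⟨i, hi, hti⟩ := hc t ht
    show E.indicator f t ≤ _
    rw [Set.indicator_of_mem ht, ← Set.indicator_of_mem hti f]
    exact Finset.single_le_sum h0 hi
  · show E.indicator f t ≤ _
    rw [Set.indicator_of_notMem ht]
    exact Finset.sum_nonneg h0

lemma setIntegral_le_sqrt {μ : Measure ℝ} [IsFiniteMeasure μ] {f : ℝ → ℝ} (hf : CB f)
    (hf0 : ∀ t, 0 ≤ f t) (E : Set ℝ) :
    ∫ t in E, f t ∂μ ≤ Real.sqrt (μ.real E * ∫ t, f t ^ 2 ∂μ) := by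
  have h := integral_mul_le_sqrt (μ := μ.restrict E) (CB.const (1 : ℝ)) hf (fun _ => zero_le_one) hf0
  simp only [one_mul, one_pow] at h
  refine h.trans (Real.sqrt_le_sqrt ?_)
  rw [setIntegral_const, smul_eq_mul, mul_one]
  exact mul_le_mul_of_nonneg_left (setIntegral_le_integral (hf.pow 2).integrable
    (Filter.Eventually.of_forall fun t => sq_nonneg _)) measureReal_nonneg

/-- A large-value dichotomy: each point of `E` lies in a cell on which one of the factors `p v` has
size about `y v ^ (-σ)`, while no other factor is larger than that. -/
lemma setIntegral_prod_le_of_large_values (V : Finset ℕ) (p : ℕ → ℝ → ℂ) (y : ℕ → ℝ)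
    (hp : ∀ v ∈ V, CB (p v)) (hp1 : ∀ v ∈ V, ∀ t, ‖p v t‖ ≤ 1) (hy : ∀ v ∈ V, 1 ≤ y v)
    (D : ℝ → ℝ) (hD : CB D) (hD0 : ∀ t, 0 ≤ D t) (G : ℝ → ℂ) (hG : CB G) (E : Set ℝ) (hE : MeasurableSet E)
    (T R W d δ P Q : ℝ) (N : ℕ) (Vol : ℕ → ℝ) (hT : 0 < T) (hd : 0 ≤ d) (hδ : 0 ≤ δ) (hR : 0 ≤ R) (hQ : 0 ≤ Q)
    (hDE : ∀ t ∈ E, D t ≤ d) (hG1 : ∀ t, ‖G t‖ ≤ R) (hG2 : T * ∫ t, ‖G t‖ ^ 2 ∂gm T ≤ R ^ 2 * W)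
    (v₀ : ℕ) (hv₀ : v₀ ∈ V) (h₀ : ∀ t ∈ E, y v₀ ^ (-(N * δ)) < ‖p v₀ t‖)
    (L : List ℕ) (hL : ∀ v ∈ L, v ∈ V) (hP : P ≤ (L.map y).prod) (hP1 : 1 ≤ P)
    (hVol : ∀ v ∈ V, ∀ g < N, ∀ U ⊆ E, MeasurableSet U →
      (∀ t ∈ U, y v ^ (-((g + 1 : ℕ) * δ)) ≤ ‖p v t‖) → T * (gm T).real U ≤ Vol g)
    (hcond : ∀ g < N, P ^ (-(g * δ)) * d * Vol g ≤ Q ∨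
      (P ^ (-(g * δ)) * d) ^ 2 * Vol g * W ≤ Q ^ 2) :
    T * ∫ t in E, (L.map fun v => ‖p v t‖).prod * D t * ‖G t‖ ∂gm T ≤ V.card * N * (R * Q) := by
  set F : ℝ → ℝ := fun t => (L.map fun v => ‖p v t‖).prod * D t with hF
  have hFc : CB F := (CB.list_prod L fun v hv => (hp v (hL v hv)).norm).mul hD
  have hF0 : ∀ t, 0 ≤ F t := fun t => mul_nonneg (List.prod_nonneg (by simp)) (hD0 t)
  have hfc : CB fun t => F t * ‖G t‖ := hFc.mul hG.norm
  have hf0 : ∀ t, 0 ≤ F t * ‖G t‖ := fun t => mul_nonneg (hF0 t) (norm_nonneg _)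
  set U : ℕ × ℕ → Set ℝ := fun i => E ∩ ({t | y i.1 ^ (-((i.2 + 1 : ℕ) * δ)) ≤ ‖p i.1 t‖} ∩
    ⋂ v ∈ V, {t | ‖p v t‖ ≤ y v ^ (-(i.2 * δ))}) with hUdef
  have hUm : ∀ i ∈ V ×ˢ Finset.range N, MeasurableSet (U i) := fun i hi =>
    hE.inter ((measurableSet_le measurable_const
      (hp i.1 (Finset.mem_product.1 hi).1).norm.1.measurable).inter
      (V.measurableSet_biInter fun v hv => measurableSet_le (hp v hv).norm.1.measurable measurable_const))
  have hcov : ∀ t ∈ E, ∃ i ∈ V ×ˢ Finset.range N, t ∈ U i := by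
    intro t ht
    have hex : ∃ g : ℕ, ∃ v ∈ V, y v ^ (-(g * δ)) < ‖p v t‖ := ⟨N, v₀, hv₀, h₀ t ht⟩
    obtain ⟨v, hv, hvt⟩ := Nat.find_spec hex
    have hne : Nat.find hex ≠ 0 := by
      intro h0
      rw [h0] at hvt
      simp at hvt
      linarith [hp1 v hv t]
    obtain ⟨g, hg⟩ := Nat.exists_eq_succ_of_ne_zero hne
    have hgN : g < N := by
      have : Nat.find hex ≤ N := Nat.find_min' hex ⟨v₀, hv₀, h₀ t ht⟩
      omega
    rw [hg] at hvt
    refine ⟨(v, g), by simp [hv, hgN], ht, hvt.le, ?_⟩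
    simp only [Set.mem_iInter, Set.mem_ofPred_eq]
    intro u hu
    by_contra hlt
    exact Nat.find_min hex (m := g) (by omega) ⟨u, hu, not_le.1 hlt⟩
  have hcell : ∀ i ∈ V ×ˢ Finset.range N, T * ∫ t in U i, F t * ‖G t‖ ∂gm T ≤ R * Q := by
    rintro ⟨v, g⟩ hi
    obtain ⟨hv, hg⟩ : v ∈ V ∧ g < N := by simpa using hi
    set F0 : ℝ := P ^ (-(g * δ)) * d with hF0def
    have hF00 : 0 ≤ F0 := by positivity
    have hFle : ∀ t ∈ U (v, g), F t ≤ F0 := by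
      intro t ht
      have h1 : (L.map fun v => ‖p v t‖).prod ≤ (L.map y).prod ^ (-(g * δ)) := by
        refine list_prod_rpow_le L _ y _ (fun _ _ => norm_nonneg _)
          (fun i hi => zero_le_one.trans (hy i (hL i hi))) fun i hi => ?_
        have := ht.2.2
        simp only [Set.mem_iInter, Set.mem_ofPred_eq] at this
        exact this i (hL i hi)
      have h2 : (L.map y).prod ^ (-(g * δ)) ≤ P ^ (-(g * δ)) :=
        Real.rpow_le_rpow_of_nonpos (by linarith) hP (by have : 0 ≤ g * δ := by positivity
                                                         linarith)
      exact mul_le_mul (h1.trans h2) (hDE t ht.1) (hD0 t) (by positivity)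
    have hm : T * (gm T).real (U (v, g)) ≤ Vol g :=
      hVol v hv g hg _ Set.inter_subset_left (hUm _ hi) fun t ht => ht.2.1
    have hm0 : 0 ≤ T * (gm T).real (U (v, g)) := by positivity
    rcases hcond g hg with h | h
    · have h1 : ∫ t in U (v, g), F t * ‖G t‖ ∂gm T ≤ ∫ t in U (v, g), F0 * R ∂gm T :=
        setIntegral_mono_on hfc.integrable (CB.const _).integrable (hUm _ hi) fun t ht =>
          mul_le_mul (hFle t ht) (hG1 t) (norm_nonneg _) hF00
      rw [setIntegral_const, smul_eq_mul] at h1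
      calc T * ∫ t in U (v, g), F t * ‖G t‖ ∂gm T ≤ T * ((gm T).real (U (v, g)) * (F0 * R)) := by gcongr
        _ = R * (F0 * (T * (gm T).real (U (v, g)))) := by ring
        _ ≤ R * (F0 * Vol g) := by gcongr
        _ ≤ R * Q := by gcongr
    · have h1 : ∫ t in U (v, g), F t * ‖G t‖ ∂gm T ≤ ∫ t in U (v, g), F0 * ‖G t‖ ∂gm T :=
        setIntegral_mono_on hfc.integrable ((CB.const _).mul hG.norm).integrable (hUm _ hi) fun t ht =>
          mul_le_mul_of_nonneg_right (hFle t ht) (norm_nonneg _)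
      rw [integral_const_mul] at h1
      have h2 := setIntegral_le_sqrt (μ := gm T) hG.norm (fun _ => norm_nonneg _) (U (v, g))
      set I : ℝ := ∫ t, ‖G t‖ ^ 2 ∂gm T
      have h3 : T * (F0 * Real.sqrt ((gm T).real (U (v, g)) * I)) ≤ R * Q := by
        apply le_of_sq_le_sq _ (by positivity)
        have hI : 0 ≤ I := integral_nonneg fun _ => by positivity
        have hVg : 0 ≤ Vol g := hm0.trans hm
        rw [mul_pow, mul_pow, Real.sq_sqrt (by positivity)]
        calc T ^ 2 * (F0 ^ 2 * ((gm T).real (U (v, g)) * I))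
            = F0 ^ 2 * (T * (gm T).real (U (v, g))) * (T * I) := by ring
          _ ≤ F0 ^ 2 * Vol g * (R ^ 2 * W) := by gcongr
          _ = R ^ 2 * (F0 ^ 2 * Vol g * W) := by ring
          _ ≤ R ^ 2 * Q ^ 2 := by gcongr
          _ = (R * Q) ^ 2 := by ring
      refine le_trans ?_ h3
      gcongr
      exact h1.trans (mul_le_mul_of_nonneg_left h2 hF00)
  calc T * ∫ t in E, F t * ‖G t‖ ∂gm T
      ≤ T * ∑ i ∈ V ×ˢ Finset.range N, ∫ t in U i, F t * ‖G t‖ ∂gm T := by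
        gcongr; exact setIntegral_le_sum_of_cover hfc hf0 E hE _ U hUm hcov
    _ = ∑ i ∈ V ×ˢ Finset.range N, T * ∫ t in U i, F t * ‖G t‖ ∂gm T := Finset.mul_sum ..
    _ ≤ ∑ i ∈ V ×ˢ Finset.range N, R * Q := Finset.sum_le_sum hcell
    _ = V.card * N * (R * Q) := by simp [Finset.card_product]

lemma abs_log_div_ge {n y δ B : ℝ} (hn : 0 < n) (hy : 0 < y) (hnB : n ≤ B) (hyB : y ≤ B) (hδ : δ ≤ |n - y|) : δ / B ≤ |Real.log (n / y)| := by
  have key : ∀ a b : ℝ, 0 < a → 0 < b → a ≤ B → b ≤ a → (a - b) / B ≤ Real.log (a / b) := by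
    intro a b ha hb haB hba
    have h1 := Real.one_sub_inv_le_log_of_pos (div_pos ha hb)
    have h2 : 1 - (a / b)⁻¹ = (a - b) / a := by field_simp
    rw [h2] at h1
    exact (div_le_div_of_nonneg_left (by linarith) ha haB).trans h1
  have hB : 0 < B := by linarith
  rcases le_total n y with h | h
  · rw [← abs_neg, ← Real.log_inv, inv_div]
    rw [abs_of_nonpos (by linarith)] at hδ
    refine le_trans ?_ ((key y n hy hn hyB h).trans (le_abs_self _))
    gcongr; linarith
  · rw [abs_of_nonneg (by linarith)] at hδ
    refine le_trans ?_ ((key n y hn hy hnB h).trans (le_abs_self _))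
    gcongr

/-- Changing the width of the Gaussian weight costs only frequencies above the smaller width. -/
lemma norm_mul_integral_gm_sub_le (T₀ T : ℝ) (hT₀ : 0 < T₀) (hT : T₀ ≤ T) {f : ℝ → ℂ} (hf : CB f) :
    ‖(T₀ : ℂ) * ∫ t, f t ∂gm T₀ - T * ∫ t, f t ∂gm T‖ ≤
      T * ∫ t, ‖f t‖ * min 1 ((t / T₀) ^ 2) ∂gm T := by
  have hTp : 0 < T := by linarith
  have hsc : ∀ τ : ℝ, 0 < τ → ∀ {E : Type} [NormedAddCommGroup E] [NormedSpace ℝ E] (g : ℝ → E),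
      τ • ∫ t, g t ∂gm τ = ∫ t, (1 / Real.sqrt Real.pi * Real.exp (-(t / τ) ^ 2)) • g t := by
    intro τ hτ E _ _ g
    rw [integral_gm τ hτ, ← integral_smul]
    refine integral_congr_ae (Filter.Eventually.of_forall fun t => ?_)
    simp only [smul_smul]
    congr 1; field_simp
  have hgi : ∀ τ : ℝ, 0 < τ → Integrable fun t : ℝ => 1 / Real.sqrt Real.pi * Real.exp (-(t / τ) ^ 2) := by
    intro τ hτ
    have := integrable_exp_neg_mul_sq (b := 1 / τ ^ 2) (by positivity)
    refine (this.const_mul (1 / Real.sqrt Real.pi)).congr (Filter.Eventually.of_forall fun t => ?_)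
    simp only
    congr 2; field_simp
  obtain ⟨hfc, C, hC⟩ := hf
  have hInt : ∀ τ : ℝ, 0 < τ →
      Integrable fun t : ℝ => (1 / Real.sqrt Real.pi * Real.exp (-(t / τ) ^ 2)) • f t := fun τ hτ =>
    (hgi τ hτ).smul_bdd C hfc.aestronglyMeasurable (Filter.Eventually.of_forall hC)
  have e1 := hsc T₀ hT₀ f
  have e2 := hsc T hTp f
  rw [← Complex.real_smul, ← Complex.real_smul, e1, e2, ← integral_sub (hInt T₀ hT₀) (hInt T hTp)]
  rw [← smul_eq_mul (a := T), hsc T hTp fun t => ‖f t‖ * min 1 ((t / T₀) ^ 2)]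
  have hmin : ∀ t, 0 ≤ min 1 ((t / T₀) ^ 2) := fun t => le_min zero_le_one (sq_nonneg _)
  refine norm_integral_le_of_norm_le ?_ (Filter.Eventually.of_forall fun t => ?_)
  · refine (hgi T hTp).smul_bdd C ?_ (Filter.Eventually.of_forall fun t => ?_)
    · exact (by fun_prop : Continuous fun t : ℝ => ‖f t‖ * min 1 ((t / T₀) ^ 2)).aestronglyMeasurable
    · rw [norm_mul, norm_norm, Real.norm_of_nonneg (hmin t)]
      calc ‖f t‖ * min 1 ((t / T₀) ^ 2) ≤ ‖f t‖ * 1 := by gcongr; exact min_le_left _ _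
        _ ≤ C := by rw [mul_one]; exact hC t
  · rw [← sub_smul, norm_smul, ← mul_sub, Real.norm_eq_abs, abs_mul, abs_of_nonneg (by positivity),
      smul_eq_mul, mul_comm ‖f t‖, ← mul_assoc, mul_assoc (1 / Real.sqrt Real.pi)]
    have h1 : (t / T) ^ 2 ≤ (t / T₀) ^ 2 := by
      rw [div_pow, div_pow]; gcongr
    have h2 : Real.exp (-(t / T₀) ^ 2) ≤ Real.exp (-(t / T) ^ 2) := Real.exp_le_exp.2 (by linarith)
    have h3 : Real.exp (-(t / T) ^ 2) * (1 - (t / T₀) ^ 2) ≤ Real.exp (-(t / T₀) ^ 2) := by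
      have h4 := Real.add_one_le_exp (-(t / T₀) ^ 2 + (t / T) ^ 2)
      calc Real.exp (-(t / T) ^ 2) * (1 - (t / T₀) ^ 2)
          ≤ Real.exp (-(t / T) ^ 2) * Real.exp (-(t / T₀) ^ 2 + (t / T) ^ 2) := by
            gcongr; linarith [sq_nonneg (t / T)]
        _ = _ := by rw [← Real.exp_add]; congr 1; ring
    rw [mul_assoc, mul_assoc, mul_comm (min _ _), ← mul_assoc (Real.exp _), mul_right_comm (Real.exp _)]
    refine mul_le_mul_of_nonneg_left (mul_le_mul_of_nonneg_right ?_ (norm_nonneg _)) (show 0 ≤ 1 / Real.sqrt Real.pi by positivity)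
    rw [abs_sub_comm, abs_of_nonneg (by linarith)]
    rcases min_choice 1 ((t / T₀) ^ 2) with h | h <;> rw [h]
    · linarith [Real.exp_pos (-(t / T₀) ^ 2)]
    · linarith

namespace Law

/-- The Gaussian-smoothed count of the products `s m` of the law near `y`. -/
noncomputable def smooth (A : Law) (κ Y y τ : ℝ) : ℝ :=
  ∑ i, A.w i * (1 / (Y / A.y i) * ∑ m ∈ Finset.Ioc ⌊Y / A.y i⌋₊ ⌊κ * (Y / A.y i)⌋₊,
    Real.exp (-(τ ^ 2 * Real.log (A.s i * m / y) ^ 2 / 4)))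

lemma integral_R_mul_ch (A : Law) (hs : ∀ i, A.s i ≠ 0) (κ Y y τ : ℝ) (hy : 0 < y) :
    ∫ t, A.R κ Y t * ch (-t) y ∂gm τ = (A.smooth κ Y y τ : ℂ) := by
  have e : ∀ t, A.R κ Y t * ch (-t) y = ∑ i, ∑ m ∈ Finset.Ioc ⌊Y / A.y i⌋₊ ⌊κ * (Y / A.y i)⌋₊,
      ((A.w i : ℂ) * ((1 / (Y / A.y i) : ℝ) : ℂ)) * ch t (A.s i * m / y) := by
    intro t
    unfold R dz
    rw [Finset.sum_mul]
    refine Finset.sum_congr rfl fun i _ => ?_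
    rw [Finset.mul_sum, Finset.mul_sum, Finset.sum_mul]
    refine Finset.sum_congr rfl fun m hm => ?_
    have hs' : (A.s i : ℝ) ≠ 0 := by exact_mod_cast hs i
    have hm' : (m : ℝ) ≠ 0 := by
      have := (Finset.mem_Ioc.1 hm).1
      exact_mod_cast (by omega : m ≠ 0)
    rw [ch_div t (mul_ne_zero hs' hm') hy.ne', ch_mul t hs' hm', conj_ch]
    ring
  simp_rw [e]
  rw [integral_finsetSum _ fun i _ => integrable_finsetSum _ fun m _ => ((CB.const _).mul (CB.ch _)).integrable]
  unfold smooth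
  push_cast
  refine Finset.sum_congr rfl fun i _ => ?_
  rw [integral_finsetSum _ fun m _ => ((CB.const _).mul (CB.ch _)).integrable, Finset.mul_sum, Finset.mul_sum]
  refine Finset.sum_congr rfl fun m _ => ?_
  rw [integral_const_mul, integral_ch_gm]
  push_cast; ring

variable {A : Law} {lo hi : ℕ} {S Γ U : ℝ}

lemma Good.smooth_nonneg (hA : A.Good lo hi S Γ U) (κ Y y τ : ℝ) (hY : 0 < Y) : 0 ≤ A.smooth κ Y y τ :=
  Finset.sum_nonneg fun i _ => mul_nonneg (hA.w_nonneg i) (mul_nonneg (by have := hA.y_pos i; positivity)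
    (Finset.sum_nonneg fun m _ => (Real.exp_pos _).le))

lemma Good.smooth_le (hA : A.Good lo hi S Γ U) (κ Y y T δ : ℝ) (hY : 0 < Y) (hδ : 0 ≤ δ)
    (hb : ∀ i, ∀ m ∈ Finset.Ioc ⌊Y / A.y i⌋₊ ⌊κ * (Y / A.y i)⌋₊, δ ≤ |Real.log (A.s i * m / y)|) :
    A.smooth κ Y y T ≤ Real.exp (-(T ^ 2 * δ ^ 2 / 8)) * A.smooth κ Y y (T / Real.sqrt 2) := by
  unfold smooth
  rw [Finset.mul_sum]
  refine Finset.sum_le_sum fun i _ => ?_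
  rw [mul_left_comm (Real.exp _), mul_left_comm (Real.exp _), Finset.mul_sum (a := Real.exp _)]
  have := hA.y_pos i
  refine mul_le_mul_of_nonneg_left (mul_le_mul_of_nonneg_left (Finset.sum_le_sum fun m hm => ?_)
    (show 0 ≤ 1 / (Y / A.y i) by positivity)) (hA.w_nonneg i)
  rw [← Real.exp_add, div_pow, Real.sq_sqrt (by norm_num)]
  apply Real.exp_le_exp.2
  have h1 : δ ^ 2 ≤ Real.log (A.s i * m / y) ^ 2 := by
    rw [← sq_abs (Real.log _)]; exact pow_le_pow_left₀ hδ (hb i m hm) 2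
  have h2 : T ^ 2 * δ ^ 2 ≤ T ^ 2 * Real.log (A.s i * m / y) ^ 2 := by gcongr
  linarith

lemma Good.one_le_smooth (hA : A.Good lo hi S Γ U) (X y T : ℝ) (hX : 0 < X) (hy : X ≤ y) (hy2 : y ≤ 3 * X)
    (hT : 1 ≤ T) (hU : 4 * S * T * U ≤ X) : 1 ≤ T * A.smooth (16 * S) (X / (2 * S)) y T := by
  have hS := hA.one_le_S
  have hterm : ∀ i, 1 ≤ T * (1 / (X / (2 * S) / A.y i) *
      ∑ m ∈ Finset.Ioc ⌊X / (2 * S) / A.y i⌋₊ ⌊16 * S * (X / (2 * S) / A.y i)⌋₊,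
      Real.exp (-(T ^ 2 * Real.log (A.s i * m / y) ^ 2 / 4))) := by
    intro i
    have hyi := hA.y_pos i
    have hsi : (0 : ℝ) < A.s i := by exact_mod_cast hA.s_pos i
    have hle := hA.y_le i
    have hle2 := hA.s_le i
    have hleU := hA.y_le_U i
    set a : ℝ := y / A.s i with ha
    have hyp : 0 < y := by linarith
    have hap : 0 < a := by positivity
    have hZa : X / (2 * S) / A.y i ≤ a := by
      rw [div_div, ha, div_le_div_iff₀ (by positivity) hsi]
      have h1 : X * A.s i ≤ y * (S * A.y i) := by gcongr
      have h2 : 0 ≤ y * (S * A.y i) := by positivity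
      calc X * A.s i ≤ y * (S * A.y i) := h1
        _ ≤ y * (2 * S * A.y i) := by linarith
    have hbκ : a * (1 + 1 / T) ≤ 16 * S * (X / (2 * S) / A.y i) := by
      have h1 : 16 * S * (X / (2 * S) / A.y i) = 8 * X / A.y i := by field_simp; ring
      rw [h1]
      have h2 : 1 / T ≤ 1 := by rw [div_le_one (by linarith)]; exact hT
      calc a * (1 + 1 / T) ≤ a * 2 := by gcongr; linarith
        _ ≤ (3 * X / A.y i) * 2 := by rw [ha]; gcongr
        _ ≤ 8 * X / A.y i := by rw [div_mul_eq_mul_div]; exact div_le_div_of_nonneg_right (by linarith) hyi.le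
    have hsub : Finset.Ioc ⌊a⌋₊ ⌊a * (1 + 1 / T)⌋₊ ⊆
        Finset.Ioc ⌊X / (2 * S) / A.y i⌋₊ ⌊16 * S * (X / (2 * S) / A.y i)⌋₊ :=
      Finset.Ioc_subset_Ioc (Nat.floor_mono hZa) (Nat.floor_mono hbκ)
    have hcard : a / T - 1 ≤ ((Finset.Ioc ⌊a⌋₊ ⌊a * (1 + 1 / T)⌋₊).card : ℝ) := by
      rw [Nat.card_Ioc]
      have h1 := Nat.lt_floor_add_one (a * (1 + 1 / T))
      have h2 := Nat.floor_le hap.le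
      have h3 : (⌊a * (1 + 1 / T)⌋₊ : ℝ) ≤ ((⌊a * (1 + 1 / T)⌋₊ - ⌊a⌋₊ : ℕ) : ℝ) + ⌊a⌋₊ := by
        exact_mod_cast (by omega : ⌊a * (1 + 1 / T)⌋₊ ≤ (⌊a * (1 + 1 / T)⌋₊ - ⌊a⌋₊) + ⌊a⌋₊)
      have h4 : a * (1 + 1 / T) = a + a / T := by ring
      linarith
    have hexp : ∀ m ∈ Finset.Ioc ⌊a⌋₊ ⌊a * (1 + 1 / T)⌋₊,
        (3 / 4 : ℝ) ≤ Real.exp (-(T ^ 2 * Real.log (A.s i * m / y) ^ 2 / 4)) := by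
      intro m hm
      rw [Finset.mem_Ioc] at hm
      have hm1 : a < m := (Nat.floor_lt hap.le).1 hm.1
      have hm2 : (m : ℝ) ≤ a * (1 + 1 / T) := (Nat.le_floor_iff (by positivity)).1 hm.2
      have hq : (A.s i * m / y : ℝ) = m / a := by rw [ha]; field_simp
      rw [hq]
      have hl0 : 0 ≤ Real.log (m / a) := Real.log_nonneg (by rw [le_div_iff₀ hap]; linarith)
      have hl1 : Real.log (m / a) ≤ 1 / T := by
        have h1 := Real.log_le_sub_one_of_pos (div_pos (hap.trans hm1) hap)
        have h2 : (m : ℝ) / a ≤ 1 + 1 / T := by rw [div_le_iff₀ hap]; linarith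
        linarith
      have h3 : T ^ 2 * Real.log (m / a) ^ 2 ≤ T ^ 2 * (1 / T) ^ 2 := by gcongr
      have h4 : T ^ 2 * (1 / T) ^ 2 = 1 := by field_simp
      have h5 := Real.add_one_le_exp (-(T ^ 2 * Real.log (m / a) ^ 2 / 4))
      linarith
    have hZ : 0 < X / (2 * S) / A.y i := by positivity
    have hsum : (a / T - 1) * (3 / 4) ≤
        ∑ m ∈ Finset.Ioc ⌊X / (2 * S) / A.y i⌋₊ ⌊16 * S * (X / (2 * S) / A.y i)⌋₊,
        Real.exp (-(T ^ 2 * Real.log (A.s i * m / y) ^ 2 / 4)) := by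
      refine le_trans ?_ (Finset.sum_le_sum_of_subset_of_nonneg hsub fun _ _ _ => (Real.exp_pos _).le)
      refine le_trans ?_ (Finset.card_nsmul_le_sum _ _ _ hexp)
      rw [nsmul_eq_mul]
      gcongr
    have hgoal : 1 ≤ T * (1 / (X / (2 * S) / A.y i) * ((a / T - 1) * (3 / 4))) := by
      have e1 : T * (1 / (X / (2 * S) / A.y i) * ((a / T - 1) * (3 / 4))) =
          (a - T) * (3 / 2 * (S * A.y i)) / X := by field_simp; ring
      rw [e1, le_div_iff₀ hX]
      have h1 : y ≤ a * (S * A.y i) := by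
        calc y = a * A.s i := by rw [ha]; field_simp
          _ ≤ _ := by gcongr
      have h2 : T * (S * A.y i) ≤ S * T * U := by
        calc T * (S * A.y i) ≤ T * (S * U) := by gcongr
          _ = _ := by ring
      have h3 : (a - T) * (3 / 2 * (S * A.y i)) =
        3 / 2 * (a * (S * A.y i)) - 3 / 2 * (T * (S * A.y i)) := by ring
      linarith
    refine hgoal.trans ?_
    gcongr
  unfold smooth
  rw [Finset.mul_sum]
  refine hA.w_sum.symm.le.trans (Finset.sum_le_sum fun i _ => ?_)
  rw [mul_left_comm]
  exact le_mul_of_one_le_right (hA.w_nonneg i) (hterm i)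

lemma Good.card_le (hA : A.Good lo hi S Γ U) (X h T T₀ : ℝ) (Q : Finset ℕ) (hX : 0 < X) (hh : 0 < h)
    (hhX : h ≤ X) (hT₀ : 1 ≤ T₀) (hT : T₀ ≤ T) (hU : 4 * S * T₀ * U ≤ X)
    (hQ : ∀ x ∈ Q, X ≤ (x : ℝ) ∧ (x : ℝ) ≤ 2 * X)
    (hbad : ∀ x ∈ Q, ∀ i, ∀ m ∈ Finset.Ioc ⌊X / (2 * S) / A.y i⌋₊ ⌊16 * S * (X / (2 * S) / A.y i)⌋₊,
      x < A.s i * m → (x : ℝ) + h < A.s i * m) :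
    (Q.card : ℝ) ≤ Real.exp (-(T ^ 2 * (h / (16 * S * X)) ^ 2 / 8)) *
      (T * Real.sqrt ((∫ t, ‖A.R (16 * S) (X / (2 * S)) t‖ ^ 2 ∂gm (T / Real.sqrt 2)) *
        ∫ t, ‖∑ x ∈ Q, ch (-t) (x + h / 2)‖ ^ 2 ∂gm (T / Real.sqrt 2))) +
      T * ∫ t, ‖A.R (16 * S) (X / (2 * S)) t‖ * ‖∑ x ∈ Q, ch (-t) (x + h / 2)‖ * min 1 ((t / T₀) ^ 2) ∂gm T := by
  have hS := hA.one_le_S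
  have hY : 0 < X / (2 * S) := by positivity
  have hTp : 0 < T := by linarith
  set F : ℝ → ℂ := A.R (16 * S) (X / (2 * S)) with hF
  have hFc : CB F := A.CB_R _ _
  set G : ℝ → ℂ := fun t => ∑ x ∈ Q, ch (-t) (x + h / 2) with hG
  have hGc : CB G := CB.sum _ fun x _ => CB.ch_neg _
  have hInt : ∀ τ, ∫ t, F t * G t ∂gm τ =
      ((∑ x ∈ Q, A.smooth (16 * S) (X / (2 * S)) (x + h / 2) τ : ℝ) : ℂ) := by
    intro τ
    have e : ∀ t, F t * G t = ∑ x ∈ Q, F t * ch (-t) (x + h / 2) := fun t => Finset.mul_sum ..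
    simp_rw [e]
    rw [integral_finsetSum _ fun x _ => (hFc.mul (CB.ch_neg _)).integrable]
    push_cast
    exact Finset.sum_congr rfl fun x hx =>
      integral_R_mul_ch A hA.s_ne_zero _ _ _ τ (by linarith [(hQ x hx).1])
  have hnn : ∀ τ, 0 ≤ ∑ x ∈ Q, A.smooth (16 * S) (X / (2 * S)) (x + h / 2) τ := fun τ =>
    Finset.sum_nonneg fun x _ => hA.smooth_nonneg _ _ _ _ hY
  have hlow : (Q.card : ℝ) ≤ ‖(T₀ : ℂ) * ∫ t, F t * G t ∂gm T₀‖ := by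
    rw [hInt, norm_mul, Complex.norm_real, Complex.norm_real, Real.norm_of_nonneg (by linarith),
      Real.norm_of_nonneg (hnn _), Finset.mul_sum, Finset.cast_card]
    exact Finset.sum_le_sum fun x hx => hA.one_le_smooth X _ T₀ hX (by linarith [(hQ x hx).1])
      (by linarith [(hQ x hx).2]) hT₀ hU
  have hup : ‖(T : ℂ) * ∫ t, F t * G t ∂gm T‖ ≤ Real.exp (-(T ^ 2 * (h / (16 * S * X)) ^ 2 / 8)) *
      (T * Real.sqrt ((∫ t, ‖F t‖ ^ 2 ∂gm (T / Real.sqrt 2)) * ∫ t, ‖G t‖ ^ 2 ∂gm (T / Real.sqrt 2))) := by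
    have h1 : ∑ x ∈ Q, A.smooth (16 * S) (X / (2 * S)) (x + h / 2) T ≤
        Real.exp (-(T ^ 2 * (h / (16 * S * X)) ^ 2 / 8)) *
          ∑ x ∈ Q, A.smooth (16 * S) (X / (2 * S)) (x + h / 2) (T / Real.sqrt 2) := by
      rw [Finset.mul_sum]
      refine Finset.sum_le_sum fun x hx => hA.smooth_le _ _ _ _ _ hY (by positivity) fun i m hm => ?_
      have hxX := hQ x hx
      have hsi : (0 : ℝ) < A.s i := by exact_mod_cast hA.s_pos i
      have hyi := hA.y_pos i
      have hsy := hA.s_le i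
      have hmm := Finset.mem_Ioc.1 hm
      have hmp : (0 : ℝ) < m := by exact_mod_cast (by omega : 0 < m)
      have hmle : (m : ℝ) ≤ 16 * S * (X / (2 * S) / A.y i) := (Nat.le_floor_iff (by positivity)).1 hmm.2
      have hB : (A.s i * m : ℝ) ≤ 8 * S * X := by
        calc (A.s i * m : ℝ) ≤ (S * A.y i) * (16 * S * (X / (2 * S) / A.y i)) := by gcongr
          _ = 8 * S * X := by field_simp; ring
      have hyB : (x : ℝ) + h / 2 ≤ 8 * S * X := by
        calc (x : ℝ) + h / 2 ≤ 8 * 1 * X := by linarith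
          _ ≤ _ := by gcongr
      have hd : h / 2 ≤ |(A.s i * m : ℝ) - (x + h / 2)| := by
        rcases le_or_gt (A.s i * m) x with h2 | h2
        · have h3 : (A.s i * m : ℝ) ≤ x := by exact_mod_cast h2
          rw [abs_of_nonpos (by linarith)]; linarith
        · have h3 := hbad x hx i m hm h2
          rw [abs_of_nonneg (by linarith)]; linarith
      have := abs_log_div_ge (by positivity) (by linarith) hB hyB hd
      refine le_trans (le_of_eq ?_) this
      field_simp; ring
    have h2 : ∑ x ∈ Q, A.smooth (16 * S) (X / (2 * S)) (x + h / 2) (T / Real.sqrt 2) ≤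
        Real.sqrt ((∫ t, ‖F t‖ ^ 2 ∂gm (T / Real.sqrt 2)) * ∫ t, ‖G t‖ ^ 2 ∂gm (T / Real.sqrt 2)) := by
      have e := hInt (T / Real.sqrt 2)
      have e2 := congrArg norm e
      rw [Complex.norm_real, Real.norm_of_nonneg (hnn _)] at e2
      rw [← e2]
      refine (norm_integral_le_integral_norm _).trans ?_
      simp_rw [norm_mul]
      exact integral_mul_le_sqrt hFc.norm hGc.norm (fun _ => norm_nonneg _) fun _ => norm_nonneg _
    rw [hInt, norm_mul, Complex.norm_real, Complex.norm_real, Real.norm_of_nonneg hTp.le,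
      Real.norm_of_nonneg (hnn _), mul_left_comm]
    gcongr
    exact h1.trans (mul_le_mul_of_nonneg_left h2 (Real.exp_pos _).le)
  have hsub := norm_mul_integral_gm_sub_le T₀ T (by linarith) hT (hFc.mul hGc)
  simp_rw [norm_mul (F _) (G _)] at hsub
  have := norm_sub_norm_le ((T₀ : ℂ) * ∫ t, F t * G t ∂gm T₀) (T * ∫ t, F t * G t ∂gm T)
  linarith

end Law

lemma integral_norm_sum_ch_neg_sq_le (Q : Finset ℕ) (X h T : ℝ) (hh : 0 < h) (hT : 0 < T) (hX : 0 < X)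
    (hhX : h ≤ X) (hQ : ∀ x ∈ Q, X ≤ (x : ℝ) ∧ (x : ℝ) ≤ 2 * X)
    (hsep : ∀ x ∈ Q, ∀ x' ∈ Q, x ≠ x' → h ≤ |(x : ℝ) - x'|) :
    ∫ t, ‖∑ x ∈ Q, ch (-t) (x + h / 2)‖ ^ 2 ∂gm T ≤ 24 * (1 + 3 * X / (h * T)) * Q.card := by
  have h1 := mean_value_separated Q (fun _ => 1) (fun x : ℕ => (x : ℝ) + h / 2) (3 * X) h T hh hT
    (fun x hx => ⟨by linarith [(hQ x hx).1], by linarith [(hQ x hx).2]⟩)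
    (fun x hx y hy hxy => by rw [add_sub_add_right_eq_sub]; exact hsep x hx y hy hxy)
  simp only [one_pow, Finset.sum_const, nsmul_eq_mul, mul_one, Complex.ofReal_one, one_mul] at h1
  refine le_trans (le_of_eq (integral_congr_ae (Filter.Eventually.of_forall fun t => ?_))) h1
  simp only
  rw [← Complex.norm_conj, map_sum]
  simp_rw [conj_ch, neg_neg]

lemma gm_real_abs_ge_le (T T₁ : ℝ) (hT : 0 < T) : (gm T).real {t | T₁ < |t|} ≤ 2 * Real.exp (4 - 4 * T₁ / T) := by
  have hv : ((Real.toNNReal (T ^ 2 / 2) : NNReal) : ℝ) = T ^ 2 / 2 := Real.coe_toNNReal _ (by positivity)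
  have hm : ∀ u : ℝ, ProbabilityTheory.mgf id (gm T) u = Real.exp (T ^ 2 / 2 * u ^ 2 / 2) := by
    intro u
    rw [ProbabilityTheory.mgf_gaussianReal (μ := 0) (v := Real.toNNReal (T ^ 2 / 2)) (by simp [gm]), hv, zero_mul, zero_add]
  have h1 := ProbabilityTheory.measure_ge_le_exp_mul_mgf (μ := gm T) (X := id) (t := 4 / T) T₁ (by positivity)
    (ProbabilityTheory.integrable_exp_mul_gaussianReal _)
  have h2 := ProbabilityTheory.measure_le_le_exp_mul_mgf (μ := gm T) (X := id) (t := -(4 / T)) (-T₁)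
    (by rw [neg_nonpos]; positivity) (ProbabilityTheory.integrable_exp_mul_gaussianReal _)
  rw [hm, ← Real.exp_add] at h1 h2
  have e : ∀ u, (u = 4 / T ∨ u = -(4 / T)) → T ^ 2 / 2 * u ^ 2 / 2 = 4 := by
    rintro u (rfl | rfl)
    · field_simp; norm_num
    · field_simp; norm_num
  rw [e _ (Or.inl rfl)] at h1
  rw [e _ (Or.inr rfl)] at h2
  have hsub : {t : ℝ | T₁ < |t|} ⊆ {t : ℝ | T₁ ≤ id t} ∪ {t : ℝ | id t ≤ -T₁} := by
    intro t (ht : T₁ < |t|)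
    rcases lt_abs.1 ht with h | h
    · exact Or.inl h.le
    · exact Or.inr (by show t ≤ -T₁; linarith)
  have e1 : -(4 / T) * T₁ + 4 = 4 - 4 * T₁ / T := by ring
  have e2 : -(-(4 / T)) * -T₁ + 4 = 4 - 4 * T₁ / T := by ring
  rw [e1] at h1
  rw [e2] at h2
  calc (gm T).real {t | T₁ < |t|} ≤ (gm T).real ({t : ℝ | T₁ ≤ id t} ∪ {t : ℝ | id t ≤ -T₁}) :=
        measureReal_mono hsub
    _ ≤ (gm T).real {t : ℝ | T₁ ≤ id t} + (gm T).real {t : ℝ | id t ≤ -T₁} := measureReal_union_le _ _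
    _ ≤ 2 * Real.exp (4 - 4 * T₁ / T) := by linarith

lemma mul_gm_real_le (T a : ℝ) (hT : 0 < T) (ha : 0 ≤ a) : T * (gm T).real {t | |t| ≤ a} ≤ 2 * a := by
  have h := gm_le T hT {t | |t| ≤ a}
  have hset : {t : ℝ | |t| ≤ a} = Set.Icc (-a) a := by ext t; exact abs_le (a := t)
  rw [Measure.smul_apply, hset, Real.volume_Icc, smul_eq_mul, ← ENNReal.ofReal_mul (by positivity)] at h
  have h2 : (gm T).real {t | |t| ≤ a} ≤ 1 / T * (a - -a) := by
    rw [hset, measureReal_def]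
    have h0 : 0 ≤ a - -a := by linarith
    exact ENNReal.toReal_le_of_le_ofReal (by positivity) h
  calc T * (gm T).real {t | |t| ≤ a} ≤ T * (1 / T * (a - -a)) := by gcongr
    _ = 2 * a := by field_simp; ring

namespace Law

variable {A : Law} {lo hi : ℕ} {S Γ U : ℝ}

lemma Good.card_le_setIntegral (hA : A.Good lo hi S Γ U) (X h T T₀ T₁ : ℝ) (Q : Finset ℕ) (hX : 0 < X)
    (hh : 0 < h) (hhX : h ≤ X) (hT₀ : 1 ≤ T₀) (hT : T₀ ≤ T) (hTX : T ≤ X) (hThX : X ≤ h * T)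
    (hU : 4 * S * T₀ * U ≤ X) (hQ : ∀ x ∈ Q, X ≤ (x : ℝ) ∧ (x : ℝ) ≤ 2 * X)
    (hsep : ∀ x ∈ Q, ∀ x' ∈ Q, x ≠ x' → h ≤ |(x : ℝ) - x'|)
    (hbad : ∀ x ∈ Q, ∀ i, ∀ m ∈ Finset.Ioc ⌊X / (2 * S) / A.y i⌋₊ ⌊16 * S * (X / (2 * S) / A.y i)⌋₊,
      x < A.s i * m → (x : ℝ) + h < A.s i * m) :
    (Q.card : ℝ) ≤ Real.exp (-((T * h / X) ^ 2 / (2048 * S ^ 2))) * (1200 * Real.sqrt (S ^ 3 * Γ * T * Q.card)) +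
      (32 * S / Real.sqrt T₀ + 32 * S * T * Real.exp (4 - 4 * T₁ / T)) * Q.card +
      T * ∫ t in {t | Real.sqrt T₀ < |t| ∧ |t| ≤ T₁},
        ‖A.R (16 * S) (X / (2 * S)) t‖ * ‖∑ x ∈ Q, ch (-t) (x + h / 2)‖ ∂gm T := by
  have hS := hA.one_le_S
  have hΓ := hA.one_le_Γ
  have hY : 0 < X / (2 * S) := by positivity
  have hTp : 0 < T := by linarith
  have hT₀p : 0 < T₀ := by linarith
  have hmain := hA.card_le X h T T₀ Q hX hh hhX hT₀ hT hU hQ hbad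
  set F : ℝ → ℂ := A.R (16 * S) (X / (2 * S)) with hF
  have hFc : CB F := A.CB_R _ _
  set G : ℝ → ℂ := fun t => ∑ x ∈ Q, ch (-t) (x + h / 2) with hG
  have hGc : CB G := CB.sum _ fun x _ => CB.ch_neg _
  have hF1 : ∀ t, ‖F t‖ ≤ 16 * S := fun t => hA.norm_R_le _ _ t (by positivity) hY
  have hG1 : ∀ t, ‖G t‖ ≤ Q.card := by
    intro t
    refine (norm_sum_le _ _).trans ?_
    simp [norm_ch]
  set q : ℝ := (Q.card : ℝ) with hq
  have hq0 : 0 ≤ q := Nat.cast_nonneg _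
  have hs2 : 0 < Real.sqrt 2 := by positivity
  have hs2le : Real.sqrt 2 ≤ 3 / 2 := by
    rw [Real.sqrt_le_left (by norm_num)]; norm_num
  have hfirst : T * Real.sqrt ((∫ t, ‖F t‖ ^ 2 ∂gm (T / Real.sqrt 2)) * ∫ t, ‖G t‖ ^ 2 ∂gm (T / Real.sqrt 2)) ≤
      1200 * Real.sqrt (S ^ 3 * Γ * T * q) := by
    have h1 := hA.mean_value (16 * S) (X / (2 * S)) (T / Real.sqrt 2) (by linarith) hY (by positivity)
    have h2 := integral_norm_sum_ch_neg_sq_le Q X h (T / Real.sqrt 2) hh (by positivity) hX hhX hQ hsep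
    have h1' : ∫ t, ‖F t‖ ^ 2 ∂gm (T / Real.sqrt 2) ≤ 9984 * S ^ 3 * Γ / T := by
      refine h1.trans ?_
      have e1 : 1 / (X / (2 * S)) ≤ 2 * S ^ 2 / T := by
        rw [one_div_div, div_le_div_iff₀ hX hTp]
        calc 2 * S * T ≤ 2 * (S * S) * X := by
              have : S ≤ S * S := le_mul_of_one_le_left (by linarith) hS
              gcongr
          _ = _ := by ring
      have e2 : 16 * S * S / (T / Real.sqrt 2) ≤ 24 * S ^ 2 / T := by
        rw [div_div_eq_mul_div]
        apply div_le_div_of_nonneg_right _ hTp.le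
        calc 16 * S * S * Real.sqrt 2 ≤ 16 * S * S * (3 / 2) := by gcongr
          _ = _ := by ring
      calc 24 * (16 * S) * Γ * (1 / (X / (2 * S)) + 16 * S * S / (T / Real.sqrt 2))
          ≤ 24 * (16 * S) * Γ * (2 * S ^ 2 / T + 24 * S ^ 2 / T) := by gcongr
        _ = 9984 * S ^ 3 * Γ / T := by ring
    have h2' : ∫ t, ‖G t‖ ^ 2 ∂gm (T / Real.sqrt 2) ≤ 132 * q := by
      refine h2.trans ?_
      have e1 : 3 * X / (h * (T / Real.sqrt 2)) ≤ 9 / 2 := by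
        rw [div_le_iff₀ (by positivity)]
        have : 9 / 2 * (h * (T / Real.sqrt 2)) = 3 * (h * T) * (3 / 2 / Real.sqrt 2) := by ring
        rw [this]
        have h3 : 1 ≤ 3 / 2 / Real.sqrt 2 := by rw [le_div_iff₀ hs2]; linarith
        calc 3 * X ≤ 3 * (h * T) * 1 := by linarith
          _ ≤ _ := by gcongr
      calc 24 * (1 + 3 * X / (h * (T / Real.sqrt 2))) * q ≤ 24 * (1 + 9 / 2) * q := by gcongr
        _ = 132 * q := by ring
    have h0 : 0 ≤ ∫ t, ‖G t‖ ^ 2 ∂gm (T / Real.sqrt 2) := integral_nonneg fun _ => by positivity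
    calc T * Real.sqrt ((∫ t, ‖F t‖ ^ 2 ∂gm (T / Real.sqrt 2)) * ∫ t, ‖G t‖ ^ 2 ∂gm (T / Real.sqrt 2))
        ≤ T * Real.sqrt ((9984 * S ^ 3 * Γ / T) * (132 * q)) := by gcongr
      _ = Real.sqrt (T ^ 2) * Real.sqrt ((9984 * S ^ 3 * Γ / T) * (132 * q)) := by
          rw [Real.sqrt_sq hTp.le]
      _ = Real.sqrt (1317888 * (S ^ 3 * Γ * T * q)) := by
          rw [← Real.sqrt_mul (by positivity)]; congr 1; field_simp; ring
      _ ≤ Real.sqrt (1200 ^ 2 * (S ^ 3 * Γ * T * q)) := by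
          apply Real.sqrt_le_sqrt
          have : 0 ≤ S ^ 3 * Γ * T * q := by positivity
          linarith
      _ = _ := by rw [Real.sqrt_mul (by positivity), Real.sqrt_sq (by norm_num)]
  have hexp : T ^ 2 * (h / (16 * S * X)) ^ 2 / 8 = (T * h / X) ^ 2 / (2048 * S ^ 2) := by
    field_simp; ring
  rw [hexp] at hmain
  set K : ℝ → ℝ := fun t => ‖F t‖ * ‖G t‖ * min 1 ((t / T₀) ^ 2) with hK
  have hmin0 : ∀ t, 0 ≤ min 1 ((t / T₀) ^ 2) := fun t => le_min zero_le_one (sq_nonneg _)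
  have hKc : CB K := (hFc.norm.mul hGc.norm).mul ⟨by fun_prop, 1, fun t => by
    rw [Real.norm_of_nonneg (hmin0 t)]; exact min_le_left _ _⟩
  have hK0 : ∀ t, 0 ≤ K t := fun t => by have := hmin0 t; positivity
  have hFG : ∀ t, ‖F t‖ * ‖G t‖ ≤ 16 * S * q := fun t =>
    mul_le_mul (hF1 t) (hG1 t) (norm_nonneg _) (by positivity)
  have hm1 : MeasurableSet {t : ℝ | |t| ≤ Real.sqrt T₀} := measurableSet_le (by fun_prop) measurable_const
  have hm2 : MeasurableSet {t : ℝ | T₁ < |t|} := measurableSet_lt measurable_const (by fun_prop)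
  have hm3 : MeasurableSet {t : ℝ | Real.sqrt T₀ < |t| ∧ |t| ≤ T₁} :=
    MeasurableSet.inter (s₁ := {t : ℝ | Real.sqrt T₀ < |t|}) (s₂ := {t : ℝ | |t| ≤ T₁})
      (measurableSet_lt measurable_const (by fun_prop)) (measurableSet_le (by fun_prop) measurable_const)
  have hsplit := setIntegral_le_sum_of_cover (μ := gm T) hKc hK0 Set.univ MeasurableSet.univ
    (Finset.univ : Finset (Fin 3)) ![{t | |t| ≤ Real.sqrt T₀}, {t | T₁ < |t|}, {t | Real.sqrt T₀ < |t| ∧ |t| ≤ T₁}]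
    (fun i _ => by fin_cases i <;> assumption) (fun t _ => by
      by_cases h1 : |t| ≤ Real.sqrt T₀
      · exact ⟨0, Finset.mem_univ _, h1⟩
      by_cases h2 : T₁ < |t|
      · exact ⟨1, Finset.mem_univ _, h2⟩
      · exact ⟨2, Finset.mem_univ _, not_le.1 h1, not_lt.1 h2⟩)
  rw [Fin.sum_univ_three, setIntegral_univ] at hsplit
  simp only [Matrix.cons_val_zero, Matrix.cons_val_one, Matrix.cons_val] at hsplit
  have hI1 : T * ∫ t in {t | |t| ≤ Real.sqrt T₀}, K t ∂gm T ≤ 32 * S / Real.sqrt T₀ * q := by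
    have hb : ∫ t in {t | |t| ≤ Real.sqrt T₀}, K t ∂gm T ≤
        ∫ t in {t | |t| ≤ Real.sqrt T₀}, 16 * S * q * (1 / T₀) ∂gm T := by
      refine setIntegral_mono_on hKc.integrable (CB.const _).integrable hm1 fun t ht => ?_
      refine mul_le_mul (hFG t) ((min_le_right _ _).trans ?_) (hmin0 t) (by positivity)
      rw [div_pow, ← sq_abs t, div_le_div_iff₀ (by positivity) hT₀p]
      have : |t| ^ 2 ≤ T₀ := by
        rw [← Real.sq_sqrt hT₀p.le]; exact pow_le_pow_left₀ (abs_nonneg _) ht 2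
      calc |t| ^ 2 * T₀ ≤ T₀ * T₀ := by gcongr
        _ = 1 * T₀ ^ 2 := by ring
    rw [setIntegral_const, smul_eq_mul] at hb
    have hg := mul_gm_real_le T (Real.sqrt T₀) hTp (Real.sqrt_nonneg _)
    calc T * ∫ t in {t | |t| ≤ Real.sqrt T₀}, K t ∂gm T
        ≤ T * ((gm T).real {t | |t| ≤ Real.sqrt T₀} * (16 * S * q * (1 / T₀))) := by gcongr
      _ = T * (gm T).real {t | |t| ≤ Real.sqrt T₀} * (16 * S * q * (1 / T₀)) := by ring
      _ ≤ 2 * Real.sqrt T₀ * (16 * S * q * (1 / T₀)) := by gcongr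
      _ = 32 * S * q * (Real.sqrt T₀ / T₀) := by ring
      _ = _ := by rw [Real.sqrt_div_self']; ring
  have hI2 : T * ∫ t in {t | T₁ < |t|}, K t ∂gm T ≤ 32 * S * T * Real.exp (4 - 4 * T₁ / T) * q := by
    have hb : ∫ t in {t | T₁ < |t|}, K t ∂gm T ≤ ∫ t in {t | T₁ < |t|}, 16 * S * q * 1 ∂gm T :=
      setIntegral_mono_on hKc.integrable (CB.const _).integrable hm2 fun t _ =>
        mul_le_mul (hFG t) (min_le_left _ _) (hmin0 t) (by positivity)
    rw [setIntegral_const, smul_eq_mul] at hb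
    calc T * ∫ t in {t | T₁ < |t|}, K t ∂gm T
        ≤ T * ((gm T).real {t | T₁ < |t|} * (16 * S * q * 1)) := by gcongr
      _ ≤ T * ((2 * Real.exp (4 - 4 * T₁ / T)) * (16 * S * q * 1)) := by
          gcongr; exact gm_real_abs_ge_le T T₁ hTp
      _ = _ := by ring
  have hI3 : ∫ t in {t | Real.sqrt T₀ < |t| ∧ |t| ≤ T₁}, K t ∂gm T ≤
      ∫ t in {t | Real.sqrt T₀ < |t| ∧ |t| ≤ T₁}, ‖F t‖ * ‖G t‖ ∂gm T :=
    setIntegral_mono_on hKc.integrable (hFc.norm.mul hGc.norm).integrable hm3 fun t _ =>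
      mul_le_of_le_one_right (by positivity) (min_le_left _ _)
  have hI : T * ∫ t, K t ∂gm T ≤ T * ∫ t in {t | |t| ≤ Real.sqrt T₀}, K t ∂gm T +
      T * ∫ t in {t | T₁ < |t|}, K t ∂gm T +
      T * ∫ t in {t | Real.sqrt T₀ < |t| ∧ |t| ≤ T₁}, ‖F t‖ * ‖G t‖ ∂gm T := by
    rw [← mul_add, ← mul_add]
    gcongr
    linarith
  have hE : Real.exp (-((T * h / X) ^ 2 / (2048 * S ^ 2))) *
      (T * Real.sqrt ((∫ t, ‖F t‖ ^ 2 ∂gm (T / Real.sqrt 2)) * ∫ t, ‖G t‖ ^ 2 ∂gm (T / Real.sqrt 2))) ≤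
      Real.exp (-((T * h / X) ^ 2 / (2048 * S ^ 2))) * (1200 * Real.sqrt (S ^ 3 * Γ * T * q)) := by gcongr
  linarith

end Law

lemma eventually_sum_prime_inv_ge : ∃ v₀ : ℕ, 1 ≤ v₀ ∧ ∀ v : ℕ, v₀ ≤ v →
    1 / (16 * (v : ℝ)) ≤ ∑ p ∈ (Finset.Ico (4 ^ v) (4 ^ (v + 1))).filter Nat.Prime, (1 / (p : ℝ)) := by
  have hev : ∀ᶠ x : ℝ in Filter.atTop, Real.log (x + 1) + 2 * √x * Real.log x ≤ x / 4 * Real.log 2 := by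
    have h1 := eventually_log_pow_le 1 1 (1/4 : ℝ) (by norm_num)
    have h2 := eventually_const_le 1000 (1/4 : ℝ) (by norm_num)
    filter_upwards [h1, h2, Filter.eventually_ge_atTop 2] with x hx1 hx2 hx
    have hx0 : (0:ℝ) ≤ x := by linarith
    have hl2 : 0.69 < Real.log 2 := by linarith [Real.log_two_gt_d9]
    have h5 : Real.log (x + 1) ≤ 2 * Real.log x := by
      rw [← Real.log_rpow (by linarith)]
      apply Real.log_le_log (by linarith)
      rw [Real.rpow_two]; nlinarith
    have hs : √x = x ^ (1/4:ℝ) * x ^ (1/4:ℝ) := by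
      rw [← Real.rpow_add (by linarith), Real.sqrt_eq_rpow]; norm_num
    have hs4 : x = √x * √x := (Real.mul_self_sqrt hx0).symm
    rw [pow_one, one_mul] at hx1
    have hs1 : 1 ≤ √x := by rw [Real.one_le_sqrt]; linarith
    have hq1 : 1000 ≤ x ^ (1/4:ℝ) := by linarith
    have hlog0 : 0 ≤ Real.log x := Real.log_nonneg (by linarith)
    calc Real.log (x + 1) + 2 * √x * Real.log x ≤ 2 * Real.log x + 2 * √x * Real.log x := by linarith
      _ ≤ 2 * (√x * Real.log x) + 2 * √x * Real.log x := by
          have : Real.log x ≤ √x * Real.log x := le_mul_of_one_le_left hlog0 hs1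
          linarith
      _ = √x * (4 * Real.log x) := by ring
      _ ≤ √x * (4 * x ^ (1/4:ℝ)) := by gcongr
      _ ≤ √x * (x ^ (1/4:ℝ) * x ^ (1/4:ℝ) / 4 * 0.69) := by
          apply mul_le_mul_of_nonneg_left _ (by positivity)
          nlinarith
      _ = √x * √x / 4 * 0.69 := by rw [hs]; ring
      _ = x / 4 * 0.69 := by rw [← hs4]
      _ ≤ x / 4 * Real.log 2 := by gcongr
  have htend : Filter.Tendsto (fun v : ℕ => (4 : ℝ) ^ (v + 1)) Filter.atTop Filter.atTop :=
    (tendsto_pow_atTop_atTop_of_one_lt (by norm_num)).comp (Filter.tendsto_add_atTop_nat 1)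
  obtain ⟨v₁, hv₁⟩ := Filter.eventually_atTop.1 (htend.eventually hev)
  refine ⟨max v₁ 1, le_max_right _ _, fun v hv => ?_⟩
  have hv1 : 1 ≤ v := (le_max_right _ _).trans hv
  have hb := hv₁ v ((le_max_left _ _).trans hv)
  have hθ1 := Chebyshev.theta_ge (4 ^ (v + 1))
  have hθ2 := Chebyshev.theta_le_log4_mul_x (x := ((4 ^ v : ℕ) : ℝ)) (by positivity)
  have hl4 : Real.log 4 = 2 * Real.log 2 := by
    rw [show (4 : ℝ) = 2 ^ 2 by norm_num, Real.log_pow]; norm_num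
  have hl2 : 0 < Real.log 2 := Real.log_pos (by norm_num)
  push_cast at hθ1 hθ2
  have hdiff : (4 : ℝ) ^ v * Real.log 2 ≤ Chebyshev.theta ((4:ℝ) ^ (v + 1)) - Chebyshev.theta ((4:ℝ) ^ v) := by
    have e : (4:ℝ) ^ (v + 1) = 4 * 4 ^ v := by ring
    rw [hl4] at hθ2
    rw [e] at hθ1 hb ⊢
    linarith
  set P := (Finset.Ico (4 ^ v) (4 ^ (v + 1))).filter Nat.Prime with hP
  have hnp : ∀ k, 1 ≤ k → ¬ (4 ^ k).Prime := by
    intro k hk hp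
    have h1 : (4 : ℕ) ^ k = 2 ^ (2 * k) := by rw [pow_mul]; norm_num
    rw [h1] at hp
    have := hp.eq_one_of_pow
    omega
  have hsum : Chebyshev.theta ((4:ℝ) ^ (v + 1)) - Chebyshev.theta ((4:ℝ) ^ v) ≤ ∑ p ∈ P, Real.log p := by
    have e1 := Chebyshev.theta_eq_sum_Icc ((4:ℝ) ^ (v + 1))
    have e2 := Chebyshev.theta_eq_sum_Icc ((4:ℝ) ^ v)
    rw [show (4:ℝ) ^ (v+1) = ((4 ^ (v+1) : ℕ) : ℝ) by push_cast; rfl, Nat.floor_natCast] at e1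
    rw [show (4:ℝ) ^ v = ((4 ^ v : ℕ) : ℝ) by push_cast; rfl, Nat.floor_natCast] at e2
    push_cast at e1 e2
    rw [e1, e2, sub_le_iff_le_add, ← Finset.sum_union]
    · apply Finset.sum_le_sum_of_subset_of_nonneg
      · intro p hp
        rw [Finset.mem_filter, Finset.mem_Icc] at hp
        rw [Finset.mem_union, hP, Finset.mem_filter, Finset.mem_Ico, Finset.mem_filter, Finset.mem_Icc]
        have : p ≠ 4 ^ (v + 1) := fun h => hnp (v + 1) (by omega) (h ▸ hp.2)
        by_cases hpv : p ≤ 4 ^ v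
        · exact Or.inr ⟨⟨hp.1.1, hpv⟩, hp.2⟩
        · exact Or.inl ⟨⟨by omega, by omega⟩, hp.2⟩
      · intro p _ _
        exact Real.log_natCast_nonneg p
    · rw [Finset.disjoint_left]
      intro p hp hp'
      rw [hP, Finset.mem_filter, Finset.mem_Ico] at hp
      rw [Finset.mem_filter, Finset.mem_Icc] at hp'
      have : p = 4 ^ v := le_antisymm hp'.1.2 hp.1.1
      exact hnp v hv1 (this ▸ hp.2)
  have hterm : ∀ p ∈ P, Real.log p ≤ (4 * 4 ^ v * (4 * v * Real.log 2)) * (1 / (p : ℝ)) := by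
    intro p hp
    rw [hP, Finset.mem_filter, Finset.mem_Ico] at hp
    have hp0 : (0:ℝ) < p := by exact_mod_cast hp.2.pos
    have hp1 : (p : ℝ) ≤ 4 * 4 ^ v := by
      have : (p : ℝ) ≤ ((4 ^ (v+1) : ℕ) : ℝ) := by exact_mod_cast hp.1.2.le
      push_cast at this
      linarith [show (4:ℝ) ^ (v + 1) = 4 * 4 ^ v by ring]
    have hlog : Real.log p ≤ 4 * v * Real.log 2 := by
      have hv1' : (1:ℝ) ≤ v := by exact_mod_cast hv1
      calc Real.log p ≤ Real.log (4 * 4 ^ v) := Real.log_le_log hp0 hp1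
        _ = Real.log (4 ^ (v + 1)) := by congr 1; ring
        _ = (v + 1) * (2 * Real.log 2) := by rw [Real.log_pow, hl4]; push_cast; ring
        _ ≤ (v + v) * (2 * Real.log 2) := by gcongr
        _ = _ := by ring
    rw [mul_one_div, le_div_iff₀ hp0, mul_comm]
    exact mul_le_mul hp1 hlog (Real.log_natCast_nonneg p) (by positivity)
  have hfin := hdiff.trans (hsum.trans (Finset.sum_le_sum hterm))
  rw [← Finset.mul_sum] at hfin
  have hv0 : (0:ℝ) < v := by exact_mod_cast hv1
  have h4 : (0:ℝ) < 4 ^ v := by positivity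
  rw [div_le_iff₀ (by positivity)]
  have : (4:ℝ) ^ v * Real.log 2 * 1 ≤ 4 ^ v * Real.log 2 * ((∑ p ∈ P, (1 / (p:ℝ))) * (16 * v)) := by
    linarith
  exact le_of_mul_le_mul_left this (by positivity)

namespace Law

lemma PrimeLaw.mono {A : Law} {lo hi lo' hi' : ℕ} {S M U S' M' U' : ℝ} (h : PrimeLaw A lo hi S M U)
    (hlo : lo' ≤ lo) (hhi : hi ≤ hi') (hS : S ≤ S') (hM : M ≤ M') (hU : U ≤ U') :
    PrimeLaw A lo' hi' S' M' U' where
  w_nonneg := h.w_nonneg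
  w_sum := h.w_sum
  y_pos := h.y_pos
  y_le := h.y_le
  s_le i := (h.s_le i).trans (mul_le_mul_of_nonneg_right hS (h.y_pos i).le)
  y_le_U i := (h.y_le_U i).trans hU
  prime := h.prime
  range i := ⟨hlo.trans (h.range i).1, (h.range i).2.trans_le hhi⟩
  inj := h.inj
  w_mul_le i := (h.w_mul_le i).trans hM

/-- A law supported on primes in `[4 ^ v, 4 ^ (v + 1))` with constant size `y` in that interval. -/
structure IsBlock (A : Law) (S M : ℝ) (v : ℕ) (y : ℝ) : Prop where
  le_y : (4 : ℝ) ^ v ≤ y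
  y_lt : y < (4 : ℝ) ^ (v + 1)
  y_eq : ∀ i, A.y i = y
  primeLaw : PrimeLaw A (4 ^ v) (4 ^ (v + 1)) S M (4 ^ (v + 1))

lemma exists_isBlock_four : ∃ v₀ : ℕ, 1 ≤ v₀ ∧ ∀ v : ℕ, v₀ ≤ v → ∃ A : Law, IsBlock A 4 (16 * v) v (4 ^ v) := by
  obtain ⟨v₀, hv₀, h⟩ := eventually_sum_prime_inv_ge
  refine ⟨v₀, hv₀, fun v hv => ?_⟩
  have hs := h v hv
  set P := (Finset.Ico (4 ^ v) (4 ^ (v + 1))).filter Nat.Prime with hP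
  have hv0 : (0:ℝ) < v := by exact_mod_cast (hv₀.trans hv)
  have hpos : 0 < ∑ p ∈ P, (1 / (p : ℝ)) := lt_of_lt_of_le (by positivity) hs
  have hne : P.Nonempty := by
    by_contra hne
    rw [Finset.not_nonempty_iff_eq_empty] at hne
    rw [hne, Finset.sum_empty] at hpos
    exact lt_irrefl _ hpos
  have hmem : ∀ p ∈ P, (4 ^ v ≤ p ∧ p < 4 ^ (v + 1)) ∧ p.Prime := by
    intro p hp
    rwa [hP, Finset.mem_filter, Finset.mem_Ico] at hp
  refine ⟨Law.blk P (4 ^ v), le_rfl, by gcongr <;> norm_num, fun _ => rfl, ?_⟩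
  refine (PrimeLaw.blk P (4 ^ v) 4 (4 ^ v) (4 ^ (v + 1)) hne (fun p hp => (hmem p hp).2) (by positivity)
    (fun p hp => ⟨by exact_mod_cast (hmem p hp).1.1, ?_⟩) fun p hp => (hmem p hp).1).mono le_rfl le_rfl le_rfl ?_ ?_
  · have : (p : ℝ) ≤ ((4 ^ (v + 1) : ℕ) : ℝ) := by exact_mod_cast (hmem p hp).1.2.le
    push_cast at this
    linarith [show (4:ℝ) ^ (v + 1) = 4 * 4 ^ v by ring]
  · rw [div_le_iff₀ hpos]
    calc (1:ℝ) = 16 * v * (1 / (16 * v)) := by field_simp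
      _ ≤ _ := by gcongr
  · gcongr <;> norm_num

lemma exists_isBlock : ∃ v₀ : ℕ, 1 ≤ v₀ ∧ ∀ j v : ℕ, v₀ ≤ v → ∃ A : Law, ∃ y : ℝ,
    IsBlock A (2 ^ ((1 / 2 : ℝ) ^ j)) (32 * 2 ^ j * v) v y := by
  obtain ⟨v₀, hv₀, h⟩ := eventually_sum_prime_inv_ge
  refine ⟨v₀, hv₀, fun j v hv => ?_⟩
  have hs := h v hv
  set P := (Finset.Ico (4 ^ v) (4 ^ (v + 1))).filter Nat.Prime with hP
  have hv0 : (0:ℝ) < v := by exact_mod_cast (hv₀.trans hv)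
  have hmem : ∀ p ∈ P, (4 ^ v ≤ p ∧ p < 4 ^ (v + 1)) ∧ p.Prime := by
    intro p hp
    rwa [hP, Finset.mem_filter, Finset.mem_Ico] at hp
  set ρ : ℝ := 2 ^ ((1 / 2 : ℝ) ^ j) with hρ
  have hρ1 : 1 < ρ := Real.one_lt_rpow (by norm_num) (by positivity)
  have hρ4 : ρ ^ (2 ^ (j + 1)) = 4 := by
    rw [hρ, ← Real.rpow_natCast, ← Real.rpow_mul (by norm_num)]
    have : (1 / 2 : ℝ) ^ j * ((2 ^ (j + 1) : ℕ) : ℝ) = 2 := by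
      push_cast; rw [pow_succ, ← mul_assoc, ← mul_pow]; norm_num
    rw [this]; norm_num
  set N := 2 ^ (j + 1) with hN
  have hN0 : 0 < N := by positivity
  -- the cells of ratio `ρ`
  set cell : ℕ → Finset ℕ := fun k => P.filter fun p : ℕ => 4 ^ v * ρ ^ k ≤ (p : ℝ) ∧ (p : ℝ) < 4 ^ v * ρ ^ (k + 1) with hcell
  have hcov : ∀ p ∈ P, ∃ k ∈ Finset.range N, p ∈ cell k := by
    intro p hp
    by_contra hcon
    push Not at hcon
    have hind : ∀ k ≤ N, 4 ^ v * ρ ^ k ≤ (p : ℝ) := by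
      intro k
      induction k with
      | zero => intro _; simpa using (by exact_mod_cast (hmem p hp).1.1 : (4:ℝ) ^ v ≤ p)
      | succ k ih =>
        intro hk
        have h1 := ih (by omega)
        have h2 := hcon k (Finset.mem_range.2 (by omega))
        rw [hcell, Finset.mem_filter] at h2
        by_contra h3
        exact h2 ⟨hp, h1, not_le.1 h3⟩
    have h1 := hind N le_rfl
    rw [hρ4] at h1
    have : (p : ℝ) < ((4 ^ (v + 1) : ℕ) : ℝ) := by exact_mod_cast (hmem p hp).1.2
    push_cast at this
    linarith [show (4:ℝ) ^ (v + 1) = 4 ^ v * 4 by ring]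
  have hle : ∑ p ∈ P, (1 / (p : ℝ)) ≤ ∑ k ∈ Finset.range N, ∑ p ∈ cell k, (1 / (p : ℝ)) := by
    have hswap : ∑ k ∈ Finset.range N, ∑ p ∈ cell k, (1 / (p : ℝ)) =
        ∑ p ∈ P, ∑ k ∈ (Finset.range N).filter (fun k => p ∈ cell k), (1 / (p : ℝ)) := by
      apply Finset.sum_comm'
      intro k p
      exact ⟨fun h => ⟨Finset.mem_filter.2 h, (Finset.mem_filter.1 h.2).1⟩, fun h => Finset.mem_filter.1 h.1⟩
    rw [hswap]
    refine Finset.sum_le_sum fun p hp => ?_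
    obtain ⟨k, hk, hpk⟩ := hcov p hp
    exact Finset.single_le_sum (f := fun _ : ℕ => (1 / (p : ℝ))) (fun _ _ => by positivity)
      (Finset.mem_filter.2 ⟨hk, hpk⟩)
  have hpig : ∃ k ∈ Finset.range N, 1 / (32 * 2 ^ j * (v : ℝ)) ≤ ∑ p ∈ cell k, (1 / (p : ℝ)) := by
    apply Finset.exists_le_of_sum_le (Finset.nonempty_range_iff.2 hN0.ne')
    rw [Finset.sum_const, Finset.card_range, nsmul_eq_mul]
    refine le_trans (le_of_eq ?_) (hs.trans hle)
    rw [hN]; push_cast; field_simp; ring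
  obtain ⟨k, hk, hsum⟩ := hpig
  have hpos : 0 < ∑ p ∈ cell k, (1 / (p : ℝ)) := lt_of_lt_of_le (by positivity) hsum
  have hne : (cell k).Nonempty := by
    by_contra hne
    rw [Finset.not_nonempty_iff_eq_empty] at hne
    rw [hne, Finset.sum_empty] at hpos
    exact lt_irrefl _ hpos
  have hcm : ∀ p ∈ cell k, p ∈ P ∧ 4 ^ v * ρ ^ k ≤ (p : ℝ) ∧ (p : ℝ) < 4 ^ v * ρ ^ (k + 1) := fun p hp => by
    rwa [hcell, Finset.mem_filter] at hp
  have hy1 : (4:ℝ) ^ v ≤ 4 ^ v * ρ ^ k := le_mul_of_one_le_right (by positivity) (one_le_pow₀ hρ1.le)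
  have hy2 : (4:ℝ) ^ v * ρ ^ k < 4 ^ (v + 1) := by
    rw [pow_succ, ← hρ4]
    have := pow_lt_pow_right₀ hρ1 (Finset.mem_range.1 hk)
    gcongr
  refine ⟨Law.blk (cell k) (4 ^ v * ρ ^ k), 4 ^ v * ρ ^ k, hy1, hy2, fun _ => rfl, ?_⟩
  refine (PrimeLaw.blk (cell k) (4 ^ v * ρ ^ k) ρ (4 ^ v) (4 ^ (v + 1)) hne
    (fun p hp => (hmem p (hcm p hp).1).2) (by positivity)
    (fun p hp => ⟨(hcm p hp).2.1, (hcm p hp).2.2.le.trans (le_of_eq (by ring))⟩)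
    fun p hp => (hmem p (hcm p hp).1).1).mono le_rfl le_rfl le_rfl ?_ hy2.le
  rw [div_le_iff₀ hpos]
  calc (1:ℝ) = 32 * 2 ^ j * v * (1 / (32 * 2 ^ j * v)) := by field_simp
    _ ≤ _ := by gcongr

/-- The mixture of blocks with weights proportional to `1 / v`. -/
noncomputable def invMix (V : Finset ℕ) (B : ℕ → Law) : Law :=
  mix V (fun v => (1 / (v : ℝ)) / ∑ u ∈ V, (1 / (u : ℝ))) B

lemma invMix_primeLaw (V : Finset ℕ) (B : ℕ → Law) (y : ℕ → ℝ) (S C : ℝ) (a b : ℕ) (ha : 1 ≤ a)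
    (hV : V.Nonempty) (hab : ∀ v ∈ V, a ≤ v ∧ v ≤ b) (hB : ∀ v ∈ V, IsBlock (B v) S (C * v) v (y v)) :
    PrimeLaw (invMix V B) (4 ^ a) (4 ^ (b + 1)) S (C / ∑ u ∈ V, (1 / (u : ℝ))) (4 ^ (b + 1)) := by
  have hpos : 0 < ∑ u ∈ V, (1 / (u : ℝ)) :=
    Finset.sum_pos (fun u hu => by
      have : 0 < u := by have := (hab u hu).1; omega
      positivity) hV
  refine PrimeLaw.mix V _ B (fun v => 4 ^ v) (fun v => 4 ^ (v + 1)) S _ _ (fun v => C * v)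
    (fun v _ => by positivity) ?_
    (fun v hv => (hB v hv).primeLaw.mono le_rfl le_rfl le_rfl le_rfl ?_) ?_ ?_ ?_
  · rw [← Finset.sum_div, div_self hpos.ne']
  · exact pow_le_pow_right₀ (by norm_num) (by have := (hab v hv).2; omega)
  · intro v hv
    have : (0:ℝ) < v := by exact_mod_cast (lt_of_lt_of_le ha (hab v hv).1)
    refine le_of_eq ?_
    field_simp
  · intro v _ v' _ hvv
    exact pow_le_pow_right₀ (by norm_num) hvv
  · intro v hv
    exact ⟨pow_le_pow_right₀ (by norm_num) (hab v hv).1,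
      pow_le_pow_right₀ (by norm_num) (by have := (hab v hv).2; omega)⟩

end Law

namespace Law

lemma setIntegral_R_mix_prod_le (V : Finset ℕ) (W : ℕ → ℝ) (A : ℕ → Law) (B : Law) (κ Y : ℝ) (y : ℕ → ℝ)
    (hW : ∀ v ∈ V, 0 ≤ W v)
    (hA : ∀ v ∈ V, ∀ i, (A v).s i ≠ 0) (hB : ∀ i, B.s i ≠ 0) (hy : ∀ v ∈ V, ∀ i, (A v).y i = y v)
    {μ : Measure ℝ} [IsFiniteMeasure μ] (g : ℝ → ℝ) (hg : CB g) (hg0 : ∀ t, 0 ≤ g t) (E : Set ℝ) :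
    ∫ t in E, ‖((mix V W A).prod B).R κ Y t‖ * g t ∂μ ≤
      ∑ v ∈ V, W v * ∫ t in E, ‖B.R κ (Y / y v) t‖ * (‖(A v).poly t‖ * g t) ∂μ := by
  have hc : ∀ v, CB fun t => ‖B.R κ (Y / y v) t‖ * (‖(A v).poly t‖ * g t) := fun v =>
    (B.CB_R _ _).norm.mul ((A v).CB_poly.norm.mul hg)
  have e : ∑ v ∈ V, W v * ∫ t in E, ‖B.R κ (Y / y v) t‖ * (‖(A v).poly t‖ * g t) ∂μ =
      ∫ t in E, ∑ v ∈ V, W v * (‖B.R κ (Y / y v) t‖ * (‖(A v).poly t‖ * g t)) ∂μ := by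
    rw [integral_finsetSum _ fun v _ => (hc v).integrable.const_mul (W v)]
    exact Finset.sum_congr rfl fun v _ => (integral_const_mul _ _).symm
  rw [e]
  refine integral_mono (((Law.CB_R _ _ _).norm.mul hg).integrable)
    (integrable_finsetSum _ fun v _ => (hc v).integrable.const_mul (W v)) fun t => ?_
  simp only
  rw [R_mix_prod V W A B κ Y t y hA hB hy]
  calc ‖∑ v ∈ V, (W v : ℂ) * ((A v).poly t * B.R κ (Y / y v) t)‖ * g t
      ≤ (∑ v ∈ V, ‖(W v : ℂ) * ((A v).poly t * B.R κ (Y / y v) t)‖) * g t :=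
        mul_le_mul_of_nonneg_right (norm_sum_le _ _) (hg0 t)
    _ = ∑ v ∈ V, W v * (‖B.R κ (Y / y v) t‖ * (‖(A v).poly t‖ * g t)) := by
        rw [Finset.sum_mul]
        refine Finset.sum_congr rfl fun v hv => ?_
        rw [norm_mul, norm_mul, Complex.norm_real, Real.norm_of_nonneg (hW v hv)]
        ring

lemma setIntegral_R_pow_mix_le (V : Finset ℕ) (W : ℕ → ℝ) (A : ℕ → Law) (κ : ℝ) (y : ℕ → ℝ)
    (hW : ∀ v ∈ V, 0 ≤ W v) (hW1 : ∑ v ∈ V, W v = 1)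
    (hA : ∀ v ∈ V, ∀ i, (A v).s i ≠ 0) (hy : ∀ v ∈ V, ∀ i, (A v).y i = y v)
    {μ : Measure ℝ} [IsFiniteMeasure μ] (E : Set ℝ) (C : ℝ) (n : ℕ) : ∀ (Y : ℝ)
    (g : ℝ → ℝ), CB g → (∀ t, 0 ≤ g t) →
    (∀ L : List ℕ, L.length = n → (∀ v ∈ L, v ∈ V) →
      ∫ t in E, (L.map fun v => ‖(A v).poly t‖).prod * ‖dz κ (Y / (L.map y).prod) t‖ * g t ∂μ ≤ C) →
    ∫ t in E, ‖((mix V W A).pow n).R κ Y t‖ * g t ∂μ ≤ C := by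
  have hmix : ∀ i, (mix V W A).s i ≠ 0 := fun i : Σ v : V, (A v).ι => hA _ i.1.2 i.2
  induction n with
  | zero =>
    intro Y g hg hg0 h
    have := h [] rfl (by simp)
    simp only [List.map_nil, List.prod_nil, one_mul, div_one] at this
    refine le_trans (le_of_eq ?_) this
    refine integral_congr_ae (Filter.Eventually.of_forall fun t => ?_)
    show ‖one.R κ Y t‖ * g t = _
    rw [R_one]
  | succ n ih =>
    intro Y g hg hg0 h
    refine (setIntegral_R_mix_prod_le V W A ((mix V W A).pow n) κ Y y hW hA
      (pow_s_ne_zero _ hmix n) hy g hg hg0 E).trans ?_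
    calc ∑ v ∈ V, W v * ∫ t in E, ‖((mix V W A).pow n).R κ (Y / y v) t‖ * (‖(A v).poly t‖ * g t) ∂μ
        ≤ ∑ v ∈ V, W v * C := by
          refine Finset.sum_le_sum fun v hv => mul_le_mul_of_nonneg_left ?_ (hW v hv)
          refine ih (Y / y v) _ ((A v).CB_poly.norm.mul hg) (fun t => mul_nonneg (norm_nonneg _) (hg0 t)) ?_
          intro L hL hLV
          have := h (v :: L) (by simp [hL]) (by simpa using ⟨hv, hLV⟩)
          refine le_trans (le_of_eq ?_) this
          refine integral_congr_ae (Filter.Eventually.of_forall fun t => ?_)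
          simp only [List.map_cons, List.prod_cons]
          rw [div_div]
          ring
      _ = C := by rw [← Finset.sum_mul, hW1, one_mul]

/-- The estimate for products of block polynomials and one smooth sum on a set where one block
polynomial is large. -/
lemma eventually_setIntegral_prod_le (η s Cm δ q : ℝ) (N : ℕ) (hη : 0 < η) (hs : 0 < s) (hCm : 0 ≤ Cm)
    (hδ : 0 ≤ δ) (hq : 0 < q) (hN : N * δ ≤ 1 / 4) :
    ∀ᶠ X : ℝ in Filter.atTop, ∀ (V : Finset ℕ) (A : ℕ → Law) (y : ℕ → ℝ) (T T₁ τ c ρ ω R κ Z : ℝ)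
      (E : Set ℝ) (G : ℝ → ℂ) (v₀ : ℕ) (L : List ℕ),
      (V.card : ℝ) ≤ Real.log X →
      (∀ v ∈ V, ∃ (lo hi : ℕ) (M U : ℝ), (A v).PrimeLaw lo hi 4 M U ∧ M ≤ Cm * Real.log X) →
      (∀ v ∈ V, ∀ i, (A v).y i = y v) → (∀ v ∈ V, X ^ (η / 2) ≤ y v ∧ y v ≤ X ^ (2 * η)) →
      0 < T → 1 ≤ T₁ → T₁ ≤ X ^ (τ + s) → 0 ≤ τ → τ ≤ 1 → MeasurableSet E → (∀ t ∈ E, |t| ≤ T₁) →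
      (∀ t ∈ E, ‖dz κ Z t‖ ≤ X ^ (-c)) → CB G → (∀ t, ‖G t‖ ≤ R) → 0 ≤ R →
      T * ∫ t, ‖G t‖ ^ 2 ∂gm T ≤ R ^ 2 * X ^ ω →
      v₀ ∈ V → (∀ t ∈ E, y v₀ ^ (-(N * δ)) < ‖(A v₀).poly t‖) →
      (∀ v ∈ L, v ∈ V) → 0 ≤ ρ → X ^ ρ ≤ (L.map y).prod →
      (∀ g : ℕ, g < N →
        -(ρ * (g * δ)) - c + (τ * ((g + 1) * δ) / (1 - 2 * ((g + 1) * δ)) + 4 * s + η) ≤ -(2 * q) ∨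
        2 * (-(ρ * (g * δ)) - c) + (τ * ((g + 1) * δ) / (1 - 2 * ((g + 1) * δ)) + 4 * s + η) + ω ≤ -(4 * q)) →
      T * ∫ t in E, (L.map fun v => ‖(A v).poly t‖).prod * ‖dz κ Z t‖ * ‖G t‖ ∂gm T ≤ R * X ^ (-q) := by
  filter_upwards [PrimeLaw.eventually_large_values η s Cm hη hs hCm, eventually_log_pow_le N 1 q hq,
    Filter.eventually_ge_atTop 1] with X hX hXq hX1
  intro V A y T T₁ τ c ρ ω R κ Z E G v₀ L hcard hA hAy hy hT hT1 hT1' hτ0 hτ1 hE hET hD hG hG1 hR hG2 hv₀ h₀ hL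
    hρ hP hcond
  have hXp : 0 < X := by linarith
  have h := setIntegral_prod_le_of_large_values V (fun v => (A v).poly) y (fun v _ => (A v).CB_poly)
    (fun v hv t => by
      obtain ⟨lo, hi, M, U, h, -⟩ := hA v hv
      exact h.good.norm_poly_le t)
    (fun v hv => (Real.one_le_rpow hX1 (by positivity)).trans (hy v hv).1)
    (fun t => ‖dz κ Z t‖) (CB.dz κ Z).norm (fun _ => norm_nonneg _) G hG E hE T R (X ^ ω) (X ^ (-c)) δ (X ^ ρ)
    (X ^ (-(2 * q))) N
    (fun g => X ^ (τ * ((g + 1) * δ) / (1 - 2 * ((g + 1) * δ)) + 4 * s + η)) hT (by positivity) hδ hR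
    (by positivity) hD hG1 hG2 v₀ hv₀ h₀ L hL hP (Real.one_le_rpow hX1 hρ)
    (fun v hv g hg U hU hUm hUl => by
      obtain ⟨lo, hi, M, U', hp, hM⟩ := hA v hv
      have hg' : ((g : ℝ) + 1) ≤ N := by exact_mod_cast hg
      refine hX (A v) lo hi M U' (y v) T T₁ τ ((g + 1) * δ) U hp hM (hAy v hv) (hy v hv).1 (hy v hv).2 hT hT1
        hT1' hτ0 hτ1 (by positivity) ?_ hUm (fun t ht => hET t (hU ht)) (fun t ht => ?_)
      · exact (mul_le_mul_of_nonneg_right hg' hδ).trans hN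
      · have := hUl t ht
        push_cast at this
        exact this)
    (fun g hg => by
      rcases hcond g hg with h | h
      · left
        rw [← Real.rpow_mul hXp.le, ← Real.rpow_add hXp, ← Real.rpow_add hXp]
        apply Real.rpow_le_rpow_of_exponent_le hX1
        linarith
      · right
        rw [← Real.rpow_mul hXp.le, ← Real.rpow_add hXp, ← Real.rpow_natCast, ← Real.rpow_mul hXp.le,
          ← Real.rpow_add hXp, ← Real.rpow_add hXp, ← Real.rpow_natCast, ← Real.rpow_mul hXp.le]
        apply Real.rpow_le_rpow_of_exponent_le hX1
        push_cast
        linarith)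
  refine h.trans ?_
  have h1 : (V.card : ℝ) * N ≤ X ^ q := by
    refine le_trans ?_ hXq
    rw [pow_one, mul_comm]
    gcongr
  calc (V.card : ℝ) * N * (R * X ^ (-(2 * q))) ≤ X ^ q * (R * X ^ (-(2 * q))) := by gcongr
    _ = R * (X ^ q * X ^ (-(2 * q))) := by ring
    _ = R * X ^ (-q) := by rw [← Real.rpow_add hXp]; congr 2; ring

end Law

lemma norm_dz_power_saving (δ : ℝ) (hδ : 0 < δ) (n : ℕ) : ∃ η : ℝ, 0 < η ∧ η ≤ 1 ∧ ∀ J : ℕ, ∃ A : ℝ, 0 < A ∧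
    ∀ κ Z t : ℝ, 1 ≤ Z → 1 ≤ κ → κ ≤ 2 ^ J → (2 ^ J * Z) ^ δ ≤ |t| → |t| ≤ Z ^ n →
      ‖dz κ Z t‖ ≤ A * Z ^ (-η) := by
  obtain ⟨A, hA, η, hη, h⟩ := zeta_power_saving 2 one_le_two δ hδ n
  have key : ∀ J : ℕ, ∃ A' : ℝ, 0 < A' ∧ ∀ κ Z t : ℝ, 1 ≤ Z → 1 ≤ κ → κ ≤ 2 ^ J → (2 ^ J * Z) ^ δ ≤ |t| →
      |t| ≤ Z ^ n → ‖∑ m ∈ Finset.Ioc ⌊Z⌋₊ ⌊κ * Z⌋₊, ch t m‖ ≤ A' * Z ^ (1 - min η 1) := by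
    intro J
    induction J with
    | zero =>
      refine ⟨1, one_pos, fun κ Z t hZ h1 h2 _ _ => ?_⟩
      have : κ = 1 := le_antisymm (by simpa using h2) h1
      rw [this, one_mul, Finset.Ioc_self, Finset.sum_empty, norm_zero]
      positivity
    | succ J ih =>
      obtain ⟨A', hA', h'⟩ := ih
      refine ⟨A + A' * 2 ^ (1 - min η 1), by positivity, fun κ Z t hZ h1 h2 ht1 ht2 => ?_⟩
      have hZp : 0 < Z := by linarith
      have hpc : A * Z ^ (1 - η) ≤ A * Z ^ (1 - min η 1) :=
        mul_le_mul_of_nonneg_left (Real.rpow_le_rpow_of_exponent_le hZ (by linarith [min_le_left η 1])) hA.le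
      have htZ : Z ^ δ ≤ |t| := by
        refine le_trans (Real.rpow_le_rpow hZp.le ?_ hδ.le) ht1
        exact le_mul_of_one_le_left hZp.le (one_le_pow₀ one_le_two)
      have hfl : Z ≤ (⌊Z⌋₊ : ℝ) + 1 := (Nat.lt_floor_add_one Z).le
      have hfirst : ∀ b : ℕ, (b : ℝ) ≤ 2 * Z →
          ‖∑ m ∈ Finset.Ioc ⌊Z⌋₊ b, ch t m‖ ≤ A * Z ^ (1 - min η 1) := fun b hb =>
        (h Z t ⌊Z⌋₊ b hZ hfl hb htZ ht2).trans hpc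
      have h2Z : (2 * Z) ^ (1 - min η 1) = 2 ^ (1 - min η 1) * Z ^ (1 - min η 1) :=
        Real.mul_rpow (by norm_num) hZp.le
      rcases le_total κ 2 with hκ | hκ
      · refine (hfirst _ ((Nat.floor_le (by positivity)).trans (by gcongr))).trans ?_
        have : 0 ≤ A' * 2 ^ (1 - min η 1) * Z ^ (1 - min η 1) := by positivity
        linarith
      · have hsplit : ∑ m ∈ Finset.Ioc ⌊Z⌋₊ ⌊κ * Z⌋₊, ch t m =
            ∑ m ∈ Finset.Ioc ⌊Z⌋₊ ⌊2 * Z⌋₊, ch t m + ∑ m ∈ Finset.Ioc ⌊2 * Z⌋₊ ⌊κ * Z⌋₊, ch t m :=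
          (Finset.sum_Ioc_consecutive _ (Nat.floor_mono (by linarith)) (Nat.floor_mono (by gcongr))).symm
        have h3 := h' (κ / 2) (2 * Z) t (by linarith) (by linarith)
          (by rw [pow_succ] at h2; linarith)
          (by rw [← mul_assoc, ← pow_succ]; exact ht1) (ht2.trans (by gcongr; linarith))
        rw [show κ / 2 * (2 * Z) = κ * Z by ring, h2Z] at h3
        rw [hsplit]
        refine (norm_add_le _ _).trans ?_
        have h4 := hfirst ⌊2 * Z⌋₊ (Nat.floor_le (by positivity))
        linarith
  refine ⟨min η 1, lt_min hη one_pos, min_le_right _ _, fun J => ?_⟩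
  obtain ⟨A', hA', h'⟩ := key J
  refine ⟨A', hA', fun κ Z t hZ h1 h2 ht1 ht2 => ?_⟩
  have hZp : 0 < Z := by linarith
  unfold dz
  rw [norm_mul, Complex.norm_real, Real.norm_of_nonneg (by positivity)]
  calc 1 / Z * ‖∑ m ∈ Finset.Ioc ⌊Z⌋₊ ⌊κ * Z⌋₊, ch t m‖ ≤ 1 / Z * (A' * Z ^ (1 - min η 1)) := by
        gcongr; exact h' κ Z t hZ h1 h2 ht1 ht2
    _ = A' * Z ^ (-min η 1) := by
        rw [show (1 : ℝ) - min η 1 = 1 + -min η 1 by ring, Real.rpow_add hZp, Real.rpow_one]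
        field_simp

lemma eventually_norm_dz_le (a b e : ℝ) (ha : 0 < a) (hb : 0 < b) (he : 0 < e) : ∃ c : ℝ, 0 < c ∧ c ≤ 1 ∧
    ∀ κ : ℝ, 1 ≤ κ → ∀ᶠ X : ℝ in Filter.atTop, ∀ Z t : ℝ, X ^ a ≤ Z → Z ≤ X ^ b → X ^ e ≤ |t| → |t| ≤ X ^ (2 : ℝ) →
      ‖dz κ Z t‖ ≤ X ^ (-c) := by
  obtain ⟨η, hη, hη1, h⟩ := norm_dz_power_saving (e / (2 * b)) (by positivity) (⌈2 / a⌉₊)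
  refine ⟨min (η * a / 2) 1, lt_min (by positivity) one_pos, min_le_right _ _, fun κ hκ => ?_⟩
  obtain ⟨J, hJ⟩ := pow_unbounded_of_one_lt κ (one_lt_two : (1:ℝ) < 2)
  obtain ⟨A, hA, h⟩ := h J
  filter_upwards [Filter.eventually_ge_atTop 1, eventually_const_le A (η * a / 2) (by positivity),
    eventually_const_le ((2 ^ J) ^ (e / (2 * b))) (e / 2) (by positivity)] with X hX1 hXA hXJ Z t hZ1 hZ2 ht1 ht2
  have hXp : 0 < X := by linarith
  have hZ : 1 ≤ Z := (Real.one_le_rpow hX1 ha.le).trans hZ1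
  have hZp : 0 < Z := by linarith
  refine (h κ Z t hZ hκ hJ.le ?_ ?_).trans ?_
  · refine le_trans ?_ ht1
    rw [Real.mul_rpow (by positivity) hZp.le]
    calc (2 ^ J : ℝ) ^ (e / (2 * b)) * Z ^ (e / (2 * b)) ≤ X ^ (e / 2) * (X ^ b) ^ (e / (2 * b)) := by gcongr
      _ = X ^ e := by
        rw [← Real.rpow_mul hXp.le, ← Real.rpow_add hXp]
        congr 1; field_simp; ring
  · refine ht2.trans ?_
    rw [← Real.rpow_natCast]
    calc X ^ (2:ℝ) ≤ X ^ (a * (⌈2 / a⌉₊ : ℝ)) := by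
          apply Real.rpow_le_rpow_of_exponent_le hX1
          have := Nat.le_ceil (2 / a)
          rw [div_le_iff₀ ha] at this
          linarith
      _ = (X ^ a) ^ ((⌈2 / a⌉₊ : ℕ) : ℝ) := by rw [Real.rpow_mul hXp.le]
      _ ≤ _ := by gcongr
  · calc A * Z ^ (-η) ≤ X ^ (η * a / 2) * (X ^ a) ^ (-η) := by
          gcongr ?_ * ?_
          exact Real.rpow_le_rpow_of_nonpos (by positivity) hZ1 (by linarith)
      _ = X ^ (-(η * a / 2)) := by
          rw [← Real.rpow_mul hXp.le, ← Real.rpow_add hXp]; congr 1; ring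
      _ ≤ X ^ (-min (η * a / 2) 1) :=
          Real.rpow_le_rpow_of_exponent_le hX1 (by linarith [min_le_left (η * a / 2) 1])

namespace Law

variable {A Q : Law} {lo hi lo' hi' : ℕ} {S Γ U M S' Γ' U' : ℝ}

lemma Good.integral_norm_R_mul_le (hA : A.Good lo hi S Γ U) (κ Y T : ℝ) (hκ : 1 ≤ κ) (hT : 0 < T) (hTY : T ≤ Y)
    (G : ℝ → ℂ) (hG : CB G) :
    T * ∫ t, ‖A.R κ Y t‖ * ‖G t‖ ∂gm T ≤ Real.sqrt (48 * κ ^ 2 * S * Γ) * Real.sqrt (T * ∫ t, ‖G t‖ ^ 2 ∂gm T) := by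
  have hS := hA.one_le_S
  have hΓ := hA.one_le_Γ
  have hY : 0 < Y := by linarith
  have h1 := integral_mul_le_sqrt (μ := gm T) (A.CB_R κ Y).norm hG.norm (fun _ => norm_nonneg _) (fun _ => norm_nonneg _)
  have h2 := hA.mean_value κ Y T (by linarith) hY hT
  have h3 : T * ∫ t, ‖A.R κ Y t‖ ^ 2 ∂gm T ≤ 48 * κ ^ 2 * S * Γ := by
    have h4 : 1 / Y + κ * S / T ≤ 2 * (κ * S) / T := by
      have : 1 / Y ≤ κ * S / T := by
        apply div_le_div₀ (by positivity) _ hT hTY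
        nlinarith
      rw [two_mul, add_div]; linarith
    calc T * ∫ t, ‖A.R κ Y t‖ ^ 2 ∂gm T ≤ T * (24 * κ * Γ * (2 * (κ * S) / T)) := by
          refine mul_le_mul_of_nonneg_left (h2.trans ?_) hT.le
          exact mul_le_mul_of_nonneg_left h4 (by positivity)
      _ = _ := by field_simp; ring
  have h0 : 0 ≤ ∫ t, ‖A.R κ Y t‖ ^ 2 ∂gm T := integral_nonneg fun _ => by positivity
  have h0' : 0 ≤ ∫ t, ‖G t‖ ^ 2 ∂gm T := integral_nonneg fun _ => by positivity
  calc T * ∫ t, ‖A.R κ Y t‖ * ‖G t‖ ∂gm T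
      ≤ T * Real.sqrt ((∫ t, ‖A.R κ Y t‖ ^ 2 ∂gm T) * ∫ t, ‖G t‖ ^ 2 ∂gm T) :=
        mul_le_mul_of_nonneg_left h1 hT.le
    _ = Real.sqrt (T ^ 2) * Real.sqrt ((∫ t, ‖A.R κ Y t‖ ^ 2 ∂gm T) * ∫ t, ‖G t‖ ^ 2 ∂gm T) := by
        rw [Real.sqrt_sq hT.le]
    _ = Real.sqrt ((T * ∫ t, ‖A.R κ Y t‖ ^ 2 ∂gm T) * (T * ∫ t, ‖G t‖ ^ 2 ∂gm T)) := by
        rw [← Real.sqrt_mul (by positivity)]; congr 1; ring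
    _ = Real.sqrt (T * ∫ t, ‖A.R κ Y t‖ ^ 2 ∂gm T) * Real.sqrt (T * ∫ t, ‖G t‖ ^ 2 ∂gm T) :=
        Real.sqrt_mul (by positivity) _
    _ ≤ _ := mul_le_mul_of_nonneg_right (Real.sqrt_le_sqrt h3) (Real.sqrt_nonneg _)

/-- Contribution of the set where the polynomial of a factor of constant size is small. -/
lemma Good.setIntegral_R_prod_le_of_small (hQ : Q.Good lo hi S Γ U) (hA : ∀ i, A.s i ≠ 0) (y : ℝ)
    (hAy : ∀ i, A.y i = y) (κ Y T : ℝ) (hκ : 1 ≤ κ) (hT : 0 < T) (hTY : T ≤ Y / y)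
    (G : ℝ → ℂ) (hG : CB G) (E : Set ℝ) (hE : MeasurableSet E) (l : ℝ) (hl : 0 ≤ l)
    (hl' : ∀ t ∈ E, ‖A.poly t‖ ≤ l) :
    T * ∫ t in E, ‖(A.prod Q).R κ Y t‖ * ‖G t‖ ∂gm T ≤
      l * (Real.sqrt (48 * κ ^ 2 * S * Γ) * Real.sqrt (T * ∫ t, ‖G t‖ ^ 2 ∂gm T)) := by
  have h := hQ.integral_norm_R_mul_le κ (Y / y) T hκ hT hTY G hG
  have hc : CB fun t => ‖Q.R κ (Y / y) t‖ * ‖G t‖ := (Q.CB_R _ _).norm.mul hG.norm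
  have h1 : ∫ t in E, ‖(A.prod Q).R κ Y t‖ * ‖G t‖ ∂gm T ≤ l * ∫ t, ‖Q.R κ (Y / y) t‖ * ‖G t‖ ∂gm T := by
    rw [← integral_const_mul]
    refine le_trans (setIntegral_mono_on ((Law.CB_R _ _ _).norm.mul hG.norm).integrable
      (hc.integrable.const_mul l) hE fun t ht => ?_)
      (setIntegral_le_integral (hc.integrable.const_mul l) (Filter.Eventually.of_forall fun t => ?_))
    · rw [R_prod_const A Q κ Y t y hA hQ.s_ne_zero hAy, norm_mul, ← mul_assoc]
      exact mul_le_mul_of_nonneg_right (mul_le_mul_of_nonneg_right (hl' t ht) (norm_nonneg _)) (norm_nonneg _)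
    · exact mul_nonneg hl (mul_nonneg (norm_nonneg _) (norm_nonneg _))
  calc _ ≤ T * (l * ∫ t, ‖Q.R κ (Y / y) t‖ * ‖G t‖ ∂gm T) := mul_le_mul_of_nonneg_left h1 hT.le
    _ = l * (T * ∫ t, ‖Q.R κ (Y / y) t‖ * ‖G t‖ ∂gm T) := by ring
    _ ≤ _ := mul_le_mul_of_nonneg_left h hl

/-- One step of the iteration: on the set where the polynomial of `A` is large, pass to the sets where the
polynomials of the mixed factors are large. -/
lemma Good.setIntegral_R_mix_prod_le_of_large (hA : A.PrimeLaw lo hi 4 M U) (y : ℝ) (hAy : ∀ i, A.y i = y)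
    (hQ : Q.Good lo' hi' S' Γ' U') (hd : hi ≤ lo') (hl : lo ≤ lo') (hh : hi ≤ hi')
    (V : Finset ℕ) (W : ℕ → ℝ) (B : ℕ → Law) (yB : ℕ → ℝ) (hW : ∀ v ∈ V, 0 ≤ W v) (hW1 : ∑ v ∈ V, W v = 1)
    (hB : ∀ v ∈ V, ∃ (a b : ℕ) (S M U : ℝ), (B v).PrimeLaw a b S M U) (hBy : ∀ v ∈ V, ∀ i, (B v).y i = yB v)
    (κ Y T R e e' lA : ℝ) (lB : ℕ → ℝ) (k : ℕ → ℕ) (hκ : 1 ≤ κ) (hT : 0 < T) (hlA : 0 < lA)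
    (hlB : ∀ v ∈ V, 0 < lB v) (G : ℝ → ℂ) (hG : CB G) (E : Set ℝ) (hE : MeasurableSet E) (hy0 : 0 < y)
    (hk : ∀ v ∈ V, T ≤ Y * y ^ k v / yB v)
    (hrec : ∀ v ∈ V, T * ∫ t in E ∩ {t | lB v < ‖(B v).poly t‖}, ‖Q.R κ (Y / yB v) t‖ * ‖G t‖ ∂gm T ≤ R * e)
    (hnum : ∀ v ∈ V, lB v * (lA ^ k v)⁻¹ * (Real.sqrt (48 * κ ^ 2 * (4 ^ k v * S') * ((1 + k v * M) ^ k v * Γ')) *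
      Real.sqrt (T * ∫ t, ‖G t‖ ^ 2 ∂gm T)) ≤ R * e') :
    T * ∫ t in E ∩ {t | lA < ‖A.poly t‖}, ‖((mix V W B).prod Q).R κ Y t‖ * ‖G t‖ ∂gm T ≤ R * (e + e') := by
  have hBs : ∀ v ∈ V, ∀ i, (B v).s i ≠ 0 := fun v hv i => by
    obtain ⟨a, b, S, M, U, h⟩ := hB v hv
    exact (h.prime i).ne_zero
  have hm : ∀ (L : Law) (l : ℝ), MeasurableSet {t | l < ‖L.poly t‖} := fun L l =>
    measurableSet_lt measurable_const L.CB_poly.norm.1.measurable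
  have hm' : ∀ (L : Law) (l : ℝ), MeasurableSet {t | ‖L.poly t‖ ≤ l} := fun L l =>
    measurableSet_le L.CB_poly.norm.1.measurable measurable_const
  have hEA := hE.inter (hm A lA)
  have h1 := setIntegral_R_mix_prod_le V W B Q κ Y yB hW hBs hQ.s_ne_zero hBy (μ := gm T) (fun t => ‖G t‖) hG.norm
    (fun _ => norm_nonneg _) (E ∩ {t | lA < ‖A.poly t‖})
  have key : ∀ v ∈ V, T * ∫ t in E ∩ {t | lA < ‖A.poly t‖}, ‖Q.R κ (Y / yB v) t‖ * (‖(B v).poly t‖ * ‖G t‖) ∂gm T ≤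
      R * (e + e') := by
    intro v hv
    have hB1 : ∀ t, ‖(B v).poly t‖ ≤ 1 := fun t => by
      obtain ⟨a, b, S, M, U, h⟩ := hB v hv
      exact h.good.norm_poly_le t
    have hlBv := hlB v hv
    have hfc : CB fun t => ‖Q.R κ (Y / yB v) t‖ * (‖(B v).poly t‖ * ‖G t‖) :=
      (Q.CB_R _ _).norm.mul ((B v).CB_poly.norm.mul hG.norm)
    have hcov := setIntegral_le_sum_of_cover (μ := gm T) hfc (fun t => by positivity) _ hEA
      (Finset.univ : Finset (Fin 2)) ![E ∩ {t | lB v < ‖(B v).poly t‖},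
        (E ∩ {t | lA < ‖A.poly t‖}) ∩ {t | ‖(B v).poly t‖ ≤ lB v}]
      (fun i _ => by
        fin_cases i
        · exact hE.inter (hm _ _)
        · exact hEA.inter (hm' _ _)) (fun t ht => by
        by_cases h : lB v < ‖(B v).poly t‖
        · exact ⟨0, Finset.mem_univ _, ht.1, h⟩
        · exact ⟨1, Finset.mem_univ _, ht, not_lt.1 h⟩)
    rw [Fin.sum_univ_two] at hcov
    simp only [Matrix.cons_val_zero, Matrix.cons_val_one, Matrix.cons_val_fin_one] at hcov
    have hI1 : ∫ t in E ∩ {t | lB v < ‖(B v).poly t‖}, ‖Q.R κ (Y / yB v) t‖ * (‖(B v).poly t‖ * ‖G t‖) ∂gm T ≤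
        ∫ t in E ∩ {t | lB v < ‖(B v).poly t‖}, ‖Q.R κ (Y / yB v) t‖ * ‖G t‖ ∂gm T := by
      refine integral_mono hfc.integrable ((Q.CB_R _ _).norm.mul hG.norm).integrable fun t => ?_
      exact mul_le_mul_of_nonneg_left (mul_le_of_le_one_left (norm_nonneg _) (hB1 t)) (norm_nonneg _)
    have hAk := (hA.pow_good (k v)).prod hQ hd hl hh
    set Y' := Y * y ^ k v / yB v with hY'
    have hF := hAk.integral_norm_R_mul_le κ Y' T hκ hT (hk v hv) G hG
    have hFc : CB fun t => ‖((A.pow (k v)).prod Q).R κ Y' t‖ * ‖G t‖ := (Law.CB_R _ _ _).norm.mul hG.norm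
    have hI2 : ∫ t in (E ∩ {t | lA < ‖A.poly t‖}) ∩ {t | ‖(B v).poly t‖ ≤ lB v},
        ‖Q.R κ (Y / yB v) t‖ * (‖(B v).poly t‖ * ‖G t‖) ∂gm T ≤
        (lB v * (lA ^ k v)⁻¹) * ∫ t, ‖((A.pow (k v)).prod Q).R κ Y' t‖ * ‖G t‖ ∂gm T := by
      rw [← integral_const_mul]
      refine le_trans (setIntegral_mono_on hfc.integrable (hFc.integrable.const_mul _)
        (hEA.inter (hm' _ _)) fun t ht => ?_)
        (setIntegral_le_integral (hFc.integrable.const_mul _) (Filter.Eventually.of_forall fun t => ?_))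
      · rw [R_pow_prod_const A Q κ Y' t y (k v) (fun i => (hA.prime i).ne_zero) hQ.s_ne_zero hAy, norm_mul, norm_pow,
          show Y' / y ^ k v = Y / yB v by rw [hY']; field_simp]
        have hA1 : 1 ≤ (lA ^ k v)⁻¹ * ‖A.poly t‖ ^ k v := by
          rw [inv_mul_eq_div, one_le_div (by positivity)]
          exact pow_le_pow_left₀ hlA.le (le_of_lt ht.1.2) _
        calc ‖Q.R κ (Y / yB v) t‖ * (‖(B v).poly t‖ * ‖G t‖)
            = ‖(B v).poly t‖ * 1 * (‖Q.R κ (Y / yB v) t‖ * ‖G t‖) := by ring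
          _ ≤ lB v * ((lA ^ k v)⁻¹ * ‖A.poly t‖ ^ k v) * (‖Q.R κ (Y / yB v) t‖ * ‖G t‖) :=
              mul_le_mul_of_nonneg_right (mul_le_mul ht.2 hA1 zero_le_one hlBv.le) (by positivity)
          _ = _ := by ring
      · show (0:ℝ) ≤ _
        positivity
    calc T * ∫ t in E ∩ {t | lA < ‖A.poly t‖}, ‖Q.R κ (Y / yB v) t‖ * (‖(B v).poly t‖ * ‖G t‖) ∂gm T
        ≤ T * (∫ t in E ∩ {t | lB v < ‖(B v).poly t‖}, ‖Q.R κ (Y / yB v) t‖ * ‖G t‖ ∂gm T +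
          (lB v * (lA ^ k v)⁻¹) * ∫ t, ‖((A.pow (k v)).prod Q).R κ Y' t‖ * ‖G t‖ ∂gm T) :=
          mul_le_mul_of_nonneg_left (hcov.trans (add_le_add hI1 hI2)) hT.le
      _ = T * ∫ t in E ∩ {t | lB v < ‖(B v).poly t‖}, ‖Q.R κ (Y / yB v) t‖ * ‖G t‖ ∂gm T +
          (lB v * (lA ^ k v)⁻¹) * (T * ∫ t, ‖((A.pow (k v)).prod Q).R κ Y' t‖ * ‖G t‖ ∂gm T) := by ring
      _ ≤ R * e + R * e' := by
          refine add_le_add (hrec v hv) (le_trans (mul_le_mul_of_nonneg_left hF (by positivity)) (hnum v hv))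
      _ = _ := by ring
  calc T * ∫ t in E ∩ {t | lA < ‖A.poly t‖}, ‖((mix V W B).prod Q).R κ Y t‖ * ‖G t‖ ∂gm T
      ≤ T * ∑ v ∈ V, W v * ∫ t in E ∩ {t | lA < ‖A.poly t‖},
          ‖Q.R κ (Y / yB v) t‖ * (‖(B v).poly t‖ * ‖G t‖) ∂gm T := mul_le_mul_of_nonneg_left h1 hT.le
    _ = ∑ v ∈ V, W v * (T * ∫ t in E ∩ {t | lA < ‖A.poly t‖},
          ‖Q.R κ (Y / yB v) t‖ * (‖(B v).poly t‖ * ‖G t‖) ∂gm T) := by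
        rw [Finset.mul_sum]
        exact Finset.sum_congr rfl fun v _ => by ring
    _ ≤ ∑ v ∈ V, W v * (R * (e + e')) :=
        Finset.sum_le_sum fun v hv => mul_le_mul_of_nonneg_left (key v hv) (hW v hv)
    _ = R * (e + e') := by rw [← Finset.sum_mul, hW1, one_mul]

end Law

lemma ladder_exponent_le (ε K : ℝ) (hε : 0 < ε) (hε1 : ε ≤ 1) (hK : 140 / ε ≤ K) (j v v' : ℕ) (a a' : ℝ)
    (hv : 1 ≤ v) (ha : a ≤ 1 / 4) (ha0 : 0 ≤ a) (haa' : a + ε * (1 / 2) ^ (j + 1) ≤ a')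
    (h1 : K * 4 ^ j * v ≤ v') (h2 : K * 4 ^ j * (Real.log v' + 1) ≤ v) :
    (4:ℝ) ^ (-(a' * v')) * (((4:ℝ) ^ (-(a * v))) ^ (v' / v + 6))⁻¹ *
      (Real.sqrt (4 ^ (v' / v + 6) * (1 + (v' / v + 6 : ℕ) * (32 * 2 ^ j * v)) ^ (v' / v + 6)) * 4 ^ v * 4 ^ v) ≤
      ((4:ℝ) ^ v)⁻¹ := by
  set k := v' / v + 6 with hk
  have hv0 : (0:ℝ) < v := by exact_mod_cast hv
  have hK140 : 140 ≤ ε * K := by rw [div_le_iff₀ hε] at hK; linarith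
  have hK0 : 0 < K := lt_of_lt_of_le (by positivity) hK
  have hK1 : 140 ≤ K := by nlinarith
  have h4j : (1:ℝ) ≤ 4 ^ j := one_le_pow₀ (by norm_num)
  have hvv' : (v:ℝ) ≤ v' := by
    refine le_trans ?_ h1
    have : 1 ≤ K * 4 ^ j := by nlinarith
    nlinarith
  have hv'1 : (1:ℝ) ≤ v' := by
    have : (1:ℝ) ≤ v := by exact_mod_cast hv
    linarith
  have hlv' : 0 ≤ Real.log v' := Real.log_nonneg hv'1
  have hq : ((v' / v : ℕ) : ℝ) * v ≤ v' := by exact_mod_cast Nat.div_mul_le_self v' v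
  have hkv : (k:ℝ) * v ≤ v' + 6 * v := by rw [hk]; push_cast; linarith
  have hkv7 : (k:ℝ) * v ≤ 7 * v' := by linarith
  have h2j : (1:ℝ) ≤ 2 ^ j := one_le_pow₀ (by norm_num)
  have hk0 : (0:ℝ) ≤ k := Nat.cast_nonneg k
  set m : ℝ := 1 + k * (32 * 2 ^ j * v) with hm
  have hm1 : 1 ≤ m := by rw [hm]; have : 0 ≤ (k:ℝ) * (32 * 2 ^ j * v) := by positivity
                         linarith
  have hm2 : m ≤ 225 * 2 ^ j * v' := by
    have e1 : (k:ℝ) * (32 * 2 ^ j * v) ≤ 224 * 2 ^ j * v' := by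
      calc (k:ℝ) * (32 * 2 ^ j * v) = 32 * 2 ^ j * (k * v) := by ring
        _ ≤ 32 * 2 ^ j * (7 * v') := mul_le_mul_of_nonneg_left hkv7 (by positivity)
        _ = _ := by ring
    have e2 : (1:ℝ) ≤ 2 ^ j * v' := one_le_mul_of_one_le_of_one_le h2j hv'1
    rw [hm]; linarith
  have hL4 : Real.log 4 = 2 * Real.log 2 := by
    rw [show (4:ℝ) = 2 ^ 2 by norm_num, Real.log_pow]; norm_num
  have hl2 := Real.log_two_gt_d9
  have hl2' := Real.log_two_lt_d9
  have hlm : Real.log m ≤ 6 + j + Real.log v' := by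
    refine (Real.log_le_log (by linarith) hm2).trans ?_
    rw [Real.log_mul (by positivity) (by positivity), Real.log_mul (by norm_num) (by positivity), Real.log_pow]
    have e1 : Real.log 225 ≤ 6 := by
      have : Real.log 225 ≤ Real.log (2 ^ 8) := Real.log_le_log (by norm_num) (by norm_num)
      rw [Real.log_pow] at this
      push_cast at this; linarith
    have e2 : (j:ℝ) * Real.log 2 ≤ j := mul_le_of_le_one_right (Nat.cast_nonneg j) (by linarith)
    linarith
  have hlm0 : 0 ≤ Real.log m := Real.log_nonneg hm1
  have hsq : Real.sqrt (4 ^ k * m ^ k) = Real.exp (k * ((Real.log 4 + Real.log m) / 2)) := by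
    rw [← mul_pow, Real.sqrt_eq_rpow, ← Real.rpow_natCast, ← Real.rpow_mul (by positivity),
      Real.rpow_def_of_pos (by positivity), Real.log_mul (by norm_num) (by positivity)]
    congr 1; ring
  have hpow : ∀ n : ℕ, (4:ℝ) ^ n = Real.exp (Real.log 4 * n) := fun n => by
    rw [← Real.rpow_natCast, Real.rpow_def_of_pos (by norm_num)]
  rw [hsq, Real.rpow_def_of_pos (by norm_num), Real.rpow_def_of_pos (by norm_num), ← Real.exp_nat_mul,
    hpow v, ← Real.exp_neg, ← Real.exp_neg, ← Real.exp_add, ← Real.exp_add, ← Real.exp_add, ← Real.exp_add]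
  refine Real.exp_le_exp.2 ?_
  -- main inequality of exponents
  have main1 : a * (k * v) ≤ a * v' + 3 / 2 * v := by
    calc a * (k * v) ≤ a * (v' + 6 * v) := mul_le_mul_of_nonneg_left hkv ha0
      _ = a * v' + 6 * a * v := by ring
      _ ≤ _ := by
        have := mul_le_mul_of_nonneg_right ha hv0.le
        linarith
  have main2 : (a + ε * (1 / 2) ^ (j + 1)) * v' ≤ a' * v' := mul_le_mul_of_nonneg_right haa' (by positivity)
  set g : ℝ := ε * (1 / 2) ^ j * v' with hg
  have hgj : ε * (1 / 2) ^ (j + 1) * v' = g / 2 := by rw [hg, pow_succ]; ring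
  have main3 : 9 / 2 * (v:ℝ) ≤ g / 4 := by
    have : ε * (1 / 2) ^ j * (K * 4 ^ j * v) ≤ g := mul_le_mul_of_nonneg_left h1 (by positivity)
    have e : ε * (1 / 2) ^ j * (K * 4 ^ j * v) = (ε * K) * (2 ^ j * v) := by
      have : (1 / 2 : ℝ) ^ j * 4 ^ j = 2 ^ j := by rw [← mul_pow]; norm_num
      calc _ = ε * K * (((1 / 2 : ℝ) ^ j * 4 ^ j) * v) := by ring
        _ = _ := by rw [this]
    have e2 : 140 * (v:ℝ) ≤ (ε * K) * (2 ^ j * v) := by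
      have : (v:ℝ) ≤ 2 ^ j * v := le_mul_of_one_le_left hv0.le h2j
      exact mul_le_mul hK140 this hv0.le (by linarith)
    linarith
  have main4 : (k:ℝ) * ((Real.log 4 + Real.log m) / 2) ≤ Real.log 4 * (g / 4) := by
    have hb : (Real.log 4 + Real.log m) / 2 ≤ 4 * ((1 + j) * (1 + Real.log v')) := by
      have : (1 + (j:ℝ)) * (1 + Real.log v') = 1 + j + Real.log v' + j * Real.log v' := by ring
      have : 0 ≤ (j:ℝ) * Real.log v' := by positivity
      have : (0:ℝ) ≤ j := by positivity
      linarith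
    have hj2 : (1 + (j:ℝ)) ≤ 2 ^ j := by
      have := Nat.lt_two_pow_self (n := j)
      exact_mod_cast (by omega : 1 + j ≤ 2 ^ j)
    have h3 : (ε * (1 / 2) ^ j) * (K * 4 ^ j * (Real.log v' + 1)) ≤ (ε * (1 / 2) ^ j) * v :=
      mul_le_mul_of_nonneg_left h2 (by positivity)
    have h4 : (ε * (1 / 2) ^ j) * (K * 4 ^ j * (Real.log v' + 1)) = (ε * K) * (2 ^ j * (1 + Real.log v')) := by
      have : (1 / 2 : ℝ) ^ j * 4 ^ j = 2 ^ j := by rw [← mul_pow]; norm_num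
      calc _ = ε * K * (((1 / 2 : ℝ) ^ j * 4 ^ j) * (1 + Real.log v')) := by ring
        _ = _ := by rw [this]
    have h5 : 140 * ((1 + j) * (1 + Real.log v')) ≤ (ε * (1 / 2) ^ j) * v := by
      rw [h4] at h3
      refine le_trans (mul_le_mul hK140 (mul_le_mul_of_nonneg_right hj2 (by linarith)) (by positivity) (by linarith)) h3
    have h6 : (k:ℝ) * (140 * ((1 + j) * (1 + Real.log v'))) ≤ 7 * g := by
      calc (k:ℝ) * (140 * ((1 + j) * (1 + Real.log v'))) ≤ k * ((ε * (1 / 2) ^ j) * v) :=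
            mul_le_mul_of_nonneg_left h5 hk0
        _ = (ε * (1 / 2) ^ j) * (k * v) := by ring
        _ ≤ (ε * (1 / 2) ^ j) * (7 * v') := mul_le_mul_of_nonneg_left hkv7 (by positivity)
        _ = 7 * g := by rw [hg]; ring
    have h7 : (k:ℝ) * ((Real.log 4 + Real.log m) / 2) ≤ g / 5 := by
      have := mul_le_mul_of_nonneg_left hb hk0
      linarith
    have hg0 : 0 ≤ g := by positivity
    have h8 : (1:ℝ) * (g / 4) ≤ Real.log 4 * (g / 4) := mul_le_mul_of_nonneg_right (by linarith) (by positivity)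
    linarith
  have hL0 : 0 < Real.log 4 := by rw [hL4]; linarith
  have main5 : Real.log 4 * (-(a' * v') + a * (k * v) + 3 * v + g / 4) ≤ 0 := by
    refine mul_nonpos_of_nonneg_of_nonpos hL0.le ?_
    linarith
  have : Real.log 4 * -(a' * ↑v') + -(↑k * (Real.log 4 * -(a * ↑v))) = Real.log 4 * (-(a' * v') + a * (k * v)) := by ring
  linarith

namespace Law

/-- The exponents of the thresholds in the iteration. -/
noncomputable def rung (ε : ℝ) (j : ℕ) : ℝ := 1 / 4 - ε - ε * (1 / 2) ^ j

/-- The set where the polynomial of `A` exceeds `4 ^ (-a v)`. -/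
def largeSet (A : Law) (a : ℝ) (v : ℕ) : Set ℝ := {t | (4 : ℝ) ^ (-(a * v)) < ‖A.poly t‖}

lemma measurableSet_largeSet (A : Law) (a : ℝ) (v : ℕ) : MeasurableSet (A.largeSet a v) :=
  measurableSet_lt measurable_const A.CB_poly.norm.1.measurable

lemma setIntegral_R_invMix_prod_le {Q : Law} {lo' hi' : ℕ} {S' Γ' U' : ℝ} (hQ : Q.Good lo' hi' S' Γ' U')
    (V : Finset ℕ) (B : ℕ → Law) (yB : ℕ → ℝ) (C : ℝ) (a b : ℕ) (ha : 1 ≤ a) (hV : V.Nonempty)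
    (hab : ∀ v ∈ V, a ≤ v ∧ v ≤ b) {SB : ℝ} (hB : ∀ v ∈ V, IsBlock (B v) SB (C * v) v (yB v))
    (ε K : ℝ) (hε : 0 < ε) (hε1 : ε ≤ 1 / 8) (hK : 140 / ε ≤ K) (j v : ℕ) (hv : 1 ≤ v)
    (hnum : ∀ u ∈ V, K * 4 ^ j * v ≤ u ∧ K * 4 ^ j * (Real.log u + 1) ≤ v)
    {A : Law} {y : ℝ} (hA : IsBlock A (2 ^ ((1 / 2 : ℝ) ^ j)) (32 * 2 ^ j * v) v y)
    (hd : 4 ^ (v + 1) ≤ lo') (hh : 4 ^ (v + 1) ≤ hi')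
    (κ T Y R e : ℝ) (hκ : 1 ≤ κ) (hT : 0 < T) (hR : 0 ≤ R) (G : ℝ → ℂ) (hG : CB G) (E : Set ℝ)
    (hE : MeasurableSet E) (hTY : T ≤ Y * y ^ 2)
    (hQv : Real.sqrt (48 * κ ^ 2 * S' * Γ') ≤ 4 ^ v) (hGv : Real.sqrt (T * ∫ t, ‖G t‖ ^ 2 ∂gm T) ≤ 4 ^ v * R)
    (hrec : ∀ u ∈ V, T * ∫ t in E ∩ (B u).largeSet (rung ε (j + 1)) u, ‖Q.R κ (Y / yB u) t‖ * ‖G t‖ ∂gm T ≤ R * e) :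
    T * ∫ t in E ∩ A.largeSet (rung ε j) v, ‖((invMix V B).prod Q).R κ Y t‖ * ‖G t‖ ∂gm T ≤
      R * (e + (4 ^ v)⁻¹) := by
  have hpos : 0 < ∑ u ∈ V, (1 / (u : ℝ)) :=
    Finset.sum_pos (fun u hu => by
      have : 0 < u := by have := (hab u hu).1; omega
      positivity) hV
  have hS4 : (2:ℝ) ^ ((1 / 2 : ℝ) ^ j) ≤ 4 := by
    calc (2:ℝ) ^ ((1 / 2 : ℝ) ^ j) ≤ 2 ^ (1:ℝ) :=
          Real.rpow_le_rpow_of_exponent_le (by norm_num) (pow_le_one₀ (by norm_num) (by norm_num))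
      _ ≤ 4 := by norm_num
  have hy1 : (4:ℝ) ^ v ≤ y := hA.le_y
  have hy0 : 0 < y := lt_of_lt_of_le (by positivity) hy1
  have hY0 : 0 < Y := by
    by_contra hY
    have : Y * y ^ 2 ≤ 0 := mul_nonpos_of_nonpos_of_nonneg (not_lt.1 hY) (by positivity)
    linarith
  have hS' := hQ.one_le_S
  have hΓ' := hQ.one_le_Γ
  have hrung : 0 ≤ rung ε j ∧ rung ε j ≤ 1 / 4 := by
    have : (1 / 2 : ℝ) ^ j ≤ 1 := pow_le_one₀ (by norm_num) (by norm_num)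
    have h0 : (0:ℝ) ≤ (1 / 2 : ℝ) ^ j := by positivity
    have h1 : ε * (1 / 2) ^ j ≤ ε * 1 := mul_le_mul_of_nonneg_left this hε.le
    have h2 : 0 ≤ ε * (1 / 2) ^ j := by positivity
    unfold rung
    constructor <;> linarith
  have hrung' : rung ε j + ε * (1 / 2) ^ (j + 1) ≤ rung ε (j + 1) := by
    unfold rung
    rw [pow_succ]
    exact le_of_eq (by ring)
  refine Good.setIntegral_R_mix_prod_le_of_large (hA.primeLaw.mono le_rfl le_rfl hS4 le_rfl le_rfl) y hA.y_eq hQ hd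
    ((Nat.pow_le_pow_right (by norm_num) (by omega)).trans hd) hh V
    (fun v => (1 / (v : ℝ)) / ∑ u ∈ V, (1 / (u : ℝ))) B yB
    (fun u hu => by positivity) (by rw [← Finset.sum_div, div_self hpos.ne'])
    (fun u hu => ⟨_, _, _, _, _, (hB u hu).primeLaw⟩) (fun u hu => (hB u hu).y_eq) κ Y T R e _ _
    (fun u => (4 : ℝ) ^ (-(rung ε (j + 1) * u))) (fun u => u / v + 6) hκ hT (by positivity) (fun u _ => by positivity)
    G hG E hE hy0 (fun u hu => ?_) hrec (fun u hu => ?_)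
  · have hyu := (hB u hu).y_lt
    have hyu0 : 0 < yB u := lt_of_lt_of_le (by positivity) (hB u hu).le_y
    rw [le_div_iff₀ hyu0, pow_add y (u / v) 6]
    have hvu : u + 1 ≤ v * (u / v) + 4 * v := by
      have := Nat.div_add_mod u v
      have := Nat.mod_lt u (show 0 < v by omega)
      omega
    have h1 : yB u ≤ y ^ (u / v) * y ^ 4 := by
      calc yB u ≤ (4:ℝ) ^ (u + 1) := hyu.le
        _ ≤ 4 ^ (v * (u / v) + 4 * v) := pow_le_pow_right₀ (by norm_num) hvu
        _ = (4 ^ v) ^ (u / v) * (4 ^ v) ^ 4 := by rw [pow_add, pow_mul]; ring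
        _ ≤ _ := by gcongr
    calc T * yB u ≤ (Y * y ^ 2) * (y ^ (u / v) * y ^ 4) := mul_le_mul hTY h1 hyu0.le (by positivity)
      _ = _ := by ring
  · have h := ladder_exponent_le ε K hε (by linarith) hK j v u (rung ε j) (rung ε (j + 1)) hv hrung.2 hrung.1 hrung'
      (hnum u hu).1 (hnum u hu).2
    set k := u / v + 6 with hk
    set D : ℝ := (4:ℝ) ^ (-(rung ε (j + 1) * u)) * (((4:ℝ) ^ (-(rung ε j * v))) ^ k)⁻¹ with hD
    have hD0 : 0 ≤ D := by positivity
    have hsplit : Real.sqrt (48 * κ ^ 2 * (4 ^ k * S') * ((1 + k * (32 * 2 ^ j * v)) ^ k * Γ')) =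
        Real.sqrt (4 ^ k * (1 + (k : ℕ) * (32 * 2 ^ j * v)) ^ k) * Real.sqrt (48 * κ ^ 2 * S' * Γ') := by
      rw [← Real.sqrt_mul (by positivity)]; congr 1; ring
    rw [hsplit]
    set s := Real.sqrt (4 ^ k * (1 + (k : ℕ) * (32 * 2 ^ j * v)) ^ k) with hs
    have hs0 : 0 ≤ s := Real.sqrt_nonneg _
    calc D * (s * Real.sqrt (48 * κ ^ 2 * S' * Γ') * Real.sqrt (T * ∫ t, ‖G t‖ ^ 2 ∂gm T))
        ≤ D * (s * 4 ^ v * (4 ^ v * R)) := by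
          refine mul_le_mul_of_nonneg_left ?_ hD0
          exact mul_le_mul (mul_le_mul_of_nonneg_left hQv hs0) hGv (Real.sqrt_nonneg _) (by positivity)
      _ = R * (D * (s * 4 ^ v * 4 ^ v)) := by ring
      _ ≤ _ := mul_le_mul_of_nonneg_left h hR

end Law

lemma log_le_sum_Icc_inv (a b : ℕ) (ha : 1 ≤ a) (hab : a ≤ b) :
    Real.log ((b + 1) / a) ≤ ∑ u ∈ Finset.Icc a b, (1 / (u : ℝ)) := by
  have key : ∀ n : ℕ, 1 ≤ n → Real.log ((n + 1) / n) ≤ 1 / (n : ℝ) := fun n hn => by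
    have hn0 : (0:ℝ) < n := by exact_mod_cast hn
    have := Real.log_le_sub_one_of_pos (show (0:ℝ) < (n + 1) / n by positivity)
    refine this.trans (le_of_eq ?_)
    field_simp; ring
  induction b, hab using Nat.le_induction with
  | base => simpa using key a ha
  | succ b hab ih =>
    have ha0 : (0:ℝ) < a := by exact_mod_cast ha
    rw [Finset.sum_Icc_succ_top (by omega)]
    have h2 := key (b + 1) (by omega)
    have h3 : Real.log (((b + 1 : ℕ) + 1) / a) = Real.log ((b + 1) / a) + Real.log (((b + 1 : ℕ) + 1) / (b + 1 : ℕ)) := by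
      rw [← Real.log_mul (by positivity) (by positivity)]
      congr 1; push_cast; field_simp
    rw [h3]
    exact add_le_add ih h2

namespace Law

/-- There is a law `Q`, supported on integers with prime factors above the scale interval, for which the integral over
the set where a block polynomial of scale in `[V, V']` is large is small. -/
def LadderBound (ε κ T X Ya D Sb Γb Ub Lw fin R : ℝ) (hb : ℕ) (G : ℝ → ℂ) (E : Set ℝ) (n j V V' : ℕ) : Prop :=
  ∃ (Q : Law) (lo : ℕ) (S Γ U : ℝ), Q.Good lo hb S Γ U ∧ 4 ^ (V' + 1) ≤ lo ∧ lo ≤ hb ∧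
    S ≤ Sb * 2 ^ ((1 / 2 : ℝ) ^ j) ∧ Γ ≤ Γb * Real.exp ((1 / 2) ^ j) ∧ U ≤ Ub * D ^ n ∧ (∀ i, Lw ≤ Q.y i) ∧
    ∀ (v : ℕ) (A : Law) (y : ℝ), V ≤ v → v ≤ V' → IsBlock A (2 ^ ((1 / 2 : ℝ) ^ j)) (32 * 2 ^ j * v) v y →
      ∀ Y : ℝ, Ya * D ^ n ≤ Y → Y ≤ X → T ≤ Y * y ^ 2 →
        T * ∫ t in E ∩ A.largeSet (rung ε j) v, ‖Q.R κ Y t‖ * ‖G t‖ ∂gm T ≤ R * (2 * (4 ^ V)⁻¹ + fin)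

lemma LadderBound.step {ε κ T X Ya D Sb Γb Ub Lw fin R : ℝ} {hb : ℕ} {G : ℝ → ℂ} {E : Set ℝ} {n j V V' v₁ : ℕ} {K : ℝ}
    (h : LadderBound ε κ T X Ya D Sb Γb Ub Lw fin R hb G E n (j + 1) (V ^ 4) (V ^ 8))
    (hε : 0 < ε) (hε1 : ε ≤ 1 / 8) (hK : 140 / ε ≤ K) (hκ : 1 ≤ κ) (hT : 0 < T) (hR : 0 ≤ R) (hG : CB G)
    (hE : MeasurableSet E) (hYa : 0 ≤ Ya) (hSb : 0 ≤ Sb) (hΓb : 0 ≤ Γb)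
    (hv₁ : 1 ≤ v₁) (hblock : ∀ j v : ℕ, v₁ ≤ v → ∃ A : Law, ∃ y : ℝ, IsBlock A (2 ^ ((1 / 2 : ℝ) ^ j)) (32 * 2 ^ j * v) v y)
    (hQv : Real.sqrt (48 * κ ^ 2 * (Sb * 2) * (Γb * Real.exp 1)) ≤ 4 ^ v₁)
    (hGv : Real.sqrt (T * ∫ t, ‖G t‖ ^ 2 ∂gm T) ≤ 4 ^ v₁ * R)
    (hV : v₁ ≤ V) (hVV' : V ≤ V') (hV' : V' ≤ V ^ 2) (hD : (4:ℝ) ^ (V ^ 8 + 1) ≤ D)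
    (hj : K * 4 ^ j ≤ Real.log V) (hVl : Real.log V * (8 * Real.log V + 1) ≤ V) :
    LadderBound ε κ T X Ya D Sb Γb Ub Lw fin R hb G E (n + 1) j V V' := by
  obtain ⟨Q, lo, S, Γ, U, hQ, hlo, hlohb, hS, hΓ, hU, hLw, hInt⟩ := h
  have hV1 : 1 ≤ V := hv₁.trans hV
  have hV1' : (1:ℝ) ≤ V := by exact_mod_cast hV1
  have hK1 : 140 ≤ K := le_trans (by rw [le_div_iff₀ hε]; linarith) hK
  have h4j : (1:ℝ) ≤ 4 ^ j := one_le_pow₀ (by norm_num)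
  have hK4 : 140 ≤ K * 4 ^ j := hK1.trans (le_mul_of_one_le_right (by linarith) h4j)
  have hlogV : 140 ≤ Real.log V := hK4.trans hj
  have hVlt : (140:ℝ) ≤ V := hlogV.trans ((Real.log_le_sub_one_of_pos (by linarith)).trans (by linarith))
  have hVlt' : 140 ≤ V := by exact_mod_cast hVlt
  have hV24 : V ^ 2 < V ^ 4 := Nat.pow_lt_pow_right (by omega) (by norm_num)
  have hV48 : V ^ 4 ≤ V ^ 8 := Nat.pow_le_pow_right hV1 (by norm_num)
  have hV34 : V ^ 3 ≤ V ^ 4 := Nat.pow_le_pow_right hV1 (by norm_num)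
  have hV4 : V ≤ V ^ 4 := Nat.le_self_pow (by norm_num) V
  choose B yB hB using fun u : ℕ => fun hu : v₁ ≤ u => hblock (j + 1) u hu
  have hu1 : ∀ u ∈ Finset.Icc (V ^ 4) (V ^ 8), v₁ ≤ u := fun u hu => by
    have := (Finset.mem_Icc.1 hu).1; omega
  let B' : ℕ → Law := fun u => if hu : v₁ ≤ u then B u hu else one
  let y' : ℕ → ℝ := fun u => if hu : v₁ ≤ u then yB u hu else 1
  have hB' : ∀ u ∈ Finset.Icc (V ^ 4) (V ^ 8), IsBlock (B' u) (2 ^ ((1 / 2 : ℝ) ^ (j + 1))) (32 * 2 ^ (j + 1) * u) u (y' u) := by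
    intro u hu
    have := hu1 u hu
    simp only [B', y', this, dif_pos]
    exact hB u this
  have hVne : (Finset.Icc (V ^ 4) (V ^ 8)).Nonempty := Finset.nonempty_Icc.2 hV48
  have hab : ∀ u ∈ Finset.Icc (V ^ 4) (V ^ 8), V ^ 4 ≤ u ∧ u ≤ V ^ 8 := fun u hu => Finset.mem_Icc.1 hu
  have hP := invMix_primeLaw _ B' y' _ _ _ _ (Nat.one_le_pow _ _ hV1) hVne hab hB'
  set H := ∑ u ∈ Finset.Icc (V ^ 4) (V ^ 8), (1 / (u : ℝ)) with hH
  have hHl : Real.log V ≤ H := by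
    refine le_trans ?_ (log_le_sum_Icc_inv (V ^ 4) (V ^ 8) (Nat.one_le_pow _ _ hV1) hV48)
    refine Real.log_le_log (by linarith) ?_
    rw [le_div_iff₀ (by positivity)]
    have : V * V ^ 4 ≤ V ^ 8 + 1 := by
      calc V * V ^ 4 = V ^ 5 := by ring
        _ ≤ V ^ 8 := Nat.pow_le_pow_right hV1 (by norm_num)
        _ ≤ _ := Nat.le_succ _
    exact_mod_cast this
  have hHpos : 0 < H := by linarith
  have hM : 32 * 2 ^ (j + 1) / H ≤ (1 / 2) ^ (j + 1) := by
    rw [div_le_iff₀ hHpos]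
    have h1 : (1 / 2 : ℝ) ^ (j + 1) * (140 * 4 ^ j) ≤ (1 / 2) ^ (j + 1) * H :=
      mul_le_mul_of_nonneg_left ((mul_le_mul_of_nonneg_right hK1 (by positivity)).trans (hj.trans hHl)) (by positivity)
    have h2 : (1 / 2 : ℝ) ^ (j + 1) * (140 * 4 ^ j) = 70 * 2 ^ j := by
      have : (1 / 2 : ℝ) ^ j * 4 ^ j = 2 ^ j := by rw [← mul_pow]; norm_num
      rw [pow_succ]; linear_combination 70 * this
    have h3 : (32:ℝ) * 2 ^ (j + 1) = 64 * 2 ^ j := by rw [pow_succ]; ring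
    have h4 : (0:ℝ) ≤ 2 ^ j := by positivity
    linarith
  have hQ' := hP.good.prod hQ hlo ((Nat.pow_le_pow_right (by norm_num) (by omega)).trans hlo) (hlo.trans hlohb)
  have hhalf : (1 / 2 : ℝ) ^ j = (1 / 2) ^ (j + 1) + (1 / 2) ^ (j + 1) := by rw [pow_succ]; ring
  have hDpos : 0 < D := lt_of_lt_of_le (by positivity) hD
  have hD1 : 1 ≤ D := le_trans (one_le_pow₀ (by norm_num)) hD
  have hUQ := hQ.U_pos
  have hp1 : (1 / 2 : ℝ) ^ (j + 1) ≤ 1 := pow_le_one₀ (by norm_num) (by norm_num)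
  refine ⟨_, _, _, _, _, hQ', Nat.pow_le_pow_right (by norm_num) (show V' + 1 ≤ V ^ 4 by omega),
    (Nat.pow_le_pow_right (by norm_num) (by omega)).trans (hlo.trans hlohb), ?_, ?_, ?_, ?_, ?_⟩
  · rw [hhalf, Real.rpow_add (by norm_num)]
    calc _ ≤ (2:ℝ) ^ ((1 / 2 : ℝ) ^ (j + 1)) * (Sb * 2 ^ ((1 / 2 : ℝ) ^ (j + 1))) :=
          mul_le_mul_of_nonneg_left hS (by positivity)
      _ = _ := by ring
  · rw [hhalf, Real.exp_add]
    calc (1 + 32 * 2 ^ (j + 1) / H) * Γ ≤ Real.exp ((1 / 2) ^ (j + 1)) * (Γb * Real.exp ((1 / 2) ^ (j + 1))) := by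
          refine mul_le_mul ?_ hΓ (by linarith [hQ.one_le_Γ]) (by positivity)
          have := Real.add_one_le_exp ((1 / 2 : ℝ) ^ (j + 1))
          linarith
      _ = _ := by ring
  · rw [pow_succ]
    calc _ ≤ D * (Ub * D ^ n) := mul_le_mul hD hU hUQ.le hDpos.le
      _ = _ := by ring
  · intro i
    have h1 : 1 ≤ (invMix (Finset.Icc (V ^ 4) (V ^ 8)) B').y i.1 := by
      have h2 := hB' _ i.1.1.2
      have h3 : (B' i.1.1).y i.1.2 = _ := h2.y_eq i.1.2
      show 1 ≤ (B' i.1.1).y i.1.2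
      rw [h3]
      exact (one_le_pow₀ (by norm_num)).trans h2.le_y
    exact (hLw i.2).trans (le_mul_of_one_le_left (hQ.y_pos _).le h1)
  · intro v A y hvV hvV' hA Y hY1 hY2 hTY
    have hv1 : 1 ≤ v := by omega
    have hvV2 : v ≤ V ^ 2 := hvV'.trans hV'
    have hvR : (V:ℝ) ≤ v := by exact_mod_cast hvV
    have hvR2 : (v:ℝ) ≤ V ^ 2 := by exact_mod_cast hvV2
    have h4v : (4:ℝ) ^ v₁ ≤ 4 ^ v := pow_le_pow_right₀ (by norm_num) (by omega)
    have hmain := setIntegral_R_invMix_prod_le hQ (Finset.Icc (V ^ 4) (V ^ 8)) B' y' (32 * 2 ^ (j + 1)) _ _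
      (Nat.one_le_pow _ _ hV1) hVne hab hB' ε K hε hε1 hK j v hv1 (fun u hu => ?_) hA
      ((Nat.pow_le_pow_right (by norm_num) (by omega)).trans hlo)
      ((Nat.pow_le_pow_right (by norm_num) (by omega)).trans (hlo.trans hlohb)) κ T Y R
      (2 * (4 ^ (V ^ 4))⁻¹ + fin) hκ hT hR G hG E hE hTY ?_ ?_ (fun u hu => ?_)
    · refine hmain.trans (mul_le_mul_of_nonneg_left ?_ hR)
      have h1 : ((4:ℝ) ^ v)⁻¹ ≤ (4 ^ V)⁻¹ := inv_anti₀ (by positivity) (pow_le_pow_right₀ (by norm_num) hvV)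
      have h2 : ((4:ℝ) ^ (V ^ 4))⁻¹ ≤ (4 ^ (V + 1))⁻¹ :=
        inv_anti₀ (by positivity) (pow_le_pow_right₀ (by norm_num) (by omega))
      have h3 : ((4:ℝ) ^ (V + 1))⁻¹ = (4 ^ V)⁻¹ / 4 := by rw [pow_succ, mul_inv]; ring
      have h4 : 0 ≤ ((4:ℝ) ^ V)⁻¹ := by positivity
      linarith
    · obtain ⟨hu1, hu2⟩ := hab u hu
      have huR : (V:ℝ) ^ 4 ≤ u := by exact_mod_cast hu1
      have huR2 : (u:ℝ) ≤ V ^ 8 := by exact_mod_cast hu2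
      have hu0 : (0:ℝ) < u := lt_of_lt_of_le (by positivity) huR
      have hlu : Real.log u ≤ 8 * Real.log V := by
        have := Real.log_le_log hu0 huR2
        rwa [Real.log_pow] at this
      have hKV : K * 4 ^ j ≤ V := hj.trans ((Real.log_le_sub_one_of_pos (by linarith)).trans (by linarith))
      constructor
      · calc K * 4 ^ j * v ≤ V * V ^ 2 := mul_le_mul hKV hvR2 (by positivity) (by positivity)
          _ = (V:ℝ) ^ 3 := by ring
          _ ≤ V ^ 4 := pow_le_pow_right₀ hV1' (by norm_num)
          _ ≤ u := huR
      · calc K * 4 ^ j * (Real.log u + 1) ≤ Real.log V * (8 * Real.log V + 1) :=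
              mul_le_mul hj (by linarith) (by
                have : 0 ≤ Real.log u := Real.log_nonneg (le_trans (one_le_pow₀ hV1') huR)
                linarith) (by linarith)
          _ ≤ V := hVl
          _ ≤ v := hvR
    · refine le_trans (Real.sqrt_le_sqrt ?_) (hQv.trans h4v)
      have e1 : S ≤ Sb * 2 := by
        refine hS.trans (mul_le_mul_of_nonneg_left ?_ hSb)
        calc (2:ℝ) ^ ((1 / 2 : ℝ) ^ (j + 1)) ≤ 2 ^ (1:ℝ) := Real.rpow_le_rpow_of_exponent_le (by norm_num) hp1
          _ = 2 := by norm_num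
      have e2 : Γ ≤ Γb * Real.exp 1 := hΓ.trans (mul_le_mul_of_nonneg_left (Real.exp_le_exp.2 hp1) hΓb)
      refine mul_le_mul (mul_le_mul_of_nonneg_left e1 (by positivity)) e2 (by linarith [hQ.one_le_Γ]) (by positivity)
    · exact hGv.trans (mul_le_mul_of_nonneg_right h4v hR)
    · have hBu := hB' u hu
      obtain ⟨hu1, hu2⟩ := hab u hu
      have hyu1 : (4:ℝ) ^ u ≤ y' u := hBu.le_y
      have hyu0 : 0 < y' u := lt_of_lt_of_le (by positivity) hyu1
      have hyuD : y' u ≤ D := hBu.y_lt.le.trans ((pow_le_pow_right₀ (by norm_num) (by omega)).trans hD)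
      have hyu1' : 1 ≤ y' u := le_trans (one_le_pow₀ (by norm_num)) hyu1
      have hY0 : 0 ≤ Y := le_trans (by positivity) hY1
      refine hInt u (B' u) (y' u) hu1 hu2 hBu (Y / y' u) ?_ ((div_le_self hY0 hyu1').trans hY2) ?_
      · rw [le_div_iff₀ hyu0]
        calc Ya * D ^ n * y' u ≤ Ya * D ^ n * D := mul_le_mul_of_nonneg_left hyuD (by positivity)
          _ = Ya * D ^ (n + 1) := by ring
          _ ≤ Y := hY1
      · have hyA := hA.y_lt
        have hyA0 : 0 < y := lt_of_lt_of_le (by positivity) hA.le_y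
        have : y ^ 2 ≤ y' u := by
          calc y ^ 2 ≤ ((4:ℝ) ^ (v + 1)) ^ 2 := pow_le_pow_left₀ hyA0.le hyA.le 2
            _ = 4 ^ ((v + 1) * 2) := by rw [pow_mul]
            _ ≤ 4 ^ u := by
                refine pow_le_pow_right₀ (by norm_num) ?_
                have : 4 * V ^ 2 ≤ V ^ 2 * V ^ 2 := Nat.mul_le_mul_right _ (by nlinarith)
                have : V ^ 2 * V ^ 2 = V ^ 4 := by ring
                omega
            _ ≤ _ := hyu1
        calc T ≤ Y * y ^ 2 := hTY
          _ ≤ Y * y' u := mul_le_mul_of_nonneg_left this hY0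
          _ = Y / y' u * y' u ^ 2 := by field_simp

lemma LadderBound.of_base {ε κ T X Ya D Sb Γb Ub Lw fin R w : ℝ} {hb : ℕ} {G : ℝ → ℂ} {E : Set ℝ} {v₁ : ℕ} {K : ℝ}
    (hbase : ∀ n j V V' : ℕ, v₁ ≤ V → V ≤ V' → w ≤ V → (V' : ℝ) ≤ w ^ 8 → K * 4 ^ j ≤ Real.log V →
      LadderBound ε κ T X Ya D Sb Γb Ub Lw fin R hb G E n j V V')
    (hε : 0 < ε) (hε1 : ε ≤ 1 / 8) (hK : 140 / ε ≤ K) (hκ : 1 ≤ κ) (hT : 0 < T) (hR : 0 ≤ R) (hG : CB G)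
    (hE : MeasurableSet E) (hYa : 0 ≤ Ya) (hSb : 0 ≤ Sb) (hΓb : 0 ≤ Γb)
    (hv₁ : 1 ≤ v₁) (hblock : ∀ j v : ℕ, v₁ ≤ v → ∃ A : Law, ∃ y : ℝ, IsBlock A (2 ^ ((1 / 2 : ℝ) ^ j)) (32 * 2 ^ j * v) v y)
    (hQv : Real.sqrt (48 * κ ^ 2 * (Sb * 2) * (Γb * Real.exp 1)) ≤ 4 ^ v₁)
    (hGv : Real.sqrt (T * ∫ t, ‖G t‖ ^ 2 ∂gm T) ≤ 4 ^ v₁ * R) (hD : (4:ℝ) ^ (w ^ 8 + 1) ≤ D)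
    (hVl : ∀ V : ℕ, v₁ ≤ V → Real.log V * (8 * Real.log V + 1) ≤ V) :
    ∀ n j V V' : ℕ, v₁ ≤ V → V ≤ V' → V' ≤ V ^ 2 → (V' : ℝ) ≤ w ^ 8 → K * 4 ^ j ≤ Real.log V → w ≤ (V : ℝ) ^ 4 ^ n →
      LadderBound ε κ T X Ya D Sb Γb Ub Lw fin R hb G E n j V V' := by
  intro n
  induction n with
  | zero =>
    intro j V V' h1 h2 h3 h4 h5 h6
    exact hbase 0 j V V' h1 h2 (by simpa using h6) h4 h5
  | succ n ih =>
    intro j V V' h1 h2 h3 h4 h5 h6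
    rcases le_or_gt w V with hw | hw
    · exact hbase _ j V V' h1 h2 hw h4 h5
    · have hV1 : 1 ≤ V := hv₁.trans h1
      have hV8 : (V : ℝ) ^ 8 ≤ w ^ 8 := pow_le_pow_left₀ (by positivity) hw.le 8
      refine LadderBound.step (K := K) (ih (j + 1) (V ^ 4) (V ^ 8) (h1.trans (Nat.le_self_pow (by norm_num) V))
        (Nat.pow_le_pow_right hV1 (by norm_num)) (by rw [← pow_mul]) (by exact_mod_cast hV8) ?_ ?_)
        hε hε1 hK hκ hT hR hG hE hYa hSb hΓb hv₁ hblock hQv hGv h1 h2 h3 ?_ h5 (hVl V h1)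
      · push_cast
        rw [Real.log_pow, pow_succ]; push_cast; linarith
      · refine h6.trans (le_of_eq ?_)
        push_cast
        rw [← pow_mul, pow_succ, mul_comm]
      · refine le_trans ?_ hD
        rw [← Real.rpow_natCast]
        refine Real.rpow_le_rpow_of_exponent_le (by norm_num) ?_
        push_cast
        linarith

end Law

lemma list_prod_bounds (L : List ℕ) (f : ℕ → ℝ) (a b : ℝ) (ha : 0 ≤ a) (h : ∀ v ∈ L, a ≤ f v ∧ f v ≤ b) :
    a ^ L.length ≤ (L.map f).prod ∧ (L.map f).prod ≤ b ^ L.length := by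
  induction L with
  | nil => simp
  | cons v L ih =>
    have h1 := h v (by simp)
    have h2 := ih fun u hu => h u (by simp [hu])
    have h3 : 0 ≤ a ^ L.length := by positivity
    simp only [List.map_cons, List.prod_cons, List.length_cons, pow_succ']
    exact ⟨mul_le_mul h1.1 h2.1 h3 (ha.trans h1.1),
      mul_le_mul h1.2 h2.2 (h3.trans h2.1) (ha.trans (h1.1.trans h1.2))⟩

/-- The largest scale `v` with `4 ^ v ≤ X ^ η`. -/
noncomputable def topScale (η X : ℝ) : ℕ := ⌊η * Real.log X / Real.log 4⌋₊

lemma four_pow_topScale_le (η X : ℝ) (hη : 0 ≤ η) (hX : 1 ≤ X) : (4:ℝ) ^ topScale η X ≤ X ^ η := by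
  have h4 : 0 < Real.log 4 := Real.log_pos (by norm_num)
  have h := Nat.floor_le (show 0 ≤ η * Real.log X / Real.log 4 from
    div_nonneg (mul_nonneg hη (Real.log_nonneg hX)) h4.le)
  rw [le_div_iff₀ h4] at h
  rw [← Real.rpow_natCast, Real.rpow_def_of_pos (by norm_num), Real.rpow_def_of_pos (by linarith)]
  refine Real.exp_le_exp.2 ?_
  unfold topScale
  linarith

lemma le_four_pow_topScale (η X : ℝ) (hX : 1 ≤ X) : X ^ η ≤ (4:ℝ) ^ (topScale η X + 1) := by
  have h4 : 0 < Real.log 4 := Real.log_pos (by norm_num)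
  have h := (Nat.lt_floor_add_one (η * Real.log X / Real.log 4)).le
  rw [div_le_iff₀ h4] at h
  rw [← Real.rpow_natCast, Real.rpow_def_of_pos (by linarith), Real.rpow_def_of_pos (by norm_num)]
  refine Real.exp_le_exp.2 ?_
  unfold topScale
  push_cast
  linarith

lemma topScale_le_log (η X : ℝ) (hη : 0 ≤ η) (hη1 : η ≤ 1) (hX : 1 ≤ X) : (topScale η X : ℝ) + 1 ≤ Real.log X + 1 := by
  have h4 : 1 ≤ Real.log 4 := by
    rw [Real.le_log_iff_exp_le (by norm_num)]; linarith [Real.exp_one_lt_d9]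
  have hl := Real.log_nonneg hX
  have h := Nat.floor_le (show 0 ≤ η * Real.log X / Real.log 4 from
    div_nonneg (mul_nonneg hη hl) (by linarith))
  have : η * Real.log X / Real.log 4 ≤ Real.log X :=
    (div_le_self (mul_nonneg hη hl) h4).trans (mul_le_of_le_one_left hl hη1)
  unfold topScale
  linarith

lemma four_pow_scale_ge (η r X : ℝ) (v : ℕ) (hr : 0 ≤ r) (hr1 : r ≤ 1) (hX : 1 ≤ X)
    (hv : ⌈(1 - r) * topScale η X⌉₊ ≤ v) : X ^ (η * (1 - r)) / 4 ≤ (4:ℝ) ^ v := by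
  have hXp : 0 < X := by linarith
  have h1 : (1 - r) * topScale η X ≤ v := (Nat.le_ceil _).trans (by exact_mod_cast hv)
  have h2 : (4:ℝ) ^ ((1 - r) * (topScale η X : ℝ)) ≤ (4:ℝ) ^ v := by
    rw [← Real.rpow_natCast (4:ℝ) v]
    exact Real.rpow_le_rpow_of_exponent_le (by norm_num) h1
  refine le_trans ?_ h2
  have h3 := Real.rpow_le_rpow (by positivity) (le_four_pow_topScale η X hX) (show 0 ≤ 1 - r by linarith)
  rw [← Real.rpow_mul hXp.le] at h3
  rw [div_le_iff₀ (by norm_num)]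
  refine h3.trans ?_
  rw [← Real.rpow_natCast, ← Real.rpow_mul (by norm_num)]
  calc (4:ℝ) ^ (((topScale η X + 1 : ℕ) : ℝ) * (1 - r)) ≤ 4 ^ ((1 - r) * (topScale η X : ℝ) + 1) := by
        refine Real.rpow_le_rpow_of_exponent_le (by norm_num) ?_
        push_cast
        linarith
    _ = _ := by rw [Real.rpow_add (by norm_num), Real.rpow_one]

namespace Law

/-- Contribution of the set where one base block polynomial is large. -/
lemma eventually_setIntegral_pow_mix_le (d η s q δ c : ℝ) (N l : ℕ) (hd : 0 < d) (hd1 : d ≤ 1 / 4) (hη : 0 < η)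
    (hηd : η ≤ d) (hl : ((l : ℝ) + 1) * η = 1 - d) (hs : 0 < s) (hδ : 0 ≤ δ) (hq : 0 < q) (hN : N * δ ≤ 1 / 4)
    (κ : ℝ)
    (hD : ∀ᶠ X : ℝ in Filter.atTop, ∀ Z t : ℝ, X ^ (d / 2) ≤ Z → Z ≤ X ^ (2 * d) → X ^ (d / 16) ≤ |t| →
      |t| ≤ X ^ (2 : ℝ) → ‖dz κ Z t‖ ≤ X ^ (-c)) :
    ∀ᶠ X : ℝ in Filter.atTop, ∀ (V : Finset ℕ) (W : ℕ → ℝ) (B : ℕ → Law) (T τ ω R : ℝ) (G : ℝ → ℂ),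
      V ⊆ Finset.Icc ⌈(1 - d / 4) * topScale η X⌉₊ (topScale η X) →
      (∀ v ∈ V, 0 ≤ W v) → ∑ v ∈ V, W v = 1 → (∀ v ∈ V, IsBlock (B v) 4 (16 * v) v (4 ^ v)) →
      1 ≤ T → T ≤ X → 0 ≤ τ → τ ≤ 1 → T ≤ X ^ (τ + s / 2) → CB G → (∀ t, ‖G t‖ ≤ R) → 0 ≤ R →
      T * ∫ t, ‖G t‖ ^ 2 ∂gm T ≤ R ^ 2 * X ^ ω →
      (∀ g : ℕ, g < N →
        -((1 - 3 * d) * (g * δ)) - c + (τ * ((g + 1) * δ) / (1 - 2 * ((g + 1) * δ)) + 4 * s + η) ≤ -(2 * q) ∨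
        2 * (-((1 - 3 * d) * (g * δ)) - c) + (τ * ((g + 1) * δ) / (1 - 2 * ((g + 1) * δ)) + 4 * s + η) + ω ≤ -(4 * q)) →
      ∀ v ∈ V, ∀ Y : ℝ, X ^ (1 - d / 4) ≤ Y → Y ≤ X →
        T * ∫ t in {t | X ^ (d / 16) < |t| ∧ |t| ≤ T * Real.log X} ∩ (B v).largeSet (N * δ) v,
          ‖((mix V W B).pow l).R κ (Y / 4 ^ v) t‖ * ‖G t‖ ∂gm T ≤ R * X ^ (-q) := by
  filter_upwards [eventually_setIntegral_prod_le η s 16 δ q N hη hs (by norm_num) hδ hq hN, hD,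
    Filter.eventually_ge_atTop (Real.exp 1), eventually_log_pow_le 1 1 (s / 2) (by positivity),
    eventually_log_pow_le 1 1 1 (by norm_num),
    eventually_const_le (4 ^ (l + 1)) (d / 4) (by positivity), eventually_const_le 4 (η / 4) (by positivity)]
    with X hprod hD hXe hXs hX2 hX4 hX4'
  intro V W B T τ ω R G hV hW hW1 hB hT1 hTX hτ0 hτ1 hTτ hG hGR hR hG2 hcond v₀ hv₀ Y hY1 hY2
  have hX1 : 1 ≤ X := le_trans (by linarith [Real.add_one_le_exp 1]) hXe
  have hXp : 0 < X := by linarith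
  have hTp : 0 < T := by linarith
  have hlog1 : 1 ≤ Real.log X := (Real.le_log_iff_exp_le hXp).2 hXe
  rw [pow_one, one_mul] at hXs hX2
  rw [Real.rpow_one] at hX2
  have hd4 : d / 4 ≤ 1 := by linarith
  set yl : ℝ := X ^ (η * (1 - d / 4)) / 4 with hyl
  have hyl0 : 0 < yl := by positivity
  have hlη : (l : ℝ) * η = 1 - d - η := by linarith
  have hη1 : η ≤ 1 := by linarith
  have hyb : ∀ v ∈ V, yl ≤ (4:ℝ) ^ v ∧ (4:ℝ) ^ v ≤ X ^ η := fun v hv => by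
    have := Finset.mem_Icc.1 (hV hv)
    exact ⟨four_pow_scale_ge η (d / 4) X v (by positivity) (by linarith) hX1 this.1,
      (pow_le_pow_right₀ (by norm_num) this.2).trans (four_pow_topScale_le η X hη.le hX1)⟩
  have hylη : X ^ (η / 2) ≤ yl := by
    rw [hyl, le_div_iff₀ (by norm_num)]
    calc X ^ (η / 2) * 4 ≤ X ^ (η / 2) * X ^ (η / 4) := mul_le_mul_of_nonneg_left hX4' (by positivity)
      _ = X ^ (η / 2 + η / 4) := by rw [Real.rpow_add hXp]
      _ ≤ _ := Real.rpow_le_rpow_of_exponent_le hX1 (by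
        have : η * (d / 4) ≤ η * (1 / 16) := mul_le_mul_of_nonneg_left (by linarith) hη.le
        linarith)
  have hcard : (V.card : ℝ) ≤ Real.log X := by
    have hmem := Finset.mem_Icc.1 (hV hv₀)
    have h1 : V.card ≤ topScale η X + 1 := (Finset.card_le_card hV).trans (by
      rw [Nat.card_Icc]; omega)
    have h1' : (V.card : ℝ) ≤ topScale η X + 1 := by exact_mod_cast h1
    have h4 : (1:ℝ) < Real.log 4 := by
      rw [Real.lt_log_iff_exp_lt (by norm_num)]; linarith [Real.exp_one_lt_d9]
    have h2 := Nat.floor_le (show 0 ≤ η * Real.log X / Real.log 4 from by positivity)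
    have h3 : η * Real.log X / Real.log 4 ≤ η * Real.log X := div_le_self (by positivity) h4.le
    have h5 : (topScale η X : ℝ) ≤ η * Real.log X := h2.trans h3
    have h6 : η * Real.log X ≤ 1 / 4 * Real.log X := mul_le_mul_of_nonneg_right (by linarith) (by linarith)
    have h7 : (4:ℝ) ≤ X ^ (1 / 16 : ℝ) := hX4'.trans (Real.rpow_le_rpow_of_exponent_le hX1 (by linarith))
    have h8 : Real.log 4 ≤ 1 / 16 * Real.log X := by
      have := Real.log_le_log (by norm_num) h7
      rwa [Real.log_rpow hXp] at this
    linarith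
  have hEm : MeasurableSet ({t : ℝ | X ^ (d / 16) < |t| ∧ |t| ≤ T * Real.log X} ∩ (B v₀).largeSet (N * δ) v₀) :=
    ((measurableSet_lt measurable_const continuous_abs.measurable).inter
      (measurableSet_le continuous_abs.measurable measurable_const)).inter (measurableSet_largeSet _ _ _)
  set E := {t : ℝ | X ^ (d / 16) < |t| ∧ |t| ≤ T * Real.log X} ∩ (B v₀).largeSet (N * δ) v₀ with hE
  have hT1' : 1 ≤ T * Real.log X := one_le_mul_of_one_le_of_one_le hT1 hlog1
  have hTs : T * Real.log X ≤ X ^ (τ + s) := by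
    calc T * Real.log X ≤ X ^ (τ + s / 2) * X ^ (s / 2) := mul_le_mul hTτ hXs (by linarith) (by positivity)
      _ = X ^ (τ + s) := by rw [← Real.rpow_add hXp]; congr 1; ring
  have hY0 : 0 < Y := lt_of_lt_of_le (by positivity) hY1
  have h4l : (0:ℝ) < 4 ^ (l + 1) := by positivity
  have key := setIntegral_R_pow_mix_le V W B κ (fun v => (4:ℝ) ^ v) hW hW1
    (fun v hv i => ((hB v hv).primeLaw.prime i).ne_zero) (fun v hv => (hB v hv).y_eq) (μ := gm T) E (R * X ^ (-q) / T)
    l (Y / 4 ^ v₀) (fun t => ‖G t‖) hG.norm (fun _ => norm_nonneg _) (fun L hLl hL => ?_)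
  · rw [le_div_iff₀ hTp] at key
    linarith
  · rw [le_div_iff₀ hTp, mul_comm]
    obtain ⟨hP1, hP2⟩ := list_prod_bounds L (fun v => (4:ℝ) ^ v) yl (X ^ η) hyl0.le (fun v hv => hyb v (hL v hv))
    rw [hLl] at hP1 hP2
    set P := (L.map fun v => (4:ℝ) ^ v).prod with hP
    have hPp : 0 < P := lt_of_lt_of_le (by positivity) hP1
    obtain ⟨h01, h02⟩ := hyb v₀ hv₀
    have h4v : (0:ℝ) < 4 ^ v₀ := by positivity
    have hZ1 : X ^ (d / 2) ≤ Y / 4 ^ v₀ / P := by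
      rw [div_div, le_div_iff₀ (by positivity)]
      calc X ^ (d / 2) * (4 ^ v₀ * P) ≤ X ^ (d / 2) * (X ^ η * (X ^ η) ^ l) :=
            mul_le_mul_of_nonneg_left (mul_le_mul h02 hP2 hPp.le (by positivity)) (by positivity)
        _ = X ^ (d / 2 + (1 - d)) := by
            rw [← pow_succ', ← Real.rpow_natCast, ← Real.rpow_mul hXp.le, ← Real.rpow_add hXp, ← hl]
            congr 1; push_cast; ring
        _ ≤ X ^ (1 - d / 4) := Real.rpow_le_rpow_of_exponent_le hX1 (by linarith)
        _ ≤ Y := hY1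
    have hdd : d * d ≤ d * (1 / 4) := mul_le_mul_of_nonneg_left hd1 hd.le
    have hylpow : ∀ m : ℕ, yl ^ m = X ^ (η * (1 - d / 4) * m) / 4 ^ m := fun m => by
      rw [hyl, div_pow, ← Real.rpow_natCast (X ^ _) m, ← Real.rpow_mul hXp.le]
    have hZ2 : Y / 4 ^ v₀ / P ≤ X ^ (2 * d) := by
      rw [div_div, div_le_iff₀ (by positivity)]
      have h1 : X ^ (1 - 2 * d) ≤ 4 ^ v₀ * P := by
        calc X ^ (1 - 2 * d) ≤ yl * yl ^ l := by
              rw [← pow_succ', hylpow, le_div_iff₀ h4l]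
              calc X ^ (1 - 2 * d) * 4 ^ (l + 1) ≤ X ^ (1 - 2 * d) * X ^ (d / 4) :=
                    mul_le_mul_of_nonneg_left hX4 (by positivity)
                _ = X ^ (1 - 2 * d + d / 4) := by rw [Real.rpow_add hXp]
                _ ≤ _ := by
                    refine Real.rpow_le_rpow_of_exponent_le hX1 ?_
                    have : η * (1 - d / 4) * ((l + 1 : ℕ) : ℝ) = (1 - d) * (1 - d / 4) := by
                      rw [← hl]; push_cast; ring
                    rw [this]
                    have : (1 - d) * (1 - d / 4) = 1 - d - d / 4 + d * d / 4 := by ring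
                    have : 0 ≤ d * d := by positivity
                    linarith
          _ ≤ _ := mul_le_mul h01 hP1 (by positivity) h4v.le
      calc Y ≤ X := hY2
        _ = X ^ (2 * d) * X ^ (1 - 2 * d) := by
            rw [← Real.rpow_add hXp]; conv_lhs => rw [← Real.rpow_one X]
            congr 1; ring
        _ ≤ _ := mul_le_mul_of_nonneg_left h1 (by positivity)
    refine hprod V B (fun v => (4:ℝ) ^ v) T (T * Real.log X) τ c (1 - 3 * d) ω R κ (Y / 4 ^ v₀ / P) E G v₀ L hcard
      (fun v hv => ⟨_, _, _, _, (hB v hv).primeLaw, ?_⟩) (fun v hv => (hB v hv).y_eq)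
      (fun v hv => ⟨hylη.trans (hyb v hv).1, (hyb v hv).2.trans (Real.rpow_le_rpow_of_exponent_le hX1 (by linarith))⟩)
      hTp hT1' hTs hτ0 hτ1 hEm (fun t ht => ht.1.2) (fun t ht => ?_) hG hGR hR hG2 hv₀ (fun t ht => ?_) hL
      (by linarith) ?_ hcond
    · have h1 := topScale_le_log η X hη.le hη1 hX1
      have h2 : (v : ℝ) ≤ topScale η X := by exact_mod_cast (Finset.mem_Icc.1 (hV hv)).2
      linarith
    · refine hD _ t hZ1 hZ2 ht.1.1.le (ht.1.2.trans ?_)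
      calc T * Real.log X ≤ X * X := mul_le_mul hTX hX2 (by linarith) hXp.le
        _ = X ^ (2:ℝ) := by rw [Real.rpow_two, sq]
    · have := ht.2
      simp only [largeSet, Set.mem_ofPred_eq] at this
      refine lt_of_eq_of_lt ?_ this
      rw [← Real.rpow_natCast, ← Real.rpow_mul (by norm_num)]
      congr 1; ring
    · refine le_trans ?_ hP1
      rw [hylpow, le_div_iff₀ (by positivity)]
      calc X ^ (1 - 3 * d) * 4 ^ l ≤ X ^ (1 - 3 * d) * X ^ (d / 4) := by
            refine mul_le_mul_of_nonneg_left (le_trans ?_ hX4) (by positivity)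
            exact pow_le_pow_right₀ (by norm_num) (by omega)
        _ = X ^ (1 - 3 * d + d / 4) := by rw [Real.rpow_add hXp]
        _ ≤ _ := by
            refine Real.rpow_le_rpow_of_exponent_le hX1 ?_
            have : η * (1 - d / 4) * (l : ℝ) = (1 - d - η) * (1 - d / 4) := by rw [← hlη]; ring
            rw [this]
            have : (1 - d - η) * (1 - d / 4) = 1 - d - η - d / 4 + d * d / 4 + η * (d / 4) := by ring
            have : 0 ≤ d * d := by positivity
            have : 0 ≤ η * (d / 4) := by positivity
            linarith

end Law

namespace Law

lemma pow_y_ge (A : Law) (b : ℝ) (hb : 0 ≤ b) (h : ∀ i, b ≤ A.y i) (k : ℕ) : ∀ i, b ^ k ≤ (A.pow k).y i := by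
  induction k with
  | zero => intro i; simp [pow, one]
  | succ k ih =>
    intro i
    rw [pow_succ']
    exact mul_le_mul (h i.1) (ih i.2) (by positivity) (hb.trans (h i.1))

lemma setIntegral_largeSet_mono (A : Law) {a a' : ℝ} (haa' : a ≤ a') (v : ℕ) {T C : ℝ} (hT : 0 ≤ T) {f : ℝ → ℝ}
    (hf : CB f) (hf0 : ∀ t, 0 ≤ f t) (E : Set ℝ)
    (h : T * ∫ t in E ∩ A.largeSet a' v, f t ∂gm T ≤ C) : T * ∫ t in E ∩ A.largeSet a v, f t ∂gm T ≤ C := by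
  refine le_trans (mul_le_mul_of_nonneg_left ?_ hT) h
  refine setIntegral_mono_set hf.integrable.integrableOn (Filter.Eventually.of_forall hf0)
    (Filter.Eventually.of_forall fun t ht => ?_)
  refine ⟨ht.1, ?_⟩
  have h2 : (4:ℝ) ^ (-(a * v)) < ‖A.poly t‖ := ht.2
  show (4:ℝ) ^ (-(a' * v)) < ‖A.poly t‖
  refine lt_of_le_of_lt ?_ h2
  refine Real.rpow_le_rpow_of_exponent_le (by norm_num) ?_
  have := mul_le_mul_of_nonneg_right haa' (Nat.cast_nonneg (α := ℝ) v)
  linarith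

lemma LadderBound.base {ε κ T X Ya D fin R M U : ℝ} {hb a b l : ℕ} {G : ℝ → ℂ} {E : Set ℝ} {n j V V' : ℕ} {K : ℝ}
    {B : ℕ → Law}
    (hε : 0 < ε) (hε1 : ε ≤ 1 / 8) (hK : 140 / ε ≤ K) (hκ : 1 ≤ κ) (hT : 0 < T) (hR : 0 ≤ R) (hG : CB G)
    (hE : MeasurableSet E) (hYa : 0 ≤ Ya) (hD : 1 ≤ D)
    (hB : ∀ v ∈ Finset.Icc a b, IsBlock (B v) 4 (16 * v) v (4 ^ v)) (hab : a ≤ b)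
    (hP : PrimeLaw (invMix (Finset.Icc a b) B) (4 ^ a) hb 4 M U) (hbhb : 4 ^ (b + 1) ≤ hb)
    (hQv : Real.sqrt (48 * κ ^ 2 * (4 ^ (l + 1) * 2) * ((1 + (l + 1) * M) ^ (l + 1) * Real.exp 1)) ≤ 4 ^ V)
    (hGv : Real.sqrt (T * ∫ t, ‖G t‖ ^ 2 ∂gm T) ≤ 4 ^ V * R)
    (hV : 1 ≤ V) (hV' : V' + 1 ≤ a)
    (hnum1 : K * 4 ^ j * V' ≤ a) (hnum2 : K * 4 ^ j * (Real.log b + 1) ≤ V)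
    (hrec : ∀ u ∈ Finset.Icc a b, ∀ Y, Ya ≤ Y → Y ≤ X →
      T * ∫ t in E ∩ (B u).largeSet (1 / 4 - ε) u,
        ‖((invMix (Finset.Icc a b) B).pow l).R κ (Y / 4 ^ u) t‖ * ‖G t‖ ∂gm T ≤ R * fin) :
    LadderBound ε κ T X Ya D (4 ^ (l + 1)) ((1 + (l + 1) * M) ^ (l + 1)) (U ^ (l + 1)) ((4 ^ a) ^ (l + 1)) fin R
      hb G E n j V V' := by
  have hM := hP.M_nonneg
  have hK0 : 0 < K := lt_of_lt_of_le (by positivity) hK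
  have ha1 : 1 ≤ a := by omega
  have hQ := hP.pow_good l
  have hQ' := hP.pow_good (l + 1)
  have hU := hQ'.U_pos
  have h2 : (1:ℝ) ≤ 2 ^ ((1 / 2 : ℝ) ^ j) := Real.one_le_rpow (by norm_num) (by positivity)
  have h3 : (1:ℝ) ≤ Real.exp ((1 / 2) ^ j) := Real.one_le_exp (by positivity)
  have h4 : (1:ℝ) ≤ 2 * Real.exp 1 := by have := Real.add_one_le_exp (1:ℝ); linarith
  refine ⟨_, _, _, _, _, hQ', Nat.pow_le_pow_right (by norm_num) hV',
    (Nat.pow_le_pow_right (by norm_num) (by omega)).trans hbhb, le_mul_of_one_le_right (by positivity) h2, ?_,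
    le_mul_of_one_le_right hU.le (one_le_pow₀ hD), ?_, ?_⟩
  · push_cast
    exact le_mul_of_one_le_right (by positivity) h3
  · refine pow_y_ge _ _ (by positivity) (fun i => ?_) _
    have h5 := hB _ i.1.2
    have h6 : (B i.1.1).y i.2 = _ := h5.y_eq i.2
    show _ ≤ (B i.1.1).y i.2
    rw [h6]
    exact pow_le_pow_right₀ (by norm_num) (Finset.mem_Icc.1 i.1.2).1
  · intro v A y hvV hvV' hA Y hY1 hY2 hTY
    have hvR : (V:ℝ) ≤ v := by exact_mod_cast hvV
    have hvR' : (v:ℝ) ≤ V' := by exact_mod_cast hvV'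
    have h4v : (4:ℝ) ^ V ≤ 4 ^ v := pow_le_pow_right₀ (by norm_num) hvV
    have hY : Ya ≤ Y := (le_mul_of_one_le_right hYa (one_le_pow₀ hD)).trans hY1
    have hmain := setIntegral_R_invMix_prod_le hQ (Finset.Icc a b) B (fun v => 4 ^ v) 16 a b ha1
      (Finset.nonempty_Icc.2 hab) (fun u hu => Finset.mem_Icc.1 hu) hB ε K hε hε1 hK j v (hV.trans hvV) (fun u hu => ?_) hA
      (Nat.pow_le_pow_right (by norm_num) (by omega))
      ((Nat.pow_le_pow_right (by norm_num) (by omega)).trans hbhb) κ T Y R fin hκ hT hR G hG E hE hTY ?_ ?_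
      (fun u hu => ?_)
    · refine hmain.trans (mul_le_mul_of_nonneg_left ?_ hR)
      have h1 : ((4:ℝ) ^ v)⁻¹ ≤ (4 ^ V)⁻¹ := inv_anti₀ (by positivity) h4v
      have h4 : 0 ≤ ((4:ℝ) ^ V)⁻¹ := by positivity
      linarith
    · obtain ⟨hu1, hu2⟩ := Finset.mem_Icc.1 hu
      have hu1R : (a:ℝ) ≤ u := by exact_mod_cast hu1
      have hu2R : (u:ℝ) ≤ b := by exact_mod_cast hu2
      have hu0 : (0:ℝ) < u := by exact_mod_cast (show 0 < u by omega)
      constructor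
      · exact (mul_le_mul_of_nonneg_left hvR' (by positivity)).trans (hnum1.trans hu1R)
      · refine le_trans ?_ (hnum2.trans hvR)
        have := Real.log_le_log hu0 hu2R
        exact mul_le_mul_of_nonneg_left (by linarith) (by positivity)
    · refine le_trans (Real.sqrt_le_sqrt ?_) (hQv.trans h4v)
      have e1 : (4:ℝ) ^ l ≤ 4 ^ (l + 1) * 2 := by rw [pow_succ]; linarith [show (0:ℝ) < 4 ^ l by positivity]
      have e2 : (1 + (l:ℝ) * M) ^ l ≤ (1 + (l + 1) * M) ^ (l + 1) * Real.exp 1 := by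
        have e3 : (1:ℝ) ≤ 1 + (l + 1) * M := by have : 0 ≤ ((l:ℝ) + 1) * M := by positivity
                                                linarith
        calc (1 + (l:ℝ) * M) ^ l ≤ (1 + (l + 1) * M) ^ l :=
              pow_le_pow_left₀ (by positivity) (by linarith) l
          _ ≤ (1 + (l + 1) * M) ^ (l + 1) := pow_le_pow_right₀ e3 (by omega)
          _ ≤ _ := le_mul_of_one_le_right (by positivity) (Real.one_le_exp (by norm_num))
      exact mul_le_mul (mul_le_mul_of_nonneg_left e1 (by positivity)) e2 (by positivity) (by positivity)
    · exact hGv.trans (mul_le_mul_of_nonneg_right h4v hR)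
    · refine setIntegral_largeSet_mono (B u) ?_ u hT.le ((Law.CB_R _ _ _).norm.mul hG.norm)
        (fun t => mul_nonneg (norm_nonneg _) (norm_nonneg _)) E (hrec u hu Y hY hY2)
      unfold rung
      have : 0 ≤ ε * (1 / 2) ^ (j + 1) := by positivity
      linarith

/-- If the integral over the medium frequencies is small then no point of `Q` can be bad. -/
lemma Good.card_eq_zero_of_setIntegral_le {F : Law} {lo hi : ℕ} {S Γ U : ℝ} (hF : F.Good lo hi S Γ U)
    (X h T T₀ T₁ θ Lw : ℝ) (Q : Finset ℕ)
    (hX : 1 ≤ X) (hh : 0 < h) (hhX : h ≤ X) (hT₀ : 1 ≤ T₀) (hT : T₀ ≤ T) (hTX : T ≤ X) (hThX : X ≤ h * T)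
    (hU : 4 * S * T₀ * U ≤ X) (hQ : ∀ x ∈ Q, X ≤ (x : ℝ) ∧ (x : ℝ) ≤ 2 * X)
    (hsep : ∀ x ∈ Q, ∀ x' ∈ Q, x ≠ x' → h ≤ |(x : ℝ) - x'|) (hθ : 0 ≤ θ) (hhi : (hi : ℝ) ≤ X ^ θ)
    (hLw : ∀ i, Lw ≤ F.y i) (hLwX : 8 * X ≤ X ^ θ * Lw)
    (hbad : ∀ x ∈ Q, ¬ ∃ n : ℕ, x < n ∧ (n : ℝ) ≤ (x : ℝ) + h ∧ ∀ p : ℕ, p.Prime → p ∣ n → (p : ℝ) ≤ (x : ℝ) ^ θ)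
    (h1 : Real.exp (-((T * h / X) ^ 2 / (2048 * S ^ 2))) * (1200 * Real.sqrt (S ^ 3 * Γ * T * Q.card)) ≤ Q.card / 4)
    (h2 : 32 * S / Real.sqrt T₀ + 32 * S * T * Real.exp (4 - 4 * T₁ / T) ≤ 1 / 4)
    (h3 : T * ∫ t in {t | Real.sqrt T₀ < |t| ∧ |t| ≤ T₁},
        ‖F.R (16 * S) (X / (2 * S)) t‖ * ‖∑ x ∈ Q, ch (-t) (x + h / 2)‖ ∂gm T ≤ Q.card / 4) : Q.card = 0 := by
  have hS := hF.one_le_S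
  have hXp : 0 < X := by linarith
  have hmain := hF.card_le_setIntegral X h T T₀ T₁ Q hXp hh hhX hT₀ hT hTX hThX hU hQ hsep
    (fun x hx i m hm hxm => ?_)
  · have h0 : (0:ℝ) ≤ Q.card := Nat.cast_nonneg _
    have h4 := mul_le_mul_of_nonneg_right h2 h0
    have : (Q.card : ℝ) ≤ 0 := by linarith
    exact_mod_cast le_antisymm this h0
  · by_contra hcon
    rw [not_lt] at hcon
    refine hbad x hx ⟨F.s i * m, hxm, by push_cast; exact hcon, fun p hp hpd => ?_⟩
    have hxX : X ^ θ ≤ (x : ℝ) ^ θ := Real.rpow_le_rpow hXp.le (hQ x hx).1 hθ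
    refine le_trans ?_ hxX
    rcases (hp.dvd_mul).1 hpd with hps | hpm
    · have := (hF.primes i p hp hps).2.le
      exact le_trans (by exact_mod_cast this) hhi
    · have hm0 : 0 < m := lt_of_le_of_lt (Nat.zero_le _) (Finset.mem_Ioc.1 hm).1
      have hpm' : (p : ℝ) ≤ m := by exact_mod_cast Nat.le_of_dvd hm0 hpm
      have hyi : 0 < F.y i := hF.y_pos i
      have hm2 : (m : ℝ) ≤ 16 * S * (X / (2 * S) / F.y i) :=
        (Nat.cast_le.2 (Finset.mem_Ioc.1 hm).2).trans (Nat.floor_le (by positivity))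
      have e : 16 * S * (X / (2 * S) / F.y i) = 8 * X / F.y i := by
        field_simp; ring
      rw [e] at hm2
      refine hpm'.trans (hm2.trans ?_)
      rw [div_le_iff₀ hyi]
      exact hLwX.trans (mul_le_mul_of_nonneg_left (hLw i) (by positivity))

end Law

namespace Law

/-- The set of medium frequencies. -/
def midRange (T₀ T₁ : ℝ) : Set ℝ := {t | Real.sqrt T₀ < |t| ∧ |t| ≤ T₁}

lemma measurableSet_midRange (T₀ T₁ : ℝ) : MeasurableSet (midRange T₀ T₁) :=
  (measurableSet_lt measurable_const measurable_norm).inter (measurableSet_le measurable_norm measurable_const)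

/-- The exponential sum over the midpoints of the intervals `(x, x + h]`. -/
noncomputable def midSum (Q : Finset ℕ) (h t : ℝ) : ℂ := ∑ x ∈ Q, ch (-t) (x + h / 2)

lemma CB_midSum (Q : Finset ℕ) (h : ℝ) : CB (midSum Q h) :=
  CB.sum Q fun _ _ => CB.ch_neg _

lemma norm_midSum_le (Q : Finset ℕ) (h t : ℝ) : ‖midSum Q h t‖ ≤ Q.card := by
  refine (norm_sum_le _ _).trans ?_
  simp [norm_ch]

lemma integral_norm_midSum_sq_le (Q : Finset ℕ) (X h T : ℝ) (hh : 0 < h) (hT : 0 < T) (hX : 0 < X)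
    (hhX : h ≤ X) (hThX : X ≤ h * T) (hQ : ∀ x ∈ Q, X ≤ (x : ℝ) ∧ (x : ℝ) ≤ 2 * X)
    (hsep : ∀ x ∈ Q, ∀ x' ∈ Q, x ≠ x' → h ≤ |(x : ℝ) - x'|) :
    T * ∫ t, ‖midSum Q h t‖ ^ 2 ∂gm T ≤ 96 * T * Q.card := by
  have h1 := integral_norm_sum_ch_neg_sq_le Q X h T hh hT hX hhX hQ hsep
  have h2 : 3 * X / (h * T) ≤ 3 := by
    rw [div_le_iff₀ (by positivity)]; linarith
  calc T * ∫ t, ‖midSum Q h t‖ ^ 2 ∂gm T ≤ T * (24 * (1 + 3 * X / (h * T)) * Q.card) :=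
        mul_le_mul_of_nonneg_left h1 hT.le
    _ ≤ T * (24 * (1 + 3) * Q.card) := by
        refine mul_le_mul_of_nonneg_left (mul_le_mul_of_nonneg_right ?_ (Nat.cast_nonneg _)) hT.le
        linarith
    _ = 96 * T * Q.card := by ring

lemma LadderBound.card_eq_zero {ε κ S X h T T₀ T₁ θ Ya D Sb Γb Ub Lw fin : ℝ} {hb n v : ℕ} {Q : Finset ℕ}
    (hLB : LadderBound ε κ T X Ya D Sb Γb Ub Lw fin Q.card hb (midSum Q h) (midRange T₀ T₁) n 0 v v)
    (hblock : ∃ A : Law, ∃ y : ℝ, IsBlock A (2 ^ ((1 / 2 : ℝ) ^ 0)) (32 * 2 ^ 0 * v) v y)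
    (hSS : 4 * Sb ≤ S) (hκS : κ = 16 * S) (hX : 1 ≤ X) (hh : 0 < h) (hhX : h ≤ X) (hT₀ : 1 ≤ T₀) (hT : T₀ ≤ T) (hTX : T ≤ X)
    (hThX : X ≤ h * T) (hU : 4 * S * T₀ * (4 ^ (v + 1) * (Ub * D ^ n)) ≤ X)
    (hQ : ∀ x ∈ Q, X ≤ (x : ℝ) ∧ (x : ℝ) ≤ 2 * X)
    (hsep : ∀ x ∈ Q, ∀ x' ∈ Q, x ≠ x' → h ≤ |(x : ℝ) - x'|) (hθ : 0 ≤ θ) (hhi : (hb : ℝ) ≤ X ^ θ)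
    (hLw0 : 0 ≤ Lw) (hLwX : 8 * X ≤ X ^ θ * Lw)
    (hbad : ∀ x ∈ Q, ¬ ∃ n : ℕ, x < n ∧ (n : ℝ) ≤ (x : ℝ) + h ∧ ∀ p : ℕ, p.Prime → p ∣ n → (p : ℝ) ≤ (x : ℝ) ^ θ)
    (h1 : Real.exp (-((T * h / X) ^ 2 / (2048 * S ^ 2))) *
      (1200 * Real.sqrt (S ^ 3 * ((1 + 32 * v) * (Γb * Real.exp 1)) * T * Q.card)) ≤ Q.card / 4)
    (h2 : 32 * S / Real.sqrt T₀ + 32 * S * T * Real.exp (4 - 4 * T₁ / T) ≤ 1 / 4)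
    (hYa : Ya * D ^ n * 4 ^ (v + 1) ≤ X / (2 * S)) (hTv : T * 4 ^ (v + 1) ≤ X / (2 * S))
    (h3 : (4:ℝ) ^ (-((1 / 4 - 2 * ε) * v)) * (Real.sqrt (48 * κ ^ 2 * (Sb * 2) * (Γb * Real.exp 1)) *
      Real.sqrt (T * ∫ t, ‖midSum Q h t‖ ^ 2 ∂gm T)) ≤ Q.card / 8)
    (h4 : 2 * (4 ^ v)⁻¹ + fin ≤ 1 / 8) : Q.card = 0 := by
  obtain ⟨B, lo, SB, ΓB, UB, hB, hlo, hlohb, hSB, hΓB, hUB, hLw, hInt⟩ := hLB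
  obtain ⟨A, y, hA⟩ := hblock
  have hAint := hInt v A y le_rfl le_rfl hA
  have hPA := hA.primeLaw
  simp only [pow_zero, mul_one, Real.rpow_one] at hPA hSB hΓB
  have hAg := hPA.good
  have hy1 : (4:ℝ) ^ v ≤ y := hA.le_y
  have hy0 : 0 < y := lt_of_lt_of_le (by positivity) hy1
  have hy11 : 1 ≤ y := (one_le_pow₀ (by norm_num)).trans hy1
  have hAy := hA.y_eq
  have hS1 := hB.one_le_S
  have hΓ1 := hB.one_le_Γ
  have hUp := hB.U_pos
  have hSp : 1 ≤ S := by linarith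
  have hXp : 0 < X := by linarith
  have hTp : 0 < T := by linarith
  have hκ1 : 1 ≤ κ := by rw [hκS]; linarith
  have hUA : (y:ℝ) ≤ 4 ^ (v + 1) := hA.y_lt.le
  have hF : (A.prod B).Good (4 ^ v) hb S ((1 + 32 * v) * (Γb * Real.exp 1)) (4 ^ (v + 1) * (Ub * D ^ n)) := by
    refine (hAg.prod hB hlo ((Nat.pow_le_pow_right (by norm_num) (by omega)).trans hlo) (hlo.trans hlohb)).mono
      le_rfl le_rfl (by linarith) (mul_le_mul_of_nonneg_left hΓB (by positivity)) (mul_le_mul_of_nonneg_left hUB (by positivity))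
  have hYe : ∀ z, 0 ≤ z → z * 4 ^ (v + 1) ≤ X / (2 * S) → z ≤ X / (2 * S) / y := fun z hz hz' => by
    rw [le_div_iff₀ hy0]
    exact (mul_le_mul_of_nonneg_left hUA hz).trans hz'
  have hTY := hYe T hTp.le hTv
  have hA0 := hAg.s_ne_zero
  have hB0 := hB.s_ne_zero
  have hG := CB_midSum Q h
  have hR0 : (0:ℝ) ≤ Q.card := Nat.cast_nonneg _
  have hcA : CB fun t => ‖(A.prod B).R κ (X / (2 * S)) t‖ * ‖midSum Q h t‖ := (Law.CB_R _ _ _).norm.mul hG.norm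
  have hcB : CB fun t => ‖B.R κ (X / (2 * S) / y) t‖ * ‖midSum Q h t‖ := (Law.CB_R _ _ _).norm.mul hG.norm
  have hlarge : T * ∫ t in midRange T₀ T₁ ∩ A.largeSet (rung ε 0) v,
      ‖(A.prod B).R κ (X / (2 * S)) t‖ * ‖midSum Q h t‖ ∂gm T ≤ Q.card * (1 / 8) := by
    refine le_trans (mul_le_mul_of_nonneg_left ?_ hTp.le) ((hAint (X / (2 * S) / y) ?_ ?_ ?_).trans
      (mul_le_mul_of_nonneg_left h4 hR0))
    · refine setIntegral_mono hcA.integrable.integrableOn hcB.integrable.integrableOn fun t => ?_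
      refine mul_le_mul_of_nonneg_right ?_ (norm_nonneg _)
      rw [R_prod_const A B _ _ _ y hA0 hB0 hAy, norm_mul]
      exact mul_le_of_le_one_left (norm_nonneg _) (hAg.norm_poly_le t)
    · rw [le_div_iff₀ hy0]
      rcases le_or_gt 0 (Ya * D ^ n) with h0 | h0
      · exact (mul_le_mul_of_nonneg_left hUA h0).trans hYa
      · exact (mul_nonpos_of_nonpos_of_nonneg h0.le hy0.le).trans (by positivity)
    · rw [div_div]
      refine div_le_self hXp.le ?_
      exact one_le_mul_of_one_le_of_one_le (by linarith) hy11
    · refine hTY.trans (le_mul_of_one_le_right (by positivity) (one_le_pow₀ hy11))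
  have hsmall : T * ∫ t in midRange T₀ T₁ \ A.largeSet (rung ε 0) v,
      ‖(A.prod B).R κ (X / (2 * S)) t‖ * ‖midSum Q h t‖ ∂gm T ≤ Q.card * (1 / 8) := by
    refine (hB.setIntegral_R_prod_le_of_small hA0 y hAy κ _ T hκ1 hTp hTY _ hG _
      ((measurableSet_midRange _ _).diff (A.measurableSet_largeSet _ _)) _ (by positivity)
      (fun t ht => not_lt.1 ht.2)).trans ?_
    have e1 : rung ε 0 = 1 / 4 - 2 * ε := by unfold rung; ring
    rw [e1]
    refine le_trans (mul_le_mul_of_nonneg_left (mul_le_mul_of_nonneg_right (Real.sqrt_le_sqrt ?_) (Real.sqrt_nonneg _))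
      (by positivity)) (h3.trans (le_of_eq (by ring)))
    have hSb0 : 0 ≤ Sb := by linarith
    exact mul_le_mul (mul_le_mul_of_nonneg_left hSB (by positivity)) hΓB (by linarith) (by positivity)
  have hsplit : ∫ t in midRange T₀ T₁, ‖(A.prod B).R κ (X / (2 * S)) t‖ * ‖midSum Q h t‖ ∂gm T =
      (∫ t in midRange T₀ T₁ ∩ A.largeSet (rung ε 0) v,
        ‖(A.prod B).R κ (X / (2 * S)) t‖ * ‖midSum Q h t‖ ∂gm T) +
      ∫ t in midRange T₀ T₁ \ A.largeSet (rung ε 0) v,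
        ‖(A.prod B).R κ (X / (2 * S)) t‖ * ‖midSum Q h t‖ ∂gm T :=
    (integral_inter_add_sdiff (A.measurableSet_largeSet _ _) hcA.integrable.integrableOn).symm
  refine hF.card_eq_zero_of_setIntegral_le X h T T₀ T₁ θ Lw Q hX hh hhX hT₀ hT hTX hThX hU hQ hsep hθ hhi
    (fun i => ?_) hLwX hbad h1 h2 ?_
  · have h5 : Lw ≤ B.y i.2 := hLw i.2
    have h6 : 1 ≤ A.y i.1 := by rw [hAy]; exact hy11
    show Lw ≤ A.y i.1 * B.y i.2
    exact h5.trans (le_mul_of_one_le_left (hLw0.trans h5) h6)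
  · subst hκS
    have h7 : T * ∫ t in midRange T₀ T₁, ‖(A.prod B).R (16 * S) (X / (2 * S)) t‖ * ‖midSum Q h t‖ ∂gm T ≤ Q.card / 4 := by
      rw [hsplit, mul_add]; linarith
    exact h7

end Law

namespace Law

lemma LadderBound.exists_of_invMix {ε κ T X Ya fin R M U w : ℝ} {hb a b l n v : ℕ} {G : ℝ → ℂ} {E : Set ℝ} {K : ℝ}
    {B : ℕ → Law}
    (hε : 0 < ε) (hε1 : ε ≤ 1 / 8) (hK : 140 / ε ≤ K) (hκ : 1 ≤ κ) (hT : 0 < T) (hR : 0 ≤ R) (hG : CB G)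
    (hE : MeasurableSet E) (hYa : 0 ≤ Ya)
    (hB : ∀ v ∈ Finset.Icc a b, IsBlock (B v) 4 (16 * v) v (4 ^ v)) (hab : a ≤ b)
    (hP : PrimeLaw (invMix (Finset.Icc a b) B) (4 ^ a) hb 4 M U) (hbhb : 4 ^ (b + 1) ≤ hb)
    (hQv : Real.sqrt (48 * κ ^ 2 * (4 ^ (l + 1) * 2) * ((1 + (l + 1) * M) ^ (l + 1) * Real.exp 1)) ≤ 4 ^ v)
    (hGv : Real.sqrt (T * ∫ t, ‖G t‖ ^ 2 ∂gm T) ≤ 4 ^ v * R)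
    (hblock : ∀ j u : ℕ, v ≤ u → ∃ A : Law, ∃ y : ℝ, IsBlock A (2 ^ ((1 / 2 : ℝ) ^ j)) (32 * 2 ^ j * u) u y)
    (hv4 : 4 ≤ v) (hKv : K ≤ Real.log v) (hVl : ∀ V : ℕ, v ≤ V → Real.log V * (16 * Real.log V + 1) ≤ V)
    (hw : 1 ≤ w) (hwn : w ≤ n) (hbw : (b : ℝ) ≤ w ^ 16) (hKva : K * v ≤ a) (hwa : 8 * Real.log w * w ^ 8 ≤ a)
    (hwa' : w ^ 8 + 1 ≤ a)
    (hrec : ∀ u ∈ Finset.Icc a b, ∀ Y, Ya ≤ Y → Y ≤ X →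
      T * ∫ t in E ∩ (B u).largeSet (1 / 4 - ε) u,
        ‖((invMix (Finset.Icc a b) B).pow l).R κ (Y / 4 ^ u) t‖ * ‖G t‖ ∂gm T ≤ R * fin) :
    LadderBound ε κ T X Ya (4 ^ (w ^ 8 + 1)) (4 ^ (l + 1)) ((1 + (l + 1) * M) ^ (l + 1)) (U ^ (l + 1))
      ((4 ^ a) ^ (l + 1)) fin R hb G E n 0 v v := by
  have hM := hP.M_nonneg
  have hK140 : 140 ≤ K := by
    refine le_trans ?_ hK
    rw [le_div_iff₀ hε]; linarith
  have hD1 : (1:ℝ) ≤ 4 ^ (w ^ 8 + 1) := Real.one_le_rpow (by norm_num) (by positivity)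
  have hv4R : (4:ℝ) ≤ v := by exact_mod_cast hv4
  have ha0 : (0:ℝ) < a := by
    have : 0 < K * v := by positivity
    linarith
  have hb0 : (0:ℝ) < b := lt_of_lt_of_le ha0 (by exact_mod_cast hab)
  have hlogb : Real.log b ≤ 16 * Real.log w := by
    have := Real.log_le_log hb0 hbw
    rwa [Real.log_pow] at this
  have main : ∀ m j V V' : ℕ, v ≤ V → V ≤ V' → w ≤ V → K * 4 ^ j ≤ Real.log V → K * 4 ^ j * V' ≤ a → V' + 1 ≤ a →
      LadderBound ε κ T X Ya (4 ^ (w ^ 8 + 1)) (4 ^ (l + 1)) ((1 + (l + 1) * M) ^ (l + 1)) (U ^ (l + 1))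
        ((4 ^ a) ^ (l + 1)) fin R hb G E m j V V' := by
    intro m j V V' h1 h2 h3 h4 h5 h6
    have h4V : (4:ℝ) ^ v ≤ 4 ^ V := pow_le_pow_right₀ (by norm_num) h1
    refine LadderBound.base hε hε1 hK hκ hT hR hG hE hYa hD1 hB hab hP hbhb (hQv.trans h4V)
      (hGv.trans (mul_le_mul_of_nonneg_right h4V hR)) (by omega) h6 h5 ?_ hrec
    have hlw : Real.log w ≤ Real.log V := Real.log_le_log (by linarith) h3
    have hlw0 : 0 ≤ Real.log w := Real.log_nonneg hw
    refine le_trans (mul_le_mul h4 (by linarith : _ ≤ 16 * Real.log V + 1) ?_ (by linarith)) (hVl V h1)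
    have : 0 ≤ Real.log b := Real.log_natCast_nonneg b
    linarith
  rcases le_or_gt w v with hwv | hwv
  · refine main n 0 v v le_rfl le_rfl hwv (by simpa using hKv) (by simpa using hKva) ?_
    have h7 : (v:ℝ) + 1 ≤ a := by
      have : 140 * (v:ℝ) ≤ K * v := mul_le_mul_of_nonneg_right hK140 (by linarith)
      linarith
    exact_mod_cast h7
  · have hw8 : w ≤ w ^ 8 := le_self_pow₀ hw (by norm_num)
    refine LadderBound.of_base (v₁ := v) (K := K) (w := w) (fun m j V V' h1 h2 h3 h4 h5 => ?_) hε hε1 hK hκ hT hR hG hE hYa (by positivity)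
      (by positivity) (by omega) hblock hQv hGv le_rfl (fun V hV => ?_) n 0 v v le_rfl le_rfl
      (Nat.le_self_pow (by norm_num) v) (hwv.le.trans hw8) (by simpa using hKv) ?_
    · have hV'0 : (0:ℝ) ≤ V' := Nat.cast_nonneg _
      have hV1 : (0:ℝ) < V := lt_of_lt_of_le (by linarith) h3
      have hVV' : (V:ℝ) ≤ V' := by exact_mod_cast h2
      refine main m j V V' h1 h2 h3 h5 ?_ ?_
      · have hl8 : Real.log V ≤ 8 * Real.log w := by
          have := Real.log_le_log hV1 (hVV'.trans h4)
          rwa [Real.log_pow] at this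
        refine le_trans (mul_le_mul (h5.trans hl8) h4 hV'0 ?_) hwa
        have := Real.log_nonneg hw
        linarith
      · have : (V':ℝ) + 1 ≤ a := by linarith
        exact_mod_cast this
    · refine le_trans ?_ (hVl V hV)
      have := Real.log_natCast_nonneg V
      exact mul_le_mul_of_nonneg_left (by linarith) this
    · have hn4 : (n:ℝ) ≤ 4 ^ n := by exact_mod_cast (Nat.lt_pow_self (by norm_num) : n < 4 ^ n).le
      have h4n : (4:ℝ) ^ n ≤ (4:ℝ) ^ 4 ^ n :=
        pow_le_pow_right₀ (by norm_num) (Nat.lt_pow_self (by norm_num) : n < 4 ^ n).le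
      exact hwn.trans (hn4.trans (h4n.trans (pow_le_pow_left₀ (by norm_num) hv4R _)))

end Law

lemma eventually_ladder_growth (η β : ℝ) (hη : 0 < η) (hβ : 0 < β) : ∀ᶠ X : ℝ in Filter.atTop, ∃ w : ℝ, 1 ≤ w ∧
    w ^ 16 = Real.log X ∧ 8 * Real.log w * w ^ 8 ≤ η * Real.log X ∧ w ^ 8 + 1 ≤ η * Real.log X ∧
    ((4:ℝ) ^ (w ^ 8 + 1)) ^ ⌈w⌉₊ ≤ X ^ β := by
  have ht : Filter.Tendsto (fun X : ℝ => Real.log X ^ (1 / 16 : ℝ)) Filter.atTop Filter.atTop :=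
    (tendsto_rpow_atTop (by norm_num)).comp Real.tendsto_log_atTop
  filter_upwards [ht.eventually_ge_atTop (1 + 8 / η + 8 / β), Filter.eventually_ge_atTop 1] with X hw hX
  set w := Real.log X ^ (1 / 16 : ℝ) with hwdef
  have hη' : 0 < 8 / η := by positivity
  have hβ' : 0 < 8 / β := by positivity
  have hw1 : 1 ≤ w := by linarith
  have hw0 : 0 < w := by linarith
  have hXp : 0 < X := by linarith
  have hw16 : w ^ 16 = Real.log X := by
    rw [hwdef, ← Real.rpow_natCast, ← Real.rpow_mul (Real.log_nonneg hX)]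
    norm_num
  have hw7 : w ≤ w ^ 7 := le_self_pow₀ hw1 (by norm_num)
  have key : ∀ g, 0 < g → 8 / g ≤ w → 8 * w ^ 9 ≤ g * Real.log X := fun g hg hgw => by
    rw [← hw16]
    rw [div_le_iff₀ hg] at hgw
    calc 8 * w ^ 9 ≤ (w * g) * w ^ 9 := mul_le_mul_of_nonneg_right hgw (by positivity)
      _ ≤ (w ^ 7 * g) * w ^ 9 := mul_le_mul_of_nonneg_right (mul_le_mul_of_nonneg_right hw7 hg.le) (by positivity)
      _ = g * w ^ 16 := by ring
  have hk1 := key η hη (by linarith)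
  have hw8 : 1 ≤ w ^ 8 := one_le_pow₀ hw1
  have hw89 : w ^ 8 ≤ w ^ 9 := pow_le_pow_right₀ hw1 (by norm_num)
  refine ⟨w, hw1, hw16, ?_, by linarith, ?_⟩
  · have : Real.log w ≤ w := Real.log_le_self hw0.le
    calc 8 * Real.log w * w ^ 8 ≤ 8 * w * w ^ 8 :=
          mul_le_mul_of_nonneg_right (by linarith) (by positivity)
      _ = 8 * w ^ 9 := by ring
      _ ≤ _ := hk1
  · have hk2 := key β hβ (by linarith)
    have hn : (⌈w⌉₊ : ℝ) ≤ 2 * w := by have := (Nat.ceil_lt_add_one hw0.le).le; linarith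
    have hl4 : Real.log 4 ≤ 2 := by
      have : Real.log 4 = 2 * Real.log 2 := by
        rw [show (4:ℝ) = 2 ^ 2 by norm_num, Real.log_pow]; norm_num
      rw [this]; linarith [Real.log_two_lt_d9]
    have hl40 : 0 ≤ Real.log 4 := Real.log_nonneg (by norm_num)
    rw [← Real.rpow_natCast, ← Real.rpow_mul (by norm_num), Real.rpow_def_of_pos (by norm_num), Real.rpow_def_of_pos hXp]
    refine Real.exp_le_exp.2 ?_
    calc Real.log 4 * ((w ^ 8 + 1) * (⌈w⌉₊ : ℝ)) ≤ 2 * ((2 * w ^ 8) * (2 * w)) := by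
          refine mul_le_mul hl4 (mul_le_mul (by linarith) hn (Nat.cast_nonneg _) (by positivity)) (by positivity) (by norm_num)
      _ = 8 * w ^ 9 := by ring
      _ ≤ β * Real.log X := hk2
      _ = _ := mul_comm _ _

lemma tendsto_topScale (η : ℝ) (hη : 0 < η) : Filter.Tendsto (topScale η) Filter.atTop Filter.atTop := by
  unfold topScale
  refine tendsto_nat_floor_atTop.comp ?_
  exact ((Real.tendsto_log_atTop).const_mul_atTop hη).atTop_div_const (Real.log_pos (by norm_num))

lemma eventually_log_mul_le : ∀ᶠ V : ℕ in Filter.atTop, Real.log V * (16 * Real.log V + 1) ≤ V := by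
  have h := (Real.isLittleO_pow_log_id_atTop (n := 2)).bound (show (0:ℝ) < 1 / 17 by norm_num)
  have h' := Real.tendsto_log_atTop.eventually_ge_atTop 1
  filter_upwards [tendsto_natCast_atTop_atTop.eventually h, tendsto_natCast_atTop_atTop.eventually h'] with V hV hV'
  simp only [id, Real.norm_eq_abs, abs_pow, sq_abs, Nat.abs_cast] at hV
  have e : Real.log V ≤ Real.log V ^ 2 := le_self_pow₀ hV' (by norm_num)
  calc Real.log V * (16 * Real.log V + 1) = 16 * Real.log V ^ 2 + Real.log V := by ring
    _ ≤ _ := by linarith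

lemma eventually_topScale_large (r K A : ℝ) (v₀ : ℕ) (hr : 0 < r) : ∀ᶠ h : ℝ in Filter.atTop, v₀ ≤ topScale r h ∧
    K ≤ Real.log (topScale r h) ∧ A ≤ 4 ^ topScale r h ∧
    ∀ V : ℕ, topScale r h ≤ V → Real.log V * (16 * Real.log V + 1) ≤ V := by
  have ht := tendsto_topScale r hr
  obtain ⟨V₀, hV₀⟩ := Filter.eventually_atTop.1 eventually_log_mul_le
  have h1 : Filter.Tendsto (fun v : ℕ => Real.log v) Filter.atTop Filter.atTop :=
    Real.tendsto_log_atTop.comp tendsto_natCast_atTop_atTop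
  have h2 : Filter.Tendsto (fun v : ℕ => (4:ℝ) ^ v) Filter.atTop Filter.atTop :=
    tendsto_pow_atTop_atTop_of_one_lt (by norm_num)
  filter_upwards [ht.eventually_ge_atTop v₀, ht.eventually (h1.eventually_ge_atTop K),
    ht.eventually (h2.eventually_ge_atTop A), ht.eventually_ge_atTop V₀] with h e1 e2 e3 e4
  exact ⟨e1, e2, e3, fun V hV => hV₀ V (e4.trans hV)⟩

lemma le_four_pow_topScale_mul (η X : ℝ) (hX : 1 ≤ X) : X ^ η / 4 ≤ 4 ^ topScale η X := by
  have h := le_four_pow_topScale η X hX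
  rw [pow_succ] at h
  linarith

lemma eventually_exp_neg_rpow_le (s b C : ℝ) (hs : 0 < s) (hb : 0 < b) :
    ∀ᶠ h : ℝ in Filter.atTop, Real.exp (-(b * h ^ s)) * (C * h) ≤ 1 / 4 := by
  have h1 := (tendsto_rpow_mul_exp_neg_mul_atTop_nhds_zero (1 / s) b hb).comp (tendsto_rpow_atTop hs)
  have h2 := h1.const_mul C
  rw [mul_zero] at h2
  filter_upwards [h2.eventually_le_const (show (0:ℝ) < 1 / 4 by norm_num), Filter.eventually_ge_atTop 1] with h hh hh1
  refine le_trans (le_of_eq ?_) hh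
  have : (h ^ s) ^ (1 / s) = h := by
    rw [← Real.rpow_mul (by linarith), mul_one_div_cancel hs.ne', Real.rpow_one]
  simp only [Function.comp, this]
  rw [neg_mul]; ring

/-- The scales between `(1 - d/4) E` and `E`, where `E` is the top scale. -/
lemma eventually_scales (d η : ℝ) (hd : 0 < d) (hd1 : d ≤ 1 / 4) (hη : 0 < η) (hη1 : η ≤ 1) (v₀ : ℕ) : ∀ᶠ X : ℝ in Filter.atTop,
    ∀ a b : ℕ, b = topScale η X → a = ⌈(1 - d / 4) * (b : ℝ)⌉₊ →
      a ≤ b ∧ 1 ≤ a ∧ v₀ ≤ a ∧ η / 4 * Real.log X ≤ a ∧ (b : ℝ) ≤ Real.log X ∧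
        d / 8 ≤ ∑ u ∈ Finset.Icc a b, (1 / (u : ℝ)) := by
  filter_upwards [(tendsto_topScale η hη).eventually_ge_atTop (2 * v₀ + 2), Filter.eventually_ge_atTop 1,
    (Real.tendsto_log_atTop.const_mul_atTop hη).eventually_ge_atTop 100] with X hb hX hlog
  rintro a b rfl rfl
  set b := topScale η X with hbdef
  have hbR : 2 * (v₀ : ℝ) + 2 ≤ b := by exact_mod_cast hb
  have hv₀ : (0:ℝ) ≤ v₀ := Nat.cast_nonneg _
  have hlb := Nat.le_ceil ((1 - d / 4) * (b : ℝ))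
  have hub := (Nat.ceil_lt_add_one (show 0 ≤ (1 - d / 4) * (b : ℝ) by
    have : 0 ≤ 1 - d / 4 := by linarith
    positivity)).le
  set a := ⌈(1 - d / 4) * (b : ℝ)⌉₊ with ha
  have hdb : d / 4 * b ≤ 1 / 16 * b := mul_le_mul_of_nonneg_right (by linarith) (by linarith)
  have hab : a ≤ b := by
    rw [ha]
    refine Nat.ceil_le.2 ?_
    have : 0 ≤ d / 4 * b := by positivity
    linarith
  have haR : (v₀ : ℝ) + 1 ≤ a := by linarith
  have ha1 : v₀ + 1 ≤ a := by exact_mod_cast haR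
  refine ⟨hab, by omega, by omega, ?_, ?_, ?_⟩
  · have h4 : 0 < Real.log 4 := Real.log_pos (by norm_num)
    have hl4 : Real.log 4 ≤ 3 / 2 := by
      have : Real.log 4 = 2 * Real.log 2 := by
        rw [show (4:ℝ) = 2 ^ 2 by norm_num, Real.log_pow]; norm_num
      rw [this]; linarith [Real.log_two_lt_d9]
    have h5 : η * Real.log X / Real.log 4 < b + 1 := Nat.lt_floor_add_one _
    have h6 : η * Real.log X / (3 / 2) ≤ η * Real.log X / Real.log 4 :=
      div_le_div_of_nonneg_left (by linarith) h4 hl4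
    linarith
  · have := topScale_le_log η X hη.le hη1 hX
    linarith
  · refine le_trans ?_ (log_le_sum_Icc_inv a b (by omega) hab)
    have ha0 : (0:ℝ) < a := by linarith
    have hd8 : 0 < 1 - d / 8 := by linarith
    have h7 : (1 - d / 8)⁻¹ ≤ ((b:ℝ) + 1) / a := by
      rw [inv_eq_one_div, div_le_div_iff₀ hd8 ha0]
      have : d / 8 * 1 ≤ d / 8 * b := mul_le_mul_of_nonneg_left (by linarith) (by positivity)
      linarith
    refine le_trans ?_ (Real.log_le_log (by positivity) h7)
    rw [Real.log_inv]
    have := Real.log_le_sub_one_of_pos hd8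
    linarith

/-- A well-spaced set of points `x` such that `(x, x + h]` contains no smooth number. -/
structure BadSet (θ X h : ℝ) (Q : Finset ℕ) : Prop where
  mem : ∀ x ∈ Q, X ≤ (x : ℝ) ∧ (x : ℝ) ≤ 2 * X
  sep : ∀ x ∈ Q, ∀ x' ∈ Q, x ≠ x' → h ≤ |(x : ℝ) - x'|
  bad : ∀ x ∈ Q, ¬ ∃ n : ℕ, x < n ∧ (n : ℝ) ≤ (x : ℝ) + h ∧ ∀ p : ℕ, p.Prime → p ∣ n → (p : ℝ) ≤ (x : ℝ) ^ θ

lemma height_bounds {X h e T : ℝ} (hX : 1 ≤ X) (hh : 1 ≤ h) (hhX : h ≤ X) (he : 0 ≤ e) (he1 : e ≤ 1)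
    (hT : T = X * h ^ (-1 + e)) : 1 ≤ T ∧ T ≤ X ∧ X ≤ h * T := by
  have hXp : 0 < X := by linarith
  have hhp : 0 < h := by linarith
  refine ⟨?_, ?_, ?_⟩
  · calc (1:ℝ) = h * h ^ (-1:ℝ) := by rw [Real.rpow_neg_one]; field_simp
      _ ≤ X * h ^ (-1 + e) := mul_le_mul hhX (Real.rpow_le_rpow_of_exponent_le hh (by linarith)) (by positivity) hXp.le
      _ = T := hT.symm
  · rw [hT]
    exact mul_le_of_le_one_right hXp.le (Real.rpow_le_one_of_one_le_of_nonpos hh (by linarith))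
  · calc X ≤ X * h ^ e := le_mul_of_one_le_right hXp.le (Real.one_le_rpow hh he)
      _ = h * T := by rw [hT, Real.rpow_add hhp, Real.rpow_neg_one]; field_simp

lemma BadSet.integral_le {θ X h e f T : ℝ} {Q : Finset ℕ} (hQ : BadSet θ X h Q) (hX : 1 ≤ X) (hh : 1 ≤ h) (hhX : h ≤ X)
    (he : 0 ≤ e) (he1 : e ≤ 1) (hT : T = X * h ^ (-1 + e)) (hR : T * h ^ (-(1 / 2) + f) ≤ Q.card) :
    T * ∫ t, ‖Law.midSum Q h t‖ ^ 2 ∂gm T ≤ 96 * ((Q.card : ℝ) ^ 2 * h ^ (1 / 2 - f)) ∧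
      T * Q.card ≤ (Q.card : ℝ) ^ 2 * h ^ (1 / 2 - f) := by
  have hXp : 0 < X := by linarith
  have hhp : 0 < h := by linarith
  obtain ⟨hT1, -, hThX⟩ := height_bounds hX hh hhX he he1 hT
  have hTp : 0 < T := by linarith
  have h1 := Law.integral_norm_midSum_sq_le Q X h T hhp hTp hXp hhX hThX hQ.mem hQ.sep
  have h2 : T ≤ Q.card * h ^ (1 / 2 - f) := by
    calc T = T * h ^ (-(1 / 2) + f) * h ^ (1 / 2 - f) := by
          rw [mul_assoc, ← Real.rpow_add hhp]; norm_num
      _ ≤ _ := mul_le_mul_of_nonneg_right hR (by positivity)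
  have h3 : T * Q.card ≤ (Q.card : ℝ) ^ 2 * h ^ (1 / 2 - f) := by
    calc T * Q.card ≤ (Q.card * h ^ (1 / 2 - f)) * Q.card := mul_le_mul_of_nonneg_right h2 (Nat.cast_nonneg _)
      _ = _ := by ring
  exact ⟨by linarith, h3⟩

lemma sqrt_rpow_eq (X a b : ℝ) (hX : 0 ≤ X) (hab : a = 2 * b) : Real.sqrt (X ^ a) = X ^ b := by
  rw [Real.sqrt_eq_rpow, ← Real.rpow_mul hX, hab]
  congr 1; ring

lemma cell_exponent_le {e d η c δ g : ℝ} (he : 0 < e) (he8 : e ≤ 1 / 8) (hde : 3 * d ≤ 2 * e) (hηc : η ≤ c / 20)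
    (hc : 0 < c) (hδ0 : 0 ≤ δ) (hδc : δ ≤ c / 20) (hg : 0 ≤ g) (hg1 : (g + 1) * δ ≤ 1 / 4 - e) :
    2 * (-((1 - 3 * d) * (g * δ)) - c) + (1 * ((g + 1) * δ) / (1 - 2 * ((g + 1) * δ)) + 4 * (c / 20) + η) + c / 8 ≤
      -(4 * (c / 20)) := by
  have hg0 : 0 ≤ g * δ := by positivity
  have e0 : 1 ≤ 2 * (1 - 2 * e) * (1 / 2 + 2 * e) := by
    have h1 : 0 ≤ e * (1 / 4 - e) := mul_nonneg he.le (by linarith)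
    linarith
  have e1 : 1 * ((g + 1) * δ) / (1 - 2 * ((g + 1) * δ)) ≤ ((g + 1) * δ) * (2 * (1 - 2 * e)) := by
    rw [one_mul, div_le_iff₀ (by linarith), mul_assoc]
    refine le_mul_of_one_le_right (by positivity) (e0.trans ?_)
    exact mul_le_mul_of_nonneg_left (by linarith) (by linarith)
  have e2 : ((g + 1) * δ) * (2 * (1 - 2 * e)) ≤ 2 * (g * δ) * (1 - 2 * e) + 2 * δ := by
    have : 0 ≤ δ * e := by positivity
    linarith
  have e3 : g * δ * (3 * d) ≤ g * δ * (2 * e) := mul_le_mul_of_nonneg_left hde hg0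
  linarith

lemma BadSet.sqrt_integral_le {θ X h e T : ℝ} {Q : Finset ℕ} (hQ : BadSet θ X h Q) (hX : 1 ≤ X) (hh : 1536 ≤ h) (hhX : h ≤ X)
    (he : 0 < e) (he8 : e ≤ 1 / 8) (hT : T = X * h ^ (-1 + e)) (hR : T * h ^ (-(1 / 2) + 8 * e) ≤ Q.card) :
    Real.sqrt (T * ∫ t, ‖Law.midSum Q h t‖ ^ 2 ∂gm T) ≤ 4 ^ topScale (1 - 2 * e) h * Q.card := by
  have hh1 : 1 ≤ h := by linarith
  have hhp : 0 < h := by linarith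
  obtain ⟨hI, -⟩ := hQ.integral_le hX hh1 hhX he.le (by linarith) hT hR
  refine Real.sqrt_le_iff.2 ⟨by positivity, hI.trans ?_⟩
  have e1 : h ^ (3 / 4 : ℝ) / 4 ≤ 4 ^ topScale (1 - 2 * e) h :=
    le_trans (div_le_div_of_nonneg_right (Real.rpow_le_rpow_of_exponent_le hh1 (by linarith)) (by norm_num))
      (le_four_pow_topScale_mul (1 - 2 * e) h hh1)
  have e2 : (h ^ (3 / 4 : ℝ) / 4) ^ 2 ≤ (4 ^ topScale (1 - 2 * e) h) ^ 2 := pow_le_pow_left₀ (by positivity) e1 2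
  have e3 : (h ^ (3 / 4 : ℝ) / 4) ^ 2 = h * h ^ (1 / 2 : ℝ) / 16 := by
    rw [div_pow, ← Real.rpow_natCast, ← Real.rpow_mul hhp.le]
    nth_rewrite 2 [← Real.rpow_one h]
    rw [← Real.rpow_add hhp]; norm_num
  have e4 : 1536 * h ^ (1 / 2 : ℝ) ≤ h * h ^ (1 / 2 : ℝ) := mul_le_mul_of_nonneg_right hh (by positivity)
  have hh12 : h ^ (1 / 2 - 8 * e) ≤ h ^ (1 / 2 : ℝ) := Real.rpow_le_rpow_of_exponent_le hh1 (by linarith)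
  have e5 : 96 * h ^ (1 / 2 - 8 * e) ≤ (4 ^ topScale (1 - 2 * e) h) ^ 2 := by linarith
  calc 96 * ((Q.card : ℝ) ^ 2 * h ^ (1 / 2 - 8 * e)) = (96 * h ^ (1 / 2 - 8 * e)) * (Q.card : ℝ) ^ 2 := by ring
    _ ≤ (4 ^ topScale (1 - 2 * e) h) ^ 2 * (Q.card : ℝ) ^ 2 := mul_le_mul_of_nonneg_right e5 (by positivity)
    _ = _ := by rw [mul_pow]

namespace Law

lemma exists_ladderBound {θ e d η c c₀ S : ℝ} {l : ℕ} (he : 0 < e) (he8 : e ≤ 1 / 8) (hd : 0 < d) (hde : 3 * d ≤ 2 * e)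
    (hη : 0 < η) (hηd : η ≤ d) (hηc : η ≤ c / 20) (hl : ((l : ℝ) + 1) * η = 1 - d)
    (hc : 0 < c) (hc1 : c ≤ 1) (hc₀c : c₀ ≤ c / 8) (hc₀η : 140 / e * c₀ ≤ η / 4) (hS : 1 ≤ S)
    (hD : ∀ κ : ℝ, 1 ≤ κ → ∀ᶠ X : ℝ in Filter.atTop, ∀ Z t : ℝ, X ^ (d / 2) ≤ Z → Z ≤ X ^ (2 * d) →
      X ^ (d / 16) ≤ |t| → |t| ≤ X ^ (2 : ℝ) → ‖dz κ Z t‖ ≤ X ^ (-c)) :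
    ∃ h₀ : ℝ, ∀ᶠ X : ℝ in Filter.atTop, ∀ h, h₀ ≤ h → h ≤ X ^ c₀ → ∃ (D : ℝ) (n : ℕ), D ^ n ≤ X ^ (d / 32) ∧
      ∀ (Q : Finset ℕ) (T : ℝ), BadSet θ X h Q → T = X * h ^ (-1 + e) → T * h ^ (-(1 / 2) + 8 * e) ≤ Q.card →
        LadderBound e (16 * S) T X (X ^ (1 - d / 4)) D (4 ^ (l + 1)) ((1 + (l + 1) * (128 / d)) ^ (l + 1))
          ((4 ^ (topScale η X + 1)) ^ (l + 1)) ((4 ^ ⌈(1 - d / 4) * (topScale η X : ℝ)⌉₊) ^ (l + 1)) (X ^ (-(c / 20)))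
          Q.card (4 ^ (topScale η X + 1)) (midSum Q h) (midRange (X ^ (d / 8)) (T * Real.log X)) n 0
          (topScale (1 - 2 * e) h) (topScale (1 - 2 * e) h) := by
  obtain ⟨v₁, hv₁, hblock⟩ := exists_isBlock
  obtain ⟨v₂, hv₂, hfour⟩ := exists_isBlock_four
  have hfour' : ∀ v : ℕ, ∃ A : Law, v₂ ≤ v → IsBlock A 4 (16 * v) v (4 ^ v) := fun v => by
    rcases le_or_gt v₂ v with h | h
    · obtain ⟨A, hA⟩ := hfour v h
      exact ⟨A, fun _ => hA⟩
    · exact ⟨one, fun h' => absurd h' (not_le.2 h)⟩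
  choose B hB using hfour'
  set M : ℝ := 128 / d with hMdef
  set N : ℕ := ⌈5 / c⌉₊ with hNdef
  have hN5 : 5 / c ≤ N := Nat.le_ceil _
  have hN0 : (0:ℝ) < N := lt_of_lt_of_le (by positivity) hN5
  set δ : ℝ := (1 / 4 - e) / N with hδdef
  have hNδ : N * δ = 1 / 4 - e := by rw [hδdef]; field_simp
  have hδ0 : 0 ≤ δ := div_nonneg (by linarith) hN0.le
  have hδc : δ ≤ c / 20 := by
    rw [hδdef, div_le_iff₀ hN0]
    have : c / 20 * (5 / c) ≤ c / 20 * N := mul_le_mul_of_nonneg_left hN5 (by positivity)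
    have h2 : c / 20 * (5 / c) = 1 / 4 := by field_simp; norm_num
    linarith
  have hκ : 1 ≤ 16 * S := by linarith
  have hd4 : d ≤ 1 / 4 := by linarith
  have hη1 : η ≤ 1 := by linarith
  obtain ⟨h₁, hh₁⟩ := Filter.eventually_atTop.1 (eventually_topScale_large (1 - 2 * e) (140 / e)
    (Real.sqrt (48 * (16 * S) ^ 2 * (4 ^ (l + 1) * 2) * ((1 + (l + 1) * M) ^ (l + 1) * Real.exp 1))) (max v₁ 4)
    (by linarith))
  refine ⟨max h₁ 1536, ?_⟩
  filter_upwards [eventually_setIntegral_pow_mix_le d η (c / 20) (c / 20) δ c N l hd hd4 hη hηd hl (by positivity) hδ0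
      (by positivity) (by linarith) (16 * S) (hD _ hκ), eventually_scales d η hd hd4 hη hη1 v₂,
      eventually_ladder_growth (η / 4) (d / 32) (by positivity) (by positivity), eventually_const_le 96 (c / 16) (by positivity),
      Filter.eventually_ge_atTop 1] with X hpow hsc hgr h96 hX1
  intro h hh hhX
  obtain ⟨hab, ha1, hva, hηa, hblog, hsum⟩ := hsc _ _ rfl rfl
  obtain ⟨w, hw1, hw16, hw1', hw2', hDn⟩ := hgr
  have hXp : 0 < X := by linarith
  have hh1536 : 1536 ≤ h := (le_max_right _ _).trans hh
  have hhp : 0 < h := by linarith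
  have hh1 : 1 ≤ h := by linarith
  have hc₀1 : c₀ ≤ 1 := by linarith
  have hhX' : h ≤ X := hhX.trans ((Real.rpow_le_rpow_of_exponent_le hX1 hc₀1).trans (Real.rpow_one X).le)
  obtain ⟨hvv, hKv, hQv, hVl⟩ := hh₁ h ((le_max_left _ _).trans hh)
  have hvlow := le_four_pow_topScale_mul (1 - 2 * e) h hh1
  have hvlog := topScale_le_log (1 - 2 * e) h (by linarith) (by linarith) hh1
  set v := topScale (1 - 2 * e) h with hvdef
  refine ⟨_, _, hDn, fun Q T hQ hT hRl => ?_⟩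
  have hloghX : Real.log h ≤ c₀ * Real.log X := by
    have := Real.log_le_log hhp hhX
    rwa [Real.log_rpow hXp] at this
  have hlogX : 0 ≤ Real.log X := Real.log_nonneg hX1
  have hR0 : (0:ℝ) ≤ Q.card := Nat.cast_nonneg _
  obtain ⟨hI, -⟩ := hQ.integral_le hX1 hh1 hhX' he.le (by linarith) hT hRl
  obtain ⟨hT1, hTX, -⟩ := height_bounds hX1 hh1 hhX' he.le (by linarith) hT
  have hTp : 0 < T := by linarith
  have hh12 : h ^ (1 / 2 - 8 * e) ≤ h ^ (1 / 2 : ℝ) := Real.rpow_le_rpow_of_exponent_le hh1 (by linarith)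
  have hP := invMix_primeLaw (Finset.Icc ⌈(1 - d / 4) * (topScale η X : ℝ)⌉₊ (topScale η X)) B (fun v => 4 ^ v) 4 16 _ _ ha1
    (Finset.nonempty_Icc.2 hab) (fun u hu => Finset.mem_Icc.1 hu) (fun u hu => hB u (hva.trans (Finset.mem_Icc.1 hu).1))
  have hP' := hP.mono le_rfl le_rfl le_rfl (show _ ≤ M by
    rw [hMdef]
    refine (div_le_div_of_nonneg_left (by norm_num) (by positivity) hsum).trans (le_of_eq ?_)
    field_simp; norm_num) le_rfl
  have hKvR : 140 / e * v ≤ η / 4 * Real.log X := by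
    calc 140 / e * v ≤ 140 / e * (c₀ * Real.log X) := mul_le_mul_of_nonneg_left (by linarith) (by positivity)
      _ = 140 / e * c₀ * Real.log X := by ring
      _ ≤ _ := mul_le_mul_of_nonneg_right hc₀η hlogX
  have hGv := hQ.sqrt_integral_le hX1 hh1536 hhX' he he8 hT hRl
  have hG2 : T * ∫ t, ‖midSum Q h t‖ ^ 2 ∂gm T ≤ (Q.card : ℝ) ^ 2 * X ^ (c / 8) := by
    refine hI.trans ?_
    have e1 : h ^ (1 / 2 - 8 * e) ≤ X ^ (c / 16) := by
      calc h ^ (1 / 2 - 8 * e) ≤ h ^ (1 / 2 : ℝ) := hh12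
        _ ≤ (X ^ c₀) ^ (1 / 2 : ℝ) := Real.rpow_le_rpow hhp.le hhX (by norm_num)
        _ = X ^ (c₀ * (1 / 2)) := by rw [← Real.rpow_mul hXp.le]
        _ ≤ _ := Real.rpow_le_rpow_of_exponent_le hX1 (by linarith)
    calc 96 * ((Q.card : ℝ) ^ 2 * h ^ (1 / 2 - 8 * e)) = (Q.card : ℝ) ^ 2 * (96 * h ^ (1 / 2 - 8 * e)) := by ring
      _ ≤ (Q.card : ℝ) ^ 2 * (X ^ (c / 16) * X ^ (c / 16)) :=
          mul_le_mul_of_nonneg_left (mul_le_mul h96 e1 (by positivity) (by positivity)) (by positivity)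
      _ = _ := by rw [← Real.rpow_add hXp]; congr 2; ring
  have hE : midRange (X ^ (d / 8)) (T * Real.log X) = {t | X ^ (d / 16) < |t| ∧ |t| ≤ T * Real.log X} := by
    unfold midRange
    rw [sqrt_rpow_eq X (d / 8) (d / 16) hXp.le (by ring)]
  have hpos : 0 < ∑ u ∈ Finset.Icc ⌈(1 - d / 4) * (topScale η X : ℝ)⌉₊ (topScale η X), (1 / (u : ℝ)) :=
    lt_of_lt_of_le (by positivity) hsum
  refine LadderBound.exists_of_invMix (w := w) (K := 140 / e) he he8 le_rfl hκ hTp hR0 (CB_midSum Q h)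
    (measurableSet_midRange _ _) (by positivity)
    (fun u hu => hB u (hva.trans (Finset.mem_Icc.1 hu).1)) hab hP' le_rfl hQv hGv
    (fun j u hu => hblock j u (((le_max_left _ _).trans hvv).trans hu)) ((le_max_right _ _).trans hvv) hKv hVl hw1
    (Nat.le_ceil w) (by rw [hw16]; exact hblog) (hKvR.trans hηa) (hw1'.trans hηa) (hw2'.trans hηa) ?_
  intro u hu Y hY1 hY2
  rw [hE, ← hNδ]
  refine hpow _ (fun v => (1 / (v : ℝ)) / ∑ u ∈ Finset.Icc ⌈(1 - d / 4) * (topScale η X : ℝ)⌉₊ (topScale η X), (1 / (u : ℝ)))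
    B T 1 (c / 8) Q.card (midSum Q h) (Finset.Subset.refl _) (fun v _ => by positivity) ?_
    (fun u hu => hB u (hva.trans (Finset.mem_Icc.1 hu).1)) hT1 hTX zero_le_one le_rfl
    (hTX.trans ((Real.rpow_one X).symm.le.trans (Real.rpow_le_rpow_of_exponent_le hX1 (by linarith)))) (CB_midSum Q h)
    (norm_midSum_le Q h) hR0 hG2 (fun g hg => Or.inr ?_) u hu Y hY1 hY2
  · rw [← Finset.sum_div]
    exact div_self hpos.ne'
  · have hg1 : ((g:ℝ) + 1) * δ ≤ 1 / 4 - e := by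
      rw [← hNδ]
      exact mul_le_mul_of_nonneg_right (by exact_mod_cast hg) hδ0
    exact cell_exponent_le he he8 hde hηc hc hδ0 hδc (by positivity) hg1

end Law

lemma eventually_tail_le (d S : ℝ) (hd : 0 < d) (hS : 1 ≤ S) : ∀ᶠ X : ℝ in Filter.atTop, ∀ T : ℝ, 1 ≤ T → T ≤ X →
    32 * S / Real.sqrt (X ^ (d / 8)) + 32 * S * T * Real.exp (4 - 4 * (T * Real.log X) / T) ≤ 1 / 4 := by
  filter_upwards [eventually_const_le (256 * S) (d / 16) (by positivity), eventually_const_le (256 * S * Real.exp 4) 1 one_pos,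
    Filter.eventually_ge_atTop 1] with X h1 h2 hX1 T hT1 hTX
  have hXp : 0 < X := by linarith
  have hTp : 0 < T := by linarith
  rw [Real.rpow_one] at h2
  rw [sqrt_rpow_eq X (d / 8) (d / 16) hXp.le (by ring)]
  have e1 : 32 * S / X ^ (d / 16) ≤ 1 / 8 := by
    rw [div_le_iff₀ (by positivity)]; linarith
  have e2 : 32 * S * T * Real.exp (4 - 4 * (T * Real.log X) / T) ≤ 1 / 8 := by
    have e3 : 4 * (T * Real.log X) / T = Real.log X * 4 := by field_simp
    rw [e3, Real.exp_sub, Real.exp_mul, Real.exp_log hXp, ← mul_div_assoc, div_le_iff₀ (by positivity)]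
    have e4 : X ^ (4:ℝ) = X ^ 4 := by norm_cast
    rw [e4]
    have e5 : X * X ≤ X ^ 4 := by rw [← sq]; exact pow_le_pow_right₀ hX1 (by norm_num)
    have hS0 : 0 ≤ 32 * S * Real.exp 4 := by positivity
    calc 32 * S * T * Real.exp 4 = (32 * S * Real.exp 4) * T := by ring
      _ ≤ (32 * S * Real.exp 4) * X := mul_le_mul_of_nonneg_left hTX hS0
      _ ≤ (X / 8) * X := mul_le_mul_of_nonneg_right (by linarith) hXp.le
      _ = 1 / 8 * (X * X) := by ring
      _ ≤ _ := mul_le_mul_of_nonneg_left e5 (by norm_num)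
  linarith

lemma smoothing_error_le {X h e T S g C R : ℝ} {v : ℕ} (hX : 0 < X) (hh : 1 ≤ h)
    (he : 0 ≤ e) (hT : T = X * h ^ (-1 + e)) (hR0 : 0 ≤ R) (hTR : T * R ≤ R ^ 2 * h ^ (1 / 2 - 8 * e))
    (hS : 0 ≤ S) (hg : 0 ≤ g) (hv : (v : ℝ) ≤ Real.log h) (hC : 1200 * Real.sqrt (S ^ 3 * (33 * g)) ≤ C)
    (hexp : Real.exp (-(1 / (2048 * S ^ 2) * h ^ (2 * e))) * (C * h) ≤ 1 / 4) :
    Real.exp (-((T * h / X) ^ 2 / (2048 * S ^ 2))) * (1200 * Real.sqrt (S ^ 3 * ((1 + 32 * v) * g) * T * R)) ≤ R / 4 := by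
  have hhp : 0 < h := by linarith
  have e1 : T * h / X = h ^ e := by
    rw [hT, Real.rpow_add hhp, Real.rpow_neg_one]; field_simp
  have e2 : (h ^ e) ^ 2 / (2048 * S ^ 2) = 1 / (2048 * S ^ 2) * h ^ (2 * e) := by
    rw [← Real.rpow_natCast, ← Real.rpow_mul hhp.le]
    rw [show e * ((2:ℕ):ℝ) = 2 * e by push_cast; ring]; ring
  rw [e1, e2]
  have hvh : 1 + 32 * (v:ℝ) ≤ 33 * h := by
    have := Real.log_le_sub_one_of_pos hhp
    linarith
  have hh1 : h ^ (1 / 2 - 8 * e) ≤ h := by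
    calc _ ≤ h ^ (1:ℝ) := Real.rpow_le_rpow_of_exponent_le hh (by linarith)
      _ = h := Real.rpow_one h
  have e3 : S ^ 3 * ((1 + 32 * v) * g) * T * R ≤ S ^ 3 * (33 * g) * (h * R) ^ 2 := by
    calc S ^ 3 * ((1 + 32 * v) * g) * T * R = S ^ 3 * g * (1 + 32 * v) * (T * R) := by ring
      _ ≤ S ^ 3 * g * (33 * h) * (R ^ 2 * h) := by
          refine mul_le_mul (mul_le_mul_of_nonneg_left hvh (by positivity))
            (hTR.trans (mul_le_mul_of_nonneg_left hh1 (by positivity))) ?_ (by positivity)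
          rw [hT]; positivity
      _ = _ := by ring
  have e4 : 1200 * Real.sqrt (S ^ 3 * ((1 + 32 * v) * g) * T * R) ≤ C * h * R := by
    calc _ ≤ 1200 * Real.sqrt (S ^ 3 * (33 * g) * (h * R) ^ 2) :=
          mul_le_mul_of_nonneg_left (Real.sqrt_le_sqrt e3) (by norm_num)
      _ = 1200 * Real.sqrt (S ^ 3 * (33 * g)) * (h * R) := by
          rw [Real.sqrt_mul (by positivity), Real.sqrt_sq (by positivity)]; ring
      _ ≤ C * (h * R) := mul_le_mul_of_nonneg_right hC (by positivity)
      _ = C * h * R := by ring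
  calc _ ≤ Real.exp (-(1 / (2048 * S ^ 2) * h ^ (2 * e))) * (C * h * R) := mul_le_mul_of_nonneg_left e4 (Real.exp_pos _).le
    _ = Real.exp (-(1 / (2048 * S ^ 2) * h ^ (2 * e))) * (C * h) * R := by ring
    _ ≤ 1 / 4 * R := mul_le_mul_of_nonneg_right hexp hR0
    _ = R / 4 := by ring

lemma small_part_le {h e I C R : ℝ} (hh : 1 ≤ h) (he : 0 < e) (he8 : e ≤ 1 / 8) (hR0 : 0 ≤ R)
    (hI : I ≤ 96 * (R ^ 2 * h ^ (1 / 2 - 8 * e))) (hC : 0 ≤ C) (hCh : 320 * C ≤ h ^ (3 / 2 * e)) :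
    (4:ℝ) ^ (-((1 / 4 - 2 * e) * topScale (1 - 2 * e) h)) * (C * Real.sqrt I) ≤ R / 8 := by
  have hhp : 0 < h := by linarith
  have hv := le_four_pow_topScale_mul (1 - 2 * e) h hh
  set v := topScale (1 - 2 * e) h with hvdef
  have hx : 0 ≤ 1 / 4 - 2 * e := by linarith
  have e1 : (4:ℝ) ^ (-((1 / 4 - 2 * e) * v)) ≤ 4 * h ^ (-(1 / 4) + 5 / 2 * e) := by
    have e2 : (4:ℝ) ^ (-((1 / 4 - 2 * e) * (v:ℝ))) = ((4:ℝ) ^ v) ^ (-(1 / 4 - 2 * e)) := by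
      rw [← Real.rpow_natCast, ← Real.rpow_mul (by norm_num)]; congr 1; ring
    rw [e2]
    calc ((4:ℝ) ^ v) ^ (-(1 / 4 - 2 * e)) ≤ (h ^ (1 - 2 * e) / 4) ^ (-(1 / 4 - 2 * e)) :=
          Real.rpow_le_rpow_of_nonpos (by positivity) hv (by linarith)
      _ = h ^ ((1 - 2 * e) * -(1 / 4 - 2 * e)) * 4 ^ (1 / 4 - 2 * e) := by
          rw [Real.div_rpow (by positivity) (by norm_num), ← Real.rpow_mul hhp.le, Real.rpow_neg (x := 4) (by norm_num), div_inv_eq_mul]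
      _ ≤ h ^ (-(1 / 4) + 5 / 2 * e) * 4 ^ (1:ℝ) := by
          refine mul_le_mul (Real.rpow_le_rpow_of_exponent_le hh ?_) (Real.rpow_le_rpow_of_exponent_le (by norm_num) (by linarith))
            (by positivity) (by positivity)
          have : 0 ≤ e * e := by positivity
          linarith
      _ = _ := by rw [Real.rpow_one, mul_comm]
  have e3 : Real.sqrt I ≤ 10 * (R * h ^ (1 / 4 - 4 * e)) := by
    refine Real.sqrt_le_iff.2 ⟨by positivity, hI.trans ?_⟩
    have e4 : (h ^ (1 / 4 - 4 * e)) ^ 2 = h ^ (1 / 2 - 8 * e) := by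
      rw [← Real.rpow_natCast, ← Real.rpow_mul hhp.le]; congr 1; push_cast; ring
    rw [mul_pow, mul_pow, e4]
    refine mul_le_mul_of_nonneg_right (by norm_num) (by positivity)
  calc _ ≤ (4 * h ^ (-(1 / 4) + 5 / 2 * e)) * (C * (10 * (R * h ^ (1 / 4 - 4 * e)))) :=
        mul_le_mul e1 (mul_le_mul_of_nonneg_left e3 hC) (by positivity) (by positivity)
    _ = 40 * C * R * (h ^ (-(1 / 4) + 5 / 2 * e) * h ^ (1 / 4 - 4 * e)) := by ring
    _ = (320 * C) * h ^ (-(3 / 2 * e)) * R / 8 := by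
        rw [← Real.rpow_add hhp, show -(1 / 4) + 5 / 2 * e + (1 / 4 - 4 * e) = -(3 / 2 * e) by ring]; ring
    _ ≤ h ^ (3 / 2 * e) * h ^ (-(3 / 2 * e)) * R / 8 := by
        refine div_le_div_of_nonneg_right (mul_le_mul_of_nonneg_right (mul_le_mul_of_nonneg_right hCh (by positivity)) hR0) (by norm_num)
    _ = R / 8 := by rw [← Real.rpow_add hhp, add_neg_cancel, Real.rpow_zero, one_mul]

/-- Size conditions for the law used with short intervals. -/
lemma eventually_size_le {θ d η S : ℝ} {l : ℕ} (hd : 0 < d) (hd1 : d ≤ 1 / 4) (hη : 0 < η)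
    (hl : ((l : ℝ) + 1) * η = 1 - d) (hθ : 0 < θ) (hdθ : d ≤ θ / 4) (hηθ : η ≤ θ / 2) (hS : 1 ≤ S) :
    ∀ᶠ X : ℝ in Filter.atTop,
      (∀ y P : ℝ, 0 ≤ y → y ≤ 4 * X ^ (d / 64) → 0 ≤ P → P ≤ X ^ (d / 32) →
        4 * S * X ^ (d / 8) * (y * ((4 ^ (topScale η X + 1)) ^ (l + 1) * P)) ≤ X ∧
        X ^ (1 - d / 4) * P * y ≤ X / (2 * S)) ∧
      (4:ℝ) ^ (topScale η X + 1) ≤ X ^ θ ∧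
      8 * X ≤ X ^ θ * (4 ^ ⌈(1 - d / 4) * (topScale η X : ℝ)⌉₊) ^ (l + 1) := by
  filter_upwards [eventually_const_le (4 * S * 4 * 4 ^ (l + 1)) (d / 4) (by positivity),
    eventually_const_le (8 * S) (d / 64) (by positivity), eventually_const_le 4 (θ / 2) (by positivity),
    eventually_const_le (8 * 4 ^ (l + 1)) (θ / 2) (by positivity), Filter.eventually_ge_atTop 1] with X h1 h2 h3 h4 hX1
  have hXp : 0 < X := by linarith
  have hE := four_pow_topScale_le η X hη.le hX1
  have hE' : (4:ℝ) ^ (topScale η X + 1) ≤ 4 * X ^ η := by rw [pow_succ]; linarith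
  refine ⟨fun y P hy hyX hP hPX => ⟨?_, ?_⟩, ?_, ?_⟩
  · have e1 : ((4:ℝ) ^ (topScale η X + 1)) ^ (l + 1) ≤ 4 ^ (l + 1) * X ^ (1 - d) := by
      calc ((4:ℝ) ^ (topScale η X + 1)) ^ (l + 1) ≤ (4 * X ^ η) ^ (l + 1) := pow_le_pow_left₀ (by positivity) hE' _
        _ = 4 ^ (l + 1) * X ^ (1 - d) := by
            rw [mul_pow, ← Real.rpow_natCast (X ^ η), ← Real.rpow_mul hXp.le, ← hl]
            congr 2; push_cast; ring
    calc 4 * S * X ^ (d / 8) * (y * ((4 ^ (topScale η X + 1)) ^ (l + 1) * P)) ≤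
          4 * S * X ^ (d / 8) * ((4 * X ^ (d / 64)) * ((4 ^ (l + 1) * X ^ (1 - d)) * X ^ (d / 32))) := by
          refine mul_le_mul_of_nonneg_left (mul_le_mul hyX (mul_le_mul e1 hPX hP (by positivity)) (by positivity)
            (by positivity)) (by positivity)
      _ = 4 * S * 4 * 4 ^ (l + 1) * (X ^ (d / 8) * X ^ (d / 64) * X ^ (1 - d) * X ^ (d / 32)) := by ring
      _ ≤ X ^ (d / 4) * (X ^ (d / 8) * X ^ (d / 64) * X ^ (1 - d) * X ^ (d / 32)) :=
          mul_le_mul_of_nonneg_right h1 (by positivity)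
      _ = X ^ (d / 4 + (d / 8 + d / 64 + (1 - d) + d / 32)) := by
          simp only [← Real.rpow_add hXp]
      _ ≤ X ^ (1:ℝ) := Real.rpow_le_rpow_of_exponent_le hX1 (by linarith)
      _ = X := Real.rpow_one X
  · rw [le_div_iff₀ (by positivity)]
    calc X ^ (1 - d / 4) * P * y * (2 * S) ≤ X ^ (1 - d / 4) * X ^ (d / 32) * (4 * X ^ (d / 64)) * (2 * S) := by
          refine mul_le_mul_of_nonneg_right (mul_le_mul (mul_le_mul_of_nonneg_left hPX (by positivity)) hyX hy
            (by positivity)) (by positivity)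
      _ = (8 * S) * (X ^ (1 - d / 4) * X ^ (d / 32) * X ^ (d / 64)) := by ring
      _ ≤ X ^ (d / 64) * (X ^ (1 - d / 4) * X ^ (d / 32) * X ^ (d / 64)) := mul_le_mul_of_nonneg_right h2 (by positivity)
      _ = X ^ (d / 64 + (1 - d / 4 + d / 32 + d / 64)) := by simp only [← Real.rpow_add hXp]
      _ ≤ X ^ (1:ℝ) := Real.rpow_le_rpow_of_exponent_le hX1 (by linarith)
      _ = X := Real.rpow_one X
  · calc (4:ℝ) ^ (topScale η X + 1) ≤ 4 * X ^ η := hE'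
      _ ≤ X ^ (θ / 2) * X ^ (θ / 2) :=
          mul_le_mul h3 (Real.rpow_le_rpow_of_exponent_le hX1 hηθ) (by positivity) (by positivity)
      _ = X ^ θ := by rw [← Real.rpow_add hXp]; congr 1; ring
  · have e1 := four_pow_scale_ge η (d / 4) X _ (by positivity) (by linarith) hX1 le_rfl
    have e2 : X ^ (1 - 2 * d) / 4 ^ (l + 1) ≤ ((4:ℝ) ^ ⌈(1 - d / 4) * (topScale η X : ℝ)⌉₊) ^ (l + 1) := by
      calc X ^ (1 - 2 * d) / 4 ^ (l + 1) ≤ X ^ (η * (1 - d / 4) * ((l + 1 : ℕ) : ℝ)) / 4 ^ (l + 1) := by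
            refine div_le_div_of_nonneg_right (Real.rpow_le_rpow_of_exponent_le hX1 ?_) (by positivity)
            have : η * (1 - d / 4) * ((l + 1 : ℕ) : ℝ) = (1 - d) * (1 - d / 4) := by
              rw [← hl]; push_cast; ring
            rw [this]
            have : 0 ≤ d * d := by positivity
            linarith
        _ = (X ^ (η * (1 - d / 4)) / 4) ^ (l + 1) := by
            rw [div_pow, ← Real.rpow_natCast (X ^ _), ← Real.rpow_mul hXp.le]
        _ ≤ _ := pow_le_pow_left₀ (by positivity) e1 _
    calc 8 * X = X ^ θ * ((8 * 4 ^ (l + 1)) * X ^ (1 - θ) / 4 ^ (l + 1)) := by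
          rw [Real.rpow_sub hXp, Real.rpow_one]; field_simp
      _ ≤ X ^ θ * (X ^ (θ / 2) * X ^ (1 - θ) / 4 ^ (l + 1)) := by
          refine mul_le_mul_of_nonneg_left (div_le_div_of_nonneg_right (mul_le_mul_of_nonneg_right h4 (by positivity))
            (by positivity)) (by positivity)
      _ ≤ X ^ θ * (X ^ (1 - 2 * d) / 4 ^ (l + 1)) := by
          rw [← Real.rpow_add hXp]
          refine mul_le_mul_of_nonneg_left (div_le_div_of_nonneg_right (Real.rpow_le_rpow_of_exponent_le hX1 (by linarith))
            (by positivity)) (by positivity)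
      _ ≤ _ := mul_le_mul_of_nonneg_left e2 (by positivity)

/-- The bound for bad sets when `h` is at most a small power of `X`. -/
lemma BadSet.card_le_of_short {θ e : ℝ} (hθ : 0 < θ) (he : 0 < e) (he8 : e ≤ 1 / 8) :
    ∃ c₀ h₀ : ℝ, 0 < c₀ ∧ ∀ᶠ X : ℝ in Filter.atTop, ∀ h, h₀ ≤ h → h ≤ X ^ c₀ → ∀ Q : Finset ℕ, BadSet θ X h Q →
      (Q.card : ℝ) ≤ X * h ^ (-1 + e) * h ^ (-(1 / 2) + 8 * e) := by
  set d : ℝ := min (e / 2) (θ / 4) with hddef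
  have hd : 0 < d := lt_min (by positivity) (by positivity)
  have hde : d ≤ e / 2 := min_le_left _ _
  have hdθ : d ≤ θ / 4 := min_le_right _ _
  obtain ⟨c, hc, hc1, hD⟩ := eventually_norm_dz_le (d / 2) (2 * d) (d / 16) (by positivity) (by positivity) (by positivity)
  set m : ℝ := min d (min (c / 20) (θ / 2)) with hmdef
  have hm : 0 < m := lt_min hd (lt_min (by positivity) (by positivity))
  set l : ℕ := ⌈1 / m⌉₊ with hldef
  have hlm : 1 / m ≤ l := Nat.le_ceil _
  set η : ℝ := (1 - d) / (l + 1) with hηdef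
  have hη : 0 < η := div_pos (by linarith) (by positivity)
  have hl : ((l : ℝ) + 1) * η = 1 - d := by rw [hηdef]; field_simp
  have hηm : η ≤ m := by
    rw [hηdef, div_le_iff₀ (by positivity)]
    rw [div_le_iff₀ hm] at hlm
    linarith
  have hηd : η ≤ d := hηm.trans (min_le_left _ _)
  have hηc : η ≤ c / 20 := hηm.trans ((min_le_right _ _).trans (min_le_left _ _))
  have hηθ : η ≤ θ / 2 := hηm.trans ((min_le_right _ _).trans (min_le_right _ _))
  set S : ℝ := 4 ^ (l + 2) with hSdef
  have hS : 1 ≤ S := one_le_pow₀ (by norm_num)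
  set c₀ : ℝ := min (d / 64) (min (c / 8) (η / 4 / (140 / e))) with hc₀def
  have hc₀ : 0 < c₀ := lt_min (by positivity) (lt_min (by positivity) (by positivity))
  have hc₀d : c₀ ≤ d / 64 := min_le_left _ _
  have hc₀c : c₀ ≤ c / 8 := (min_le_right _ _).trans (min_le_left _ _)
  have hc₀η : 140 / e * c₀ ≤ η / 4 := by
    have h1 : c₀ ≤ η / 4 / (140 / e) := (min_le_right _ _).trans (min_le_right _ _)
    rw [le_div_iff₀ (by positivity)] at h1
    linarith
  set g : ℝ := (1 + (l + 1) * (128 / d)) ^ (l + 1) * Real.exp 1 with hgdef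
  have hg : 0 ≤ g := by positivity
  obtain ⟨h₁, hlad⟩ := Law.exists_ladderBound (θ := θ) he he8 hd (by linarith) hη hηd hηc hl hc hc1 hc₀c hc₀η hS hD
  obtain ⟨v₁, hv₁, hblock⟩ := Law.exists_isBlock
  obtain ⟨h₂, hh₂⟩ := Filter.eventually_atTop.1 (((eventually_topScale_large (1 - 2 * e) 1 32 v₁ (by linarith)).and
    (eventually_exp_neg_rpow_le (2 * e) (1 / (2048 * S ^ 2)) (1200 * Real.sqrt (S ^ 3 * (33 * g))) (by positivity) (by positivity))).and
    ((eventually_const_le (320 * Real.sqrt (48 * (16 * S) ^ 2 * (4 ^ (l + 1) * 2) * g)) (3 / 2 * e) (by positivity)).and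
      (eventually_const_le (8 * S) e he)))
  refine ⟨c₀, max 1 (max h₁ h₂), hc₀, ?_⟩
  filter_upwards [hlad, eventually_size_le hd (by linarith) hη hl hθ hdθ hηθ hS, eventually_tail_le d S hd hS,
    eventually_const_le 16 (c / 20) (by positivity), Filter.eventually_ge_atTop 1] with X hlad hsize htail h16 hX1
  intro h hh hhX Q hQ
  have hXp : 0 < X := by linarith
  have hh1 : 1 ≤ h := (le_max_left _ _).trans hh
  have hhp : 0 < h := by linarith
  obtain ⟨⟨⟨hvv, -, hv32, -⟩, hexp⟩, hsm, h8S⟩ := hh₂ h ((le_max_right _ _).trans ((le_max_right _ _).trans hh))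
  obtain ⟨D, n, hDn, hlad⟩ := hlad h ((le_max_left _ _).trans ((le_max_right _ _).trans hh)) hhX
  obtain ⟨hsize, hhi, hLw⟩ := hsize
  have hhX' : h ≤ X := hhX.trans ((Real.rpow_le_rpow_of_exponent_le hX1 (by linarith)).trans (Real.rpow_one X).le)
  by_contra hcon
  rw [not_le] at hcon
  obtain ⟨T, hT⟩ : ∃ T, T = X * h ^ (-1 + e) := ⟨_, rfl⟩
  rw [← hT] at hcon
  have hLB := hlad Q T hQ hT hcon.le
  obtain ⟨hT1, hTX, hThX⟩ := height_bounds hX1 hh1 hhX' he.le (by linarith) hT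
  obtain ⟨hI, hTR⟩ := hQ.integral_le hX1 hh1 hhX' he.le (by linarith) hT hcon.le
  have hR0 : (0:ℝ) ≤ Q.card := Nat.cast_nonneg _
  have hvh := four_pow_topScale_le (1 - 2 * e) h (by linarith) hh1
  have hvlog : (topScale (1 - 2 * e) h : ℝ) ≤ Real.log h := by
    have := topScale_le_log (1 - 2 * e) h (by linarith) (by linarith) hh1
    linarith
  have hvs : ∀ C, 4 ^ topScale (1 - 2 * e) h ≤ C → (4:ℝ) ^ (topScale (1 - 2 * e) h + 1) ≤ 4 * C := fun C hC => by
    rw [pow_succ]; linarith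
  have hs4 := small_part_le hh1 he he8 hR0 hI (Real.sqrt_nonneg _) hsm
  have hblock' := hblock 0 (topScale (1 - 2 * e) h) hvv
  set v := topScale (1 - 2 * e) h with hvdef
  have hy : (4:ℝ) ^ (v + 1) ≤ 4 * X ^ (d / 64) := by
    refine hvs _ (hvh.trans ?_)
    calc h ^ (1 - 2 * e) ≤ h ^ (1:ℝ) := Real.rpow_le_rpow_of_exponent_le hh1 (by linarith)
      _ = h := Real.rpow_one h
      _ ≤ X ^ c₀ := hhX
      _ ≤ _ := Real.rpow_le_rpow_of_exponent_le hX1 hc₀d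
  have hT₀ : (1:ℝ) ≤ X ^ (d / 8) := Real.one_le_rpow hX1 (by positivity)
  have hT₀T : X ^ (d / 8) ≤ T := by
    have e1 : X ^ (-c₀) ≤ h ^ (-1 + e) := by
      calc X ^ (-c₀) = (X ^ c₀) ^ (-1:ℝ) := by rw [← Real.rpow_mul hXp.le]; congr 1; ring
        _ ≤ h ^ (-1:ℝ) := Real.rpow_le_rpow_of_nonpos hhp hhX (by norm_num)
        _ ≤ _ := Real.rpow_le_rpow_of_exponent_le hh1 (by linarith)
    calc X ^ (d / 8) ≤ X ^ (1 + -c₀) := Real.rpow_le_rpow_of_exponent_le hX1 (by linarith)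
      _ = X * X ^ (-c₀) := by rw [Real.rpow_add hXp, Real.rpow_one]
      _ ≤ T := by rw [hT]; exact mul_le_mul_of_nonneg_left e1 hXp.le
  have hDn' : 0 ≤ max (D ^ n) 0 := le_max_right _ _
  have hcard : Q.card = 0 := by
    refine hLB.card_eq_zero hblock' (le_of_eq ?_) rfl hX1 hhp hhX' hT₀ hT₀T hTX hThX ?_ hQ.mem hQ.sep hθ.le
      (by push_cast; exact hhi) (by positivity) hLw hQ.bad
      (smoothing_error_le hXp hh1 he.le hT hR0 hTR (by linarith) hg hvlog le_rfl hexp) (htail T hT1 hTX) ?_ ?_ hs4 ?_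
    · rw [hSdef, pow_succ 4 (l + 1)]; ring
    · refine le_trans ?_ (hsize _ _ (by positivity) hy hDn' (max_le hDn (by positivity))).1
      refine mul_le_mul_of_nonneg_left (mul_le_mul_of_nonneg_left (mul_le_mul_of_nonneg_left (le_max_left _ _) ?_) ?_) ?_ <;>
        positivity
    · refine le_trans ?_ (hsize _ _ (by positivity) hy hDn' (max_le hDn (by positivity))).2
      exact mul_le_mul_of_nonneg_right (mul_le_mul_of_nonneg_left (le_max_left _ _) (by positivity)) (by positivity)
    · rw [le_div_iff₀ (by positivity), hT]
      calc X * h ^ (-1 + e) * 4 ^ (v + 1) * (2 * S) ≤ X * h ^ (-1 + e) * (4 * h ^ (1 - 2 * e)) * (2 * S) :=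
            mul_le_mul_of_nonneg_right (mul_le_mul_of_nonneg_left (hvs _ hvh) (by positivity)) (by positivity)
        _ = X * (h ^ (-1 + e) * h ^ (1 - 2 * e)) * (8 * S) := by ring
        _ = X * h ^ (-e) * (8 * S) := by rw [← Real.rpow_add hhp]; congr 3; ring
        _ ≤ X * h ^ (-e) * h ^ e := mul_le_mul_of_nonneg_left h8S (by positivity)
        _ = X := by rw [mul_assoc, ← Real.rpow_add hhp, neg_add_cancel, Real.rpow_zero, mul_one]
    · have e1 : ((4:ℝ) ^ v)⁻¹ ≤ 32⁻¹ := inv_anti₀ (by norm_num) hv32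
      have e2 : X ^ (-(c / 20)) ≤ 16⁻¹ := by
        rw [Real.rpow_neg hXp.le]; exact inv_anti₀ (by norm_num) h16
      linarith
  rw [hcard] at hcon
  have : 0 < T * h ^ (-(1 / 2) + 8 * e) := by
    have : 0 < T := by linarith
    positivity
  rw [Nat.cast_zero] at hcon
  linarith

namespace Law

lemma R_of_const (A : Law) (κ Y t y : ℝ) (hy : ∀ i, A.y i = y) : A.R κ Y t = A.poly t * dz κ (Y / y) t := by
  unfold R poly
  rw [Finset.sum_mul]
  exact Finset.sum_congr rfl fun i _ => by rw [hy]

lemma poly_mix_singleton (E : ℕ) (W : ℕ → ℝ) (B : ℕ → Law) (hW : W E = 1) (t : ℝ) :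
    (mix {E} W B).poly t = (B E).poly t := by
  unfold poly mix
  simp only
  rw [Fintype.sum_sigma, Finset.sum_coe_sort {E} fun v => ∑ i : (B v).ι, ((W v * (B v).w i : ℝ) : ℂ) * ch t ((B v).s i),
    Finset.sum_singleton, hW]
  simp only [one_mul]

lemma R_pow_mix_singleton (E : ℕ) (W : ℕ → ℝ) (B : ℕ → Law) (hW : W E = 1) (y : ℝ) (hy : ∀ i, (B E).y i = y)
    (hs : ∀ i, (B E).s i ≠ 0) (l : ℕ) (κ Y t : ℝ) :
    ((mix {E} W B).pow l).R κ Y t = ((B E).pow l).R κ Y t := by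
  have hmy : ∀ i, (mix {E} W B).y i = y := by
    rintro ⟨⟨v, hv⟩, i⟩
    obtain rfl := Finset.mem_singleton.1 hv
    exact hy i
  have hms : ∀ i, (mix {E} W B).s i ≠ 0 := by
    rintro ⟨⟨v, hv⟩, i⟩
    obtain rfl := Finset.mem_singleton.1 hv
    exact hs i
  rw [R_of_const _ κ Y t _ (pow_y_const _ y hmy l), R_of_const _ κ Y t _ (pow_y_const _ y hy l), poly_pow _ hms,
    poly_pow _ hs, poly_mix_singleton E W B hW]

lemma R_pow_add (A : Law) (κ Y t y : ℝ) (hy : ∀ i, A.y i = y) (hs : ∀ i, A.s i ≠ 0) (j k : ℕ) :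
    (A.pow (j + k)).R κ Y t = ((A.pow j).prod (A.pow k)).R κ Y t := by
  rw [R_pow_prod_const A _ κ Y t y j hs (pow_s_ne_zero A hs k) hy, R_of_const _ κ Y t _ (pow_y_const A y hy (j + k)),
    R_of_const _ κ _ t _ (pow_y_const A y hy k), poly_pow A hs, poly_pow A hs, pow_add, pow_add, div_div]
  ring

end Law

lemma div_one_sub_add_le {x δ τ : ℝ} (hδ : 0 ≤ δ) (hxδ : x + δ ≤ 1 / 4) (hτ0 : 0 ≤ τ) (hτ : τ ≤ 1) :
    τ * (x + δ) / (1 - 2 * (x + δ)) ≤ τ * x / (1 - 2 * x) + 4 * δ := by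
  have h1 : 0 < 1 - 2 * (x + δ) := by linarith
  have h2 : 0 < 1 - 2 * x := by linarith
  have h3 : (x + δ) / (1 - 2 * (x + δ)) ≤ x / (1 - 2 * x) + 4 * δ := by
    have e : (x + δ) / (1 - 2 * (x + δ)) - x / (1 - 2 * x) = δ / ((1 - 2 * x) * (1 - 2 * (x + δ))) := by
      rw [div_sub_div _ _ h1.ne' h2.ne', mul_comm (1 - 2 * (x + δ)) (1 - 2 * x)]
      congr 1; ring
    have e2 : δ / ((1 - 2 * x) * (1 - 2 * (x + δ))) ≤ 4 * δ := by
      rw [div_le_iff₀ (by positivity)]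
      have : (1 / 2 : ℝ) * (1 / 2) ≤ (1 - 2 * x) * (1 - 2 * (x + δ)) :=
        mul_le_mul (by linarith) (by linarith) (by norm_num) h2.le
      have := mul_le_mul_of_nonneg_left this (by positivity : 0 ≤ 4 * δ)
      linarith
    linarith
  calc τ * (x + δ) / (1 - 2 * (x + δ)) = τ * ((x + δ) / (1 - 2 * (x + δ))) := by ring
    _ ≤ τ * (x / (1 - 2 * x) + 4 * δ) := mul_le_mul_of_nonneg_left h3 hτ0
    _ = τ * x / (1 - 2 * x) + τ * (4 * δ) := by ring
    _ ≤ τ * x / (1 - 2 * x) + 4 * δ := by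
        have := mul_le_of_le_one_left (by positivity : 0 ≤ 4 * δ) hτ
        linarith

/-- For intervals of length `X ^ r`, on each cell one of the two ways of estimating the long sum wins. -/
lemma long_cell_exponent {e d η c δ g r τ : ℝ} (he : 0 < e) (he8 : e ≤ 1 / 8) (hd : 0 < d) (hdr : d ≤ e * r)
    (hηc : η ≤ c / 20) (hc : 0 < c) (hδ0 : 0 ≤ δ) (hδc : δ ≤ c / 20) (hg : 0 ≤ g) (hg1 : (g + 1) * δ ≤ 1 / 4 - e)
    (hτ : τ = 1 + (-1 + e) * r) (hτ0 : 0 ≤ τ) :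
    -((1 - 3 * d) * (g * δ)) - c + (τ * ((g + 1) * δ) / (1 - 2 * ((g + 1) * δ)) + 4 * (c / 20) + η) ≤ -(2 * (c / 20)) ∨
    2 * (-((1 - 3 * d) * (g * δ)) - c) + (τ * ((g + 1) * δ) / (1 - 2 * ((g + 1) * δ)) + 4 * (c / 20) + η) +
      ((1 / 2 - 8 * e) * r + c / 8) ≤ -(4 * (c / 20)) := by
  have hx0 : 0 ≤ g * δ := by positivity
  rw [add_mul, one_mul] at hg1 ⊢
  have hr0 : 0 < r := by
    by_contra h
    have := mul_nonpos_of_nonneg_of_nonpos he.le (not_lt.1 h)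
    linarith
  have her : 0 < e * r := by positivity
  have herr : e * r ≤ r / 8 := by
    have := mul_le_mul_of_nonneg_right he8 hr0.le
    linarith
  have hτ1 : τ ≤ 1 := by rw [hτ]; linarith
  have h1 := div_one_sub_add_le (x := g * δ) hδ0 (by linarith) hτ0 hτ1
  set x := g * δ with hxdef
  have hu : 0 < 1 - 2 * x := by linarith
  have hx4 : x ≤ 1 / 4 := by linarith
  have hdx : 0 ≤ d * x := by positivity
  have hdx4 : d * x ≤ d * (1 / 4) := mul_le_mul_of_nonneg_left hx4 hd.le
  have hdxx : 0 ≤ d * x * x := by positivity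
  rcases le_total (2 * x) (r - 8 * (e * r)) with h | h
  · left
    have h2 : τ * x / (1 - 2 * x) ≤ (1 - 3 * d) * x := by
      rw [div_le_iff₀ hu]
      have : τ ≤ (1 - 3 * d) * (1 - 2 * x) := by rw [hτ]; linarith
      have := mul_le_mul_of_nonneg_right this hx0
      linarith
    linarith
  · right
    have h2 : τ * x / (1 - 2 * x) ≤ 2 * x - 6 * (d * x) - (1 / 2 - 8 * e) * r := by
      rw [div_le_iff₀ hu]
      have h3 : -(4 * (e * r)) ≤ x - r / 2 := by linarith
      have h4 : (1 - 4 * x) * -(4 * (e * r)) ≤ (1 - 4 * x) * (x - r / 2) := mul_le_mul_of_nonneg_left h3 (by linarith)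
      have h5 : e * r * x ≤ e * r * (1 / 4) := mul_le_mul_of_nonneg_left hx4 her.le
      rw [hτ]
      linarith
    linarith

lemma long_small_part_le {h e y I C R : ℝ} {E j : ℕ} (hh : 1 ≤ h) (he : 0 < e) (he8 : e ≤ 1 / 8) (hR0 : 0 ≤ R)
    (hy : y = 4 ^ E) (hj : h ^ (1 - 2 * e) < y ^ (j + 1)) (hI : I ≤ 96 * (R ^ 2 * h ^ (1 / 2 - 8 * e))) (hC : 0 ≤ C)
    (hCh : 80 * C * y ≤ h ^ (5 / 2 * e)) :
    ((4:ℝ) ^ (-((1 / 4 - e) * E))) ^ j * (C * Real.sqrt I) ≤ R * (1 / 8) := by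
  have hhp : 0 < h := by linarith
  have hy1 : 1 ≤ y := by rw [hy]; exact one_le_pow₀ (by norm_num)
  have hyp : 0 < y := by linarith
  have hα : 0 ≤ 1 / 4 - e := by linarith
  have e1 : ((4:ℝ) ^ (-((1 / 4 - e) * E))) ^ j ≤ h ^ (-(1 / 4) + 3 / 2 * e) * y := by
    have e2 : ((4:ℝ) ^ (-((1 / 4 - e) * (E:ℝ)))) ^ j = (y ^ j) ^ (-(1 / 4 - e)) := by
      rw [hy, ← Real.rpow_natCast, ← Real.rpow_natCast, ← Real.rpow_natCast, ← Real.rpow_mul (by norm_num),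
        ← Real.rpow_mul (by norm_num), ← Real.rpow_mul (by norm_num)]
      congr 1; ring
    rw [e2]
    have e3 : h ^ (1 - 2 * e) / y ≤ y ^ j := by
      rw [div_le_iff₀ hyp, ← pow_succ]; exact hj.le
    calc (y ^ j) ^ (-(1 / 4 - e)) ≤ (h ^ (1 - 2 * e) / y) ^ (-(1 / 4 - e)) :=
          Real.rpow_le_rpow_of_nonpos (by positivity) e3 (by linarith)
      _ = h ^ ((1 - 2 * e) * (-(1 / 4 - e))) * y ^ (1 / 4 - e) := by
          rw [Real.div_rpow (by positivity) hyp.le, ← Real.rpow_mul hhp.le, Real.rpow_neg hyp.le, div_inv_eq_mul]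
      _ ≤ h ^ (-(1 / 4) + 3 / 2 * e) * y ^ (1:ℝ) := by
          refine mul_le_mul (Real.rpow_le_rpow_of_exponent_le hh ?_) (Real.rpow_le_rpow_of_exponent_le hy1 (by linarith))
            (by positivity) (by positivity)
          have : 0 ≤ e * e := by positivity
          linarith
      _ = _ := by rw [Real.rpow_one]
  have e4 : Real.sqrt I ≤ 10 * (R * h ^ (1 / 4 - 4 * e)) := by
    refine Real.sqrt_le_iff.2 ⟨by positivity, hI.trans ?_⟩
    have : (h ^ (1 / 4 - 4 * e)) ^ 2 = h ^ (1 / 2 - 8 * e) := by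
      rw [← Real.rpow_natCast, ← Real.rpow_mul hhp.le]; congr 1; push_cast; ring
    rw [mul_pow, mul_pow, this]
    exact mul_le_mul_of_nonneg_right (by norm_num) (by positivity)
  have e5 : h ^ (-(1 / 4) + 3 / 2 * e) * h ^ (1 / 4 - 4 * e) = h ^ (-(5 / 2 * e)) := by
    rw [← Real.rpow_add hhp]; congr 1; ring
  have e6 : h ^ (-(5 / 2 * e)) * h ^ (5 / 2 * e) = 1 := by
    rw [← Real.rpow_add hhp, neg_add_cancel, Real.rpow_zero]
  calc ((4:ℝ) ^ (-((1 / 4 - e) * E))) ^ j * (C * Real.sqrt I) ≤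
        (h ^ (-(1 / 4) + 3 / 2 * e) * y) * (C * (10 * (R * h ^ (1 / 4 - 4 * e)))) :=
        mul_le_mul e1 (mul_le_mul_of_nonneg_left e4 hC) (by positivity) (by positivity)
    _ = (h ^ (-(1 / 4) + 3 / 2 * e) * h ^ (1 / 4 - 4 * e)) * (80 * C * y) * (R / 8) := by ring
    _ ≤ h ^ (-(5 / 2 * e)) * h ^ (5 / 2 * e) * (R / 8) := by
        rw [e5]
        exact mul_le_mul_of_nonneg_right (mul_le_mul_of_nonneg_left hCh (by positivity)) (by positivity)
    _ = R * (1 / 8) := by rw [e6]; ring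

namespace Law

lemma IsBlock.card_eq_zero {A : Law} {E l j : ℕ} (hA : IsBlock A 4 (16 * E) E (4 ^ E)) {S Γ X h T T₀ T₁ θ Lw α : ℝ}
    {Q : Finset ℕ} (hS : S = 4 ^ (l + 1)) (hΓ : (1 + ((l + 1 : ℕ) : ℝ) * (16 * E)) ^ (l + 1) ≤ Γ) (hjl : j ≤ l + 1)
    (hX : 1 ≤ X) (hh : 0 < h) (hhX : h ≤ X) (hT₀ : 1 ≤ T₀) (hT : T₀ ≤ T) (hTX : T ≤ X)
    (hThX : X ≤ h * T) (hU : 4 * S * T₀ * (4 ^ (E + 1)) ^ (l + 1) ≤ X)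
    (hQ : ∀ x ∈ Q, X ≤ (x : ℝ) ∧ (x : ℝ) ≤ 2 * X)
    (hsep : ∀ x ∈ Q, ∀ x' ∈ Q, x ≠ x' → h ≤ |(x : ℝ) - x'|) (hθ : 0 ≤ θ) (hhi : (4:ℝ) ^ (E + 1) ≤ X ^ θ)
    (hLw : Lw ≤ (4 ^ E) ^ (l + 1)) (hLwX : 8 * X ≤ X ^ θ * Lw)
    (hbad : ∀ x ∈ Q, ¬ ∃ n : ℕ, x < n ∧ (n : ℝ) ≤ (x : ℝ) + h ∧ ∀ p : ℕ, p.Prime → p ∣ n → (p : ℝ) ≤ (x : ℝ) ^ θ)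
    (h1 : Real.exp (-((T * h / X) ^ 2 / (2048 * S ^ 2))) * (1200 * Real.sqrt (S ^ 3 * Γ * T * Q.card)) ≤ Q.card / 4)
    (h2 : 32 * S / Real.sqrt T₀ + 32 * S * T * Real.exp (4 - 4 * T₁ / T) ≤ 1 / 4)
    (hTj : T ≤ X / (2 * S) / (4 ^ E) ^ j)
    (h3 : ((4:ℝ) ^ (-(α * E))) ^ j * (Real.sqrt (48 * (16 * S) ^ 2 * S * Γ) *
      Real.sqrt (T * ∫ t, ‖midSum Q h t‖ ^ 2 ∂gm T)) ≤ Q.card * (1 / 8))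
    (h4 : T * ∫ t in midRange T₀ T₁ ∩ A.largeSet α E,
      ‖(A.pow l).R (16 * S) (X / (2 * S) / 4 ^ E) t‖ * ‖midSum Q h t‖ ∂gm T ≤ Q.card * (1 / 8)) : Q.card = 0 := by
  have hP := hA.primeLaw
  have hAy := hA.y_eq
  have hA0 := hP.good.s_ne_zero
  have hTp : 0 < T := by linarith
  have hS1 : 1 ≤ S := by rw [hS]; exact one_le_pow₀ (by norm_num)
  have hgood : ∀ k, k ≤ l + 1 → (A.pow k).Good (4 ^ E) (4 ^ (E + 1)) S Γ ((4 ^ (E + 1)) ^ (l + 1)) := fun k hk => by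
    refine (hP.pow_good k).mono le_rfl le_rfl ?_ (le_trans ?_ hΓ) (pow_le_pow_right₀ (one_le_pow₀ (by norm_num)) hk)
    · rw [hS]; exact pow_le_pow_right₀ (by norm_num) hk
    · have hk' : (k:ℝ) ≤ ((l + 1 : ℕ) : ℝ) := by exact_mod_cast hk
      have e1 : 1 + (k:ℝ) * (16 * E) ≤ 1 + ((l + 1 : ℕ) : ℝ) * (16 * E) := by
        have := mul_le_mul_of_nonneg_right hk' (by positivity : (0:ℝ) ≤ 16 * E)
        linarith
      refine (pow_le_pow_left₀ (by positivity) e1 k).trans (pow_le_pow_right₀ ?_ hk)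
      have : (0:ℝ) ≤ ((l + 1 : ℕ) : ℝ) * (16 * E) := by positivity
      linarith
  have hF := hgood (l + 1) le_rfl
  have hG := CB_midSum Q h
  have hcF : CB fun t => ‖(A.pow (l + 1)).R (16 * S) (X / (2 * S)) t‖ * ‖midSum Q h t‖ := (Law.CB_R _ _ _).norm.mul hG.norm
  have hlarge : T * ∫ t in midRange T₀ T₁ ∩ A.largeSet α E,
      ‖(A.pow (l + 1)).R (16 * S) (X / (2 * S)) t‖ * ‖midSum Q h t‖ ∂gm T ≤ Q.card * (1 / 8) := by
    refine le_trans (mul_le_mul_of_nonneg_left ?_ hTp.le) h4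
    refine setIntegral_mono hcF.integrable.integrableOn ((Law.CB_R _ _ _).norm.mul hG.norm).integrable.integrableOn fun t => ?_
    refine mul_le_mul_of_nonneg_right ?_ (norm_nonneg _)
    show ‖(A.prod (A.pow l)).R _ _ t‖ ≤ _
    rw [R_prod_const A _ _ _ _ _ hA0 (pow_s_ne_zero A hA0 l) hAy, norm_mul]
    exact mul_le_of_le_one_left (norm_nonneg _) (hP.good.norm_poly_le t)
  have hsmall : T * ∫ t in midRange T₀ T₁ \ A.largeSet α E,
      ‖(A.pow (l + 1)).R (16 * S) (X / (2 * S)) t‖ * ‖midSum Q h t‖ ∂gm T ≤ Q.card * (1 / 8) := by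
    obtain ⟨k, hk⟩ := Nat.exists_eq_add_of_le hjl
    simp only [hk, R_pow_add A _ _ _ _ hAy hA0]
    refine ((hgood k (by omega)).setIntegral_R_prod_le_of_small (pow_s_ne_zero A hA0 j) _ (pow_y_const A _ hAy j) _ _ T
      (by linarith) hTp hTj _ hG _ ((measurableSet_midRange _ _).diff (A.measurableSet_largeSet _ _)) _ (by positivity)
      (fun t ht => ?_)).trans h3
    rw [poly_pow A hA0, norm_pow]
    exact pow_le_pow_left₀ (norm_nonneg _) (not_lt.1 ht.2) j
  refine hF.card_eq_zero_of_setIntegral_le X h T T₀ T₁ θ Lw Q hX hh hhX hT₀ hT hTX hThX hU hQ hsep hθ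
    (by push_cast; exact hhi) (fun i => ?_) hLwX hbad h1 h2 ?_
  · rw [pow_y_const A _ hAy]; exact hLw
  · have h7 : T * ∫ t in midRange T₀ T₁, ‖(A.pow (l + 1)).R (16 * S) (X / (2 * S)) t‖ * ‖midSum Q h t‖ ∂gm T ≤ Q.card / 4 := by
      rw [← integral_inter_add_sdiff (A.measurableSet_largeSet α E) hcF.integrable.integrableOn, mul_add]
      linarith
    exact h7

end Law

/-- The gcd factor of a power of the top block is at most a small power of `X`. -/
lemma eventually_gcd_factor_le (l : ℕ) {η s : ℝ} (hη : 0 < η) (hη1 : η ≤ 1) (hs : 0 < s) :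
    ∀ᶠ X : ℝ in Filter.atTop, (1 + ((l + 1 : ℕ) : ℝ) * (16 * topScale η X)) ^ (l + 1) ≤ X ^ s := by
  filter_upwards [eventually_log_pow_le ((1 + ((l + 1 : ℕ) : ℝ) * 16) ^ (l + 1)) (l + 1) s hs,
    Filter.eventually_ge_atTop (Real.exp 1)] with X hX hXe
  have hX1 : 1 ≤ X := le_trans (by linarith [Real.add_one_le_exp 1]) hXe
  have hlog1 : 1 ≤ Real.log X := (Real.le_log_iff_exp_le (by linarith)).2 hXe
  have hE := topScale_le_log η X hη.le hη1 hX1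
  refine le_trans ?_ hX
  rw [← mul_pow]
  refine pow_le_pow_left₀ (by positivity) ?_ _
  have := mul_le_mul_of_nonneg_left (show (topScale η X : ℝ) ≤ Real.log X by linarith) (by positivity : 0 ≤ ((l + 1 : ℕ) : ℝ) * 16)
  linarith

/-- The largest power of the top scale that fits below the sum over long intervals. -/
lemma eventually_exists_pow_le {d η θ e : ℝ} {l : ℕ} (hη : 0 < η) (hl : ((l : ℝ) + 1) * η = 1 - d)
    (hθ : 0 < θ) (hdθ : d ≤ θ / 4) (he : 0 ≤ e) (he8 : e ≤ 1 / 8) :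
    ∀ᶠ X : ℝ in Filter.atTop, ∀ h, 1 ≤ h → h ≤ X ^ (1 - θ / 2) → ∃ j ≤ l + 1,
      ((4:ℝ) ^ topScale η X) ^ j ≤ h ^ (1 - 2 * e) ∧ h ^ (1 - 2 * e) < ((4:ℝ) ^ topScale η X) ^ (j + 1) := by
  filter_upwards [eventually_const_le (2 * 4 ^ (l + 1)) (θ / 4) (by positivity), eventually_const_le 8 η hη,
    Filter.eventually_ge_atTop 1] with X h1 h8 hX1 h hh hhX
  have hXp : 0 < X := by linarith
  have hE := le_four_pow_topScale_mul η X hX1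
  set y : ℝ := 4 ^ topScale η X with hy
  have hy1 : 1 < y := by linarith
  obtain ⟨j, hj1, hj2⟩ := exists_nat_pow_near (Real.one_le_rpow hh (by linarith : 0 ≤ 1 - 2 * e)) hy1
  refine ⟨j, ?_, hj1, hj2⟩
  by_contra hcon
  have hlj : l + 1 ≤ j := by omega
  have e1 : y ^ (l + 1) ≤ X ^ (1 - θ / 2) :=
    calc y ^ (l + 1) ≤ y ^ j := pow_le_pow_right₀ hy1.le hlj
      _ ≤ h ^ (1 - 2 * e) := hj1
      _ ≤ h ^ (1:ℝ) := Real.rpow_le_rpow_of_exponent_le hh (by linarith)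
      _ = h := Real.rpow_one h
      _ ≤ _ := hhX
  have e2 : X ^ (1 - d) / 4 ^ (l + 1) ≤ y ^ (l + 1) := by
    calc X ^ (1 - d) / 4 ^ (l + 1) = (X ^ η / 4) ^ (l + 1) := by
          rw [div_pow, ← Real.rpow_natCast (X ^ η), ← Real.rpow_mul hXp.le, ← hl]
          congr 2; push_cast; ring
      _ ≤ _ := pow_le_pow_left₀ (by positivity) hE _
  have e3 := e2.trans e1
  rw [div_le_iff₀ (by positivity)] at e3
  have e4 : 2 * 4 ^ (l + 1) * X ^ (1 - θ / 2) ≤ X ^ (1 - d) := by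
    calc 2 * 4 ^ (l + 1) * X ^ (1 - θ / 2) ≤ X ^ (θ / 4) * X ^ (1 - θ / 2) := mul_le_mul_of_nonneg_right h1 (by positivity)
      _ = X ^ (θ / 4 + (1 - θ / 2)) := by rw [← Real.rpow_add hXp]
      _ ≤ _ := Real.rpow_le_rpow_of_exponent_le hX1 (by linarith)
  have e5 : 0 < X ^ (1 - θ / 2) * 4 ^ (l + 1) := by positivity
  linarith

lemma BadSet.eventually_setIntegral_large_le {θ e d η c c₀ S : ℝ} {l : ℕ} (he : 0 < e) (he8 : e ≤ 1 / 8) (hd : 0 < d)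
    (hd4 : d ≤ 1 / 4) (hdc : d ≤ e * c₀) (hη : 0 < η) (hηd : η ≤ d) (hηc : η ≤ c / 20) (hl : ((l : ℝ) + 1) * η = 1 - d)
    (hc : 0 < c) (hS : 1 ≤ S)
    (hD : ∀ κ : ℝ, 1 ≤ κ → ∀ᶠ X : ℝ in Filter.atTop, ∀ Z t : ℝ, X ^ (d / 2) ≤ Z → Z ≤ X ^ (2 * d) →
      X ^ (d / 16) ≤ |t| → |t| ≤ X ^ (2 : ℝ) → ‖dz κ Z t‖ ≤ X ^ (-c)) :
    ∀ᶠ X : ℝ in Filter.atTop, ∀ h, X ^ c₀ ≤ h → h ≤ X → ∀ (Q : Finset ℕ) (T : ℝ) (A : Law), BadSet θ X h Q →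
      T = X * h ^ (-1 + e) → T * h ^ (-(1 / 2) + 8 * e) ≤ Q.card →
      Law.IsBlock A 4 (16 * topScale η X) (topScale η X) (4 ^ topScale η X) → X ^ (1 - d / 4) ≤ X / (2 * S) →
      T * ∫ t in Law.midRange (X ^ (d / 8)) (T * Real.log X) ∩ A.largeSet (1 / 4 - e) (topScale η X),
        ‖(A.pow l).R (16 * S) (X / (2 * S) / 4 ^ topScale η X) t‖ * ‖Law.midSum Q h t‖ ∂gm T ≤ Q.card * (1 / 8) := by
  set N : ℕ := ⌈5 / c⌉₊ with hNdef
  have hN5 : 5 / c ≤ N := Nat.le_ceil _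
  have hN0 : (0:ℝ) < N := lt_of_lt_of_le (by positivity) hN5
  set δ : ℝ := (1 / 4 - e) / N with hδdef
  have hNδ : N * δ = 1 / 4 - e := by rw [hδdef]; field_simp
  have hδ0 : 0 ≤ δ := div_nonneg (by linarith) hN0.le
  have hδc : δ ≤ c / 20 := by
    rw [hδdef, div_le_iff₀ hN0]
    have : c / 20 * (5 / c) ≤ c / 20 * N := mul_le_mul_of_nonneg_left hN5 (by positivity)
    have h2 : c / 20 * (5 / c) = 1 / 4 := by field_simp; norm_num
    linarith
  filter_upwards [Law.eventually_setIntegral_pow_mix_le d η (c / 20) (c / 20) δ c N l hd hd4 hη hηd hl (by positivity) hδ0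
      (by positivity) (by linarith) (16 * S) (hD _ (by linarith)), eventually_const_le 96 (c / 8) (by positivity),
      eventually_const_le 8 (c / 20) (by positivity), Filter.eventually_gt_atTop 1] with X hpow h96 h8 hX1
  intro h hcX hhX Q T A hQ hT hR hA hXS
  have hXp : 0 < X := by linarith
  have hhp : 0 < h := lt_of_lt_of_le (by positivity) hcX
  have hc₀ : 0 ≤ c₀ := by
    by_contra hcon
    have := mul_nonpos_of_nonneg_of_nonpos he.le (not_le.1 hcon).le
    linarith
  have hh1 : 1 ≤ h := (Real.one_le_rpow hX1.le hc₀).trans hcX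
  obtain ⟨hT1, hTX, -⟩ := height_bounds hX1.le hh1 hhX he.le (by linarith) hT
  obtain ⟨hI, -⟩ := hQ.integral_le hX1.le hh1 hhX he.le (by linarith) hT hR
  obtain ⟨r, hr⟩ : ∃ r, r = Real.logb X h := ⟨_, rfl⟩
  have hhr : h = X ^ r := by rw [hr, Real.rpow_logb hXp hX1.ne' hhp]
  have hrc : c₀ ≤ r := by rw [hr]; exact (Real.le_logb_iff_rpow_le hX1 hhp).2 hcX
  have hr1 : r ≤ 1 := by
    rw [hr]; refine (Real.logb_le_iff_le_rpow hX1 hhp).2 ?_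
    rwa [Real.rpow_one]
  have hr0 : 0 ≤ r := hc₀.trans hrc
  have her : 0 ≤ e * r := by positivity
  have herr : e * r ≤ r / 8 := by
    have := mul_le_mul_of_nonneg_right he8 hr0
    linarith
  obtain ⟨τ, hτ⟩ : ∃ τ, τ = 1 + (-1 + e) * r := ⟨_, rfl⟩
  have hτ0 : 0 ≤ τ := by rw [hτ]; linarith
  have hτ1 : τ ≤ 1 := by rw [hτ]; linarith
  have hTτ : T = X ^ τ := by
    rw [hT, hτ, Real.rpow_add hXp, Real.rpow_one, hhr, ← Real.rpow_mul hXp.le]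
    congr 2; ring
  have hdr : d ≤ e * r := hdc.trans (mul_le_mul_of_nonneg_left hrc he.le)
  have hG2 : T * ∫ t, ‖Law.midSum Q h t‖ ^ 2 ∂gm T ≤ (Q.card : ℝ) ^ 2 * X ^ ((1 / 2 - 8 * e) * r + c / 8) := by
    refine hI.trans ?_
    have e1 : h ^ (1 / 2 - 8 * e) = X ^ ((1 / 2 - 8 * e) * r) := by
      rw [hhr, ← Real.rpow_mul hXp.le]; congr 1; ring
    rw [e1, Real.rpow_add hXp]
    calc 96 * ((Q.card : ℝ) ^ 2 * X ^ ((1 / 2 - 8 * e) * r)) =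
          (Q.card : ℝ) ^ 2 * (X ^ ((1 / 2 - 8 * e) * r) * 96) := by ring
      _ ≤ _ := mul_le_mul_of_nonneg_left (mul_le_mul_of_nonneg_left h96 (by positivity)) (sq_nonneg _)
  have hE : Law.midRange (X ^ (d / 8)) (T * Real.log X) = {t | X ^ (d / 16) < |t| ∧ |t| ≤ T * Real.log X} := by
    unfold Law.midRange
    rw [sqrt_rpow_eq X (d / 8) (d / 16) hXp.le (by ring)]
  have hceil : ⌈(1 - d / 4) * (topScale η X : ℝ)⌉₊ ≤ topScale η X := by
    refine Nat.ceil_le.2 (mul_le_of_le_one_left (Nat.cast_nonneg _) (by linarith))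
  have key := hpow {topScale η X} (fun _ => 1) (fun _ => A) T τ ((1 / 2 - 8 * e) * r + c / 8) Q.card (Law.midSum Q h)
    (Finset.singleton_subset_iff.2 (Finset.mem_Icc.2 ⟨hceil, le_rfl⟩)) (fun v _ => zero_le_one) (Finset.sum_singleton _ _) (fun v hv => by rw [Finset.mem_singleton.1 hv]; exact hA)
    hT1 hTX hτ0 hτ1 (by rw [hTτ]; exact Real.rpow_le_rpow_of_exponent_le hX1.le (by linarith)) (Law.CB_midSum Q h)
    (Law.norm_midSum_le Q h) (Nat.cast_nonneg _) hG2 (fun g hg => ?_) _ (Finset.mem_singleton_self _) (X / (2 * S)) hXS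
    (div_le_self hXp.le (by linarith))
  · rw [hE, ← hNδ]
    simp only [Law.R_pow_mix_singleton (topScale η X) (fun _ => 1) (fun _ => A) rfl _ hA.y_eq hA.primeLaw.good.s_ne_zero] at key
    refine key.trans (mul_le_mul_of_nonneg_left ?_ (Nat.cast_nonneg _))
    rw [Real.rpow_neg hXp.le, one_div]
    exact inv_anti₀ (by norm_num) h8
  · have hg1 : ((g:ℝ) + 1) * δ ≤ 1 / 4 - e := by
      rw [← hNδ]
      exact mul_le_mul_of_nonneg_right (by exact_mod_cast hg) hδ0
    exact long_cell_exponent he he8 hd hdr hηc hc hδ0 hδc (by positivity) hg1 hτ hτ0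

/-- The bound for bad sets when `h` is at least a fixed power of `X`. -/
lemma BadSet.card_le_of_long {θ e c₀ : ℝ} (hθ : 0 < θ) (he : 0 < e) (he8 : e ≤ 1 / 8) (hc₀ : 0 < c₀) :
    ∀ᶠ X : ℝ in Filter.atTop, ∀ h, X ^ c₀ ≤ h → h ≤ X ^ (1 - θ / 2) → ∀ Q : Finset ℕ, BadSet θ X h Q →
      (Q.card : ℝ) ≤ X * h ^ (-1 + e) * h ^ (-(1 / 2) + 8 * e) := by
  set d : ℝ := min (e * c₀) (min (1 / 4) (θ / 4)) with hddef
  have hd : 0 < d := lt_min (by positivity) (lt_min (by norm_num) (by positivity))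
  have hdc : d ≤ e * c₀ := min_le_left _ _
  have hd4 : d ≤ 1 / 4 := (min_le_right _ _).trans (min_le_left _ _)
  have hdθ : d ≤ θ / 4 := (min_le_right _ _).trans (min_le_right _ _)
  obtain ⟨c, hc, hc1, hD⟩ := eventually_norm_dz_le (d / 2) (2 * d) (d / 16) (by positivity) (by positivity) (by positivity)
  set m : ℝ := min d (min (c / 20) (θ / 2)) with hmdef
  have hm : 0 < m := lt_min hd (lt_min (by positivity) (by positivity))
  set l : ℕ := ⌈1 / m⌉₊ with hldef
  have hlm : 1 / m ≤ l := Nat.le_ceil _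
  set η : ℝ := (1 - d) / (l + 1) with hηdef
  have hη : 0 < η := div_pos (by linarith) (by positivity)
  have hl : ((l : ℝ) + 1) * η = 1 - d := by rw [hηdef]; field_simp
  have hηm : η ≤ m := by
    rw [hηdef, div_le_iff₀ (by positivity)]
    rw [div_le_iff₀ hm] at hlm
    linarith
  have hηd : η ≤ d := hηm.trans (min_le_left _ _)
  have hηc : η ≤ c / 20 := hηm.trans ((min_le_right _ _).trans (min_le_left _ _))
  have hηθ : η ≤ θ / 2 := hηm.trans ((min_le_right _ _).trans (min_le_right _ _))
  set S : ℝ := 4 ^ (l + 1) with hSdef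
  have hS : 1 ≤ S := one_le_pow₀ (by norm_num)
  have hec : 0 < e * c₀ := by positivity
  obtain ⟨v₂, hv₂, hfour⟩ := Law.exists_isBlock_four
  obtain ⟨h₂, hh₂⟩ := Filter.eventually_atTop.1 ((eventually_exp_neg_rpow_le (2 * e) (1 / (4096 * S ^ 2)) 1
    (by positivity) (by positivity)).and ((eventually_exp_neg_rpow_le (2 * e) (1 / (4096 * S ^ 2))
      (1200 * Real.sqrt (33 * S ^ 3)) (by positivity) (by positivity)).and (eventually_const_le (2 * S) e he)))
  filter_upwards [BadSet.eventually_setIntegral_large_le (θ := θ) he he8 hd hd4 hdc hη hηd hηc hl hc hS hD,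
    eventually_size_le hd hd4 hη hl hθ hdθ hηθ hS, eventually_tail_le d S hd hS,
    eventually_gcd_factor_le l hη (by linarith) hec, eventually_exists_pow_le hη hl hθ hdθ he.le he8,
    eventually_scales d η hd hd4 hη (by linarith) v₂,
    eventually_const_le h₂ c₀ hc₀, eventually_const_le (80 * Real.sqrt (48 * (16 * S) ^ 2 * S)) (e * c₀ / 2) (by positivity),
    Filter.eventually_ge_atTop 1] with X hlarge hsize htail hΓ hj hsc hXh₂ h80 hX1
  intro h hcX hhX Q hQ
  have hXp : 0 < X := by linarith
  have hh1 : 1 ≤ h := (Real.one_le_rpow hX1 hc₀.le).trans hcX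
  have hhp : 0 < h := by linarith
  obtain ⟨hexp1, hexp2, h2S⟩ := hh₂ h (hXh₂.trans hcX)
  obtain ⟨hsize, hhi, hLw⟩ := hsize
  obtain ⟨hab, -, hva, -⟩ := hsc _ _ rfl rfl
  obtain ⟨j, hjl, hj1, hj2⟩ := hj h hh1 hhX
  obtain ⟨A, hA⟩ := hfour (topScale η X) (hva.trans hab)
  have hhX' : h ≤ X := hhX.trans ((Real.rpow_le_rpow_of_exponent_le hX1 (by linarith)).trans (Real.rpow_one X).le)
  by_contra hcon
  rw [not_le] at hcon
  obtain ⟨T, hT⟩ : ∃ T, T = X * h ^ (-1 + e) := ⟨_, rfl⟩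
  rw [← hT] at hcon
  obtain ⟨hT1, hTX, hThX⟩ := height_bounds hX1 hh1 hhX' he.le (by linarith) hT
  obtain ⟨hI, hTR⟩ := hQ.integral_le hX1 hh1 hhX' he.le (by linarith) hT hcon.le
  have hR0 : (0:ℝ) ≤ Q.card := Nat.cast_nonneg _
  have hsz := hsize 1 1 zero_le_one (by linarith [Real.one_le_rpow hX1 (by positivity : 0 ≤ d / 64)]) zero_le_one
    (Real.one_le_rpow hX1 (by positivity))
  have hXe : X ^ (e * c₀) ≤ h ^ e := by
    calc X ^ (e * c₀) = (X ^ c₀) ^ e := by rw [← Real.rpow_mul hXp.le]; congr 1; ring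
      _ ≤ h ^ e := Real.rpow_le_rpow (by positivity) hcX he.le
  have hΓh : (1 + ((l + 1 : ℕ) : ℝ) * (16 * topScale η X)) ^ (l + 1) ≤ h ^ e := hΓ.trans hXe
  have hT₀ : (1:ℝ) ≤ X ^ (d / 8) := Real.one_le_rpow hX1 (by positivity)
  have hT₀T : X ^ (d / 8) ≤ T := by
    have e1 : X ^ (-(1 - θ / 2)) ≤ h ^ (-1 + e) := by
      calc X ^ (-(1 - θ / 2)) = (X ^ (1 - θ / 2)) ^ (-1:ℝ) := by rw [← Real.rpow_mul hXp.le]; congr 1; ring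
        _ ≤ h ^ (-1:ℝ) := Real.rpow_le_rpow_of_nonpos hhp hhX (by norm_num)
        _ ≤ _ := Real.rpow_le_rpow_of_exponent_le hh1 (by linarith)
    calc X ^ (d / 8) ≤ X ^ (1 + -(1 - θ / 2)) := Real.rpow_le_rpow_of_exponent_le hX1 (by linarith)
      _ = X * X ^ (-(1 - θ / 2)) := by rw [Real.rpow_add hXp, Real.rpow_one]
      _ ≤ T := by rw [hT]; exact mul_le_mul_of_nonneg_left e1 hXp.le
  have hlarge' := hlarge h hcX hhX' Q T A hQ hT hcon.le hA (by simpa using hsz.2)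
  have hEη := four_pow_topScale_le η X hη.le hX1
  have hcard : Q.card = 0 := by
    refine hA.card_eq_zero (Γ := h ^ e) (α := 1 / 4 - e) rfl hΓh hjl hX1 hhp hhX' hT₀ hT₀T hTX hThX
      (by simpa using hsz.1) hQ.mem hQ.sep hθ.le hhi (pow_le_pow_left₀ (by positivity)
        (pow_le_pow_right₀ (by norm_num) hab) _) hLw hQ.bad ?_ (htail T hT1 hTX) ?_ ?_ hlarge'
    · have hexp : Real.exp (-(1 / (2048 * S ^ 2) * h ^ (2 * e))) * (1200 * Real.sqrt (33 * S ^ 3) * h * h) ≤ 1 / 4 := by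
        have e1 : -(1 / (2048 * S ^ 2) * h ^ (2 * e)) = -(1 / (4096 * S ^ 2) * h ^ (2 * e)) + -(1 / (4096 * S ^ 2) * h ^ (2 * e)) := by
          field_simp; norm_num
        rw [e1, Real.exp_add]
        have := mul_le_mul hexp1 hexp2 (by positivity) (by norm_num)
        linarith
      have := smoothing_error_le (v := 0) (S := S) (g := h ^ e) (C := 1200 * Real.sqrt (33 * S ^ 3) * h)
        hXp hh1 he.le hT hR0 hTR (by linarith) (by positivity) (by simpa using Real.log_nonneg hh1) ?_ hexp
      · simpa using this
      · rw [mul_assoc]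
        refine mul_le_mul_of_nonneg_left ?_ (by norm_num)
        rw [show S ^ 3 * (33 * h ^ e) = 33 * S ^ 3 * h ^ e by ring, Real.sqrt_mul (by positivity)]
        refine mul_le_mul_of_nonneg_left (Real.sqrt_le_iff.2 ⟨hhp.le, ?_⟩) (Real.sqrt_nonneg _)
        calc h ^ e ≤ h ^ (1:ℝ) := Real.rpow_le_rpow_of_exponent_le hh1 (by linarith)
          _ = h := Real.rpow_one h
          _ ≤ h ^ 2 := by rw [sq]; exact le_mul_of_one_le_left hhp.le hh1
    · rw [div_div, le_div_iff₀ (by positivity), hT]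
      calc X * h ^ (-1 + e) * (2 * S * (4 ^ topScale η X) ^ j) ≤ X * h ^ (-1 + e) * (h ^ e * h ^ (1 - 2 * e)) :=
            mul_le_mul_of_nonneg_left (mul_le_mul h2S hj1 (by positivity) (by positivity)) (by positivity)
        _ = X * h ^ (-1 + e + (e + (1 - 2 * e))) := by rw [← Real.rpow_add hhp, mul_assoc, ← Real.rpow_add hhp]
        _ = X := by
            rw [show -1 + e + (e + (1 - 2 * e)) = 0 by ring, Real.rpow_zero, mul_one]
    · refine long_small_part_le hh1 he he8 hR0 rfl hj2 hI (Real.sqrt_nonneg _) ?_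
      have e1 : Real.sqrt (48 * (16 * S) ^ 2 * S * h ^ e) = Real.sqrt (48 * (16 * S) ^ 2 * S) * h ^ (e / 2) := by
        rw [Real.sqrt_mul (by positivity), sqrt_rpow_eq h e (e / 2) hhp.le (by ring)]
      rw [e1]
      have e2 : (4:ℝ) ^ topScale η X ≤ h ^ e :=
        hEη.trans ((Real.rpow_le_rpow_of_exponent_le hX1 (hηd.trans hdc)).trans hXe)
      have e3 : 80 * Real.sqrt (48 * (16 * S) ^ 2 * S) ≤ h ^ e :=
        h80.trans ((Real.rpow_le_rpow_of_exponent_le hX1 (by linarith)).trans hXe)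
      calc 80 * (Real.sqrt (48 * (16 * S) ^ 2 * S) * h ^ (e / 2)) * 4 ^ topScale η X =
            (80 * Real.sqrt (48 * (16 * S) ^ 2 * S)) * h ^ (e / 2) * 4 ^ topScale η X := by ring
        _ ≤ h ^ e * h ^ (e / 2) * h ^ e :=
            mul_le_mul (mul_le_mul_of_nonneg_right e3 (by positivity)) e2 (by positivity) (by positivity)
        _ = h ^ (5 / 2 * e) := by rw [← Real.rpow_add hhp, ← Real.rpow_add hhp]; congr 1; ring
  rw [hcard, Nat.cast_zero] at hcon
  have hTp : 0 < T := by linarith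
  have : 0 < T * h ^ (-(1 / 2) + 8 * e) := by positivity
  linarith

/-- An interval `(x, x + h]` with `h` close to `x` contains the multiple of a large power of two with a small cofactor. -/
lemma eventually_exists_smooth {θ : ℝ} (hθ : 0 < θ) : ∀ᶠ X : ℝ in Filter.atTop, ∀ h, 1 ≤ h → h ≤ X →
    X ^ (1 - θ / 2) ≤ h → ∀ x : ℕ, X ≤ (x : ℝ) → (x : ℝ) ≤ 2 * X →
      ∃ n : ℕ, x < n ∧ (n : ℝ) ≤ (x : ℝ) + h ∧ ∀ p : ℕ, p.Prime → p ∣ n → (p : ℝ) ≤ (x : ℝ) ^ θ := by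
  filter_upwards [eventually_const_le 6 (θ / 2) (by positivity), Filter.eventually_ge_atTop 1] with X h6 hX1
  intro h hh hhX hXh x hx1 hx2
  have hXp : 0 < X := by linarith
  have hxθ : X ^ θ ≤ (x : ℝ) ^ θ := Real.rpow_le_rpow hXp.le hx1 hθ.le
  have h6X : 6 * X ^ (θ / 2) ≤ X ^ θ := by
    calc 6 * X ^ (θ / 2) ≤ X ^ (θ / 2) * X ^ (θ / 2) := mul_le_mul_of_nonneg_right h6 (by positivity)
      _ = X ^ θ := by rw [← Real.rpow_add hXp]; congr 1; ring
  obtain ⟨a, ha1, ha2⟩ := exists_nat_pow_near hh (by norm_num : (1:ℝ) < 2)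
  have hlt : x < 2 ^ a * (x / 2 ^ a + 1) := Nat.lt_mul_div_succ x (by positivity)
  have hle : 2 ^ a * (x / 2 ^ a + 1) ≤ x + 2 ^ a := by
    rw [mul_add, mul_one]
    exact Nat.add_le_add_right (Nat.mul_div_le x (2 ^ a)) _
  have hle' : (((2 ^ a * (x / 2 ^ a + 1) : ℕ)) : ℝ) ≤ (x : ℝ) + h := by
    have : (((2 ^ a * (x / 2 ^ a + 1) : ℕ)) : ℝ) ≤ ((x + 2 ^ a : ℕ) : ℝ) := by exact_mod_cast hle
    push_cast at this ⊢
    linarith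
  refine ⟨_, hlt, hle', fun p hp hpn => ?_⟩
  rcases (hp.dvd_mul).1 hpn with h2 | h2
  · have h3 : p ≤ 2 := Nat.le_of_dvd (by norm_num) (hp.dvd_of_dvd_pow h2)
    have h4 : (p : ℝ) ≤ 2 := by exact_mod_cast h3
    have h5 : 1 ≤ X ^ (θ / 2) := Real.one_le_rpow hX1 (by positivity)
    linarith
  · have h3 : (p : ℝ) ≤ ((x / 2 ^ a + 1 : ℕ) : ℝ) := by exact_mod_cast Nat.le_of_dvd (by positivity) h2
    refine h3.trans (le_trans ?_ (h6X.trans hxθ))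
    have h4 : ((x / 2 ^ a + 1 : ℕ) : ℝ) * h ≤ 6 * X := by
      have h5 : h ≤ 2 * 2 ^ a := by rw [pow_succ] at ha2; linarith
      have h6 := mul_le_mul_of_nonneg_left h5 (Nat.cast_nonneg (x / 2 ^ a + 1) : (0:ℝ) ≤ ((x / 2 ^ a + 1 : ℕ) : ℝ))
      rw [Nat.cast_mul] at hle'
      push_cast at hle' h6 ⊢
      linarith
    have h5 : X ^ (θ / 2) * X ^ (1 - θ / 2) = X := by
      rw [← Real.rpow_add hXp]; norm_num
    rw [← mul_le_mul_iff_of_pos_right (show 0 < X ^ (1 - θ / 2) by positivity), mul_assoc, h5]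
    exact (mul_le_mul_of_nonneg_left hXh (Nat.cast_nonneg _)).trans h4

lemma BadSet.card_le {θ e : ℝ} (hθ : 0 < θ) (he : 0 < e) (he8 : e ≤ 1 / 8) :
    ∃ h₀ : ℝ, ∀ᶠ X : ℝ in Filter.atTop, ∀ h, h₀ ≤ h → h ≤ X → ∀ Q : Finset ℕ, BadSet θ X h Q →
      (Q.card : ℝ) ≤ X * h ^ (-1 + e) * h ^ (-(1 / 2) + 8 * e) := by
  obtain ⟨c₀, h₀, hc₀, hshort⟩ := BadSet.card_le_of_short hθ he he8
  refine ⟨max 1 h₀, ?_⟩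
  filter_upwards [hshort, BadSet.card_le_of_long hθ he he8 hc₀, eventually_exists_smooth hθ,
    Filter.eventually_ge_atTop 1] with X hs hl hm hX1 h hh hhX Q hQ
  have hh1 : 1 ≤ h := (le_max_left _ _).trans hh
  rcases le_total h (X ^ c₀) with h1 | h1
  · exact hs h ((le_max_right _ _).trans hh) h1 Q hQ
  rcases le_total h (X ^ (1 - θ / 2)) with h2 | h2
  · exact hl h h1 h2 Q hQ
  have hQ0 : Q = ∅ := Finset.eq_empty_of_forall_notMem fun x hx =>
    hQ.bad x hx (hm h hh1 hhX h2 x (hQ.mem x hx).1 (hQ.mem x hx).2)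
  have hhp : 0 < h := by linarith
  have hXp : 0 < X := by linarith
  rw [hQ0, Finset.card_empty, Nat.cast_zero]
  positivity

/-- Splitting into residue classes modulo `⌈h⌉` reduces to well-spaced sets. -/
lemma card_le_of_badSet_card_le {θ X h B : ℝ} {P : Finset ℕ} (hh : 0 < h)
    (hmem : ∀ x ∈ P, X ≤ (x : ℝ) ∧ (x : ℝ) ≤ 2 * X)
    (hbad : ∀ x ∈ P, ¬ ∃ n : ℕ, x < n ∧ (n : ℝ) ≤ (x : ℝ) + h ∧ ∀ p : ℕ, p.Prime → p ∣ n → (p : ℝ) ≤ (x : ℝ) ^ θ)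
    (hB : ∀ Q : Finset ℕ, BadSet θ X h Q → (Q.card : ℝ) ≤ B) : (P.card : ℝ) ≤ ⌈h⌉₊ * B := by
  have hq : 0 < ⌈h⌉₊ := Nat.ceil_pos.2 hh
  rw [Finset.card_eq_sum_card_fiberwise (f := fun x => x % ⌈h⌉₊) (t := Finset.range ⌈h⌉₊)
    (fun x _ => by simpa using Nat.mod_lt x hq), Nat.cast_sum]
  refine (Finset.sum_le_card_nsmul _ _ B fun r _ => hB _ ⟨fun x hx => hmem x (Finset.mem_filter.1 hx).1, ?_,
    fun x hx => hbad x (Finset.mem_filter.1 hx).1⟩).trans (by simp)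
  intro x hx x' hx' hne
  have hxx : x % ⌈h⌉₊ = x' % ⌈h⌉₊ := (Finset.mem_filter.1 hx).2.trans (Finset.mem_filter.1 hx').2.symm
  refine (Nat.le_ceil h).trans ?_
  have hdvd : ((⌈h⌉₊ : ℕ) : ℤ) ∣ (x' : ℤ) - x := Nat.modEq_iff_dvd.1 hxx
  have h1 : (⌈h⌉₊ : ℤ) ≤ |(x' : ℤ) - x| := Int.le_of_dvd (abs_pos.2 (sub_ne_zero.2 (by exact_mod_cast hne.symm)))
    ((dvd_abs _ _).2 hdvd)
  rw [abs_sub_comm]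
  exact_mod_cast h1

theorem stmt_3 (θ ε : ℝ) (hθ : 0 < θ) (hε : 0 < ε) :
    ∃ C : ℝ, 0 < C ∧
      ∀ X : ℝ, 2 ≤ X → ∀ h : ℝ, 2 ≤ h → h ≤ X →
        (({x : ℕ | X ≤ (x : ℝ) ∧ (x : ℝ) ≤ 2 * X ∧
            ¬ ∃ n : ℕ, x < n ∧ (n : ℝ) ≤ (x : ℝ) + h ∧
                ∀ p : ℕ, p.Prime → p ∣ n → (p : ℝ) ≤ (x : ℝ) ^ θ}.ncard : ℝ)
          ≤ C * X * h ^ (-(1 / 2 : ℝ) + ε)) := by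
  have he : 0 < min (ε / 9) (1 / 8) := lt_min (by positivity) (by norm_num)
  have heε : min (ε / 9) (1 / 8) ≤ ε / 9 := min_le_left _ _
  obtain ⟨h₀, hmain⟩ := BadSet.card_le hθ he (min_le_right _ _)
  obtain ⟨X₀, hmain⟩ := Filter.eventually_atTop.1 hmain
  set e : ℝ := min (ε / 9) (1 / 8) with hedef
  set M : ℝ := max 1 (max X₀ h₀) with hMdef
  have hM1 : 1 ≤ M := le_max_left _ _
  have hMp : 0 < M := by linarith
  have hM2 : 1 ≤ M ^ (1 / 2 : ℝ) := Real.one_le_rpow hM1 (by norm_num)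
  refine ⟨3 * M ^ (1 / 2 : ℝ), by positivity, fun X hX h hh hhX => ?_⟩
  have hXp : 0 < X := by linarith
  have hhp : 0 < h := by linarith
  set s : Set ℕ := {x : ℕ | X ≤ (x : ℝ) ∧ (x : ℝ) ≤ 2 * X ∧
    ¬ ∃ n : ℕ, x < n ∧ (n : ℝ) ≤ (x : ℝ) + h ∧ ∀ p : ℕ, p.Prime → p ∣ n → (p : ℝ) ≤ (x : ℝ) ^ θ} with hs
  have hsub : s ⊆ Finset.range (⌊2 * X⌋₊ + 1) := fun x hx => by
    rw [Finset.coe_range, Set.mem_Iio, Nat.lt_succ_iff]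
    exact Nat.le_floor hx.2.1
  have hfin : s.Finite := (Finset.finite_toSet _).subset hsub
  have htriv : (s.ncard : ℝ) ≤ 3 * X := by
    have h1 := Set.ncard_le_ncard hsub (Finset.finite_toSet _)
    rw [Set.ncard_coe_finset, Finset.card_range] at h1
    have h2 : (s.ncard : ℝ) ≤ (⌊2 * X⌋₊ : ℝ) + 1 := by exact_mod_cast h1
    have h3 := Nat.floor_le (by linarith : 0 ≤ 2 * X)
    linarith
  rcases lt_or_ge h M with hhM | hhM
  · have h1 : 1 ≤ M ^ (1 / 2 : ℝ) * h ^ (-(1 / 2 : ℝ) + ε) := by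
      calc (1:ℝ) = M ^ (1 / 2 : ℝ) * M ^ (-(1 / 2 : ℝ)) := by
            rw [← Real.rpow_add hMp, add_neg_cancel, Real.rpow_zero]
        _ ≤ M ^ (1 / 2 : ℝ) * h ^ (-(1 / 2 : ℝ) + ε) := by
            refine mul_le_mul_of_nonneg_left ?_ (by positivity)
            exact (Real.rpow_le_rpow_of_nonpos hhp hhM.le (by norm_num)).trans
              (Real.rpow_le_rpow_of_exponent_le (by linarith) (by linarith))
    calc (s.ncard : ℝ) ≤ 3 * X * 1 := by rw [mul_one]; exact htriv
      _ ≤ 3 * X * (M ^ (1 / 2 : ℝ) * h ^ (-(1 / 2 : ℝ) + ε)) := mul_le_mul_of_nonneg_left h1 (by positivity)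
      _ = _ := by ring
  · have hXX₀ : X₀ ≤ X := ((le_max_left _ _).trans (le_max_right _ _)).trans (hhM.trans hhX)
    have hhh₀ : h₀ ≤ h := ((le_max_right _ _).trans (le_max_right _ _)).trans hhM
    have h1 := card_le_of_badSet_card_le (P := hfin.toFinset) hhp
      (fun x hx => ⟨((hfin.mem_toFinset).1 hx).1, ((hfin.mem_toFinset).1 hx).2.1⟩)
      (fun x hx => ((hfin.mem_toFinset).1 hx).2.2) (hmain X hXX₀ h hhh₀ hhX)
    rw [← Set.ncard_eq_toFinset_card s hfin] at h1
    have h2 : (⌈h⌉₊ : ℝ) ≤ 2 * h := by linarith [Nat.ceil_lt_add_one hhp.le]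
    calc (s.ncard : ℝ) ≤ ⌈h⌉₊ * (X * h ^ (-1 + e) * h ^ (-(1 / 2) + 8 * e)) := h1
      _ ≤ (2 * h) * (X * h ^ (-1 + e) * h ^ (-(1 / 2) + 8 * e)) := mul_le_mul_of_nonneg_right h2 (by positivity)
      _ = 2 * X * (h ^ (1:ℝ) * h ^ (-1 + e) * h ^ (-(1 / 2) + 8 * e)) := by rw [Real.rpow_one]; ring
      _ = 2 * X * h ^ (-(1 / 2) + 9 * e) := by
          rw [← Real.rpow_add hhp, ← Real.rpow_add hhp]; congr 2; ring
      _ ≤ 2 * X * h ^ (-(1 / 2) + ε) :=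
          mul_le_mul_of_nonneg_left (Real.rpow_le_rpow_of_exponent_le (by linarith) (by linarith)) (by positivity)
      _ ≤ 3 * M ^ (1 / 2 : ℝ) * X * h ^ (-(1 / 2) + ε) := by
          refine mul_le_mul_of_nonneg_right (mul_le_mul_of_nonneg_right ?_ hXp.le) (by positivity)
          linarith
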